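/- Let d ≥ 1 and let (p,q) and (a,b) be admissible pairs with q < ∞ and b < ∞, satisfying γ_{p,q} = γ_{a',b'} + 4, where a' and b' are the conjugate exponents of a and b (1/a + 1/a' = 1, 1/b + 1/b' = 1). Then there exists C > 0 such that for every Schwartz function u₀ on ℝ^d and every Schwartz function F on ℝ^{1+d}, the function u(t,x) := (e^{itΔ²}u₀)(x) + ∫₀ᵗ (e^{i(t-s)Δ²}F(s,·))(x) ds satisfies ‖u‖_{L^p(ℝ,L^q)} ≤ C ( ‖u₀‖_{Ḣ^{γ_{p,q}}} + ‖F‖_{L^{a'}(ℝ,L^{b'})} ). -/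

import Mathlib

open MeasureTheory Real Complex
open scoped FourierTransform ENNReal SchwartzMap RealInnerProductSpace

/-- A pair `(p,q)` is admissible if `p,q ∈ [2,∞]`, `(p,q,d) ≠ (2,∞,2)` and
`2/p + d/q ≤ d/2` (with `1/∞ = 0`). -/
def Admissible (d : ℕ) (p q : ℝ≥0∞) : Prop :=
  2 ≤ p ∧ 2 ≤ q ∧ ¬(p = 2 ∧ q = ∞ ∧ d = 2) ∧
    2 / p + (d : ℝ≥0∞) / q ≤ (d : ℝ≥0∞) / 2

/-- The exponent `γ_{p,q} = d/2 - d/q - 4/p` (with `1/∞ = 0`). -/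
noncomputable def gammaExp (d : ℕ) (p q : ℝ≥0∞) : ℝ :=
  (d : ℝ) / 2 - (d : ℝ) / q.toReal - 4 / p.toReal

/-- `L^p`-in-time norm on a set `I` of an `ℝ≥0∞`-valued function, with the usual
essential supremum convention when `p = ∞`. -/
noncomputable def timeLp (p : ℝ≥0∞) (I : Set ℝ) (g : ℝ → ℝ≥0∞) : ℝ≥0∞ :=
  if p = ∞ then essSup g (MeasureTheory.volume.restrict I)
  else (∫⁻ t in I, g t ^ p.toReal) ^ (1 / p.toReal)

/-- The mixed norm `‖u‖_{L^p(I, L^q)}`. -/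
noncomputable def mixedLp {d : ℕ} (p q : ℝ≥0∞) (I : Set ℝ)
    (u : ℝ → EuclideanSpace ℝ (Fin d) → ℂ) : ℝ≥0∞ :=
  timeLp p I fun t => eLpNorm (u t) q MeasureTheory.volume

/-- The fourth-order Schrödinger propagator
`(e^{itΔ²}u₀)(x) = ∫ e^{2πi x·ξ} e^{it(2π|ξ|)⁴} û₀(ξ) dξ`. -/
noncomputable def prop4 {d : ℕ} (t : ℝ) (u₀ : EuclideanSpace ℝ (Fin d) → ℂ)
    (x : EuclideanSpace ℝ (Fin d)) : ℂ :=
  ∫ ξ : EuclideanSpace ℝ (Fin d),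
    Complex.exp (2 * Real.pi * Complex.I * ((⟪x, ξ⟫ : ℝ) : ℂ)) *
      Complex.exp (Complex.I * (t : ℂ) * ((2 * Real.pi * ‖ξ‖ : ℝ) : ℂ) ^ 4) * 𝓕 u₀ ξ

/-- The homogeneous Sobolev norm `‖f‖_{Ḣ^γ}`, valued in `[0,∞]`. -/
noncomputable def homSobNorm {d : ℕ} (γ : ℝ) (f : EuclideanSpace ℝ (Fin d) → ℂ) : ℝ≥0∞ :=
  (∫⁻ ξ : EuclideanSpace ℝ (Fin d),
      (‖ξ‖₊ : ℝ≥0∞) ^ (2 * γ) * (‖𝓕 f ξ‖₊ : ℝ≥0∞) ^ (2 : ℝ)) ^ ((1 : ℝ) / 2)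


open MeasureTheory Real Complex
open scoped FourierTransform ENNReal SchwartzMap RealInnerProductSpace
set_option linter.all false
set_option linter.unusedVariables false
set_option linter.unusedSimpArgs false
set_option linter.deprecated false
namespace Strz

abbrev Eu (d : ℕ) := EuclideanSpace ℝ (Fin d)

/-- powers of two -/
noncomputable def tw (x : ℝ) : ℝ≥0∞ := (2 : ℝ≥0∞) ^ x

lemma tw_ne_zero (x : ℝ) : tw x ≠ 0 := by
  unfold tw; exact (ENNReal.rpow_pos (by norm_num) (by norm_num)).ne'
lemma tw_ne_top (x : ℝ) : tw x ≠ ∞ := by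
  unfold tw; exact ENNReal.rpow_ne_top_of_ne_zero (by norm_num) (by norm_num)
lemma tw_add (x y : ℝ) : tw (x + y) = tw x * tw y := by
  unfold tw; exact ENNReal.rpow_add _ _ (by norm_num) (by norm_num)
lemma tw_neg (x : ℝ) : tw (-x) = (tw x)⁻¹ := by
  unfold tw; exact ENNReal.rpow_neg _ _
lemma tw_zero : tw 0 = 1 := by unfold tw; simp
lemma tw_one : tw 1 = 2 := by unfold tw; simp
lemma tw_rpow (x y : ℝ) : tw x ^ y = tw (x * y) := by
  unfold tw; rw [ENNReal.rpow_mul]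
lemma tw_mono {x y : ℝ} (h : x ≤ y) : tw x ≤ tw y := by
  unfold tw; exact ENNReal.rpow_le_rpow_of_exponent_le (by norm_num) h
lemma tw_lt {x y : ℝ} (h : x < y) : tw x < tw y := by
  unfold tw; exact ENNReal.rpow_lt_rpow_of_exponent_lt (by norm_num) (by norm_num) h
lemma tw_ofReal (x : ℝ) : tw x = ENNReal.ofReal (2 ^ x) := by
  unfold tw
  rw [← ENNReal.ofReal_rpow_of_pos (by norm_num)]; simp

lemma exists_tw {x : ℝ≥0∞} (h0 : x ≠ 0) (ht : x ≠ ∞) : ∃ y : ℝ, x = tw y := by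
  refine ⟨Real.logb 2 x.toReal, ?_⟩
  rw [tw_ofReal, Real.rpow_logb (by norm_num) (by norm_num) (ENNReal.toReal_pos h0 ht),
    ENNReal.ofReal_toReal ht]

lemma tw_geom (ε : ℝ) (hε : 0 < ε) : ∃ C : ℝ≥0∞, C ≠ ∞ ∧ ∀ c : ℝ,
    ∑' n : ℤ, tw (-ε * |(n : ℝ) - c|) ≤ C := by
  have hs : Summable (fun n : ℤ => (2 : ℝ) ^ (-ε * |(n : ℝ)|)) := by
    have h1 : Summable (fun n : ℕ => (2 : ℝ) ^ (-ε * |((n : ℤ) : ℝ)|)) := by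
      have : Summable (fun n : ℕ => ((2 : ℝ) ^ (-ε)) ^ n) := by
        apply summable_geometric_of_lt_one (by positivity)
        exact Real.rpow_lt_one_of_one_lt_of_neg (by norm_num) (by linarith)
      refine this.congr fun n => ?_
      rw [← Real.rpow_natCast, ← Real.rpow_mul (by norm_num)]
      simp
    refine Summable.of_nat_of_neg h1 ?_
    simpa using h1
  refine ⟨tw ε * ∑' n : ℤ, ENNReal.ofReal ((2 : ℝ) ^ (-ε * |(n : ℝ)|)), ?_, fun c => ?_⟩
  · refine ENNReal.mul_ne_top (tw_ne_top _) ?_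
    rw [← ENNReal.ofReal_tsum_of_nonneg (fun n => by positivity) hs]
    exact ENNReal.ofReal_ne_top
  · rw [← ENNReal.tsum_mul_left, ← (Equiv.addRight ⌊c⌋).tsum_eq]
    refine ENNReal.tsum_le_tsum fun n => ?_
    rw [← tw_ofReal, ← tw_add]
    refine tw_mono ?_
    simp only [Equiv.coe_addRight, Int.cast_add]
    have h1 := Int.floor_le c
    have h2 := Int.lt_floor_add_one c
    have h3 : |(n : ℝ)| - 1 ≤ |(n : ℝ) + ⌊c⌋ - c| := by
      have := abs_sub_abs_le_abs_sub (n : ℝ) (c - ⌊c⌋)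
      have h4 : |c - ⌊c⌋| ≤ 1 := by rw [abs_le]; constructor <;> linarith
      have h5 : (n : ℝ) + ⌊c⌋ - c = n - (c - ⌊c⌋) := by ring
      rw [h5]; linarith
    nlinarith

lemma schur_tsum {ι κ : Type} [Countable ι] [Countable κ] (w : ι → κ → ℝ≥0∞) (a : ι → ℝ≥0∞) (b : κ → ℝ≥0∞)
    (C : ℝ≥0∞) (h1 : ∀ k, ∑' l, w k l ≤ C) (h2 : ∀ l, ∑' k, w k l ≤ C) :
    ∑' k, ∑' l, w k l * a k * b l ≤
      C * (∑' k, a k ^ (2:ℝ)) ^ (1/2 : ℝ) * (∑' l, b l ^ (2:ℝ)) ^ (1/2 : ℝ) := by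
  let _ : MeasurableSpace (ι × κ) := ⊤
  have key := ENNReal.lintegral_mul_le_Lp_mul_Lq (Measure.count : Measure (ι × κ))
    (p := 2) (q := 2) ⟨by norm_num, by norm_num, by norm_num⟩
    (f := fun z => w z.1 z.2 ^ (1/2:ℝ) * a z.1) (g := fun z => w z.1 z.2 ^ (1/2:ℝ) * b z.2)
    (measurable_of_countable _).aemeasurable (measurable_of_countable _).aemeasurable
  simp only [lintegral_count, Pi.mul_apply] at key
  have hw : ∀ x : ℝ≥0∞, x ^ (1/2:ℝ) * x ^ (1/2:ℝ) = x := fun x => by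
    rw [← ENNReal.rpow_add_of_nonneg _ _ (by norm_num) (by norm_num)]; norm_num
  have e1 : ∑' k, ∑' l, w k l * a k * b l =
      ∑' z : ι × κ, w z.1 z.2 ^ (1/2:ℝ) * a z.1 * (w z.1 z.2 ^ (1/2:ℝ) * b z.2) := by
    rw [ENNReal.tsum_prod']
    refine tsum_congr fun k => tsum_congr fun l => ?_
    calc w k l * a k * b l = (w k l ^ (1/2:ℝ) * w k l ^ (1/2:ℝ)) * a k * b l := by rw [hw]
      _ = _ := by ring
  have hsq : ∀ x y : ℝ≥0∞, (x ^ (1/2:ℝ) * y) ^ (2:ℝ) = x * y ^ (2:ℝ) := fun x y => by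
    rw [ENNReal.mul_rpow_of_nonneg _ _ (by norm_num), ← ENNReal.rpow_mul]; norm_num
  simp only [hsq] at key
  have e2 : ∑' z : ι × κ, w z.1 z.2 * a z.1 ^ (2:ℝ) ≤ C * ∑' k, a k ^ (2:ℝ) := by
    rw [ENNReal.tsum_prod', ← ENNReal.tsum_mul_left]
    refine ENNReal.tsum_le_tsum fun k => ?_
    dsimp only
    rw [ENNReal.tsum_mul_right]
    gcongr
    exact h1 k
  have e3 : ∑' z : ι × κ, w z.1 z.2 * b z.2 ^ (2:ℝ) ≤ C * ∑' k, b k ^ (2:ℝ) := by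
    rw [ENNReal.tsum_prod', ENNReal.tsum_comm, ← ENNReal.tsum_mul_left]
    refine ENNReal.tsum_le_tsum fun k => ?_
    dsimp only
    rw [ENNReal.tsum_mul_right]
    gcongr
    exact h2 k
  rw [e1]
  refine key.trans ?_
  calc _ ≤ (C * ∑' k, a k ^ (2:ℝ)) ^ (1/2:ℝ) * (C * ∑' k, b k ^ (2:ℝ)) ^ (1/2:ℝ) := by gcongr
    _ = (C ^ (1/2:ℝ) * C ^ (1/2:ℝ)) * (∑' k, a k ^ (2:ℝ)) ^ (1/2 : ℝ) * (∑' l, b l ^ (2:ℝ)) ^ (1/2 : ℝ) := by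
        rw [ENNReal.mul_rpow_of_nonneg _ _ (by norm_num), ENNReal.mul_rpow_of_nonneg _ _ (by norm_num)]; ring
    _ = _ := by rw [hw]

/-- the `L^β` size of a function -/
noncomputable def nrm {Ω : Type*} [MeasureSpace Ω] (β : ℝ) (f : Ω → ℂ) : ℝ≥0∞ :=
  (∫⁻ y, ‖f y‖ₑ ^ β) ^ (1 / β)

lemma nrm_rpow {Ω : Type*} [MeasureSpace Ω] {β : ℝ} (hβ : 0 < β) (f : Ω → ℂ) :
    nrm β f ^ β = ∫⁻ y, ‖f y‖ₑ ^ β := by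
  unfold nrm; rw [← ENNReal.rpow_mul, one_div_mul_cancel hβ.ne', ENNReal.rpow_one]

lemma nrm_one {Ω : Type*} [MeasureSpace Ω] (f : Ω → ℂ) : nrm 1 f = ∫⁻ y, ‖f y‖ₑ := by
  simp [nrm]

lemma nrm_mono {Ω : Type*} [MeasureSpace Ω] {β : ℝ} (hβ : 0 < β) {f g : Ω → ℂ}
    (h : ∀ y, ‖f y‖ₑ ≤ ‖g y‖ₑ) : nrm β f ≤ nrm β g := by
  unfold nrm
  refine ENNReal.rpow_le_rpow (lintegral_mono fun y => ENNReal.rpow_le_rpow (h y) hβ.le) (by positivity)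

lemma nrm_holder {Ω : Type*} [MeasureSpace Ω] {p q : ℝ} (hpq : p.HolderConjugate q)
    {f g : Ω → ℂ} (hf : Measurable f) (hg : Measurable g) :
    ∫⁻ y, ‖f y‖ₑ * ‖g y‖ₑ ≤ nrm p f * nrm q g :=
  ENNReal.lintegral_mul_le_Lp_mul_Lq _ hpq (by fun_prop) (by fun_prop)

/-- log-convexity -/
lemma nrm_interp {Ω : Type*} [MeasureSpace Ω] {p q r θ : ℝ} (hp : 0 < p) (hq : 0 < q) (hr : 0 < r)
    (h0 : 0 < θ) (h1 : θ < 1) (h : 1 / r = θ / p + (1 - θ) / q)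
    {f : Ω → ℂ} (hf : Measurable f) :
    nrm r f ≤ nrm p f ^ θ * nrm q f ^ (1 - θ) := by
  have h1' : 0 < 1 - θ := by linarith
  set P := p / (θ * r)
  set Q := q / ((1 - θ) * r)
  have hPQ : P.HolderConjugate Q := by
    rw [Real.holderConjugate_iff]
    have hs : P⁻¹ + Q⁻¹ = 1 := by
      simp only [P, Q, inv_div]
      have : (θ * r) / p + ((1 - θ) * r) / q = r * (θ / p + (1 - θ) / q) := by ring
      rw [this, ← h]; field_simp
    have hP : 0 < P := by positivity
    have hQ : 0 < Q := by positivity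
    refine ⟨?_, hs⟩
    have : P⁻¹ < 1 := by have := inv_pos.2 hQ; linarith
    exact (inv_lt_one₀ hP).1 this
  have key := ENNReal.lintegral_mul_le_Lp_mul_Lq (volume : Measure Ω) hPQ
    (f := fun y => ‖f y‖ₑ ^ (θ * r)) (g := fun y => ‖f y‖ₑ ^ ((1 - θ) * r)) (by fun_prop) (by fun_prop)
  have e1 : ∀ y, ‖f y‖ₑ ^ (θ * r) * ‖f y‖ₑ ^ ((1 - θ) * r) = ‖f y‖ₑ ^ r := fun y => by
    rw [← ENNReal.rpow_add_of_nonneg _ _ (by positivity) (by positivity)]; congr 1; ring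
  have e2 : ∀ y, (‖f y‖ₑ ^ (θ * r)) ^ P = ‖f y‖ₑ ^ p := fun y => by
    rw [← ENNReal.rpow_mul]; congr 1; simp only [P]; field_simp
  have e3 : ∀ y, (‖f y‖ₑ ^ ((1 - θ) * r)) ^ Q = ‖f y‖ₑ ^ q := fun y => by
    rw [← ENNReal.rpow_mul]; congr 1; simp only [Q]; field_simp
  simp only [Pi.mul_apply, e1, e2, e3] at key
  unfold nrm
  calc _ ≤ _ := ENNReal.rpow_le_rpow key (by positivity : 0 ≤ 1 / r)
    _ = _ := by
      rw [ENNReal.mul_rpow_of_nonneg _ _ (by positivity)]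
      simp only [← ENNReal.rpow_mul]
      congr 2
      · simp only [P]; field_simp
      · simp only [Q]; field_simp

end Strz


open MeasureTheory Real Complex
open scoped FourierTransform ENNReal SchwartzMap RealInnerProductSpace
set_option linter.all false
set_option linter.unusedVariables false
set_option linter.unusedSimpArgs false
set_option linter.deprecated false
namespace Strz

section atoms
variable {Ω : Type*} [MeasureSpace Ω]

noncomputable def gfun (β : ℝ) (f : Ω → ℂ) (y : Ω) : ℝ≥0∞ := (‖f y‖ₑ / nrm β f) ^ β

def gset (β : ℝ) (f : Ω → ℂ) (k : ℤ) : Set Ω :=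
  {y | tw (-((k:ℝ) + 1)) < gfun β f y ∧ gfun β f y ≤ tw (-(k:ℝ))}

noncomputable def atom (β : ℝ) (f : Ω → ℂ) (k : ℤ) : Ω → ℂ := (gset β f k).indicator f

noncomputable def cof (β : ℝ) (f : Ω → ℂ) (k : ℤ) : ℝ≥0∞ :=
  nrm β f * (∫⁻ y in gset β f k, gfun β f y) ^ (1/2 : ℝ)

lemma measurable_gfun {β : ℝ} {f : Ω → ℂ} (hf : Measurable f) : Measurable (gfun β f) := by
  unfold gfun; fun_prop

lemma measurableSet_gset {β : ℝ} {f : Ω → ℂ} (hf : Measurable f) (k : ℤ) :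
    MeasurableSet (gset β f k) :=
  (measurableSet_lt measurable_const (measurable_gfun hf)).inter
    (measurableSet_le (measurable_gfun hf) measurable_const)

lemma gset_disj (β : ℝ) (f : Ω → ℂ) : Pairwise (Function.onFun Disjoint (gset β f)) := by
  have key : ∀ k l : ℤ, k < l → Disjoint (gset β f k) (gset β f l) := by
    intro k l hkl
    rw [Set.disjoint_left]
    rintro y ⟨h1, -⟩ ⟨-, h2⟩
    have : tw (-(l:ℝ)) ≤ tw (-((k:ℝ)+1)) := tw_mono (by
      have : (k:ℝ) + 1 ≤ l := by exact_mod_cast hkl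
      linarith)
    exact absurd (h2.trans this) (not_le.2 h1)
  intro k l hkl
  rcases lt_or_gt_of_ne hkl with h | h
  · exact key k l h
  · exact (key l k h).symm

lemma exists_gset {β : ℝ} (hβ : 0 < β) {f : Ω → ℂ} (h0 : nrm β f ≠ 0) (ht : nrm β f ≠ ∞) {y : Ω}
    (hy : f y ≠ 0) : ∃ k, y ∈ gset β f k := by
  have h1 : ‖f y‖ₑ ≠ 0 := by simpa using hy
  have h2 : ‖f y‖ₑ / nrm β f ≠ 0 := ENNReal.div_ne_zero.2 ⟨h1, ht⟩
  have h3 : ‖f y‖ₑ / nrm β f ≠ ∞ := ENNReal.div_ne_top (by simp) h0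
  obtain ⟨z, hz⟩ := exists_tw (x := gfun β f y)
    (by unfold gfun; exact (ENNReal.rpow_pos (pos_iff_ne_zero.2 h2) h3).ne')
    (by unfold gfun; exact ENNReal.rpow_ne_top_of_nonneg hβ.le h3)
  refine ⟨⌊-z⌋, ?_, ?_⟩
  · rw [hz]; apply tw_lt; have := Int.lt_floor_add_one (-z); linarith
  · rw [hz]; apply tw_mono; have := Int.floor_le (-z); linarith

lemma lintegral_gfun_le {β : ℝ} (hβ : 0 < β) (f : Ω → ℂ) :
    (∫⁻ y, gfun β f y) ≤ 1 ∨ nrm β f = 0 := by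
  by_cases h0 : nrm β f = 0
  · exact Or.inr h0
  left
  by_cases ht : nrm β f = ∞
  · simp [gfun, ht, ENNReal.zero_rpow_of_pos hβ]
  have : ∀ y, gfun β f y = (nrm β f ^ β)⁻¹ * ‖f y‖ₑ ^ β := fun y => by
    unfold gfun
    rw [ENNReal.div_rpow_of_nonneg _ _ hβ.le, ENNReal.div_eq_inv_mul]
  simp only [this]
  have hne : nrm β f ^ β ≠ 0 := (ENNReal.rpow_pos (pos_iff_ne_zero.2 h0) ht).ne'
  have hnt : nrm β f ^ β ≠ ∞ := ENNReal.rpow_ne_top_of_nonneg hβ.le ht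
  rw [lintegral_const_mul' _ _ (by simpa using hne), ← nrm_rpow hβ,
    ENNReal.inv_mul_cancel hne hnt]

lemma cof_sum {β : ℝ} (hβ : 0 < β) {f : Ω → ℂ} (hf : Measurable f) :
    ∑' k, cof β f k ^ (2:ℝ) ≤ nrm β f ^ (2:ℝ) := by
  rcases lintegral_gfun_le hβ f with h | h
  · have e : ∀ k, cof β f k ^ (2:ℝ) = nrm β f ^ (2:ℝ) * ∫⁻ y in gset β f k, gfun β f y := fun k => by
      unfold cof
      rw [ENNReal.mul_rpow_of_nonneg _ _ (by norm_num), ← ENNReal.rpow_mul]; norm_num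
    simp only [e]
    rw [ENNReal.tsum_mul_left, ← lintegral_iUnion (measurableSet_gset hf) (gset_disj β f)]
    calc _ ≤ nrm β f ^ (2:ℝ) * 1 := by gcongr; exact (setLIntegral_le_lintegral _ _).trans h
      _ = _ := mul_one _
  · simp [cof, h]

lemma atom_nrm {β r : ℝ} (hβ : 1 ≤ β) (hr : 1 ≤ r) (hr2 : r ≤ 2) {f : Ω → ℂ} (hf : Measurable f)
    (k : ℤ) : nrm r (atom β f k) ≤ 2 * tw (k * (1 / r - 1 / β)) * cof β f k := by
  have hβ0 : 0 < β := by linarith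
  have hr0 : 0 < r := by linarith
  by_cases h0 : nrm β f = 0
  · have : atom β f k = 0 := by
      funext y
      unfold atom
      by_cases hy : y ∈ gset β f k <;> [rw [Set.indicator_of_mem hy]; rw [Set.indicator_of_notMem hy]]
      · by_contra hne
        have := hy.2
        have h1 : ‖f y‖ₑ ≠ 0 := by simpa using hne
        rw [gfun, h0, ENNReal.div_zero h1, ENNReal.top_rpow_of_pos hβ0] at this
        exact absurd (top_le_iff.1 this) (tw_ne_top _)
      · rfl
    rw [this]
    simp [nrm, ENNReal.zero_rpow_of_pos hr0, ENNReal.zero_rpow_of_pos (inv_pos.2 hr0)]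
  by_cases ht : nrm β f = ∞
  · have : atom β f k = 0 := by
      funext y
      unfold atom
      by_cases hy : y ∈ gset β f k <;> [rw [Set.indicator_of_mem hy]; rw [Set.indicator_of_notMem hy]]
      · have := hy.1
        rw [gfun, ht, ENNReal.div_top, ENNReal.zero_rpow_of_pos hβ0] at this
        exact absurd this (by simp)
      · rfl
    rw [this]
    simp [nrm, ENNReal.zero_rpow_of_pos hr0, ENNReal.zero_rpow_of_pos (inv_pos.2 hr0)]
  set A := gset β f k
  set ν := ∫⁻ y in A, gfun β f y with hν
  have hν1 : ν ≤ 1 := (setLIntegral_le_lintegral _ _).trans ((lintegral_gfun_le hβ0 f).resolve_right h0)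
  have hA : MeasurableSet A := measurableSet_gset hf k
  have hvol : volume A ≤ tw (k + 1) * ν := by
    have : tw (-((k:ℝ) + 1)) * volume A ≤ ν := by
      rw [← setLIntegral_const]
      exact setLIntegral_mono (measurable_gfun hf) fun y hy => hy.1.le
    calc volume A = tw (k+1) * (tw (-((k:ℝ) + 1)) * volume A) := by
          rw [← mul_assoc, ← tw_add]; simp [tw_zero]
      _ ≤ _ := by gcongr
  have hpt : ∀ y ∈ A, ‖f y‖ₑ ≤ nrm β f * tw (-(k/β)) := by
    intro y hy
    have h1 : ‖f y‖ₑ / nrm β f ≤ tw (-(k/β)) := by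
      have := ENNReal.rpow_le_rpow hy.2 (by positivity : 0 ≤ 1/β)
      rw [gfun, ← ENNReal.rpow_mul, tw_rpow] at this
      rw [mul_one_div_cancel hβ0.ne', ENNReal.rpow_one] at this
      convert this using 2; ring
    calc ‖f y‖ₑ = nrm β f * (‖f y‖ₑ / nrm β f) := (ENNReal.mul_div_cancel h0 ht).symm
      _ ≤ _ := by gcongr
  have hIntg : ∫⁻ y, ‖atom β f k y‖ₑ ^ r ≤ (nrm β f * tw (-(k/β))) ^ r * (tw (k + 1) * ν) := by
    calc ∫⁻ y, ‖atom β f k y‖ₑ ^ r = ∫⁻ y in A, ‖f y‖ₑ ^ r := by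
          rw [← lintegral_indicator hA]
          refine lintegral_congr fun y => ?_
          unfold atom
          by_cases hy : y ∈ A
          · simp [A] at *; simp [hy]
          · have hy' : y ∉ gset β f k := hy
            simp [Set.indicator_of_notMem hy, Set.indicator_of_notMem hy', ENNReal.zero_rpow_of_pos hr0]
      _ ≤ ∫⁻ y in A, (nrm β f * tw (-(k/β))) ^ r :=
          setLIntegral_mono measurable_const fun y hy => ENNReal.rpow_le_rpow (hpt y hy) hr0.le
      _ = (nrm β f * tw (-(k/β))) ^ r * volume A := setLIntegral_const _ _
      _ ≤ _ := by gcongr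
  unfold nrm
  calc _ ≤ ((nrm β f * tw (-(k/β))) ^ r * (tw (k + 1) * ν)) ^ (1/r) :=
        ENNReal.rpow_le_rpow hIntg (by positivity)
    _ = nrm β f * tw (-(k/β)) * (tw ((k+1) * (1/r)) * ν ^ (1/r)) := by
        rw [ENNReal.mul_rpow_of_nonneg _ _ (by positivity), ← ENNReal.rpow_mul,
          mul_one_div_cancel hr0.ne', ENNReal.rpow_one,
          ENNReal.mul_rpow_of_nonneg _ _ (by positivity), tw_rpow]
    _ ≤ nrm β f * tw (-(k/β)) * (tw (1 + k * (1/r)) * ν ^ (1/2:ℝ)) := by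
        refine mul_le_mul_right (mul_le_mul' ?_ ?_) _
        · apply tw_mono
          have : 1 / r ≤ 1 := by rw [div_le_one hr0]; exact hr
          linarith
        · exact ENNReal.rpow_le_rpow_of_exponent_ge hν1 (by
            apply one_div_le_one_div_of_le hr0 hr2)
    _ = _ := by
        rw [show (k:ℝ) * (1 / r - 1 / β) = -(k/β) + k * (1/r) by ring, tw_add, tw_add, tw_one]
        unfold cof
        ring

end atoms

lemma enorm_integral_le_tsum {Z ι : Type*} [Countable ι] [MeasurableSpace Z] {μ : Measure Z} {h : Z → ℂ}
    (hh : Integrable h μ) {A : ι → Set Z} (hA : ∀ i, MeasurableSet (A i))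
    (hd : Pairwise (Function.onFun Disjoint A)) (hc : ∀ᵐ z ∂μ, h z ≠ 0 → ∃ i, z ∈ A i) :
    ‖∫ z, h z ∂μ‖ₑ ≤ ∑' i, ‖∫ z in A i, h z ∂μ‖ₑ := by
  have e : ∫ z, h z ∂μ = ∫ z in ⋃ i, A i, h z ∂μ := by
    rw [← integral_indicator (MeasurableSet.iUnion hA)]
    refine integral_congr_ae ?_
    filter_upwards [hc] with z hz
    by_cases h0 : h z = 0
    · by_cases h1 : z ∈ ⋃ i, A i
      · rw [Set.indicator_of_mem h1]
      · rw [Set.indicator_of_notMem h1, h0]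
    · rw [Set.indicator_of_mem (Set.mem_iUnion.2 (hz h0))]
  rw [e]
  have hs := hasSum_integral_iUnion hA hd hh.integrableOn
  rw [← hs.tsum_eq]
  exact enorm_tsum_le_tsum_enorm

end Strz


open MeasureTheory Real Complex
open scoped FourierTransform ENNReal SchwartzMap RealInnerProductSpace
set_option linter.all false
set_option linter.unusedVariables false
set_option linter.unusedSimpArgs false
set_option linter.deprecated false
namespace Strz

section dispersive
open scoped ContDiff
variable {d : ℕ}

/-- the symbol of the bilaplacian -/
noncomputable def om (ξ : Eu d) : ℝ := (2 * Real.pi * ‖ξ‖) ^ 4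

@[fun_prop] lemma cd_inner {V W : Type*} [NormedAddCommGroup V] [NormedSpace ℝ V] [NormedAddCommGroup W]
    [InnerProductSpace ℝ W] {f g : V → W} (hf : ContDiff ℝ ∞ f) (hg : ContDiff ℝ ∞ g) :
    ContDiff ℝ ∞ (fun x => (inner ℝ (f x) (g x) : ℝ)) := ContDiff.inner ℝ hf hg

noncomputable def uexp (r : ℝ) : ℂ := Complex.exp (r * Complex.I)

lemma norm_uexp (r : ℝ) : ‖uexp r‖ = 1 := Complex.norm_exp_ofReal_mul_I r
lemma enorm_uexp (r : ℝ) : ‖uexp r‖ₑ = 1 := by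
  rw [← ofReal_norm, norm_uexp]; simp
lemma uexp_add (r s : ℝ) : uexp (r + s) = uexp r * uexp s := by
  unfold uexp; rw [← Complex.exp_add]; push_cast; ring_nf
lemma uexp_conj (r : ℝ) : (starRingEnd ℂ) (uexp r) = uexp (-r) := by
  unfold uexp; rw [← Complex.exp_conj]; simp
lemma uexp_zero : uexp 0 = 1 := by simp [uexp]
lemma contDiff_uexp : ContDiff ℝ ∞ uexp := by
  unfold uexp
  have : ContDiff ℝ ∞ (fun r : ℝ => (r : ℂ)) := Complex.ofRealCLM.contDiff
  fun_prop
@[fun_prop] lemma continuous_uexp : Continuous uexp := contDiff_uexp.continuous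
@[fun_prop] lemma continuous_om : Continuous (om : Eu d → ℝ) := by unfold om; fun_prop

lemma om_eq (ξ : Eu d) : om ξ = (2 * Real.pi) ^ 4 * (inner ℝ ξ ξ) ^ 2 := by
  unfold om; rw [real_inner_self_eq_norm_sq]; ring

/-- oscillatory kernel with amplitude `a` -/
noncomputable def ker (a : Eu d → ℝ) (τ : ℝ) (x : Eu d) : ℂ :=
  ∫ ξ, (a ξ : ℂ) * uexp (τ * om ξ + 2 * Real.pi * inner ℝ x ξ)

noncomputable def qf (z : Eu d × Eu d × ℝ) : ℝ :=
  inner ℝ z.1 z.1 * (1 + (inner ℝ z.2.1 z.2.1 - 1) ^ 2) + 2 * (inner ℝ z.1 z.2.1) ^ 2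
    + 3 * inner ℝ z.1 z.2.1 * z.2.2 + z.2.2 ^ 2

lemma contDiff_qf : ContDiff ℝ ∞ (qf : Eu d × Eu d × ℝ → ℝ) := by
  unfold qf; fun_prop

lemma qf_pos {z : Eu d × Eu d × ℝ} (hz : z.1 ≠ 0) : 0 < qf z := by
  obtain ⟨ξ, v, ρ⟩ := z
  have h1 : 0 < inner ℝ ξ ξ := real_inner_self_pos.2 hz
  have h2 : (inner ℝ ξ v) * (inner ℝ ξ v) ≤ inner ℝ ξ ξ * inner ℝ v v := real_inner_mul_inner_self_le ξ v
  unfold qf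
  simp only
  set X := inner ℝ ξ ξ
  set a := inner ℝ ξ v
  set s := inner ℝ v v
  have h3 : 0 < X * (1 + (s-1)^2 - s/4) := by
    apply mul_pos h1; nlinarith [sq_nonneg (s - 9/8)]
  nlinarith [sq_nonneg (ρ + 3/2*a)]

noncomputable def LL (A : Eu d × Eu d × ℝ → ℂ) (z : Eu d × Eu d × ℝ) : ℂ :=
  fderiv ℝ (fun z => (qf z)⁻¹ • A z) z (z.2.1, 0, 0)

def Kset (d : ℕ) : Set (Eu d × Eu d × ℝ) := {z | 1/4 ≤ ‖z.1‖^2 ∧ ‖z.1‖^2 ≤ 2}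

lemma isClosed_Kset : IsClosed (Kset d) := by
  have h : Continuous fun z : Eu d × Eu d × ℝ => ‖z.1‖^2 := by fun_prop
  exact (isClosed_le (continuous_const (y := (1/4:ℝ))) h).inter (isClosed_le h (continuous_const (y := (2:ℝ))))

def GoodA (A : Eu d × Eu d × ℝ → ℂ) : Prop := ContDiff ℝ ∞ A ∧ ∀ z ∉ Kset d, A z = 0

lemma GoodA.quot {A : Eu d × Eu d × ℝ → ℂ} (hA : GoodA A) : GoodA (fun z => (qf z)⁻¹ • A z) := by
  refine ⟨contDiff_iff_contDiffAt.2 fun z => ?_, fun z hz => by simp [hA.2 z hz]⟩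
  by_cases hz : z ∈ Kset d
  · have h0 : z.1 ≠ 0 := by
      intro h; have := hz.1; rw [h] at this; norm_num at this
    exact (contDiff_qf.contDiffAt.inv (qf_pos h0).ne').smul hA.1.contDiffAt
  · have : (fun z => (qf z)⁻¹ • A z) =ᶠ[nhds z] fun _ => 0 := by
      filter_upwards [isClosed_Kset.isOpen_compl.mem_nhds hz] with w hw
      simp [hA.2 w hw]
    exact contDiffAt_const.congr_of_eventuallyEq this

lemma GoodA.LL {A : Eu d × Eu d × ℝ → ℂ} (hA : GoodA A) : GoodA (LL A) := by
  have h := hA.quot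
  refine ⟨(h.1.fderiv_right (m := ∞) (by simp)).clm_apply (by fun_prop), fun z hz => ?_⟩
  have : (fun z => (qf z)⁻¹ • A z) =ᶠ[nhds z] fun _ => 0 := by
    filter_upwards [isClosed_Kset.isOpen_compl.mem_nhds hz] with w hw
    simp [hA.2 w hw]
  unfold Strz.LL
  rw [this.fderiv_eq]; simp

lemma GoodA.iter {A : Eu d × Eu d × ℝ → ℂ} (hA : GoodA A) (n : ℕ) : GoodA (Strz.LL^[n] A) := by
  induction n generalizing A with
  | zero => exact hA
  | succ n ih => exact ih hA.LL

lemma compact_ann : IsCompact {ξ : Eu d | ‖ξ‖^2 ≤ 2} := by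
  have : {ξ : Eu d | ‖ξ‖^2 ≤ 2} ⊆ Metric.closedBall 0 2 := by
    intro ξ hξ
    simp only [Set.mem_ofPred_eq] at hξ
    simp only [mem_closedBall_zero_iff]
    nlinarith [norm_nonneg ξ]
  exact (isCompact_closedBall (0 : Eu d) 2).of_isClosed_subset
    (isClosed_le (by fun_prop) continuous_const) this

lemma GoodA.hcs {A : Eu d × Eu d × ℝ → ℂ} (hA : GoodA A) (v : Eu d) (ρ : ℝ) :
    HasCompactSupport (fun ξ => A (ξ, v, ρ)) :=
  HasCompactSupport.intro compact_ann fun _ hξ => hA.2 _ fun h => hξ h.2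

/-- phase -/
noncomputable def ph (v : Eu d) (ρ : ℝ) (ξ : Eu d) : ℝ := om (ξ + ρ • v) - om ξ

lemma contDiff_ph (v : Eu d) (ρ : ℝ) : ContDiff ℝ ∞ (ph v ρ) := by
  unfold ph; simp only [om_eq]; fun_prop

lemma fderiv_ph {v : Eu d} (hv : ‖v‖ = 1) (ρ : ℝ) (ξ : Eu d) :
    fderiv ℝ (ph v ρ) ξ v = 4 * (2 * Real.pi) ^ 4 * ρ * qf (ξ, v, ρ) := by
  have hd : DifferentiableAt ℝ (ph v ρ) ξ := (contDiff_ph v ρ).differentiable (by simp) ξ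
  have h1 : HasDerivAt (fun t : ℝ => ph v ρ (ξ + t • v)) (fderiv ℝ (ph v ρ) ξ v) 0 := by
    have := hd.hasFDerivAt.hasLineDerivAt v
    exact this
  have hvv : inner ℝ v v = (1:ℝ) := by rw [real_inner_self_eq_norm_sq, hv]; norm_num
  have h2 : (fun t : ℝ => ph v ρ (ξ + t • v)) = fun t : ℝ =>
      (2 * Real.pi) ^ 4 * ((inner ℝ ξ ξ + 2 * inner ℝ ξ v * (t + ρ) + (t + ρ)^2)^2
        - (inner ℝ ξ ξ + 2 * inner ℝ ξ v * t + t^2)^2) := by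
    funext t
    unfold ph
    rw [om_eq, om_eq]
    have e : ξ + t • v + ρ • v = ξ + (t + ρ) • v := by rw [add_smul, add_assoc]
    have e2 : ∀ r : ℝ, inner ℝ (ξ + r • v) (ξ + r • v) = inner ℝ ξ ξ + 2 * inner ℝ ξ v * r + r^2 := by
      intro r
      rw [real_inner_add_add_self, real_inner_smul_right, real_inner_smul_right, real_inner_smul_left, hvv]
      ring
    rw [e, e2, e2]; ring
  rw [h2] at h1
  have h3 : HasDerivAt (fun t : ℝ =>
      (2 * Real.pi) ^ 4 * ((inner ℝ ξ ξ + 2 * inner ℝ ξ v * (t + ρ) + (t + ρ)^2)^2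
        - (inner ℝ ξ ξ + 2 * inner ℝ ξ v * t + t^2)^2))
      ((2 * Real.pi) ^ 4 * (2 * (inner ℝ ξ ξ + 2 * inner ℝ ξ v * (0 + ρ) + (0 + ρ)^2) *
        (2 * inner ℝ ξ v + 2 * (0 + ρ))
        - 2 * (inner ℝ ξ ξ + 2 * inner ℝ ξ v * 0 + 0^2) * (2 * inner ℝ ξ v + 2 * 0))) 0 := by
    have hi : HasDerivAt (fun t : ℝ => t) 1 0 := hasDerivAt_id _
    have hi2 := hi.add_const ρ
    have := ((((hi2.const_mul (2 * inner ℝ ξ v)).const_add (inner ℝ ξ ξ)).add (hi2.pow 2)).pow 2).sub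
      ((((hi.const_mul (2 * inner ℝ ξ v)).const_add (inner ℝ ξ ξ)).add (hi.pow 2)).pow 2)
    have := this.const_mul ((2 * Real.pi) ^ 4)
    exact this.congr_deriv (by simp)
  rw [h1.unique h3]
  unfold qf
  simp only [hvv]
  ring

lemma ibp {A : Eu d × Eu d × ℝ → ℂ} (hA : GoodA A) {v : Eu d} (hv : ‖v‖ = 1) (τ ρ : ℝ) :
    (τ * (4 * (2 * Real.pi) ^ 4 * ρ) : ℝ) * ‖∫ ξ, A (ξ, v, ρ) * uexp (τ * ph v ρ ξ)‖ ≤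
      ‖∫ ξ, LL A (ξ, v, ρ) * uexp (τ * ph v ρ ξ)‖ := by
  have hq := hA.quot
  set Q : Eu d → ℂ := fun ξ => (qf (ξ, v, ρ))⁻¹ • A (ξ, v, ρ) with hQ
  set g : Eu d → ℂ := fun ξ => uexp (τ * ph v ρ ξ) with hg
  have hgs : ContDiff ℝ ∞ g := contDiff_uexp.comp (contDiff_const.mul (contDiff_ph v ρ))
  have hQs : ContDiff ℝ ∞ Q := hq.1.comp (contDiff_id.prodMk contDiff_const)
  have hdQ : ∀ ξ, fderiv ℝ Q ξ v = LL A (ξ, v, ρ) := by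
    intro ξ
    have h1 : HasFDerivAt (fun ξ : Eu d => (ξ, v, ρ)) (ContinuousLinearMap.inl ℝ (Eu d) (Eu d × ℝ)) ξ :=
      hasFDerivAt_prodMk_left ξ (v, ρ)
    have h2 := (hq.1.differentiable (by simp) (ξ, v, ρ)).hasFDerivAt.comp ξ h1
    rw [show Q = (fun z => (qf z)⁻¹ • A z) ∘ (fun ξ : Eu d => (ξ, v, ρ)) from rfl, h2.fderiv]
    simp [LL]
    rfl
  have hdg : ∀ ξ, fderiv ℝ g ξ v = ((τ * (4 * (2 * Real.pi) ^ 4 * ρ * qf (ξ, v, ρ)) : ℝ) * Complex.I) * g ξ := by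
    intro ξ
    have h1 : HasFDerivAt (ph v ρ) (fderiv ℝ (ph v ρ) ξ) ξ :=
      ((contDiff_ph v ρ).differentiable (by simp) ξ).hasFDerivAt
    have h1' := h1.const_mul τ
    have h2 : HasDerivAt uexp (uexp (τ * ph v ρ ξ) * Complex.I) (τ * ph v ρ ξ) := by
      unfold uexp
      have := ((hasDerivAt_id (τ * ph v ρ ξ)).ofReal_comp.mul_const Complex.I).cexp
      simpa using this
    have h3 := h2.hasFDerivAt.comp ξ h1'
    rw [show g = uexp ∘ (fun ξ => τ * ph v ρ ξ) from rfl, h3.fderiv]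
    have h4 : (τ • fderiv ℝ (ph v ρ) ξ) v = τ * (4 * (2 * Real.pi) ^ 4 * ρ * qf (ξ, v, ρ)) := by
      rw [← fderiv_ph hv]; rfl
    rw [ContinuousLinearMap.comp_apply, h4, ContinuousLinearMap.toSpanSingleton_apply, Complex.real_smul]
    simp only [hg, Function.comp]
    ring
  have hcQ : HasCompactSupport Q := hq.hcs v ρ
  have hcL : HasCompactSupport (fun ξ => LL A (ξ, v, ρ)) := hA.LL.hcs v ρ
  have hLc : Continuous (fun ξ : Eu d => LL A (ξ, v, ρ)) := hA.LL.1.continuous.comp (by fun_prop)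
  have key := integral_mul_fderiv_eq_neg_fderiv_mul_of_integrable (μ := volume) (f := Q) (g := g) (v := v)
    (by simp only [hdQ]
        exact (hLc.mul hgs.continuous).integrable_of_hasCompactSupport hcL.mul_right)
    ((hQs.continuous.mul ((hgs.continuous_fderiv (by simp)).clm_apply continuous_const)).integrable_of_hasCompactSupport hcQ.mul_right)
    ((hQs.continuous.mul hgs.continuous).integrable_of_hasCompactSupport hcQ.mul_right)
    (fun x _ => hQs.differentiable (by simp) x) (fun x _ => hgs.differentiable (by simp) x)
  simp only [hdQ, hdg] at key
  have e : ∀ ξ, Q ξ * (((τ * (4 * (2 * Real.pi) ^ 4 * ρ * qf (ξ, v, ρ)) : ℝ) * Complex.I) * g ξ) =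
      ((τ * (4 * (2 * Real.pi) ^ 4 * ρ) : ℝ) * Complex.I) * (A (ξ, v, ρ) * g ξ) := by
    intro ξ
    by_cases hz : (ξ, v, ρ) ∈ Kset d
    · have h0 : (ξ, v, ρ).1 ≠ 0 := by
        intro h; have := hz.1; rw [h] at this; norm_num at this
      have hne : ((qf (ξ, v, ρ) : ℝ) : ℂ) ≠ 0 := by exact_mod_cast (qf_pos h0).ne'
      simp only [hQ, Complex.real_smul]
      push_cast
      field_simp
    · simp [hQ, hA.2 _ hz]
  simp only [e] at key
  rw [integral_const_mul] at key
  have := congrArg norm key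
  rw [norm_neg, norm_mul, norm_mul, Complex.norm_I, mul_one, Complex.norm_real] at this
  rw [← this]
  gcongr
  exact Real.le_norm_self _

lemma ibp_iter {A : Eu d × Eu d × ℝ → ℂ} (hA : GoodA A) {v : Eu d} (hv : ‖v‖ = 1) {τ ρ : ℝ} (hτ : 0 ≤ τ)
    (hρ : 0 ≤ ρ) (n : ℕ) :
    (τ * (4 * (2 * Real.pi) ^ 4 * ρ)) ^ n * ‖∫ ξ, A (ξ, v, ρ) * uexp (τ * ph v ρ ξ)‖ ≤
      ‖∫ ξ, (LL^[n] A) (ξ, v, ρ) * uexp (τ * ph v ρ ξ)‖ := by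
  induction n generalizing A with
  | zero => simp
  | succ n ih =>
    refine le_trans ?_ (ih hA.LL)
    rw [pow_succ, mul_assoc]
    exact mul_le_mul_of_nonneg_left (ibp hA hv τ ρ) (by positivity)

lemma bound_int {A : Eu d × Eu d × ℝ → ℂ} (hA : GoodA A) : ∃ C, 0 ≤ C ∧ ∀ (v : Eu d) (τ ρ : ℝ), ‖v‖ = 1 →
    0 ≤ ρ → ρ ≤ 4 → ‖∫ ξ, A (ξ, v, ρ) * uexp (τ * ph v ρ ξ)‖ ≤ C := by
  have hK : IsCompact (({ξ : Eu d | ‖ξ‖^2 ≤ 2}) ×ˢ (Metric.closedBall (0 : Eu d) 1 ×ˢ Set.Icc (0:ℝ) 4)) :=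
    compact_ann.prod ((isCompact_closedBall _ _).prod isCompact_Icc)
  obtain ⟨C, hC⟩ := hK.exists_bound_of_continuousOn hA.1.continuous.continuousOn
  refine ⟨max C 0 * (volume {ξ : Eu d | ‖ξ‖^2 ≤ 2}).toReal, by positivity, fun v τ ρ hv h0 h4 => ?_⟩
  have e : ∫ ξ, A (ξ, v, ρ) * uexp (τ * ph v ρ ξ) =
      ∫ ξ in {ξ : Eu d | ‖ξ‖^2 ≤ 2}, A (ξ, v, ρ) * uexp (τ * ph v ρ ξ) := by
    rw [setIntegral_eq_integral_of_forall_compl_eq_zero]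
    intro ξ hξ
    have hz : (ξ, v, ρ) ∉ Kset d := fun h => hξ h.2
    rw [hA.2 (ξ, v, ρ) hz, zero_mul]
  rw [e]
  refine norm_setIntegral_le_of_norm_le_const compact_ann.measure_lt_top fun ξ hξ => ?_
  rw [norm_mul, norm_uexp, mul_one]
  refine (hC _ (Set.mk_mem_prod hξ (Set.mk_mem_prod ?_ (Set.mem_Icc.2 ⟨h0, h4⟩)))).trans (le_max_left _ _)
  simp [hv]

end dispersive
end Strz


open MeasureTheory Real Complex
open scoped FourierTransform ENNReal SchwartzMap RealInnerProductSpace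
set_option linter.all false
set_option linter.unusedVariables false
set_option linter.unusedSimpArgs false
set_option linter.deprecated false
namespace Strz
section dispersive
open scoped ContDiff
variable {d : ℕ}

/-- smooth amplitudes living on the unit annulus -/
structure Amp (a : Eu d → ℝ) : Prop where
  smooth : ContDiff ℝ ∞ a
  low : ∀ ξ, ‖ξ‖^2 < 1/4 → a ξ = 0
  high : ∀ ξ, 2 < ‖ξ‖^2 → a ξ = 0

lemma Amp.hcs {a : Eu d → ℝ} (ha : Amp a) : HasCompactSupport a :=
  HasCompactSupport.intro compact_ann fun ξ hξ => ha.high ξ (not_le.1 hξ)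

lemma Amp.integrable {a : Eu d → ℝ} (ha : Amp a) : Integrable a :=
  ha.smooth.continuous.integrable_of_hasCompactSupport ha.hcs

noncomputable def Jh (a : Eu d → ℝ) (τ : ℝ) (h : Eu d) : ℂ :=
  ∫ ξ, ((a ξ * a (ξ + h) : ℝ) : ℂ) * uexp (τ * (om (ξ + h) - om ξ))

lemma Amp.good {a : Eu d → ℝ} (ha : Amp a) :
    GoodA (fun z : Eu d × Eu d × ℝ => ((a z.1 * a (z.1 + z.2.2 • z.2.1) : ℝ) : ℂ)) := by
  refine ⟨?_, fun z hz => ?_⟩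
  · have h1 : ContDiff ℝ ∞ (fun z : Eu d × Eu d × ℝ => a z.1) := ha.smooth.comp contDiff_fst
    have h2 : ContDiff ℝ ∞ (fun z : Eu d × Eu d × ℝ => a (z.1 + z.2.2 • z.2.1)) :=
      ha.smooth.comp (by fun_prop)
    exact Complex.ofRealCLM.contDiff.comp (h1.mul h2)
  · have : a z.1 = 0 := by
      by_cases h : ‖z.1‖^2 < 1/4
      · exact ha.low _ h
      · refine ha.high _ (not_le.1 fun h2 => hz ⟨not_lt.1 h, h2⟩)
    simp [this]

lemma Jh_bound {a : Eu d → ℝ} (ha : Amp a) : ∃ C, 0 ≤ C ∧ ∀ (τ : ℝ) (h : Eu d), 0 < τ →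
    ‖Jh a τ h‖ ≤ C * (1 + ‖τ • h‖) ^ (-((d:ℝ) + 1)) := by
  obtain ⟨C1, hC1, h1⟩ := bound_int (ha.good.iter (d+1))
  obtain ⟨M, hM⟩ := ha.smooth.continuous.bounded_above_of_compact_support ha.hcs
  set C0 := (∫ ξ, ‖a ξ‖) * M
  have hM0 : 0 ≤ M := (norm_nonneg _).trans (hM 0)
  have hC0 : 0 ≤ C0 := by positivity
  refine ⟨2^(d+1) * (C0 + C1), by positivity, fun τ h hτ => ?_⟩
  have b0 : ‖Jh a τ h‖ ≤ C0 := by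
    unfold Jh
    refine (norm_integral_le_of_norm_le (g := fun ξ => ‖a ξ‖ * M) (ha.integrable.norm.mul_const M) (Filter.Eventually.of_forall fun ξ => ?_)).trans ?_
    · rw [norm_mul, norm_uexp, mul_one, Complex.norm_real, norm_mul]
      gcongr
      exact hM _
    · rw [integral_mul_const]
  have b1 : (τ * ‖h‖) ^ (d+1) * ‖Jh a τ h‖ ≤ C1 := by
    by_cases h0 : h = 0
    · subst h0; simpa using hC1
    by_cases h4 : ‖h‖ ≤ 4
    · have hn : ‖h‖ ≠ 0 := norm_ne_zero_iff.2 h0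
      have hv : ‖(‖h‖⁻¹ • h)‖ = 1 := by rw [norm_smul, norm_inv, norm_norm]; field_simp
      have hs : ‖h‖ • (‖h‖⁻¹ • h) = h := by rw [smul_smul, mul_inv_cancel₀ hn, one_smul]
      have k1 := ibp_iter ha.good hv hτ.le (norm_nonneg h) (d+1)
      have k2 := k1.trans (h1 _ τ _ hv (norm_nonneg h) h4)
      simp only [ph, hs] at k2
      refine le_trans ?_ k2
      change _ ≤ _ * ‖Jh a τ h‖
      gcongr
      have hpi : 1 ≤ 4 * (2 * Real.pi)^4 := by
        have : 1 ≤ 2 * Real.pi := by linarith [Real.pi_gt_three]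
        have := one_le_pow₀ this (n := 4)
        linarith
      nlinarith [norm_nonneg h]
    · have : Jh a τ h = 0 := by
        unfold Jh
        rw [← integral_zero (Eu d) ℂ]
        congr 1
        funext ξ
        have : a ξ * a (ξ + h) = 0 := by
          by_contra hne
          have h5 : ‖ξ‖^2 ≤ 2 := not_lt.1 fun hh => hne (by rw [ha.high _ hh, zero_mul])
          have h6 : ‖ξ + h‖^2 ≤ 2 := not_lt.1 fun hh => hne (by rw [ha.high _ hh, mul_zero])
          have h7 : ‖h‖ ≤ ‖ξ + h‖ + ‖ξ‖ := by
            calc ‖h‖ = ‖(ξ + h) - ξ‖ := by simp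
              _ ≤ _ := norm_sub_le _ _
          have h8 : ‖ξ‖ ≤ 2 := by nlinarith [norm_nonneg ξ]
          have h9 : ‖ξ + h‖ ≤ 2 := by nlinarith [norm_nonneg (ξ + h)]
          exact h4 (by linarith)
        simp [this]
      rw [this]; simpa using hC1
  have hx : 0 ≤ τ * ‖h‖ := by positivity
  have hns : ‖τ • h‖ = τ * ‖h‖ := by rw [norm_smul, Real.norm_of_nonneg hτ.le]
  rw [hns, Real.rpow_neg (by positivity), ← div_eq_mul_inv, le_div_iff₀ (by positivity)]
  have e : (1 + τ * ‖h‖) ^ ((d:ℝ)+1) = (1 + τ * ‖h‖) ^ (d+1) := by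
    rw [← Real.rpow_natCast]; push_cast; rfl
  rw [e]
  have h8 : (1 + τ * ‖h‖) ^ (d+1) ≤ 2^(d+1) * (1 + (τ * ‖h‖)^(d+1)) := by
    calc (1 + τ * ‖h‖) ^ (d+1) ≤ (2 * max 1 (τ * ‖h‖)) ^ (d+1) := by
          gcongr
          linarith [le_max_left 1 (τ * ‖h‖), le_max_right 1 (τ * ‖h‖)]
      _ = 2^(d+1) * (max 1 (τ * ‖h‖))^(d+1) := mul_pow _ _ _
      _ ≤ _ := by
          gcongr
          rcases max_cases 1 (τ * ‖h‖) with ⟨h, _⟩ | ⟨h, _⟩ <;> rw [h]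
          · simp; positivity
          · linarith
  calc ‖Jh a τ h‖ * (1 + τ * ‖h‖) ^ (d+1) ≤ ‖Jh a τ h‖ * (2^(d+1) * (1 + (τ * ‖h‖)^(d+1))) := by gcongr
    _ = 2^(d+1) * (‖Jh a τ h‖ + (τ * ‖h‖)^(d+1) * ‖Jh a τ h‖) := by ring
    _ ≤ _ := by gcongr

lemma ker_conj (a : Eu d → ℝ) (τ : ℝ) (x : Eu d) : (starRingEnd ℂ) (ker a τ x) = ker a (-τ) (-x) := by
  unfold ker
  rw [← integral_conj]
  congr 1; funext ξ
  rw [map_mul, uexp_conj, Complex.conj_ofReal]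
  congr 2
  rw [inner_neg_left]; ring

lemma ker_sq {a : Eu d → ℝ} (ha : Amp a) (τ : ℝ) (x : Eu d) :
    ker a τ x * (starRingEnd ℂ) (ker a τ x) = ∫ h, uexp (2 * Real.pi * inner ℝ x h) * Jh a τ h := by
  set e : Eu d → ℂ := fun ξ => uexp (τ * om ξ + 2 * Real.pi * inner ℝ x ξ) with he
  have hac : Continuous a := ha.smooth.continuous
  have hec : Continuous e := by fun_prop
  have hcpt : HasCompactSupport (fun z : Eu d × Eu d => (a (z.1 + z.2) : ℂ) * e (z.1 + z.2) * ((a z.1 : ℂ) * (starRingEnd ℂ) (e z.1))) := by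
    refine HasCompactSupport.intro ((isCompact_closedBall (0 : Eu d) 2).prod (isCompact_closedBall (0 : Eu d) 4)) fun z hz => ?_
    by_contra hne
    apply hz
    have h5 : ‖z.1‖^2 ≤ 2 := not_lt.1 fun hh => hne (by simp [ha.high _ hh])
    have h6 : ‖z.1 + z.2‖^2 ≤ 2 := not_lt.1 fun hh => hne (by simp [ha.high _ hh])
    have h7 : ‖z.2‖ ≤ ‖z.1 + z.2‖ + ‖z.1‖ := by
      calc ‖z.2‖ = ‖(z.1 + z.2) - z.1‖ := by simp
        _ ≤ _ := norm_sub_le _ _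
    refine Set.mk_mem_prod ?_ ?_
    · rw [mem_closedBall_zero_iff]; nlinarith [norm_nonneg z.1]
    · rw [mem_closedBall_zero_iff]
      have h8 : ‖z.1‖ ≤ 2 := by nlinarith [norm_nonneg z.1]
      have h9 : ‖z.1 + z.2‖ ≤ 2 := by nlinarith [norm_nonneg (z.1 + z.2)]
      linarith
  have hIntg := Continuous.integrable_of_hasCompactSupport (μ := (volume : Measure (Eu d)).prod volume)
    (f := fun z : Eu d × Eu d => (a (z.1 + z.2) : ℂ) * e (z.1 + z.2) * ((a z.1 : ℂ) * (starRingEnd ℂ) (e z.1)))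
    (by fun_prop) hcpt
  calc ker a τ x * (starRingEnd ℂ) (ker a τ x)
      = ∫ ξ, (∫ h, (a (ξ + h) : ℂ) * e (ξ + h)) * ((a ξ : ℂ) * (starRingEnd ℂ) (e ξ)) := by
        have e1 : ∀ ξ, ∫ h, (a (ξ + h) : ℂ) * e (ξ + h) = ker a τ x := fun ξ =>
          integral_add_left_eq_self (fun η => (a η : ℂ) * e η) ξ
        simp only [e1]
        rw [integral_const_mul]
        congr 1
        unfold ker
        rw [← integral_conj]
        congr 1; funext ξ
        simp [he]
    _ = ∫ ξ, ∫ h, (a (ξ + h) : ℂ) * e (ξ + h) * ((a ξ : ℂ) * (starRingEnd ℂ) (e ξ)) := by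
        congr 1; funext ξ; rw [integral_mul_const]
    _ = ∫ h, ∫ ξ, (a (ξ + h) : ℂ) * e (ξ + h) * ((a ξ : ℂ) * (starRingEnd ℂ) (e ξ)) :=
        integral_integral_swap hIntg
    _ = _ := by
        congr 1; funext h
        unfold Jh
        rw [← integral_const_mul]
        congr 1; funext ξ
        simp only [he, uexp_conj]
        have : uexp (τ * om (ξ + h) + 2 * Real.pi * inner ℝ x (ξ + h)) * uexp (-(τ * om ξ + 2 * Real.pi * inner ℝ x ξ))
          = uexp (2 * Real.pi * inner ℝ x h) * uexp (τ * (om (ξ + h) - om ξ)) := by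
          rw [← uexp_add, ← uexp_add, inner_add_right]; congr 1; ring
        push_cast
        linear_combination ((a ξ : ℂ) * (a (ξ + h) : ℂ)) * this

theorem dispersive {a : Eu d → ℝ} (ha : Amp a) : ∃ C, 0 ≤ C ∧ ∀ (τ : ℝ) (x : Eu d), τ ≠ 0 →
    ‖ker a τ x‖ ≤ C * |τ| ^ (-((d:ℝ)/2)) := by
  obtain ⟨C, hC, hJ⟩ := Jh_bound ha
  set D := C * ∫ h : Eu d, (1 + ‖h‖) ^ (-((d:ℝ) + 1)) with hD
  have hD0 : 0 ≤ D := by positivity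
  have pos : ∀ (τ : ℝ) (x : Eu d), 0 < τ → ‖ker a τ x‖ ≤ Real.sqrt D * |τ| ^ (-((d:ℝ)/2)) := by
    intro τ x hτ
    have hIntg : Integrable (fun h : Eu d => (1 + ‖h‖) ^ (-((d:ℝ) + 1))) :=
      integrable_one_add_norm (by simp)
    have h1 : ‖ker a τ x‖^2 ≤ D * |τ| ^ (-(d:ℝ)) := by
      have h2 : ‖ker a τ x‖^2 = ‖ker a τ x * (starRingEnd ℂ) (ker a τ x)‖ := by
        rw [norm_mul, RCLike.norm_conj, sq]
      rw [h2, ker_sq ha]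
      have h3 : Integrable (fun h : Eu d => C * (1 + ‖τ • h‖) ^ (-((d:ℝ) + 1))) :=
        ((integrable_comp_smul_iff volume (fun h : Eu d => (1 + ‖h‖) ^ (-((d:ℝ) + 1))) hτ.ne').2 hIntg).const_mul C
      refine (norm_integral_le_of_norm_le h3 (Filter.Eventually.of_forall fun h => ?_)).trans ?_
      · rw [norm_mul, norm_uexp, one_mul]; exact hJ τ h hτ
      · rw [integral_const_mul, Measure.integral_comp_smul volume (fun h : Eu d => (1 + ‖h‖) ^ (-((d:ℝ) + 1)))]
        simp only [finrank_euclideanSpace, Fintype.card_fin, smul_eq_mul]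
        rw [Real.rpow_neg (abs_nonneg _), Real.rpow_natCast, hD, abs_inv, abs_pow]
        apply le_of_eq; ring
    have h4 : (Real.sqrt D * |τ| ^ (-((d:ℝ)/2)))^2 = D * |τ| ^ (-(d:ℝ)) := by
      rw [mul_pow, Real.sq_sqrt hD0, ← Real.rpow_natCast, ← Real.rpow_mul (abs_nonneg _)]
      congr 2; push_cast; ring
    rw [← h4] at h1
    exact le_of_sq_le_sq h1 (by positivity) 
  refine ⟨Real.sqrt D, Real.sqrt_nonneg _, fun τ x hτ => ?_⟩
  rcases lt_or_gt_of_ne hτ with h | h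
  · have := pos (-τ) (-x) (by linarith)
    rw [← ker_conj, RCLike.norm_conj, abs_neg] at this
    exact this
  · exact pos τ x h

end dispersive
end Strz


open MeasureTheory Real Complex
open scoped FourierTransform ENNReal SchwartzMap RealInnerProductSpace
set_option linter.all false
set_option linter.unusedVariables false
set_option linter.unusedSimpArgs false
set_option linter.deprecated false
namespace Strz
section fixedtime
variable {d : ℕ}

lemma enorm_conj' (z : ℂ) : ‖(starRingEnd ℂ) z‖ₑ = ‖z‖ₑ := by
  rw [← ofReal_norm, ← ofReal_norm, RCLike.norm_conj]

lemma cs_weight {Ω : Type*} [MeasurableSpace Ω] {μ : Measure Ω} {w u v : Ω → ℝ≥0∞} (hw : Measurable w)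
    (hu : Measurable u) (hv : Measurable v) :
    ∫⁻ y, w y * u y * v y ∂μ ≤ (∫⁻ y, w y * u y ^ (2:ℝ) ∂μ) ^ (1/2:ℝ) * (∫⁻ y, w y * v y ^ (2:ℝ) ∂μ) ^ (1/2:ℝ) := by
  have h := ENNReal.lintegral_mul_le_Lp_mul_Lq μ (p := 2) (q := 2) Real.HolderConjugate.two_two
    (f := fun y => w y ^ (1/2:ℝ) * u y) (g := fun y => w y ^ (1/2:ℝ) * v y) (by fun_prop) (by fun_prop)
  have e0 : ∀ x : ℝ≥0∞, (x ^ (1/2:ℝ)) ^ (2:ℝ) = x := fun x => by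
    rw [← ENNReal.rpow_mul]; norm_num
  have e1 : ∀ x : ℝ≥0∞, x ^ (1/2:ℝ) * x ^ (1/2:ℝ) = x := fun x => by
    rw [← ENNReal.rpow_add_of_nonneg _ _ (by norm_num) (by norm_num)]; norm_num
  have e2 : ∀ y, ((fun y => w y ^ (1/2:ℝ) * u y) * (fun y => w y ^ (1/2:ℝ) * v y)) y = w y * u y * v y := fun y => by
    simp only [Pi.mul_apply]
    calc _ = (w y ^ (1/2:ℝ) * w y ^ (1/2:ℝ)) * u y * v y := by ring
      _ = _ := by rw [e1]
  simp only [e2, ENNReal.mul_rpow_of_nonneg _ _ (show (0:ℝ) ≤ 2 by norm_num), e0] at h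
  exact h

/-- fixed-time nice functions -/
structure NiceS (f : Eu d → ℂ) : Prop where
  meas : Measurable f
  bdd : ∃ M : ℝ, ∀ y, ‖f y‖ ≤ M
  int : Integrable f

lemma NiceS.indicator {f : Eu d → ℂ} (hf : NiceS f) {A : Set (Eu d)} (hA : MeasurableSet A) :
    NiceS (A.indicator f) := by
  refine ⟨hf.meas.indicator hA, ?_, hf.int.indicator hA⟩
  obtain ⟨M, hM⟩ := hf.bdd
  exact ⟨M, fun y => (norm_indicator_le_norm_self _ _).trans (hM y)⟩

lemma NiceS.nrm_ne_top {f : Eu d → ℂ} (hf : NiceS f) {β : ℝ} (hβ : 1 ≤ β) : nrm β f ≠ ∞ := by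
  obtain ⟨M, hM⟩ := hf.bdd
  have hM0 : 0 ≤ M := (norm_nonneg _).trans (hM 0)
  unfold nrm
  apply ENNReal.rpow_ne_top_of_nonneg (by positivity)
  have h1 : ∫⁻ y, ‖f y‖ₑ ^ β ≤ ∫⁻ y, ENNReal.ofReal M ^ (β - 1) * ‖f y‖ₑ := by
    refine lintegral_mono fun y => ?_
    have : ‖f y‖ₑ ^ β = ‖f y‖ₑ ^ (β - 1) * ‖f y‖ₑ := by
      conv_rhs => rw [← ENNReal.rpow_one ‖f y‖ₑ, ← ENNReal.rpow_mul, one_mul,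
        ← ENNReal.rpow_add_of_nonneg _ _ (by linarith) (by norm_num)]
      congr 1; ring
    rw [this]
    gcongr
    rw [← ofReal_norm]
    exact ENNReal.ofReal_le_ofReal (hM y)
  refine ne_top_of_le_ne_top ?_ h1
  rw [lintegral_const_mul _ (by have := hf.meas; fun_prop)]
  exact ENNReal.mul_ne_top (ENNReal.rpow_ne_top_of_nonneg (by linarith) (by simp)) hf.int.2.ne

lemma fourier_uexp (f : Eu d → ℂ) (ξ : Eu d) :
    𝓕 f ξ = ∫ y, uexp (-(2 * Real.pi * inner ℝ y ξ)) * f y := by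
  rw [Real.fourier_eq']
  congr 1; funext y
  rw [smul_eq_mul]; unfold uexp
  congr 4; push_cast; ring

lemma enorm_fourier_le (f : Eu d → ℂ) (ξ : Eu d) : ‖𝓕 f ξ‖ₑ ≤ nrm 1 f := by
  rw [fourier_uexp, nrm_one]
  refine (enorm_integral_le_lintegral_enorm _).trans (le_of_eq ?_)
  congr 1; funext y; rw [enorm_mul, enorm_uexp, one_mul]

lemma continuous_fourier {f : Eu d → ℂ} (hf : Integrable f) : Continuous (𝓕 f) :=
  VectorFourier.fourierIntegral_continuous Real.continuous_fourierChar (by exact continuous_inner) hf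

/-- fixed-time localized form -/
noncomputable def fm (a : Eu d → ℝ) (τ : ℝ) (f g : Eu d → ℂ) : ℂ :=
  ∫ ξ, (a ξ : ℂ) * uexp (τ * om ξ) * 𝓕 f ξ * (starRingEnd ℂ) (𝓕 g ξ)

noncomputable def Qf (a : Eu d → ℝ) (f : Eu d → ℂ) : ℝ≥0∞ := ∫⁻ ξ, ‖a ξ‖ₑ * ‖𝓕 f ξ‖ₑ ^ (2:ℝ)

lemma fm_le_Q {a : Eu d → ℝ} (ha : Amp a) (τ : ℝ) {f g : Eu d → ℂ} (hf : Integrable f) (hg : Integrable g) :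
    ‖fm a τ f g‖ₑ ≤ Qf a f ^ (1/2:ℝ) * Qf a g ^ (1/2:ℝ) := by
  have hac := ha.smooth.continuous
  have h1 := continuous_fourier hf
  have h2 := continuous_fourier hg
  refine le_trans ?_ (cs_weight (w := fun ξ => ‖a ξ‖ₑ) (u := fun ξ => ‖𝓕 f ξ‖ₑ) (v := fun ξ => ‖𝓕 g ξ‖ₑ)
    (by fun_prop) (by fun_prop) (by fun_prop))
  refine (enorm_integral_le_lintegral_enorm _).trans (le_of_eq ?_)
  congr 1; funext ξ
  rw [enorm_mul, enorm_mul, enorm_mul, enorm_uexp, mul_one]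
  rw [enorm_conj']
  congr 2
  rw [← ofReal_norm, ← ofReal_norm, Complex.norm_real]

lemma ker_cont {a : Eu d → ℝ} (ha : Amp a) : Continuous (fun z : ℝ × Eu d => ker a z.1 z.2) := by
  have hac := ha.smooth.continuous
  unfold ker
  refine continuous_of_dominated (bound := fun ξ => ‖a ξ‖) ?_ ?_ ha.integrable.norm ?_
  · intro z; exact Continuous.aestronglyMeasurable (by fun_prop)
  · intro z; filter_upwards with ξ
    rw [norm_mul, norm_uexp, mul_one, Complex.norm_real]
  · filter_upwards with ξ; fun_prop

lemma ker_bdd {a : Eu d → ℝ} (ha : Amp a) (τ : ℝ) (x : Eu d) : ‖ker a τ x‖ ≤ ∫ ξ, ‖a ξ‖ := by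
  unfold ker
  refine (norm_integral_le_integral_norm _).trans (le_of_eq ?_)
  congr 1; funext ξ
  rw [norm_mul, norm_uexp, mul_one, Complex.norm_real]

lemma fm_eq_ker {a : Eu d → ℝ} (ha : Amp a) (τ : ℝ) {f g : Eu d → ℂ} (hf : Integrable f) (hg : Integrable g) :
    fm a τ f g = ∫ z : Eu d × Eu d, ker a τ (z.2 - z.1) * f z.1 * (starRingEnd ℂ) (g z.2) := by
  have hac := ha.smooth.continuous
  have hg' : Integrable (fun x => (starRingEnd ℂ) (g x)) := 
    (Complex.conjLIE.integrable_comp_iff (φ := g)).2 hg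
  have hfg : Integrable (fun z : Eu d × Eu d => f z.1 * (starRingEnd ℂ) (g z.2)) (volume.prod volume) := hf.mul_prod hg'
  have hI : Integrable (fun w : Eu d × (Eu d × Eu d) => ((a w.1 : ℂ) * (f w.2.1 * (starRingEnd ℂ) (g w.2.2))) *
      uexp (τ * om w.1 + 2 * Real.pi * inner ℝ (w.2.2 - w.2.1) w.1)) (volume.prod (volume.prod volume)) := by
    refine Integrable.mul_bdd (c := 1) ((Integrable.ofReal ha.integrable).mul_prod hfg) ?_ ?_
    · exact Continuous.aestronglyMeasurable (by fun_prop)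
    · filter_upwards with w; rw [norm_uexp]
  have hs := integral_integral_swap (f := fun (ξ : Eu d) (z : Eu d × Eu d) => ((a ξ : ℂ) * (f z.1 * (starRingEnd ℂ) (g z.2))) *
      uexp (τ * om ξ + 2 * Real.pi * inner ℝ (z.2 - z.1) ξ)) hI
  calc fm a τ f g = ∫ ξ, ∫ z : Eu d × Eu d, ((a ξ : ℂ) * (f z.1 * (starRingEnd ℂ) (g z.2))) *
      uexp (τ * om ξ + 2 * Real.pi * inner ℝ (z.2 - z.1) ξ) ∂(volume.prod volume) := by
        unfold fm
        congr 1; funext ξ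
        rw [fourier_uexp, fourier_uexp, ← integral_conj, mul_assoc, ← integral_prod_mul, ← integral_const_mul]
        congr 1; funext z
        rw [map_mul, uexp_conj, inner_sub_left,
          show τ * om ξ + 2 * Real.pi * (inner ℝ z.2 ξ - inner ℝ z.1 ξ) =
            τ * om ξ + -(2 * Real.pi * inner ℝ z.1 ξ) + - -(2 * Real.pi * inner ℝ z.2 ξ) by ring, uexp_add, uexp_add]
        ring
    _ = _ := by
        rw [hs]
        change _ = ∫ z, _ ∂(volume.prod volume)
        congr 1; funext z
        unfold ker
        rw [mul_assoc, ← integral_mul_const]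
        congr 1; funext ξ; ring

lemma fm_disp {a : Eu d → ℝ} (ha : Amp a) : ∃ C : ℝ≥0∞, C ≠ ∞ ∧ ∀ (τ : ℝ) (f g : Eu d → ℂ), NiceS f → NiceS g → τ ≠ 0 →
    ‖fm a τ f g‖ₑ ≤ C * ENNReal.ofReal |τ| ^ (-((d:ℝ)/2)) * nrm 1 f * nrm 1 g := by
  obtain ⟨C, hC, h⟩ := dispersive ha
  refine ⟨ENNReal.ofReal C, by simp, fun τ f g hf hg hτ => ?_⟩
  rw [fm_eq_ker ha τ hf.int hg.int]
  refine (enorm_integral_le_lintegral_enorm _).trans ?_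
  have hfm := hf.meas
  have hgm := hg.meas
  calc _ ≤ ∫⁻ z : Eu d × Eu d, (ENNReal.ofReal C * ENNReal.ofReal |τ| ^ (-((d:ℝ)/2))) * (‖f z.1‖ₑ * ‖g z.2‖ₑ) := by
        refine lintegral_mono fun z => ?_
        rw [enorm_mul, enorm_mul, mul_assoc]
        have e : ‖(starRingEnd ℂ) (g z.2)‖ₑ = ‖g z.2‖ₑ := by
          rw [← ofReal_norm, ← ofReal_norm, RCLike.norm_conj]
        rw [e]
        gcongr
        rw [← ofReal_norm, ENNReal.ofReal_rpow_of_pos (abs_pos.2 hτ), ← ENNReal.ofReal_mul hC]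
        exact ENNReal.ofReal_le_ofReal (h τ _ hτ)
    _ = _ := by
        rw [lintegral_const_mul _ (by fun_prop)]
        change _ * ∫⁻ z, _ ∂(volume.prod volume) = _
        rw [lintegral_prod_mul (f := fun y => ‖f y‖ₑ) (g := fun y => ‖g y‖ₑ) (by fun_prop) (by fun_prop), nrm_one, nrm_one, mul_assoc, mul_assoc, mul_assoc]

open scoped ContDiff in
lemma ker0_integrable {a : Eu d → ℝ} (ha : Amp a) : Integrable (ker a 0) := by
  have h1 : ContDiff ℝ ∞ (fun ξ => (a ξ : ℂ)) := Complex.ofRealCLM.contDiff.comp ha.smooth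
  have h2 : HasCompactSupport (fun ξ => (a ξ : ℂ)) := ha.hcs.comp_left (g := fun x : ℝ => (x:ℂ)) (by simp)
  let S : 𝓢(Eu d, ℂ) := h2.toSchwartzMap h1
  have : ker a 0 = (⇑(𝓕⁻ S : 𝓢(Eu d, ℂ)) : Eu d → ℂ) := by
    funext x
    rw [SchwartzMap.fourierInv_coe, Real.fourierInv_eq']
    unfold ker
    congr 1; funext ξ
    rw [smul_eq_mul, mul_comm]
    congr 1
    unfold uexp; congr 2
    rw [real_inner_comm]; push_cast; ring
  rw [this]; exact (𝓕⁻ S : 𝓢(Eu d, ℂ)).integrable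

lemma Qf_le {a : Eu d → ℝ} (ha : Amp a) (hpos : ∀ ξ, 0 ≤ a ξ) : ∃ C : ℝ≥0∞, C ≠ ∞ ∧ ∀ f : Eu d → ℂ, NiceS f →
    Qf a f ≤ C * nrm 2 f ^ (2:ℝ) := by
  refine ⟨∫⁻ x, ‖ker a 0 x‖ₑ, (ker0_integrable ha).2.ne, fun f hf => ?_⟩
  have hac := ha.smooth.continuous
  have hfm := hf.meas
  have hkm : Measurable (ker a 0) := ((ker_cont ha).comp (by fun_prop : Continuous fun x : Eu d => ((0:ℝ), x))).measurable
  have hfc := continuous_fourier hf.int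
  have e1 : fm a 0 f f = ((∫ ξ, a ξ * ‖𝓕 f ξ‖ ^ 2 : ℝ) : ℂ) := by
    unfold fm
    rw [← integral_complex_ofReal]
    congr 1; funext ξ
    rw [zero_mul, uexp_zero, mul_one, mul_assoc, Complex.mul_conj, Complex.normSq_eq_norm_sq]
    push_cast; ring
  have hIntg : Integrable (fun ξ => a ξ * ‖𝓕 f ξ‖ ^ 2) :=
    Continuous.integrable_of_hasCompactSupport (by fun_prop) ha.hcs.mul_right
  have e2 : Qf a f = ‖fm a 0 f f‖ₑ := by
    rw [e1, ← ofReal_norm, Complex.norm_real, Real.norm_of_nonneg (integral_nonneg fun ξ => mul_nonneg (hpos ξ) (by positivity)),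
      ofReal_integral_eq_lintegral_ofReal hIntg (by filter_upwards with ξ; exact mul_nonneg (hpos ξ) (by positivity))]
    unfold Qf
    congr 1; funext ξ
    rw [ENNReal.ofReal_mul (hpos ξ), Real.enorm_of_nonneg (hpos ξ), ENNReal.ofReal_pow (norm_nonneg _), ofReal_norm]
    norm_num
  rw [e2, fm_eq_ker ha 0 hf.int hf.int, nrm_rpow (by norm_num)]
  refine (enorm_integral_le_lintegral_enorm _).trans ?_
  have e4 : ∀ z : Eu d × Eu d, ‖ker a 0 (z.2 - z.1) * f z.1 * (starRingEnd ℂ) (f z.2)‖ₑ ≤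
      2⁻¹ * (‖ker a 0 (z.2 - z.1)‖ₑ * ‖f z.1‖ₑ ^ (2:ℝ) + ‖ker a 0 (z.2 - z.1)‖ₑ * ‖f z.2‖ₑ ^ (2:ℝ)) := by
    intro z
    have e : ‖(starRingEnd ℂ) (f z.2)‖ₑ = ‖f z.2‖ₑ := by
      rw [← ofReal_norm, ← ofReal_norm, RCLike.norm_conj]
    rw [enorm_mul, enorm_mul, e, ← mul_add, mul_assoc, mul_left_comm (2⁻¹ : ℝ≥0∞)]
    refine mul_le_mul_right ?_ _
    rw [← ofReal_norm, ← ofReal_norm, ← ENNReal.ofReal_mul (norm_nonneg _), ENNReal.ofReal_rpow_of_nonneg (norm_nonneg _) (by norm_num),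
      ENNReal.ofReal_rpow_of_nonneg (norm_nonneg _) (by norm_num), ← ENNReal.ofReal_add (by positivity) (by positivity),
      show (2:ℝ≥0∞)⁻¹ = ENNReal.ofReal 2⁻¹ by rw [ENNReal.ofReal_inv_of_pos (by norm_num)]; simp, ← ENNReal.ofReal_mul (by norm_num)]
    apply ENNReal.ofReal_le_ofReal
    norm_num
    nlinarith [sq_nonneg (‖f z.1‖ - ‖f z.2‖)]
  refine (lintegral_mono e4).trans ?_
  have hk2 : Measurable (fun z : Eu d × Eu d => ‖ker a 0 (z.2 - z.1)‖ₑ) := (hkm.comp (by fun_prop)).enorm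
  rw [lintegral_const_mul _ (by fun_prop), lintegral_add_left (by fun_prop)]
  change 2⁻¹ * ((∫⁻ z, _ ∂(volume.prod volume)) + ∫⁻ z, _ ∂(volume.prod volume)) ≤ _
  have i1 : ∫⁻ z : Eu d × Eu d, ‖ker a 0 (z.2 - z.1)‖ₑ * ‖f z.1‖ₑ ^ (2:ℝ) ∂(volume.prod volume)
      = (∫⁻ x, ‖ker a 0 x‖ₑ) * ∫⁻ y, ‖f y‖ₑ ^ (2:ℝ) := by
    rw [lintegral_prod _ (by fun_prop), ← lintegral_const_mul _ (by fun_prop)]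
    congr 1; funext y
    dsimp only
    rw [lintegral_mul_const _ (by fun_prop)]
    congr 1
    exact lintegral_sub_right_eq_self (fun x => ‖ker a 0 x‖ₑ) y
  have i2 : ∫⁻ z : Eu d × Eu d, ‖ker a 0 (z.2 - z.1)‖ₑ * ‖f z.2‖ₑ ^ (2:ℝ) ∂(volume.prod volume)
      = (∫⁻ x, ‖ker a 0 x‖ₑ) * ∫⁻ y, ‖f y‖ₑ ^ (2:ℝ) := by
    rw [lintegral_prod_symm _ (by fun_prop), ← lintegral_const_mul _ (by fun_prop)]
    congr 1; funext y
    dsimp only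
    rw [lintegral_mul_const _ (by fun_prop)]
    congr 1
    exact lintegral_sub_left_eq_self (fun x => ‖ker a 0 x‖ₑ) y
  rw [i1, i2, ← two_mul, ← mul_assoc, ENNReal.inv_mul_cancel (by norm_num) (by norm_num), one_mul]

lemma fm_L2 {a : Eu d → ℝ} (ha : Amp a) (hpos : ∀ ξ, 0 ≤ a ξ) : ∃ C : ℝ≥0∞, C ≠ ∞ ∧ ∀ (τ : ℝ) (f g : Eu d → ℂ), NiceS f → NiceS g →
    ‖fm a τ f g‖ₑ ≤ C * nrm 2 f * nrm 2 g := by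
  obtain ⟨C, hC, h⟩ := Qf_le ha hpos
  refine ⟨C, hC, fun τ f g hf hg => (fm_le_Q ha τ hf.int hg.int).trans ?_⟩
  have e0 : ∀ x : ℝ≥0∞, (x ^ (2:ℝ)) ^ (1/2:ℝ) = x := fun x => by
    rw [← ENNReal.rpow_mul]; norm_num
  have e1 : ∀ x : ℝ≥0∞, x ^ (1/2:ℝ) * x ^ (1/2:ℝ) = x := fun x => by
    rw [← ENNReal.rpow_add_of_nonneg _ _ (by norm_num) (by norm_num)]; norm_num
  calc _ ≤ (C * nrm 2 f ^ (2:ℝ)) ^ (1/2:ℝ) * (C * nrm 2 g ^ (2:ℝ)) ^ (1/2:ℝ) := by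
        gcongr
        · exact h f hf
        · exact h g hg
    _ = _ := by
        rw [ENNReal.mul_rpow_of_nonneg _ _ (by norm_num), ENNReal.mul_rpow_of_nonneg _ _ (by norm_num), e0, e0]
        calc _ = (C ^ (1/2:ℝ) * C ^ (1/2:ℝ)) * nrm 2 f * nrm 2 g := by ring
          _ = _ := by rw [e1]
end fixedtime
end Strz


open MeasureTheory Real Complex
open scoped FourierTransform ENNReal SchwartzMap RealInnerProductSpace
set_option linter.all false
set_option linter.unusedVariables false
set_option linter.unusedSimpArgs false
set_option linter.deprecated false
namespace Strz
section fixedtime2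
variable {d : ℕ}

lemma nrm_zero_ae {Ω : Type*} [MeasureSpace Ω] {β : ℝ} (hβ : 0 < β) {f : Ω → ℂ} (hf : Measurable f) (h : nrm β f = 0) :
    f =ᵐ[volume] 0 := by
  have h1 : ∫⁻ y, ‖f y‖ₑ ^ β = 0 := by rw [← nrm_rpow hβ, h, ENNReal.zero_rpow_of_pos hβ]
  rw [lintegral_eq_zero_iff (by fun_prop)] at h1
  filter_upwards [h1] with y hy
  simp only [Pi.zero_apply, ENNReal.rpow_eq_zero_iff] at hy
  rcases hy with ⟨h, _⟩ | ⟨_, h⟩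
  · simpa using h
  · linarith

lemma fm_zero_left {a : Eu d → ℝ} {τ : ℝ} {f g : Eu d → ℂ} (h : f =ᵐ[volume] 0) : fm a τ f g = 0 := by
  have : 𝓕 f = 0 := by
    funext ξ
    rw [Real.fourier_congr_ae h, fourier_uexp]; simp
  unfold fm; simp [this]

lemma fm_zero_right {a : Eu d → ℝ} {τ : ℝ} {f g : Eu d → ℂ} (h : g =ᵐ[volume] 0) : fm a τ f g = 0 := by
  have : 𝓕 g = 0 := by
    funext ξ
    rw [Real.fourier_congr_ae h, fourier_uexp]; simp
  unfold fm; simp [this]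

lemma fm_atoms {a : Eu d → ℝ} (ha : Amp a) {τ β : ℝ} (hβ : 1 ≤ β) {f g : Eu d → ℂ} (hf : NiceS f) (hg : NiceS g)
    (hf0 : nrm β f ≠ 0) (hg0 : nrm β g ≠ 0) :
    ‖fm a τ f g‖ₑ ≤ ∑' k, ∑' l, ‖fm a τ (atom β f k) (atom β g l)‖ₑ := by
  have hβ0 : 0 < β := by linarith
  have hg' : Integrable (fun x => (starRingEnd ℂ) (g x)) := 
    (Complex.conjLIE.integrable_comp_iff (φ := g)).2 hg.int
  have hfg : Integrable (fun z : Eu d × Eu d => f z.1 * (starRingEnd ℂ) (g z.2)) (volume.prod volume) := hf.int.mul_prod hg'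
  have hI : Integrable (fun z : Eu d × Eu d => ker a τ (z.2 - z.1) * f z.1 * (starRingEnd ℂ) (g z.2)) := by
    have : Integrable (fun z : Eu d × Eu d => ker a τ (z.2 - z.1) * (f z.1 * (starRingEnd ℂ) (g z.2))) (volume.prod volume) := by
      refine Integrable.bdd_mul (c := ∫ ξ, ‖a ξ‖) hfg ?_ ?_
      · exact ((ker_cont ha).comp (by fun_prop : Continuous fun z : Eu d × Eu d => (τ, z.2 - z.1))).aestronglyMeasurable
      · filter_upwards with z; exact ker_bdd ha _ _
    simp only [mul_assoc]; exact this
  have h1 := enorm_integral_le_tsum hI (A := fun i : ℤ × ℤ => gset β f i.1 ×ˢ gset β g i.2)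
    (fun i => (measurableSet_gset hf.meas _).prod (measurableSet_gset hg.meas _)) ?_ ?_
  · rw [fm_eq_ker ha τ hf.int hg.int]
    refine h1.trans (le_of_eq ?_)
    rw [ENNReal.tsum_prod']
    congr 1; funext k; congr 1; funext l
    have hk := hf.indicator (measurableSet_gset (β := β) hf.meas k)
    have hl := hg.indicator (measurableSet_gset (β := β) hg.meas l)
    unfold atom
    rw [fm_eq_ker ha τ hk.int hl.int, ← integral_indicator ((measurableSet_gset hf.meas _).prod (measurableSet_gset hg.meas _))]
    congr 2; funext z
    by_cases h1 : z.1 ∈ gset β f k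
    · by_cases h2 : z.2 ∈ gset β g l
      · rw [Set.indicator_of_mem h1, Set.indicator_of_mem h2, Set.indicator_of_mem (Set.mem_prod.2 ⟨h1, h2⟩)]
      · rw [Set.indicator_of_notMem h2, Set.indicator_of_notMem (fun h => h2 (Set.mem_prod.1 h).2)]; simp
    · rw [Set.indicator_of_notMem h1, Set.indicator_of_notMem (fun h => h1 (Set.mem_prod.1 h).1)]; simp
  · intro i j hij
    have : i.1 ≠ j.1 ∨ i.2 ≠ j.2 := by
      by_contra h; push Not at h; exact hij (Prod.ext h.1 h.2)
    show Disjoint _ _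
    rcases this with h | h
    · exact Set.disjoint_prod.2 (Or.inl (gset_disj β f h))
    · exact Set.disjoint_prod.2 (Or.inr (gset_disj β g h))
  · filter_upwards with z hz
    have h2 : f z.1 ≠ 0 := fun h => hz (by simp [h])
    have h3 : g z.2 ≠ 0 := fun h => hz (by simp [h])
    obtain ⟨k, hk⟩ := exists_gset hβ0 hf0 (hf.nrm_ne_top hβ) h2
    obtain ⟨l, hl⟩ := exists_gset hβ0 hg0 (hg.nrm_ne_top hβ) h3
    exact ⟨(k, l), Set.mem_prod.2 ⟨hk, hl⟩⟩

lemma fm_beta {a : Eu d → ℝ} (ha : Amp a) (hpos : ∀ ξ, 0 ≤ a ξ) {β : ℝ} (hβ : 1 < β) (hβ2 : β < 2) :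
    ∃ C : ℝ≥0∞, C ≠ ∞ ∧ ∀ (τ : ℝ) (f g : Eu d → ℂ), NiceS f → NiceS g → τ ≠ 0 →
    ‖fm a τ f g‖ₑ ≤ C * ENNReal.ofReal |τ| ^ (-((d:ℝ) * (1/β - 1/2))) * nrm β f * nrm β g := by
  obtain ⟨C1, hC1, h1⟩ := fm_disp ha
  obtain ⟨C2, hC2, h2⟩ := fm_L2 ha hpos
  have hβ0 : 0 < β := by linarith
  have g1 : 0 < 1 - 1/β := by rw [sub_pos, div_lt_one hβ0]; exact hβ
  have g2 : 0 < 1/β - 1/2 := by rw [sub_pos]; exact one_div_lt_one_div_of_lt hβ0 hβ2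
  set ε := min (1 - 1/β) (1/β - 1/2) with hε
  have hε0 : 0 < ε := lt_min g1 g2
  obtain ⟨D, hD, hgeo⟩ := tw_geom ε hε0
  refine ⟨4 * (C1 + C2) * D, by finiteness, fun τ f g hf hg hτ => ?_⟩
  by_cases hf0 : nrm β f = 0
  · rw [fm_zero_left (nrm_zero_ae hβ0 hf.meas hf0)]; simp
  by_cases hg0 : nrm β g = 0
  · rw [fm_zero_right (nrm_zero_ae hβ0 hg.meas hg0)]; simp
  obtain ⟨y, hy⟩ := exists_tw (x := ENNReal.ofReal |τ|) (by simpa using hτ) (by simp)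
  have key : ∀ k l : ℤ, ‖fm a τ (atom β f k) (atom β g l)‖ₑ ≤
      4 * (C1 + C2) * tw (y * (-((d:ℝ) * (1/β - 1/2)))) * (tw (-ε * |((k + l : ℤ):ℝ) - y * d|) * cof β f k * cof β g l) := by
    intro k l
    have hk := hf.indicator (measurableSet_gset (β := β) hf.meas k)
    have hl := hg.indicator (measurableSet_gset (β := β) hg.meas l)
    set n : ℝ := ((k + l : ℤ) : ℝ) with hn
    have hn' : n = k + l := by rw [hn]; push_cast; rfl
    rcases le_total n (y * d) with hle | hle
    · calc _ ≤ C1 * ENNReal.ofReal |τ| ^ (-((d:ℝ)/2)) * nrm 1 (atom β f k) * nrm 1 (atom β g l) := h1 τ _ _ hk hl hτ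
        _ ≤ C1 * ENNReal.ofReal |τ| ^ (-((d:ℝ)/2)) * (2 * tw (k * (1/1 - 1/β)) * cof β f k) * (2 * tw (l * (1/1 - 1/β)) * cof β g l) := by
            gcongr
            · exact atom_nrm hβ.le le_rfl (by norm_num) hf.meas k
            · exact atom_nrm hβ.le le_rfl (by norm_num) hg.meas l
        _ = 4 * C1 * (tw (y * (-(d/2)) + k * (1/1-1/β) + l * (1/1-1/β))) * (cof β f k * cof β g l) := by
            rw [hy, tw_rpow, tw_add, tw_add]; ring
        _ ≤ 4 * (C1 + C2) * (tw (y * (-((d:ℝ) * (1/β - 1/2))) + (-ε * |n - y * d|))) * (cof β f k * cof β g l) := by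
            gcongr
            · exact le_self_add
            · apply tw_mono
              rw [abs_of_nonpos (by linarith)]
              have : ε * (y * d - n) ≤ (1 - 1/β) * (y * d - n) :=
                mul_le_mul_of_nonneg_right (min_le_left _ _) (by linarith)
              rw [hn'] at *
              linarith
        _ = _ := by rw [tw_add]; ring
    · calc _ ≤ C2 * nrm 2 (atom β f k) * nrm 2 (atom β g l) := h2 τ _ _ hk hl
        _ ≤ C2 * (2 * tw (k * (1/2 - 1/β)) * cof β f k) * (2 * tw (l * (1/2 - 1/β)) * cof β g l) := by
            gcongr
            · exact atom_nrm hβ.le (by norm_num) le_rfl hf.meas k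
            · exact atom_nrm hβ.le (by norm_num) le_rfl hg.meas l
        _ = 4 * C2 * (tw (k * (1/2-1/β) + l * (1/2-1/β))) * (cof β f k * cof β g l) := by
            rw [tw_add]; ring
        _ ≤ 4 * (C1 + C2) * (tw (y * (-((d:ℝ) * (1/β - 1/2))) + (-ε * |n - y * d|))) * (cof β f k * cof β g l) := by
            gcongr
            · exact le_add_self
            · apply tw_mono
              rw [abs_of_nonneg (by linarith)]
              have : ε * (n - y * d) ≤ (1/β - 1/2) * (n - y * d) :=
                mul_le_mul_of_nonneg_right (min_le_right _ _) (by linarith)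
              rw [hn'] at *
              linarith
        _ = _ := by rw [tw_add]; ring
  calc _ ≤ ∑' k, ∑' l, ‖fm a τ (atom β f k) (atom β g l)‖ₑ := fm_atoms ha hβ.le hf hg hf0 hg0
    _ ≤ ∑' k, ∑' l, 4 * (C1 + C2) * tw (y * (-((d:ℝ) * (1/β - 1/2)))) * (tw (-ε * |((k + l : ℤ):ℝ) - y * d|) * cof β f k * cof β g l) :=
        ENNReal.tsum_le_tsum fun k => ENNReal.tsum_le_tsum fun l => key k l
    _ = 4 * (C1 + C2) * tw (y * (-((d:ℝ) * (1/β - 1/2)))) * ∑' k : ℤ, ∑' l : ℤ, tw (-ε * |((k + l : ℤ):ℝ) - y * d|) * cof β f k * cof β g l := by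
        simp_rw [ENNReal.tsum_mul_left]
    _ ≤ 4 * (C1 + C2) * tw (y * (-((d:ℝ) * (1/β - 1/2)))) * (D * (∑' k, cof β f k ^ (2:ℝ)) ^ (1/2 : ℝ) * (∑' l, cof β g l ^ (2:ℝ)) ^ (1/2 : ℝ)) := by
        gcongr
        refine schur_tsum (fun k l : ℤ => tw (-ε * |((k + l : ℤ):ℝ) - y * d|)) _ _ D ?_ ?_
        · intro k
          refine le_trans (le_of_eq ?_) (hgeo (y * d - k))
          congr 1; funext l; congr 3; push_cast; ring
        · intro l
          refine le_trans (le_of_eq ?_) (hgeo (y * d - l))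
          congr 1; funext k; congr 3; push_cast; ring
    _ ≤ 4 * (C1 + C2) * tw (y * (-((d:ℝ) * (1/β - 1/2)))) * (D * (nrm β f ^ (2:ℝ)) ^ (1/2 : ℝ) * (nrm β g ^ (2:ℝ)) ^ (1/2 : ℝ)) := by
        gcongr
        · exact cof_sum hβ0 hf.meas
        · exact cof_sum hβ0 hg.meas
    _ = _ := by
        have e0 : ∀ x : ℝ≥0∞, (x ^ (2:ℝ)) ^ (1/2:ℝ) = x := fun x => by
          rw [← ENNReal.rpow_mul]; norm_num
        rw [e0, e0, hy, tw_rpow]; ring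
end fixedtime2
end Strz


open MeasureTheory Real Complex
open scoped FourierTransform ENNReal SchwartzMap RealInnerProductSpace
set_option linter.all false
set_option linter.unusedVariables false
set_option linter.unusedSimpArgs false
set_option linter.deprecated false
namespace Strz
section spacetime
variable {d : ℕ}

/-- space-time test class -/
structure Nice (F : ℝ × Eu d → ℂ) : Prop where
  meas : Measurable F
  bd : ∃ M R : ℝ, ∀ s, (∀ y, ‖F (s, y)‖ ≤ M) ∧ ∫⁻ y, ‖F (s, y)‖ₑ ≤ ENNReal.ofReal M ∧ (R < |s| → ∀ y, F (s, y) = 0)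

lemma Nice.slice {F : ℝ × Eu d → ℂ} (hF : Nice F) (s : ℝ) : NiceS (fun y => F (s, y)) := by
  obtain ⟨M, R, h⟩ := hF.bd
  have hm : Measurable (fun y => F (s, y)) := hF.meas.comp (by fun_prop)
  exact ⟨hm, ⟨M, (h s).1⟩, hm.aestronglyMeasurable, ((h s).2.1).trans_lt (by simp)⟩

lemma Nice.of_le {F G : ℝ × Eu d → ℂ} (hF : Nice F) (hG : Measurable G) (h : ∀ z, ‖G z‖ ≤ ‖F z‖) : Nice G := by
  obtain ⟨M, R, hM⟩ := hF.bd
  refine ⟨hG, M, R, fun s => ⟨fun y => (h _).trans ((hM s).1 y), ?_, fun hs y => ?_⟩⟩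
  · refine le_trans (lintegral_mono fun y => ?_) (hM s).2.1
    rw [← ofReal_norm, ← ofReal_norm]; exact ENNReal.ofReal_le_ofReal (h _)
  · have := h (s, y); rw [(hM s).2.2 hs y, norm_zero] at this
    exact norm_le_zero_iff.1 this

lemma Nice.indicator {F : ℝ × Eu d → ℂ} (hF : Nice F) {A : Set (ℝ × Eu d)} (hA : MeasurableSet A) :
    Nice (A.indicator F) :=
  hF.of_le (hF.meas.indicator hA) fun z => norm_indicator_le_norm_self _ _

noncomputable def mN (α β : ℝ) (F : ℝ × Eu d → ℂ) : ℝ≥0∞ := (∫⁻ s, nrm β (fun y => F (s, y)) ^ α) ^ (1/α)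

lemma measurable_nrm (β : ℝ) {F : ℝ × Eu d → ℂ} (hF : Measurable F) : Measurable (fun s => nrm β (fun y => F (s, y))) := by
  unfold nrm
  have : Measurable (fun s => ∫⁻ y, ‖F (s, y)‖ₑ ^ β) := Measurable.lintegral_prod_right' (f := fun z : ℝ × Eu d => ‖F z‖ₑ ^ β) (by fun_prop)
  fun_prop

lemma mN_rpow {α : ℝ} (hα : 0 < α) (β : ℝ) (F : ℝ × Eu d → ℂ) : mN α β F ^ α = ∫⁻ s, nrm β (fun y => F (s, y)) ^ α := by
  unfold mN; rw [← ENNReal.rpow_mul, one_div_mul_cancel hα.ne', ENNReal.rpow_one]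

lemma mN_mono {α β : ℝ} (hα : 0 < α) (hβ : 0 < β) {F G : ℝ × Eu d → ℂ} (h : ∀ z, ‖F z‖ₑ ≤ ‖G z‖ₑ) : mN α β F ≤ mN α β G := by
  unfold mN
  refine ENNReal.rpow_le_rpow (lintegral_mono fun s => ENNReal.rpow_le_rpow (nrm_mono hβ fun y => h _) hα.le) (by positivity)

/-- spatial Fourier transform -/
noncomputable def FH (F : ℝ × Eu d → ℂ) (s : ℝ) (ξ : Eu d) : ℂ := 𝓕 (fun y => F (s, y)) ξ

lemma measurable_FH {F : ℝ × Eu d → ℂ} (hF : Measurable F) : Measurable (fun p : ℝ × Eu d => FH F p.1 p.2) := by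
  unfold FH
  simp only [fourier_uexp]
  have : StronglyMeasurable (fun q : (ℝ × Eu d) × Eu d => uexp (-(2 * Real.pi * inner ℝ q.2 q.1.2)) * F (q.1.1, q.2)) := by
    apply Measurable.stronglyMeasurable
    have h1 : Measurable (fun q : (ℝ × Eu d) × Eu d => F (q.1.1, q.2)) := hF.comp (by fun_prop)
    have h2 : Measurable (fun q : (ℝ × Eu d) × Eu d => uexp (-(2 * Real.pi * inner ℝ q.2 q.1.2))) :=
      Continuous.measurable (by fun_prop)
    exact h2.mul h1
  exact (this.integral_prod_right' (ν := volume)).measurable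

lemma Nice.FH_bd {F : ℝ × Eu d → ℂ} (hF : Nice F) : ∃ M R : ℝ, 0 ≤ M ∧ ∀ s ξ, ‖FH F s ξ‖ ≤ (Set.Icc (-R) R).indicator (fun _ => M) s := by
  obtain ⟨M, R, h⟩ := hF.bd
  have hM : 0 ≤ M := (norm_nonneg _).trans ((h 0).1 0)
  refine ⟨M, R, hM, fun s ξ => ?_⟩
  by_cases hs : s ∈ Set.Icc (-R) R
  · rw [Set.indicator_of_mem hs, ← ENNReal.ofReal_le_ofReal_iff hM, ofReal_norm]
    refine (enorm_fourier_le _ _).trans ?_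
    rw [nrm_one]; exact (h s).2.1
  · have : R < |s| := by
      by_contra hh; exact hs (Set.mem_Icc.2 (abs_le.1 (not_lt.1 hh)))
    rw [Set.indicator_of_notMem hs]
    have h0 : (fun y => F (s, y)) = 0 := by funext y; exact (h s).2.2 this y
    unfold FH; rw [h0, fourier_uexp]; simp

noncomputable def Bf (a : Eu d → ℝ) (S : Set (ℝ × ℝ)) (F G : ℝ × Eu d → ℂ) : ℂ :=
  ∫ z in S, fm a (z.2 - z.1) (fun y => F (z.1, y)) (fun y => G (z.2, y))

lemma Bf_le (a : Eu d → ℝ) (S : Set (ℝ × ℝ)) (F G : ℝ × Eu d → ℂ) : ‖Bf a S F G‖ₑ ≤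
    ∫⁻ z in S, ‖fm a (z.2 - z.1) (fun y => F (z.1, y)) (fun y => G (z.2, y))‖ₑ :=
  enorm_integral_le_lintegral_enorm _

/-- joint integrability on frequency × time × time -/
lemma int_ftt {a : Eu d → ℝ} (ha : Amp a) {F G : ℝ × Eu d → ℂ} (hF : Nice F) (hG : Nice G) :
    Integrable (fun w : Eu d × (ℝ × ℝ) => (a w.1 : ℂ) * uexp ((w.2.2 - w.2.1) * om w.1) * FH F w.2.1 w.1 *
      (starRingEnd ℂ) (FH G w.2.2 w.1)) (volume.prod (volume.prod volume)) := by
  obtain ⟨M, R, hM, h1⟩ := hF.FH_bd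
  obtain ⟨M', R', hM', h2⟩ := hG.FH_bd
  have hac := ha.smooth.continuous
  have hi : ∀ M R : ℝ, Integrable ((Set.Icc (-R) R).indicator (fun _ : ℝ => M)) volume := fun M R =>
    (integrable_indicator_iff measurableSet_Icc).2 (integrableOn_const (by simp) (by simp))
  have hb := ha.integrable.norm.mul_prod ((hi M R).mul_prod (hi M' R'))
  refine hb.mono' ?_ ?_
  · apply Measurable.aestronglyMeasurable
    have m1 : Measurable (fun w : Eu d × (ℝ × ℝ) => FH F w.2.1 w.1) := (measurable_FH hF.meas).comp (g := fun p : ℝ × Eu d => FH F p.1 p.2) (f := fun w : Eu d × (ℝ × ℝ) => (w.2.1, w.1)) (by fun_prop)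
    have m2 : Measurable (fun w : Eu d × (ℝ × ℝ) => FH G w.2.2 w.1) := (measurable_FH hG.meas).comp (g := fun p : ℝ × Eu d => FH G p.1 p.2) (f := fun w : Eu d × (ℝ × ℝ) => (w.2.2, w.1)) (by fun_prop)
    have m3 : Measurable (fun w : Eu d × (ℝ × ℝ) => (a w.1 : ℂ) * uexp ((w.2.2 - w.2.1) * om w.1)) := Continuous.measurable (by fun_prop)
    have m4 : Measurable (fun w : Eu d × (ℝ × ℝ) => (starRingEnd ℂ) (FH G w.2.2 w.1)) := (Complex.continuous_conj.measurable).comp m2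
    exact (m3.mul m1).mul m4
  · filter_upwards with w
    rw [norm_mul, norm_mul, norm_mul, norm_uexp, mul_one, RCLike.norm_conj, Complex.norm_real, mul_assoc]
    have := h1 w.2.1 w.1
    have := h2 w.2.2 w.1
    gcongr
    · exact (norm_nonneg _).trans (h1 w.2.1 w.1)

lemma fm_integrable {a : Eu d → ℝ} (ha : Amp a) {F G : ℝ × Eu d → ℂ} (hF : Nice F) (hG : Nice G) :
    Integrable (fun z : ℝ × ℝ => fm a (z.2 - z.1) (fun y => F (z.1, y)) (fun y => G (z.2, y))) :=
  (int_ftt ha hF hG).integral_prod_right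

lemma fm_swap (a : Eu d → ℝ) (τ : ℝ) (f g : Eu d → ℂ) : fm a τ f g = (starRingEnd ℂ) (fm a (-τ) g f) := by
  unfold fm
  rw [← integral_conj]
  congr 1; funext ξ
  rw [map_mul, map_mul, map_mul, uexp_conj, Complex.conj_conj, Complex.conj_ofReal, neg_mul, neg_neg]
  ring

lemma Bf_swap (a : Eu d → ℝ) {S : Set (ℝ × ℝ)} (hS : MeasurableSet S) (F G : ℝ × Eu d → ℂ) :
    Bf a S F G = (starRingEnd ℂ) (Bf a (Prod.swap ⁻¹' S) G F) := by
  unfold Bf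
  rw [← integral_conj, ← integral_indicator hS, ← integral_indicator (measurable_swap hS)]
  have := integral_prod_swap (μ := (volume : Measure ℝ)) (ν := (volume : Measure ℝ)) (S.indicator fun z : ℝ × ℝ => fm a (z.2 - z.1) (fun y => F (z.1, y)) (fun y => G (z.2, y)))
  change _ = ∫ z, _ ∂(volume.prod volume) at this
  change ∫ z, _ ∂(volume.prod volume) = ∫ z, _ ∂(volume.prod volume)
  rw [← this]
  congr 1; funext z
  by_cases hz : z.swap ∈ S
  · rw [Set.indicator_of_mem hz, Set.indicator_of_mem (show z ∈ Prod.swap ⁻¹' S from hz), fm_swap]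
    simp
  · rw [Set.indicator_of_notMem hz, Set.indicator_of_notMem (show z ∉ Prod.swap ⁻¹' S from hz)]

/-- space-time Fourier restriction -/
noncomputable def Wf (F : ℝ × Eu d → ℂ) (ξ : Eu d) : ℂ := ∫ s, uexp (-(s * om ξ)) * FH F s ξ

lemma measurable_Wf {F : ℝ × Eu d → ℂ} (hF : Measurable F) : Measurable (Wf F) := by
  unfold Wf
  have : StronglyMeasurable (fun q : Eu d × ℝ => uexp (-(q.2 * om q.1)) * FH F q.2 q.1) := by
    apply Measurable.stronglyMeasurable
    have m1 : Measurable (fun w : Eu d × ℝ => FH F w.2 w.1) := (measurable_FH hF).comp (g := fun p : ℝ × Eu d => FH F p.1 p.2) (f := fun w : Eu d × ℝ => (w.2, w.1)) (by fun_prop)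
    have m2 : Measurable (fun q : Eu d × ℝ => uexp (-(q.2 * om q.1))) := Continuous.measurable (by fun_prop)
    exact m2.mul m1
  exact (this.integral_prod_right' (ν := volume)).measurable

lemma Bf_univ {a : Eu d → ℝ} (ha : Amp a) {F G : ℝ × Eu d → ℂ} (hF : Nice F) (hG : Nice G) :
    Bf a Set.univ F G = ∫ ξ, (a ξ : ℂ) * Wf F ξ * (starRingEnd ℂ) (Wf G ξ) := by
  have hs := integral_integral_swap (f := fun (ξ : Eu d) (z : ℝ × ℝ) => (a ξ : ℂ) * uexp ((z.2 - z.1) * om ξ) * FH F z.1 ξ *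
      (starRingEnd ℂ) (FH G z.2 ξ)) (int_ftt ha hF hG)
  unfold Bf
  rw [setIntegral_univ]
  change ∫ z, _ ∂(volume.prod volume) = _
  refine hs.symm.trans ?_
  congr 1; funext ξ
  unfold Wf
  rw [← integral_conj, mul_assoc, ← integral_prod_mul, ← integral_const_mul]
  congr 1; funext z
  rw [map_mul, uexp_conj, show (z.2 - z.1) * om ξ = -(z.1 * om ξ) + - -(z.2 * om ξ) by ring, uexp_add]
  ring

noncomputable def QW (a : Eu d → ℝ) (F : ℝ × Eu d → ℂ) : ℝ≥0∞ := ∫⁻ ξ, ‖a ξ‖ₑ * ‖Wf F ξ‖ₑ ^ (2:ℝ)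

lemma Wf_bd {F : ℝ × Eu d → ℂ} (hF : Nice F) : ∃ M : ℝ, ∀ ξ, ‖Wf F ξ‖ ≤ M := by
  obtain ⟨M, R, hM, h1⟩ := hF.FH_bd
  refine ⟨∫ s, (Set.Icc (-R) R).indicator (fun _ => M) s, fun ξ => ?_⟩
  unfold Wf
  refine norm_integral_le_of_norm_le ?_ ?_
  · exact (integrable_indicator_iff measurableSet_Icc).2 (integrableOn_const (by simp) (by simp))
  · filter_upwards with s
    rw [norm_mul, norm_uexp, one_mul]; exact h1 s ξ

lemma QW_eq {a : Eu d → ℝ} (ha : Amp a) (hpos : ∀ ξ, 0 ≤ a ξ) {F : ℝ × Eu d → ℂ} (hF : Nice F) :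
    QW a F = ‖Bf a Set.univ F F‖ₑ := by
  have e1 : Bf a Set.univ F F = ((∫ ξ, a ξ * ‖Wf F ξ‖ ^ 2 : ℝ) : ℂ) := by
    rw [Bf_univ ha hF hF, ← integral_complex_ofReal]
    congr 1; funext ξ
    rw [mul_assoc, Complex.mul_conj, Complex.normSq_eq_norm_sq]
    push_cast; ring
  have hWm := measurable_Wf hF.meas
  obtain ⟨M, hM⟩ := Wf_bd hF
  have hIntg : Integrable (fun ξ => a ξ * ‖Wf F ξ‖ ^ 2) := by
    refine ha.integrable.mul_bdd (c := M^2) (by fun_prop) ?_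
    filter_upwards with ξ
    rw [norm_pow, norm_norm]
    gcongr
    exact hM ξ
  rw [e1, ← ofReal_norm, Complex.norm_real, Real.norm_of_nonneg (integral_nonneg fun ξ => mul_nonneg (hpos ξ) (by positivity)),
      ofReal_integral_eq_lintegral_ofReal hIntg (by filter_upwards with ξ; exact mul_nonneg (hpos ξ) (by positivity))]
  unfold QW
  congr 1; funext ξ
  rw [ENNReal.ofReal_mul (hpos ξ), Real.enorm_of_nonneg (hpos ξ), ENNReal.ofReal_pow (norm_nonneg _), ofReal_norm]
  norm_num

/-- fixed-`t` Duhamel form -/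
lemma fixed_t {a : Eu d → ℝ} (ha : Amp a) (t : ℝ) {F : ℝ × Eu d → ℂ} (hF : Nice F) {g : Eu d → ℂ} (hg : NiceS g) :
    ‖∫ s, fm a (t - s) (fun y => F (s, y)) g‖ₑ ≤ QW a F ^ (1/2:ℝ) * Qf a g ^ (1/2:ℝ) := by
  obtain ⟨M, R, hM, h1⟩ := hF.FH_bd
  have hac := ha.smooth.continuous
  have hgc := continuous_fourier hg.int
  have hi : Integrable ((Set.Icc (-R) R).indicator (fun _ : ℝ => M)) volume :=
    (integrable_indicator_iff measurableSet_Icc).2 (integrableOn_const (by simp) (by simp))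
  obtain ⟨N, hN⟩ : ∃ N : ℝ, ∀ ξ, ‖𝓕 g ξ‖ ≤ N := by
    refine ⟨(nrm 1 g).toReal, fun ξ => ?_⟩
    rw [← toReal_enorm]
    exact ENNReal.toReal_mono (hg.nrm_ne_top le_rfl) (enorm_fourier_le _ _)
  have hI : Integrable (fun w : Eu d × ℝ => ((a w.1 : ℂ) * uexp ((t - w.2) * om w.1) * FH F w.2 w.1) *
      (starRingEnd ℂ) (𝓕 g w.1)) (volume.prod volume) := by
    refine Integrable.mul_bdd (c := N) ?_ ?_ ?_
    · refine (ha.integrable.norm.mul_prod hi).mono' ?_ ?_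
      · have m1 : Measurable (fun w : Eu d × ℝ => FH F w.2 w.1) := (measurable_FH hF.meas).comp (g := fun p : ℝ × Eu d => FH F p.1 p.2) (f := fun w : Eu d × ℝ => (w.2, w.1)) (by fun_prop)
        have m3 : Measurable (fun w : Eu d × ℝ => (a w.1 : ℂ) * uexp ((t - w.2) * om w.1)) := Continuous.measurable (by fun_prop)
        exact (m3.mul m1).aestronglyMeasurable
      · filter_upwards with w
        rw [norm_mul, norm_mul, norm_uexp, mul_one, Complex.norm_real]
        have := h1 w.2 w.1
        gcongr
    · exact (Continuous.aestronglyMeasurable (by fun_prop))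
    · filter_upwards with w; rw [RCLike.norm_conj]; exact hN _
  have hs := integral_integral_swap (f := fun (ξ : Eu d) (s : ℝ) => ((a ξ : ℂ) * uexp ((t - s) * om ξ) * FH F s ξ) *
      (starRingEnd ℂ) (𝓕 g ξ)) hI
  have e : ∫ s, fm a (t - s) (fun y => F (s, y)) g = ∫ ξ, ((a ξ : ℂ) * uexp (t * om ξ) * Wf F ξ) * (starRingEnd ℂ) (𝓕 g ξ) := by
    refine hs.symm.trans ?_
    congr 1; funext ξ
    unfold Wf
    rw [integral_mul_const, ← integral_const_mul]
    congr 2; funext s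
    rw [show (t - s) * om ξ = t * om ξ + -(s * om ξ) by ring, uexp_add]; ring
  have hWm := measurable_Wf hF.meas
  rw [e]
  refine le_trans ?_ (cs_weight (w := fun ξ => ‖a ξ‖ₑ) (u := fun ξ => ‖Wf F ξ‖ₑ) (v := fun ξ => ‖𝓕 g ξ‖ₑ)
    (by fun_prop) (by fun_prop) (by fun_prop))
  refine (enorm_integral_le_lintegral_enorm _).trans (le_of_eq ?_)
  congr 1; funext ξ
  rw [enorm_mul, enorm_mul, enorm_mul, enorm_uexp, mul_one, enorm_conj']
  congr 2
  rw [← ofReal_norm, ← ofReal_norm, Complex.norm_real]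
end spacetime
end Strz


open MeasureTheory Real Complex
open scoped FourierTransform ENNReal SchwartzMap RealInnerProductSpace
set_option linter.all false
set_option linter.unusedVariables false
set_option linter.unusedSimpArgs false
set_option linter.deprecated false
namespace Strz
section hls

lemma lint_abs {h : ℝ → ℝ≥0∞} (hm : Measurable h) : ∫⁻ u : ℝ, h |u| = 2 * ∫⁻ u in Set.Ioi (0:ℝ), h u := by
  have e1 : ∫⁻ u in Set.Ioi (0:ℝ), h |u| = ∫⁻ u in Set.Ioi (0:ℝ), h u :=
    setLIntegral_congr_fun measurableSet_Ioi fun u hu => by rw [abs_of_pos (Set.mem_Ioi.1 hu)]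
  have e2 : ∫⁻ u in Set.Iic (0:ℝ), h |u| = ∫⁻ u in Set.Ioi (0:ℝ), h u := by
    have := (Measure.measurePreserving_neg (volume : Measure ℝ)).setLIntegral_comp_preimage (s := Set.Ici (0:ℝ)) measurableSet_Ici (f := fun u => h |u|) (by fun_prop)
    simp only [abs_neg] at this
    have h3 : (Neg.neg : ℝ → ℝ) ⁻¹' Set.Ici 0 = Set.Iic 0 := by ext; simp
    rw [h3] at this
    rw [this, setLIntegral_congr Ioi_ae_eq_Ici.symm, e1]
  rw [← lintegral_add_compl _ (measurableSet_Ioi (a := (0:ℝ))), Set.compl_Ioi, e1, e2, two_mul]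

lemma near_int {κ : ℝ} (h1 : κ < 1) {R : ℝ} (hR : 0 < R) (s : ℝ) :
    ∫⁻ t in {t : ℝ | |t - s| < R}, ENNReal.ofReal |t - s| ^ (-κ) ≤ ENNReal.ofReal (2 / (1 - κ)) * ENNReal.ofReal R ^ (1 - κ) := by
  have hk : 0 < 1 - κ := by linarith
  have hS : MeasurableSet {t : ℝ | |t - s| < R} := measurableSet_lt (by fun_prop) measurable_const
  rw [← lintegral_indicator hS]
  have e1 : ∀ t, Set.indicator {t : ℝ | |t - s| < R} (fun t => ENNReal.ofReal |t - s| ^ (-κ)) t =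
      (Set.Iio R).indicator (fun u => ENNReal.ofReal u ^ (-κ)) |t - s| := by
    intro t
    by_cases h : |t - s| < R
    · rw [Set.indicator_of_mem (show t ∈ {t : ℝ | |t - s| < R} from h), Set.indicator_of_mem (show |t - s| ∈ Set.Iio R from h)]
    · rw [Set.indicator_of_notMem (show t ∉ {t : ℝ | |t - s| < R} from h), Set.indicator_of_notMem (show |t - s| ∉ Set.Iio R from h)]
  simp_rw [e1]
  rw [lintegral_sub_right_eq_self (fun u => (Set.Iio R).indicator (fun u => ENNReal.ofReal u ^ (-κ)) |u|) s]
  have hm : Measurable (fun u : ℝ => ENNReal.ofReal u ^ (-κ)) := by fun_prop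
  rw [lint_abs (hm.indicator measurableSet_Iio), lintegral_indicator measurableSet_Iio, Measure.restrict_restrict measurableSet_Iio,
    Set.inter_comm, Set.Ioi_inter_Iio]
  have e2 : ∫⁻ u in Set.Ioo 0 R, ENNReal.ofReal u ^ (-κ) = ENNReal.ofReal (R ^ (1 - κ) / (1 - κ)) := by
    have hIntg : IntervalIntegrable (fun u : ℝ => u ^ (-κ)) volume 0 R := intervalIntegral.intervalIntegrable_rpow' (by linarith)
    have h3 := integral_rpow (a := 0) (b := R) (r := -κ) (Or.inl (by linarith))
    rw [intervalIntegral.integral_of_le hR.le, integral_Ioc_eq_integral_Ioo, Real.zero_rpow (by linarith), sub_zero, show -κ + 1 = 1 - κ by ring] at h3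
    rw [← h3, ofReal_integral_eq_lintegral_ofReal]
    · refine setLIntegral_congr_fun measurableSet_Ioo fun u hu => ?_
      rw [ENNReal.ofReal_rpow_of_pos hu.1]
    · have := (intervalIntegrable_iff_integrableOn_Ioo_of_le hR.le).1 hIntg
      exact this
    · filter_upwards [ae_restrict_mem measurableSet_Ioo] with u hu
      exact Real.rpow_nonneg hu.1.le _
  rw [e2, ENNReal.ofReal_rpow_of_pos hR, ← ENNReal.ofReal_mul (by positivity), show (2:ℝ≥0∞) = ENNReal.ofReal 2 by simp, ← ENNReal.ofReal_mul (by norm_num)]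
  apply le_of_eq; congr 1; ring

lemma far_int {R : ℝ} (hR : 0 < R) (s : ℝ) :
    ∫⁻ t in {t : ℝ | |t - s| < R}ᶜ, ENNReal.ofReal |t - s| ^ (-2:ℝ) ≤ 2 * (ENNReal.ofReal R)⁻¹ := by
  have hS : MeasurableSet {t : ℝ | |t - s| < R} := measurableSet_lt (by fun_prop) measurable_const
  rw [← lintegral_indicator hS.compl]
  have e1 : ∀ t, Set.indicator {t : ℝ | |t - s| < R}ᶜ (fun t => ENNReal.ofReal |t - s| ^ (-2:ℝ)) t =
      (Set.Ici R).indicator (fun u => ENNReal.ofReal u ^ (-2:ℝ)) |t - s| := by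
    intro t
    by_cases h : |t - s| < R
    · rw [Set.indicator_of_notMem (show t ∉ {t : ℝ | |t - s| < R}ᶜ from fun h' => h' h), Set.indicator_of_notMem (show |t - s| ∉ Set.Ici R from not_le.2 h)]
    · rw [Set.indicator_of_mem (show t ∈ {t : ℝ | |t - s| < R}ᶜ from h), Set.indicator_of_mem (show |t - s| ∈ Set.Ici R from not_lt.1 h)]
  simp_rw [e1]
  rw [lintegral_sub_right_eq_self (fun u => (Set.Ici R).indicator (fun u => ENNReal.ofReal u ^ (-2:ℝ)) |u|) s]
  have hm : Measurable (fun u : ℝ => ENNReal.ofReal u ^ (-2:ℝ)) := by fun_prop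
  rw [lint_abs (hm.indicator measurableSet_Ici), lintegral_indicator measurableSet_Ici, Measure.restrict_restrict measurableSet_Ici,
    Set.inter_eq_left.2 (show Set.Ici R ⊆ Set.Ioi 0 from fun u hu => Set.mem_Ioi.2 (lt_of_lt_of_le hR hu)), setLIntegral_congr Ioi_ae_eq_Ici.symm]
  refine mul_le_mul_right (le_of_eq ?_) _
  have h3 := integral_Ioi_rpow_of_lt (a := -2) (by norm_num) hR
  have h4 : ∫ u in Set.Ioi R, u ^ (-2:ℝ) = R⁻¹ := by
    rw [h3]; norm_num; rw [Real.rpow_neg_one]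
  rw [← ENNReal.ofReal_inv_of_pos hR, ← h4, ofReal_integral_eq_lintegral_ofReal]
  · refine setLIntegral_congr_fun measurableSet_Ioi fun u hu => ?_
    rw [ENNReal.ofReal_rpow_of_pos (hR.trans hu)]
  · exact integrableOn_Ioi_rpow_of_lt (by norm_num) hR
  · filter_upwards [ae_restrict_mem measurableSet_Ioi] with u hu
    exact Real.rpow_nonneg (hR.trans hu).le _

lemma hls_pt {α : ℝ} (h1 : 1 < α) (h2 : α < 2) {g : ℝ → ℝ≥0∞} (hg : Measurable g) (hg1 : ∫⁻ t, g t ^ α ≤ 1) (x : ℝ≥0∞) (s : ℝ) :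
    ∫⁻ t in {t | g t ≤ x}, x * g t * ENNReal.ofReal |t - s| ^ (-(2 - 2/α)) ≤ (ENNReal.ofReal (2/(1 - (2 - 2/α))) + 2) * x ^ α := by
  have hα : 0 < α := by linarith
  by_cases hx0 : x = 0
  · simp [hx0]
  by_cases hxt : x = ∞
  · rw [hxt, ENNReal.top_rpow_of_pos hα, ENNReal.mul_top (by positivity)]; exact le_top
  have hk1 : 2 - 2/α < 1 := by
    have : 1 < 2/α := by rw [lt_div_iff₀ hα]; linarith
    linarith
  set R : ℝ := (x ^ (-α)).toReal with hR
  have hRt : x ^ (-α) ≠ ∞ := ENNReal.rpow_ne_top_of_ne_zero hx0 hxt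
  have hR1 : ENNReal.ofReal R = x ^ (-α) := ENNReal.ofReal_toReal hRt
  have hR0 : 0 < R := ENNReal.toReal_pos (ENNReal.rpow_pos (pos_iff_ne_zero.2 hx0) hxt).ne' hRt
  set N := {t : ℝ | |t - s| < R} with hN
  have hS : MeasurableSet N := measurableSet_lt (by fun_prop) measurable_const
  have hA : MeasurableSet {t | g t ≤ x} := measurableSet_le hg measurable_const
  have hc : (α.HolderConjugate (α / (α - 1))) := Real.HolderConjugate.conjExponent h1
  have near : ∫⁻ t in {t | g t ≤ x} ∩ N, x * g t * ENNReal.ofReal |t - s| ^ (-(2 - 2/α)) ≤ ENNReal.ofReal (2/(1 - (2 - 2/α))) * x ^ α := by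
    calc _ ≤ ∫⁻ t in {t | g t ≤ x} ∩ N, x * x * ENNReal.ofReal |t - s| ^ (-(2 - 2/α)) := by
          refine setLIntegral_mono' (hA.inter hS) fun t ht => ?_
          gcongr
          exact ht.1
      _ ≤ ∫⁻ t in N, x * x * ENNReal.ofReal |t - s| ^ (-(2 - 2/α)) := lintegral_mono_set Set.inter_subset_right
      _ = x * x * ∫⁻ t in N, ENNReal.ofReal |t - s| ^ (-(2 - 2/α)) := lintegral_const_mul _ (by fun_prop)
      _ ≤ x * x * (ENNReal.ofReal (2/(1 - (2 - 2/α))) * ENNReal.ofReal R ^ (1 - (2 - 2/α))) := by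
          gcongr; exact near_int hk1 hR0 s
      _ = ENNReal.ofReal (2/(1 - (2 - 2/α))) * (x ^ (1:ℝ) * x ^ (1:ℝ) * x ^ (-α * (1 - (2 - 2/α)))) := by
          rw [hR1, ← ENNReal.rpow_mul, ENNReal.rpow_one]; ring
      _ = _ := by
          rw [← ENNReal.rpow_add _ _ hx0 hxt, ← ENNReal.rpow_add _ _ hx0 hxt]
          congr 2; field_simp; ring
  have far : ∫⁻ t in {t | g t ≤ x} ∩ Nᶜ, x * g t * ENNReal.ofReal |t - s| ^ (-(2 - 2/α)) ≤ 2 * x ^ α := by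
    calc _ ≤ ∫⁻ t in Nᶜ, x * g t * ENNReal.ofReal |t - s| ^ (-(2 - 2/α)) := lintegral_mono_set Set.inter_subset_right
      _ = x * ∫⁻ t in Nᶜ, (g * fun t => ENNReal.ofReal |t - s| ^ (-(2 - 2/α))) t := by
          rw [← lintegral_const_mul _ (by fun_prop)]; simp only [Pi.mul_apply, mul_assoc]
      _ ≤ x * ((∫⁻ t in Nᶜ, g t ^ α) ^ (1/α) * (∫⁻ t in Nᶜ, (ENNReal.ofReal |t - s| ^ (-(2 - 2/α))) ^ (α/(α-1))) ^ (1/(α/(α-1)))) := by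
          gcongr
          exact ENNReal.lintegral_mul_le_Lp_mul_Lq _ hc (by fun_prop) (by fun_prop)
      _ ≤ x * (1 ^ (1/α) * (2 * (ENNReal.ofReal R)⁻¹) ^ (1/(α/(α-1)))) := by
          have hh : 0 ≤ 1/(α/(α-1)) := one_div_nonneg.2 (div_nonneg hα.le (by linarith))
          refine mul_le_mul_right (mul_le_mul' (ENNReal.rpow_le_rpow ?_ (by positivity)) (ENNReal.rpow_le_rpow ?_ hh)) _
          · exact (lintegral_mono' Measure.restrict_le_self le_rfl).trans hg1
          · refine le_trans (le_of_eq ?_) (far_int hR0 s)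
            congr 1; funext t
            rw [← ENNReal.rpow_mul]
            congr 1
            have : α - 1 ≠ 0 := by linarith
            field_simp
      _ = x * (2 ^ ((α-1)/α) * x ^ (α * ((α - 1)/α))) := by
          rw [ENNReal.one_rpow, one_mul, one_div_div, hR1, ← ENNReal.rpow_neg, neg_neg, ENNReal.mul_rpow_of_nonneg _ _ (by apply div_nonneg <;> linarith),
            ← ENNReal.rpow_mul]
      _ ≤ x * (2 * x ^ (α - 1)) := by
          rw [show α * ((α - 1)/α) = α - 1 by field_simp]
          gcongr
          calc (2:ℝ≥0∞) ^ ((α-1)/α) ≤ 2 ^ (1:ℝ) := by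
                apply ENNReal.rpow_le_rpow_of_exponent_le (by norm_num)
                rw [div_le_one hα]; linarith
            _ = 2 := by simp
      _ = 2 * (x ^ (1:ℝ) * x ^ (α - 1)) := by rw [ENNReal.rpow_one]; ring
      _ = _ := by rw [← ENNReal.rpow_add _ _ hx0 hxt]; congr 2; ring
  rw [← lintegral_inter_add_diff _ _ hS, Set.diff_eq, add_mul]
  exact add_le_add near far

theorem hls {α : ℝ} (h1 : 1 < α) (h2 : α < 2) : ∃ C : ℝ≥0∞, C ≠ ∞ ∧ ∀ f g : ℝ → ℝ≥0∞, Measurable f → Measurable g →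
    ∫⁻ s, ∫⁻ t, f s * g t * ENNReal.ofReal |t - s| ^ (-(2 - 2/α)) ≤ C * (∫⁻ s, f s ^ α) ^ (1/α) * (∫⁻ s, g s ^ α) ^ (1/α) := by
  have hα : 0 < α := by linarith
  set c : ℝ≥0∞ := ENNReal.ofReal (2/(1 - (2 - 2/α))) + 2 with hc
  have hcne : c ≠ ∞ := by finiteness
  have norm1 : ∀ f g : ℝ → ℝ≥0∞, Measurable f → Measurable g → ∫⁻ s, f s ^ α ≤ 1 → ∫⁻ s, g s ^ α ≤ 1 →
      ∫⁻ s, ∫⁻ t, f s * g t * ENNReal.ofReal |t - s| ^ (-(2 - 2/α)) ≤ 2 * c := by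
    intro f g hf hg hf1 hg1
    have half : ∀ f g : ℝ → ℝ≥0∞, Measurable f → Measurable g → ∫⁻ s, f s ^ α ≤ 1 → ∫⁻ s, g s ^ α ≤ 1 →
        ∫⁻ s, ∫⁻ t in {t | g t ≤ f s}, f s * g t * ENNReal.ofReal |t - s| ^ (-(2 - 2/α)) ≤ c := by
      intro f g hf hg hf1 hg1
      calc _ ≤ ∫⁻ s, c * f s ^ α := lintegral_mono fun s => hls_pt h1 h2 hg hg1 _ _
        _ = c * ∫⁻ s, f s ^ α := lintegral_const_mul _ (by fun_prop)
        _ ≤ c * 1 := by gcongr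
        _ = c := mul_one c
    have ha := half f g hf hg hf1 hg1
    have hb := half g f hg hf hg1 hf1
    have hset : MeasurableSet {z : ℝ × ℝ | g z.2 ≤ f z.1} := measurableSet_le (by fun_prop) (by fun_prop)
    have hset' : MeasurableSet {z : ℝ × ℝ | f z.1 ≤ g z.2} := measurableSet_le (by fun_prop) (by fun_prop)
    have e2 : ∫⁻ s, ∫⁻ t in {t | f t ≤ g s}, g s * f t * ENNReal.ofReal |t - s| ^ (-(2 - 2/α)) =
        ∫⁻ s, ∫⁻ t in {t | f s ≤ g t}, f s * g t * ENNReal.ofReal |t - s| ^ (-(2 - 2/α)) := by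
      have i1 : ∀ s, MeasurableSet {t | f t ≤ g s} := fun s => measurableSet_le hf measurable_const
      have i2 : ∀ s, MeasurableSet {t | f s ≤ g t} := fun s => measurableSet_le measurable_const hg
      simp_rw [← lintegral_indicator (i1 _), ← lintegral_indicator (i2 _)]
      have hH : Measurable ({z : ℝ × ℝ | f z.1 ≤ g z.2}.indicator fun z : ℝ × ℝ => f z.1 * g z.2 * ENNReal.ofReal |z.2 - z.1| ^ (-(2 - 2/α))) := by
        apply Measurable.indicator _ hset'; fun_prop
      rw [lintegral_lintegral_swap]
      · congr 1; funext s; congr 1; funext t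
        by_cases h : f s ≤ g t
        · rw [Set.indicator_of_mem (show s ∈ {t_1 | f t_1 ≤ g t} from h), Set.indicator_of_mem (show t ∈ {t | f s ≤ g t} from h), abs_sub_comm]; ring
        · rw [Set.indicator_of_notMem (show s ∉ {t_1 | f t_1 ≤ g t} from h), Set.indicator_of_notMem (show t ∉ {t | f s ≤ g t} from h)]
      · have : Measurable ({z : ℝ × ℝ | f z.2 ≤ g z.1}.indicator fun z : ℝ × ℝ => g z.1 * f z.2 * ENNReal.ofReal |z.2 - z.1| ^ (-(2 - 2/α))) :=
          Measurable.indicator (by fun_prop) (measurableSet_le (by fun_prop) (by fun_prop))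
        exact this.aemeasurable
    rw [e2] at hb
    rw [two_mul]
    refine le_trans ?_ (add_le_add ha hb)
    rw [← lintegral_add_left]
    · refine lintegral_mono fun s => ?_
      have i1 : MeasurableSet {t | g t ≤ f s} := measurableSet_le hg measurable_const
      rw [← lintegral_add_compl _ i1]
      gcongr
      exact fun t ht => (not_le.1 (show ¬ (g t ≤ f s) from ht)).le
    · have i2 : ∀ s, MeasurableSet {t | g t ≤ f s} := fun s => measurableSet_le hg measurable_const
      simp_rw [← lintegral_indicator (i2 _)]
      exact Measurable.lintegral_prod_right' (f := {z : ℝ × ℝ | g z.2 ≤ f z.1}.indicator fun z : ℝ × ℝ => f z.1 * g z.2 * ENNReal.ofReal |z.2 - z.1| ^ (-(2 - 2/α)))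
        (Measurable.indicator (by fun_prop) hset)
  refine ⟨2 * c, by finiteness, fun f g hf hg => ?_⟩
  have zero : ∀ f : ℝ → ℝ≥0∞, Measurable f → ∫⁻ s, f s ^ α = 0 → f =ᵐ[volume] 0 := by
    intro f hf h
    rw [lintegral_eq_zero_iff (by fun_prop)] at h
    filter_upwards [h] with s hs
    simpa [hα, hα.le, not_lt.2 hα.le] using hs
  by_cases hf0 : ∫⁻ s, f s ^ α = 0
  · have : ∫⁻ s, ∫⁻ t, f s * g t * ENNReal.ofReal |t - s| ^ (-(2 - 2/α)) = ∫⁻ s : ℝ, 0 := by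
      apply lintegral_congr_ae
      filter_upwards [zero f hf hf0] with s hs
      simp [hs]
    rw [this]; simp
  by_cases hg0 : ∫⁻ s, g s ^ α = 0
  · have : ∀ s, ∫⁻ t, f s * g t * ENNReal.ofReal |t - s| ^ (-(2 - 2/α)) = ∫⁻ s : ℝ, 0 := by
      intro s
      apply lintegral_congr_ae
      filter_upwards [zero g hg hg0] with s hs
      simp [hs]
    simp_rw [this]; simp
  set A := (∫⁻ s, f s ^ α) ^ (1/α) with hA
  set B := (∫⁻ s, g s ^ α) ^ (1/α) with hB
  have hA0 : A ≠ 0 := by rw [hA]; simp [ENNReal.rpow_eq_zero_iff, hf0, hα.le, hα, not_lt.2 hα.le]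
  have hB0 : B ≠ 0 := by rw [hB]; simp [ENNReal.rpow_eq_zero_iff, hg0, hα.le, hα, not_lt.2 hα.le]
  have hc0 : (2 * c) ≠ 0 := by simp [hc]
  by_cases hAt : A = ∞
  · rw [hAt, ENNReal.mul_top hc0, ENNReal.top_mul hB0]; exact le_top
  by_cases hBt : B = ∞
  · rw [hBt, ENNReal.mul_top (mul_ne_zero hc0 hA0)]; exact le_top
  have nor : ∀ f : ℝ → ℝ≥0∞, Measurable f → ∀ A, A = (∫⁻ s, f s ^ α) ^ (1/α) → A ≠ 0 → A ≠ ∞ → ∫⁻ s, (f s * A⁻¹) ^ α ≤ 1 := by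
    intro f hf A hA hA0 hAt
    simp_rw [ENNReal.mul_rpow_of_nonneg _ _ hα.le]
    rw [lintegral_mul_const _ (by fun_prop), ENNReal.inv_rpow]
    have : A ^ α = ∫⁻ s, f s ^ α := by
      rw [hA, ← ENNReal.rpow_mul, one_div_mul_cancel hα.ne', ENNReal.rpow_one]
    rw [← this]
    exact ENNReal.mul_inv_le_one _
  have := norm1 (fun s => f s * A⁻¹) (fun s => g s * B⁻¹) (by fun_prop) (by fun_prop) (nor f hf A hA hA0 hAt) (nor g hg B hB hB0 hBt)
  calc _ = ∫⁻ s, ∫⁻ t, A * B * (f s * A⁻¹ * (g t * B⁻¹) * ENNReal.ofReal |t - s| ^ (-(2 - 2/α))) := by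
        congr 1; funext s; congr 1; funext t
        calc _ = (A * A⁻¹) * (B * B⁻¹) * (f s * g t * ENNReal.ofReal |t - s| ^ (-(2 - 2/α))) := by
              rw [ENNReal.mul_inv_cancel hA0 hAt, ENNReal.mul_inv_cancel hB0 hBt]; simp
          _ = _ := by ring
    _ = A * B * ∫⁻ s, ∫⁻ t, (f s * A⁻¹ * (g t * B⁻¹) * ENNReal.ofReal |t - s| ^ (-(2 - 2/α))) := by
        rw [← lintegral_const_mul']
        · congr 1; funext s
          rw [lintegral_const_mul' _ _ (by finiteness)]
        · finiteness
    _ ≤ A * B * (2 * c) := by gcongr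
    _ = _ := by ring
end hls
end Strz


open MeasureTheory Real Complex
open scoped FourierTransform ENNReal SchwartzMap RealInnerProductSpace
set_option linter.all false
set_option linter.unusedVariables false
set_option linter.unusedSimpArgs false
set_option linter.deprecated false
namespace Strz
section diag
variable {d : ℕ}

/-- localized bilinear estimate, uniform in the time region -/
def LocB (a : Eu d → ℝ) (α β α' β' : ℝ) : Prop :=
  ∃ C : ℝ≥0∞, C ≠ ∞ ∧ ∀ S : Set (ℝ × ℝ), MeasurableSet S → ∀ F G : ℝ × Eu d → ℂ, Nice F → Nice G →
    ‖Bf a S F G‖ₑ ≤ C * mN α β F * mN α' β' G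

lemma Bf_le_iter {a : Eu d → ℝ} (ha : Amp a) {S : Set (ℝ × ℝ)} (hS : MeasurableSet S) {F G : ℝ × Eu d → ℂ} (hF : Nice F) (hG : Nice G) :
    ‖Bf a S F G‖ₑ ≤ ∫⁻ s, ∫⁻ t, S.indicator (fun z => ‖fm a (z.2 - z.1) (fun y => F (z.1, y)) (fun y => G (z.2, y))‖ₑ) (s, t) := by
  refine (Bf_le a S F G).trans (le_of_eq ?_)
  rw [← lintegral_indicator hS]
  change ∫⁻ z, _ ∂(volume.prod volume) = _
  rw [lintegral_prod]
  exact (AEMeasurable.indicator (fm_integrable ha hF hG).1.enorm hS)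

lemma diag_L1L2 {a : Eu d → ℝ} (ha : Amp a) (hpos : ∀ ξ, 0 ≤ a ξ) : LocB a 1 2 1 2 := by
  obtain ⟨C, hC, h⟩ := fm_L2 ha hpos
  refine ⟨C, hC, fun S hS F G hF hG => (Bf_le_iter ha hS hF hG).trans ?_⟩
  have m1 := measurable_nrm 2 hF.meas
  have m2 := measurable_nrm 2 hG.meas
  calc _ ≤ ∫⁻ s, ∫⁻ t, C * nrm 2 (fun y => F (s, y)) * nrm 2 (fun y => G (t, y)) := by
        refine lintegral_mono fun s => lintegral_mono fun t => ?_
        refine (Set.indicator_le_self _ _ _).trans ?_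
        exact h _ _ _ (hF.slice s) (hG.slice t)
    _ = _ := by
        simp_rw [lintegral_const_mul _ m2]
        rw [lintegral_mul_const _ (by fun_prop), lintegral_const_mul _ m1]
        simp [mN]

lemma diag_nonend {a : Eu d → ℝ} (ha : Amp a) (hpos : ∀ ξ, 0 ≤ a ξ) (hd : 1 ≤ d) {α β : ℝ} (h1 : 1 < α) (h2 : α < 2) (hβ : 1 < β)
    (hs : 1 / β = 1/2 + 2 / d * (1 - 1/α)) : LocB a α β α β := by
  have hα : 0 < α := by linarith
  have hd' : (0:ℝ) < d := by exact_mod_cast hd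
  have hk : 0 < 1 - 1/α := by rw [sub_pos, div_lt_one hα]; exact h1
  have hβ2 : β < 2 := by
    by_contra hh
    have : 1/β ≤ 1/2 := one_div_le_one_div_of_le (by norm_num) (not_lt.1 hh)
    have : 0 < 2 / d * (1 - 1/α) := by positivity
    linarith
  obtain ⟨C, hC, h⟩ := fm_beta ha hpos hβ hβ2
  obtain ⟨D, hD, hh⟩ := hls h1 h2
  have eκ : (d:ℝ) * (1/β - 1/2) = 2 - 2/α := by rw [hs]; field_simp; ring
  rw [eκ] at h
  refine ⟨C * D, by finiteness, fun S hS F G hF hG => (Bf_le_iter ha hS hF hG).trans ?_⟩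
  have m1 := measurable_nrm β hF.meas
  have m2 := measurable_nrm β hG.meas
  calc _ ≤ ∫⁻ s, ∫⁻ t, C * (nrm β (fun y => F (s, y)) * nrm β (fun y => G (t, y)) * ENNReal.ofReal |t - s| ^ (-(2 - 2/α))) := by
        refine lintegral_mono fun s => lintegral_mono_ae ?_
        have : ∀ᵐ t : ℝ, t ≠ s := by simp [ae_iff]
        filter_upwards [this] with t ht
        refine (Set.indicator_le_self _ _ _).trans ?_
        refine (h _ _ _ (hF.slice s) (hG.slice t) (sub_ne_zero.2 ht)).trans (le_of_eq ?_)
        ring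
    _ = C * ∫⁻ s, ∫⁻ t, nrm β (fun y => F (s, y)) * nrm β (fun y => G (t, y)) * ENNReal.ofReal |t - s| ^ (-(2 - 2/α)) := by
        rw [← lintegral_const_mul' _ _ hC]
        congr 1; funext s
        rw [lintegral_const_mul' _ _ hC]
    _ ≤ C * (D * mN α β F * mN α β G) := by
        gcongr
        exact hh _ _ m1 m2
    _ = _ := by ring

lemma QW_le {a : Eu d → ℝ} (ha : Amp a) (hpos : ∀ ξ, 0 ≤ a ξ) {α β : ℝ} (h : LocB a α β α β) :
    ∃ C : ℝ≥0∞, C ≠ ∞ ∧ ∀ F : ℝ × Eu d → ℂ, Nice F → QW a F ^ (1/2:ℝ) ≤ C * mN α β F := by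
  obtain ⟨C, hC, h⟩ := h
  refine ⟨C ^ (1/2:ℝ), by finiteness, fun F hF => ?_⟩
  rw [QW_eq ha hpos hF]
  calc _ ≤ (C * mN α β F * mN α β F) ^ (1/2:ℝ) := by
        gcongr; exact h _ MeasurableSet.univ F F hF hF
    _ = _ := by
        rw [mul_assoc, ENNReal.mul_rpow_of_nonneg _ _ (by norm_num), ENNReal.mul_rpow_of_nonneg _ _ (by norm_num),
          ← ENNReal.rpow_add_of_nonneg _ _ (by norm_num) (by norm_num)]
        norm_num

lemma Qf_half {a : Eu d → ℝ} (ha : Amp a) (hpos : ∀ ξ, 0 ≤ a ξ) : ∃ C : ℝ≥0∞, C ≠ ∞ ∧ ∀ f : Eu d → ℂ, NiceS f →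
    Qf a f ^ (1/2:ℝ) ≤ C * nrm 2 f := by
  obtain ⟨C, hC, h⟩ := Qf_le ha hpos
  refine ⟨C ^ (1/2:ℝ), by finiteness, fun f hf => ?_⟩
  calc _ ≤ (C * nrm 2 f ^ (2:ℝ)) ^ (1/2:ℝ) := by
        gcongr; exact h f hf
    _ = _ := by
        rw [ENNReal.mul_rpow_of_nonneg _ _ (by norm_num), ← ENNReal.rpow_mul]; norm_num

noncomputable def cut (S : Set (ℝ × ℝ)) (t : ℝ) (F : ℝ × Eu d → ℂ) : ℝ × Eu d → ℂ :=
  {z : ℝ × Eu d | (z.1, t) ∈ S}.indicator F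

lemma cut_set_meas {S : Set (ℝ × ℝ)} (hS : MeasurableSet S) (t : ℝ) : MeasurableSet {z : ℝ × Eu d | (z.1, t) ∈ S} :=
  (by fun_prop : Measurable fun z : ℝ × Eu d => (z.1, t)) hS

lemma Nice.cut {F : ℝ × Eu d → ℂ} (hF : Nice F) {S : Set (ℝ × ℝ)} (hS : MeasurableSet S) (t : ℝ) : Nice (cut S t F) :=
  hF.indicator (cut_set_meas hS t)

lemma Bf_slice {a : Eu d → ℝ} (ha : Amp a) {S : Set (ℝ × ℝ)} (hS : MeasurableSet S) {F G : ℝ × Eu d → ℂ} (hF : Nice F) (hG : Nice G) :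
    ‖Bf a S F G‖ₑ ≤ ∫⁻ t, QW a (cut S t F) ^ (1/2:ℝ) * Qf a (fun y => G (t, y)) ^ (1/2:ℝ) := by
  have hi := (fm_integrable ha hF hG).indicator hS
  have e : Bf a S F G = ∫ t, ∫ s, fm a (t - s) (fun y => cut S t F (s, y)) (fun y => G (t, y)) := by
    unfold Bf
    rw [← integral_indicator hS]
    change ∫ z, _ ∂(volume.prod volume) = _
    rw [integral_prod_symm _ hi]
    congr 1; funext t; congr 1; funext s
    by_cases h : (s, t) ∈ S
    · rw [Set.indicator_of_mem h]
      have : (fun y => cut S t F (s, y)) = fun y => F (s, y) := by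
        funext y; exact Set.indicator_of_mem (show (s, y) ∈ {z : ℝ × Eu d | (z.1, t) ∈ S} from h) _
      rw [this]
    · rw [Set.indicator_of_notMem h]
      have : (fun y => cut S t F (s, y)) = fun y => 0 := by
        funext y; exact Set.indicator_of_notMem (show (s, y) ∉ {z : ℝ × Eu d | (z.1, t) ∈ S} from h) _
      rw [this]
      exact (fm_zero_left (by rfl)).symm
  rw [e]
  refine (enorm_integral_le_lintegral_enorm _).trans (lintegral_mono fun t => ?_)
  exact fixed_t ha t (hF.cut hS t) (hG.slice t)

lemma LocB_L1L2_right {a : Eu d → ℝ} (ha : Amp a) (hpos : ∀ ξ, 0 ≤ a ξ) {α β : ℝ} (hα : 0 < α) (hβ : 0 < β) (h : LocB a α β α β) :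
    LocB a α β 1 2 := by
  obtain ⟨C, hC, h1⟩ := QW_le ha hpos h
  obtain ⟨D, hD, h2⟩ := Qf_half ha hpos
  refine ⟨C * D, by finiteness, fun S hS F G hF hG => (Bf_slice ha hS hF hG).trans ?_⟩
  have m2 := measurable_nrm 2 hG.meas
  calc _ ≤ ∫⁻ t, (C * mN α β F * D) * nrm 2 (fun y => G (t, y)) := by
        refine lintegral_mono fun t => ?_
        calc _ ≤ (C * mN α β F) * (D * nrm 2 (fun y => G (t, y))) := by
              gcongr
              · refine (h1 _ (hF.cut hS t)).trans ?_
                gcongr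
                refine mN_mono hα hβ fun z => ?_
                exact enorm_indicator_le_enorm_self _ _
              · exact h2 _ (hG.slice t)
          _ = _ := by ring
    _ = _ := by
        rw [lintegral_const_mul _ m2]; simp [mN]; ring

lemma LocB.symm {a : Eu d → ℝ} {α β α' β' : ℝ} (h : LocB a α β α' β') : LocB a α' β' α β := by
  obtain ⟨C, hC, h⟩ := h
  refine ⟨C, hC, fun S hS F G hF hG => ?_⟩
  rw [Bf_swap a hS, enorm_conj']
  refine (h _ (measurable_swap hS) G F hG hF).trans (le_of_eq ?_)
  ring
end diag
end Strz


open MeasureTheory Real Complex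
open scoped FourierTransform ENNReal SchwartzMap RealInnerProductSpace
set_option linter.all false
set_option linter.unusedVariables false
set_option linter.unusedSimpArgs false
set_option linter.deprecated false
namespace Strz
section endp
variable {d : ℕ}

noncomputable def h4 (a : Eu d → ℝ) (F G : ℝ × Eu d → ℂ) (w : (ℝ × ℝ) × (Eu d × Eu d)) : ℂ :=
  ker a (w.1.2 - w.1.1) (w.2.2 - w.2.1) * F (w.1.1, w.2.1) * (starRingEnd ℂ) (G (w.1.2, w.2.2))

lemma measurable_h4 {a : Eu d → ℝ} (ha : Amp a) {F G : ℝ × Eu d → ℂ} (hF : Measurable F) (hG : Measurable G) : Measurable (h4 a F G) := by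
  unfold h4
  have m1 : Measurable (fun w : (ℝ × ℝ) × (Eu d × Eu d) => ker a (w.1.2 - w.1.1) (w.2.2 - w.2.1)) :=
    ((ker_cont ha).comp (by fun_prop : Continuous fun w : (ℝ × ℝ) × (Eu d × Eu d) => (w.1.2 - w.1.1, w.2.2 - w.2.1))).measurable
  have m2 : Measurable (fun w : (ℝ × ℝ) × (Eu d × Eu d) => F (w.1.1, w.2.1)) := hF.comp (by fun_prop)
  have m3 : Measurable (fun w : (ℝ × ℝ) × (Eu d × Eu d) => G (w.1.2, w.2.2)) := hG.comp (by fun_prop)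
  exact (m1.mul m2).mul ((Complex.continuous_conj.measurable).comp m3)

lemma h4_slice_int {a : Eu d → ℝ} (ha : Amp a) (τ : ℝ) {f g : Eu d → ℂ} (hf : Integrable f) (hg : Integrable g) :
    Integrable (fun z : Eu d × Eu d => ker a τ (z.2 - z.1) * f z.1 * (starRingEnd ℂ) (g z.2)) := by
  have hg' : Integrable (fun x => (starRingEnd ℂ) (g x)) := 
    (Complex.conjLIE.integrable_comp_iff (φ := g)).2 hg
  have hfg : Integrable (fun z : Eu d × Eu d => f z.1 * (starRingEnd ℂ) (g z.2)) (volume.prod volume) := hf.mul_prod hg'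
  have : Integrable (fun z : Eu d × Eu d => ker a τ (z.2 - z.1) * (f z.1 * (starRingEnd ℂ) (g z.2))) (volume.prod volume) := by
    refine Integrable.bdd_mul (c := ∫ ξ, ‖a ξ‖) hfg ?_ ?_
    · exact ((ker_cont ha).comp (by fun_prop : Continuous fun z : Eu d × Eu d => (τ, z.2 - z.1))).aestronglyMeasurable
    · filter_upwards with z; exact ker_bdd ha _ _
  simp only [mul_assoc]; exact this

lemma h4_int {a : Eu d → ℝ} (ha : Amp a) {F G : ℝ × Eu d → ℂ} (hF : Nice F) (hG : Nice G) :
    Integrable (h4 a F G) (volume.prod volume) := by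
  have hm := (measurable_h4 ha hF.meas hG.meas)
  rw [integrable_prod_iff hm.aestronglyMeasurable]
  constructor
  · filter_upwards with z
    have := h4_slice_int ha (z.2 - z.1) (f := fun y => F (z.1, y)) (g := fun y => G (z.2, y)) (hF.slice z.1).int (hG.slice z.2).int
    unfold h4
    exact this
  obtain ⟨M, R, h1⟩ := hF.bd
  obtain ⟨M', R', h2⟩ := hG.bd
  set K := ∫ ξ, ‖a ξ‖ with hK
  have hK0 : 0 ≤ K := integral_nonneg fun _ => norm_nonneg _
  have hM0 : 0 ≤ M := (norm_nonneg _).trans ((h1 0).1 0)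
  have hM0' : 0 ≤ M' := (norm_nonneg _).trans ((h2 0).1 0)
  have hdom : Integrable (fun z : ℝ × ℝ => (Set.Icc (-R) R ×ˢ Set.Icc (-R') R').indicator (fun _ => K * M * M') z) := by
    rw [integrable_indicator_iff (measurableSet_Icc.prod measurableSet_Icc)]
    apply integrableOn_const
    · change (volume.prod volume) _ ≠ ∞
      rw [Measure.prod_prod]; simp; finiteness
    · exact enorm_ne_top
  refine hdom.mono' ?_ ?_
  · exact (hm.norm.stronglyMeasurable.integral_prod_right (f := fun (x : ℝ × ℝ) (y : Eu d × Eu d) => ‖h4 a F G (x, y)‖) ).aestronglyMeasurable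
  · filter_upwards with z
    rw [Real.norm_of_nonneg (integral_nonneg fun _ => norm_nonneg _)]
    by_cases hz : z ∈ Set.Icc (-R) R ×ˢ Set.Icc (-R') R'
    · rw [Set.indicator_of_mem hz]
      have hi : Integrable (fun y : Eu d × Eu d => K * (‖F (z.1, y.1)‖ * ‖G (z.2, y.2)‖)) := by
        apply Integrable.const_mul
        exact (hF.slice z.1).int.norm.mul_prod (hG.slice z.2).int.norm
      calc _ ≤ ∫ y : Eu d × Eu d, K * (‖F (z.1, y.1)‖ * ‖G (z.2, y.2)‖) := by
            have hsl := h4_slice_int ha (z.2 - z.1) (f := fun y => F (z.1, y)) (g := fun y => G (z.2, y)) (hF.slice z.1).int (hG.slice z.2).int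
            unfold h4
            refine integral_mono hsl.norm hi fun y => ?_
            dsimp only
            rw [norm_mul, norm_mul, RCLike.norm_conj, mul_assoc]
            gcongr
            exact ker_bdd ha _ _
        _ = K * ((∫ y, ‖F (z.1, y)‖) * ∫ y, ‖G (z.2, y)‖) := by
            rw [integral_const_mul]; congr 1
            exact integral_prod_mul (μ := volume) (ν := volume) (fun y => ‖F (z.1, y)‖) (fun y => ‖G (z.2, y)‖)
        _ ≤ K * (M * M') := by
            have e1 : ∫ y, ‖F (z.1, y)‖ ≤ M := by
              rw [integral_norm_eq_lintegral_enorm (hF.slice z.1).meas.aestronglyMeasurable]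
              exact ENNReal.toReal_le_of_le_ofReal hM0 (h1 z.1).2.1
            have e2 : ∫ y, ‖G (z.2, y)‖ ≤ M' := by
              rw [integral_norm_eq_lintegral_enorm (hG.slice z.2).meas.aestronglyMeasurable]
              exact ENNReal.toReal_le_of_le_ofReal hM0' (h2 z.2).2.1
            gcongr
        _ = _ := by ring
    · rw [Set.indicator_of_notMem hz]
      have : ∀ y, h4 a F G (z, y) = 0 := by
        intro y
        have : R < |z.1| ∨ R' < |z.2| := by
          by_contra hc; push Not at hc
          exact hz (Set.mem_prod.2 ⟨abs_le.1 hc.1, abs_le.1 hc.2⟩)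
        unfold h4
        rcases this with h | h
        · rw [show F ((z, y).1.1, (z, y).2.1) = 0 from (h1 z.1).2.2 h _]; simp
        · rw [show G ((z, y).1.2, (z, y).2.2) = 0 from (h2 z.2).2.2 h _]; simp
      simp [this]

lemma Bf_eq4 {a : Eu d → ℝ} (ha : Amp a) {S : Set (ℝ × ℝ)} (hS : MeasurableSet S) {F G : ℝ × Eu d → ℂ} (hF : Nice F) (hG : Nice G) :
    Bf a S F G = ∫ w, (S ×ˢ Set.univ).indicator (h4 a F G) w ∂(volume.prod volume) := by
  rw [integral_prod _ ((h4_int ha hF hG).indicator (hS.prod MeasurableSet.univ))]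
  unfold Bf
  rw [← integral_indicator hS]
  congr 1; funext z
  by_cases hz : z ∈ S
  · rw [Set.indicator_of_mem hz, fm_eq_ker ha _ (hF.slice z.1).int (hG.slice z.2).int]
    congr 1; funext y
    rw [Set.indicator_of_mem (show (z, y) ∈ S ×ˢ Set.univ from ⟨hz, trivial⟩)]
    rfl
  · rw [Set.indicator_of_notMem hz]
    symm
    rw [← integral_zero (Eu d × Eu d) ℂ (μ := volume)]
    congr 1; funext y
    rw [Set.indicator_of_notMem (show (z, y) ∉ S ×ˢ Set.univ from fun h => hz h.1)]

lemma Bf_decomp {a : Eu d → ℝ} (ha : Amp a) {S : Set (ℝ × ℝ)} (hS : MeasurableSet S) {F G : ℝ × Eu d → ℂ} (hF : Nice F) (hG : Nice G)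
    {T : ℤ → Set (ℝ × ℝ)} {A B : ℤ → Set (ℝ × Eu d)} (hT : ∀ j, MeasurableSet (T j)) (hA : ∀ j, MeasurableSet (A j)) (hB : ∀ j, MeasurableSet (B j))
    (dT : Pairwise (Function.onFun Disjoint T)) (dA : Pairwise (Function.onFun Disjoint A)) (dB : Pairwise (Function.onFun Disjoint B))
    (cT : ∀ z : ℝ × ℝ, z.1 ≠ z.2 → ∃ j, z ∈ T j) (cA : ∀ z, F z ≠ 0 → ∃ j, z ∈ A j) (cB : ∀ z, G z ≠ 0 → ∃ j, z ∈ B j) :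
    ‖Bf a S F G‖ₑ ≤ ∑' j, ∑' k, ∑' l, ‖Bf a (S ∩ T j) ((A k).indicator F) ((B l).indicator G)‖ₑ := by
  have m1 : ∀ k, MeasurableSet {w : (ℝ × ℝ) × (Eu d × Eu d) | (w.1.1, w.2.1) ∈ A k} := fun k =>
    (by fun_prop : Measurable fun w : (ℝ × ℝ) × (Eu d × Eu d) => (w.1.1, w.2.1)) (hA k)
  have m2 : ∀ l, MeasurableSet {w : (ℝ × ℝ) × (Eu d × Eu d) | (w.1.2, w.2.2) ∈ B l} := fun l =>
    (by fun_prop : Measurable fun w : (ℝ × ℝ) × (Eu d × Eu d) => (w.1.2, w.2.2)) (hB l)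
  have m3 : ∀ j, MeasurableSet {w : (ℝ × ℝ) × (Eu d × Eu d) | w.1 ∈ T j} := fun j => measurable_fst (hT j)
  have mW : ∀ i : ℤ × ℤ × ℤ, MeasurableSet ({w : (ℝ × ℝ) × (Eu d × Eu d) | w.1 ∈ T i.1} ∩ ({w | (w.1.1, w.2.1) ∈ A i.2.1} ∩ {w | (w.1.2, w.2.2) ∈ B i.2.2})) :=
    fun i => (m3 i.1).inter ((m1 _).inter (m2 _))
  have h1 := enorm_integral_le_tsum ((h4_int ha hF hG).indicator (hS.prod MeasurableSet.univ)) (A := fun i : ℤ × ℤ × ℤ => 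
    {w : (ℝ × ℝ) × (Eu d × Eu d) | w.1 ∈ T i.1} ∩ ({w | (w.1.1, w.2.1) ∈ A i.2.1} ∩ {w | (w.1.2, w.2.2) ∈ B i.2.2})) mW ?_ ?_
  · rw [Bf_eq4 ha hS hF hG]
    refine h1.trans (le_of_eq ?_)
    rw [ENNReal.tsum_prod']
    congr 1; funext j
    rw [ENNReal.tsum_prod']
    congr 1; funext k; congr 1; funext l
    rw [Bf_eq4 ha (hS.inter (hT j)) (hF.indicator (hA k)) (hG.indicator (hB l)), ← integral_indicator (mW (j, k, l))]
    congr 2; funext w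
    unfold h4
    by_cases g0 : w.1 ∈ S <;> by_cases g1 : w.1 ∈ T j <;> by_cases g2 : (w.1.1, w.2.1) ∈ A k <;> by_cases g3 : (w.1.2, w.2.2) ∈ B l <;>
      simp [Set.indicator, g0, g1, g2, g3]
  · intro i i' hij
    show Disjoint _ _
    by_cases e1 : i.1 = i'.1
    · by_cases e2 : i.2.1 = i'.2.1
      · have e3 : i.2.2 ≠ i'.2.2 := fun h => hij (Prod.ext e1 (Prod.ext e2 h))
        have := dB e3
        rw [Set.disjoint_left]
        intro w hw hw'
        exact Set.disjoint_left.1 this hw.2.2 hw'.2.2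
      · have := dA e2
        rw [Set.disjoint_left]
        intro w hw hw'
        exact Set.disjoint_left.1 this hw.2.1 hw'.2.1
    · have := dT e1
      rw [Set.disjoint_left]
      intro w hw hw'
      exact Set.disjoint_left.1 this hw.1 hw'.1
  · have hz : ∀ᵐ z : ℝ × ℝ ∂(volume.prod volume), z.1 ≠ z.2 := by
      rw [ae_iff]
      have hms : MeasurableSet {z : ℝ × ℝ | ¬ z.1 ≠ z.2} := by
        simp only [ne_eq, not_not]; exact measurableSet_eq_fun measurable_fst measurable_snd
      rw [Measure.measure_prod_null hms]
      filter_upwards with s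
      have : Prod.mk s ⁻¹' {z : ℝ × ℝ | ¬ z.1 ≠ z.2} = {s} := by ext t; simp [eq_comm]
      rw [this]; simp
    have hz2 : ∀ᵐ w : (ℝ × ℝ) × (Eu d × Eu d) ∂((volume : Measure (ℝ × ℝ)).prod volume), w.1.1 ≠ w.1.2 :=
      Measure.quasiMeasurePreserving_fst.ae hz
    filter_upwards [hz2] with w hw hne
    obtain ⟨j, hj⟩ := cT w.1 hw
    have hne' : h4 a F G w ≠ 0 := fun h => hne (by simp [Set.indicator, h])
    unfold h4 at hne'
    obtain ⟨k, hk⟩ := cA (w.1.1, w.2.1) (fun h => hne' (by simp [h]))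
    obtain ⟨l, hl⟩ := cB (w.1.2, w.2.2) (fun h => hne' (by simp [h]))
    exact ⟨(j, k, l), hj, hk, hl⟩
end endp
end Strz


open MeasureTheory Real Complex
open scoped FourierTransform ENNReal SchwartzMap RealInnerProductSpace
set_option linter.all false
set_option linter.unusedVariables false
set_option linter.unusedSimpArgs false
set_option linter.deprecated false
namespace Strz
section band
variable {d : ℕ}

noncomputable def bw (ρ : ℝ) (z : ℝ × ℝ) : ℝ≥0∞ := {z : ℝ × ℝ | |z.2 - z.1| ≤ ρ}.indicator 1 z

lemma measurable_bw (ρ : ℝ) : Measurable (bw ρ) := by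
  unfold bw
  apply Measurable.indicator (by fun_prop)
  exact measurableSet_le (by fun_prop) (by fun_prop)

lemma bw_sq (ρ : ℝ) (z) : bw ρ (z.2, z.1) = bw ρ z := by
  unfold bw Set.indicator
  simp [abs_sub_comm]

lemma bw_int (ρ : ℝ) (s : ℝ) : ∫⁻ t, bw ρ (s, t) = ENNReal.ofReal (2 * ρ) := by
  have : (fun t => bw ρ (s, t)) = (Set.Icc (s - ρ) (s + ρ)).indicator 1 := by
    funext t
    unfold bw
    by_cases h : |t - s| ≤ ρ
    · rw [Set.indicator_of_mem (show (s, t) ∈ {z : ℝ × ℝ | |z.2 - z.1| ≤ ρ} from h), Set.indicator_of_mem]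
      · rfl
      · rw [abs_le] at h; constructor <;> linarith
    · rw [Set.indicator_of_notMem (show (s, t) ∉ {z : ℝ × ℝ | |z.2 - z.1| ≤ ρ} from h), Set.indicator_of_notMem]
      intro h'; apply h; rw [abs_le]; constructor <;> linarith [h'.1, h'.2]
  rw [this, lintegral_indicator measurableSet_Icc]
  simp only [Pi.one_apply, lintegral_const, one_mul, MeasurableSet.univ, Measure.restrict_apply, Set.univ_inter, Real.volume_Icc]
  congr 1; ring

lemma bw_int' (ρ : ℝ) (t : ℝ) : ∫⁻ s, bw ρ (s, t) = ENNReal.ofReal (2 * ρ) := by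
  rw [← bw_int ρ t]; congr 1; funext s; exact (bw_sq ρ (t, s))

lemma band_cs (ρ : ℝ) {f g : ℝ → ℝ≥0∞} (hf : Measurable f) (hg : Measurable g) :
    ∫⁻ s, ∫⁻ t, bw ρ (s, t) * f s * g t ≤ ENNReal.ofReal (2 * ρ) * (∫⁻ s, f s ^ (2:ℝ)) ^ (1/2:ℝ) * (∫⁻ s, g s ^ (2:ℝ)) ^ (1/2:ℝ) := by
  have mb := measurable_bw ρ
  have h := cs_weight (μ := (volume : Measure ℝ).prod volume) (w := bw ρ) (u := fun z => f z.1) (v := fun z => g z.2) mb (by fun_prop) (by fun_prop)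
  rw [lintegral_prod _ (by fun_prop), lintegral_prod _ (by fun_prop), lintegral_prod_symm _ (by fun_prop)] at h
  refine h.trans (le_of_eq ?_)
  have e1 : ∫⁻ s, ∫⁻ t, bw ρ (s, t) * f s ^ (2:ℝ) = ENNReal.ofReal (2 * ρ) * ∫⁻ s, f s ^ (2:ℝ) := by
    rw [← lintegral_const_mul _ (by fun_prop)]
    congr 1; funext s
    rw [lintegral_mul_const _ (by fun_prop), bw_int]
  have e2 : ∫⁻ t, ∫⁻ s, bw ρ (s, t) * g t ^ (2:ℝ) = ENNReal.ofReal (2 * ρ) * ∫⁻ s, g s ^ (2:ℝ) := by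
    rw [← lintegral_const_mul _ (by fun_prop)]
    congr 1; funext s
    rw [lintegral_mul_const _ (by fun_prop), bw_int']
  have e3 : ∀ x : ℝ≥0∞, x ^ (1/2:ℝ) * x ^ (1/2:ℝ) = x := fun x => by
    rw [← ENNReal.rpow_add_of_nonneg _ _ (by norm_num) (by norm_num)]; norm_num
  dsimp only
  rw [e1, e2, ENNReal.mul_rpow_of_nonneg _ _ (by norm_num : (0:ℝ) ≤ 1/2), ENNReal.mul_rpow_of_nonneg _ _ (by norm_num : (0:ℝ) ≤ 1/2)]
  conv_rhs => rw [← e3 (ENNReal.ofReal (2 * ρ))]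
  ring

/-- dyadic time bands -/
def Tj (j : ℤ) : Set (ℝ × ℝ) := {z | tw j ≤ ENNReal.ofReal |z.2 - z.1| ∧ ENNReal.ofReal |z.2 - z.1| < tw (j + 1)}

lemma measurableSet_Tj (j : ℤ) : MeasurableSet (Tj j) :=
  (measurableSet_le (f := fun _ => tw j) (g := fun z : ℝ × ℝ => ENNReal.ofReal |z.2 - z.1|) (by fun_prop) (by fun_prop)).inter
    (measurableSet_lt (f := fun z : ℝ × ℝ => ENNReal.ofReal |z.2 - z.1|) (g := fun _ => tw (j+1)) (by fun_prop) (by fun_prop))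

lemma Tj_disj : Pairwise (Function.onFun Disjoint Tj) := by
  have key : ∀ i j : ℤ, i < j → Disjoint (Tj i) (Tj j) := by
    intro i j h
    rw [Set.disjoint_left]
    intro z h1 h2
    have : tw (i + 1) ≤ tw j := tw_mono (by exact_mod_cast h)
    exact absurd (h1.2.trans_le (this.trans h2.1)) (lt_irrefl _)
  intro i j hij
  rcases lt_or_gt_of_ne hij with h | h
  · exact key i j h
  · exact (key j i h).symm

lemma Tj_cover (z : ℝ × ℝ) (hz : z.1 ≠ z.2) : ∃ j, z ∈ Tj j := by
  obtain ⟨y, hy⟩ := exists_tw (x := ENNReal.ofReal |z.2 - z.1|) (by simpa using sub_ne_zero.2 hz.symm) (by simp)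
  refine ⟨⌊y⌋, ?_, ?_⟩
  · rw [hy]; exact tw_mono (Int.floor_le y)
  · rw [hy]; exact tw_lt (Int.lt_floor_add_one y)

lemma Tj_swap (j : ℤ) : Prod.swap ⁻¹' (Tj j) = Tj j := by
  ext z; unfold Tj; simp [abs_sub_comm]

lemma Tj_bw {j : ℤ} {s t : ℝ} (h : (s, t) ∈ Tj j) : bw (tw (j+1)).toReal (s, t) = 1 := by
  unfold bw
  rw [Set.indicator_of_mem]; · rfl
  have := h.2.le
  rw [ENNReal.ofReal_le_iff_le_toReal (tw_ne_top _)] at this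
  exact this

lemma two_tw (j : ℤ) : ENNReal.ofReal (2 * (tw (j+1)).toReal) = tw (j + 2) := by
  rw [ENNReal.ofReal_mul (by norm_num), ENNReal.ofReal_toReal (tw_ne_top _), show (j:ℝ) + 2 = 1 + (j + 1) by ring, tw_add 1, tw_one]
  simp

lemma bound_i {a : Eu d → ℝ} (ha : Amp a) : ∃ C : ℝ≥0∞, C ≠ ∞ ∧ ∀ (j : ℤ) (S : Set (ℝ × ℝ)) (F G : ℝ × Eu d → ℂ), MeasurableSet S → Nice F → Nice G →
    ‖Bf a (S ∩ Tj j) F G‖ₑ ≤ C * tw (j * (1 - (d:ℝ)/2)) * mN 2 1 F * mN 2 1 G := by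
  obtain ⟨C, hC, h⟩ := fm_disp ha
  refine ⟨C * 4, by finiteness, fun j S F G hS hF hG => (Bf_le_iter ha (hS.inter (measurableSet_Tj j)) hF hG).trans ?_⟩
  have m1 := measurable_nrm 1 hF.meas
  have m2 := measurable_nrm 1 hG.meas
  have mb := measurable_bw (tw (j+1)).toReal
  calc _ ≤ ∫⁻ s, ∫⁻ t, C * tw (j * (-((d:ℝ)/2))) * (bw (tw (j+1)).toReal (s, t) * nrm 1 (fun y => F (s, y)) * nrm 1 (fun y => G (t, y))) := by
        refine lintegral_mono fun s => lintegral_mono fun t => ?_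
        by_cases hz : (s, t) ∈ S ∩ Tj j
        · rw [Set.indicator_of_mem hz]
          rw [Tj_bw hz.2, one_mul]
          have hts : t - s ≠ 0 := by
            intro h0
            have := hz.2.1
            simp [h0, tw_ne_zero] at this
          have := h (t - s) _ _ (hF.slice s) (hG.slice t) hts
          refine this.trans ?_
          rw [← mul_assoc]
          gcongr
          rw [← tw_rpow]
          rw [ENNReal.rpow_neg, ENNReal.rpow_neg, ENNReal.inv_le_inv]
          exact ENNReal.rpow_le_rpow hz.2.1 (by positivity)
        · rw [Set.indicator_of_notMem hz]; exact zero_le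
    _ = C * tw (j * (-((d:ℝ)/2))) * ∫⁻ s, ∫⁻ t, (bw (tw (j+1)).toReal (s, t) * nrm 1 (fun y => F (s, y)) * nrm 1 (fun y => G (t, y))) := by
        have hc : C * tw (j * (-((d:ℝ)/2))) ≠ ∞ := ENNReal.mul_ne_top hC (tw_ne_top _)
        rw [← lintegral_const_mul' _ _ hc]
        congr 1; funext s
        rw [lintegral_const_mul' _ _ hc]
    _ ≤ C * tw (j * (-((d:ℝ)/2))) * (tw (j + 2) * mN 2 1 F * mN 2 1 G) := by
        gcongr
        rw [← two_tw]
        exact band_cs _ m1 m2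
    _ = _ := by
        have : tw 2 = 4 := by unfold tw; norm_num
        rw [show (j:ℝ) * (1 - (d:ℝ)/2) = j * (-(d/2)) + j by ring, tw_add, tw_add, this]; ring

lemma hold43 {w n : ℝ → ℝ≥0∞} (hw : Measurable w) (hn : Measurable n) :
    (∫⁻ s, w s * n s ^ (4/3:ℝ)) ^ (3/4:ℝ) ≤ (∫⁻ s, w s * n s ^ (2:ℝ)) ^ (1/2:ℝ) * (∫⁻ s, w s) ^ (1/4:ℝ) := by
  have h := ENNReal.lintegral_mul_le_Lp_mul_Lq (μ := volume) (p := 3/2) (q := 3) (by constructor <;> norm_num) (f := fun s => w s ^ (2/3:ℝ) * n s ^ (4/3:ℝ)) (g := fun s => w s ^ (1/3:ℝ)) (by fun_prop) (by fun_prop)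
  have e1 : ∀ s, ((fun s => w s ^ (2/3:ℝ) * n s ^ (4/3:ℝ)) * (fun s => w s ^ (1/3:ℝ))) s = w s * n s ^ (4/3:ℝ) := by
    intro s
    simp only [Pi.mul_apply]
    rw [mul_right_comm, ← ENNReal.rpow_add_of_nonneg _ _ (by norm_num) (by norm_num)]; norm_num
  have e2 : ∀ s, (w s ^ (2/3:ℝ) * n s ^ (4/3:ℝ)) ^ (3/2:ℝ) = w s * n s ^ (2:ℝ) := by
    intro s
    rw [ENNReal.mul_rpow_of_nonneg _ _ (by norm_num), ← ENNReal.rpow_mul, ← ENNReal.rpow_mul]; norm_num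
  have e3 : ∀ s, (w s ^ (1/3:ℝ)) ^ (3:ℝ) = w s := by
    intro s; rw [← ENNReal.rpow_mul]; norm_num
  simp_rw [e1, e2, e3] at h
  calc _ ≤ _ := ENNReal.rpow_le_rpow h (by norm_num)
    _ = _ := by
      rw [ENNReal.mul_rpow_of_nonneg _ _ (by norm_num), ← ENNReal.rpow_mul, ← ENNReal.rpow_mul]; norm_num

lemma band_half (ρ : ℝ) {n g : ℝ → ℝ≥0∞} (hn : Measurable n) (hg : Measurable g) :
    ∫⁻ t, (∫⁻ s, bw ρ (s, t) * n s ^ (2:ℝ)) ^ (1/2:ℝ) * g t ≤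
      ENNReal.ofReal (2 * ρ) ^ (1/2:ℝ) * (∫⁻ s, n s ^ (2:ℝ)) ^ (1/2:ℝ) * (∫⁻ s, g s ^ (2:ℝ)) ^ (1/2:ℝ) := by
  have mb := measurable_bw ρ
  have mI : Measurable fun t => (∫⁻ s, bw ρ (s, t) * n s ^ (2:ℝ)) := by
    exact Measurable.lintegral_prod_left' (f := fun z : ℝ × ℝ => bw ρ z * n z.1 ^ (2:ℝ)) (by fun_prop)
  have := ENNReal.lintegral_mul_le_Lp_mul_Lq (μ := volume) (p := 2) (q := 2) (by constructor <;> norm_num) (f := fun t => (∫⁻ s, bw ρ (s, t) * n s ^ (2:ℝ)) ^ (1/2:ℝ)) (g := g) (by fun_prop) (by fun_prop)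
  refine this.trans (le_of_eq ?_)
  have e : ∀ x : ℝ≥0∞, (x ^ (1/2:ℝ)) ^ (2:ℝ) = x := fun x => by rw [← ENNReal.rpow_mul]; norm_num
  simp_rw [e]
  congr 1
  rw [lintegral_lintegral_swap (by fun_prop)]
  have : ∀ s, ∫⁻ t, bw ρ (s, t) * n s ^ (2:ℝ) = ENNReal.ofReal (2 * ρ) * n s ^ (2:ℝ) := by
    intro s
    rw [lintegral_mul_const _ (by fun_prop), bw_int]
  simp_rw [this]
  rw [lintegral_const_mul _ (by fun_prop), ENNReal.mul_rpow_of_nonneg _ _ (by norm_num)]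

lemma bound_iii {a : Eu d → ℝ} (ha : Amp a) (hpos : ∀ ξ, 0 ≤ a ξ) {r : ℝ} (hr : 0 < r) (hL : LocB a (4/3) r (4/3) r) : ∃ C : ℝ≥0∞, C ≠ ∞ ∧ ∀ (j : ℤ) (S : Set (ℝ × ℝ)) (F G : ℝ × Eu d → ℂ), MeasurableSet S → Nice F → Nice G →
    ‖Bf a (S ∩ Tj j) F G‖ₑ ≤ C * tw (j * (3/4)) * mN 2 r F * mN 2 2 G := by
  obtain ⟨C, hC, h1⟩ := QW_le ha hpos hL
  obtain ⟨D, hD, h2⟩ := Qf_half ha hpos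
  refine ⟨C * D * tw (3/2), by have := tw_ne_top (3/2); finiteness, fun j S F G hS hF hG => (Bf_slice ha (hS.inter (measurableSet_Tj j)) hF hG).trans ?_⟩
  have m1 := measurable_nrm r hF.meas
  have m2 := measurable_nrm 2 hG.meas
  set ρ := (tw (j+1)).toReal with hρ
  have mb := measurable_bw ρ
  have mbt : ∀ t, Measurable fun s => bw ρ (s, t) := fun t => mb.comp (by fun_prop)
  have key : ∀ t, mN (4/3) r (cut (S ∩ Tj j) t F) ≤ (∫⁻ s, bw ρ (s, t) * nrm r (fun y => F (s, y)) ^ (2:ℝ)) ^ (1/2:ℝ) * tw (j+2) ^ (1/4:ℝ) := by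
    intro t
    have := hold43 (mbt t) m1
    rw [bw_int', two_tw] at this
    refine le_trans ?_ this
    unfold mN
    rw [show (1/(4/3:ℝ)) = 3/4 by norm_num]
    refine ENNReal.rpow_le_rpow (lintegral_mono fun s => ?_) (by norm_num)
    by_cases hz : (s, t) ∈ S ∩ Tj j
    · dsimp only
      rw [Tj_bw hz.2, one_mul]
      refine ENNReal.rpow_le_rpow (nrm_mono hr fun y => ?_) (by norm_num)
      exact enorm_indicator_le_enorm_self _ _
    · have : (fun y => cut (S ∩ Tj j) t F (s, y)) = fun y => 0 := by
        funext y; exact Set.indicator_of_notMem (show (s, y) ∉ {z : ℝ × Eu d | (z.1, t) ∈ S ∩ Tj j} from hz) _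
      dsimp only
      rw [this]
      have : nrm r (fun y : Eu d => (0:ℂ)) = 0 := by
        unfold nrm; simp [hr]
      rw [this]; simp
  have hc : C * D * tw (j+2) ^ (1/4:ℝ) ≠ ∞ := by have := tw_ne_top (j+2); finiteness
  calc _ ≤ ∫⁻ t, (C * D * tw (j+2) ^ (1/4:ℝ)) * ((∫⁻ s, bw ρ (s, t) * nrm r (fun y => F (s, y)) ^ (2:ℝ)) ^ (1/2:ℝ) * nrm 2 (fun y => G (t, y))) := by
        refine lintegral_mono fun t => ?_
        calc _ ≤ (C * ((∫⁻ s, bw ρ (s, t) * nrm r (fun y => F (s, y)) ^ (2:ℝ)) ^ (1/2:ℝ) * tw (j+2) ^ (1/4:ℝ))) * (D * nrm 2 (fun y => G (t, y))) := by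
              gcongr
              · refine (h1 _ (hF.cut (hS.inter (measurableSet_Tj j)) t)).trans ?_
                gcongr
                exact key t
              · exact h2 _ (hG.slice t)
          _ = _ := by ring
    _ = (C * D * tw (j+2) ^ (1/4:ℝ)) * ∫⁻ t, ((∫⁻ s, bw ρ (s, t) * nrm r (fun y => F (s, y)) ^ (2:ℝ)) ^ (1/2:ℝ) * nrm 2 (fun y => G (t, y))) :=
        lintegral_const_mul' _ _ hc
    _ ≤ (C * D * tw (j+2) ^ (1/4:ℝ)) * ((tw (j+2)) ^ (1/2:ℝ) * mN 2 r F * mN 2 2 G) := by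
        have := band_half ρ m1 m2
        rw [two_tw] at this
        exact mul_le_mul_right this _
    _ = _ := by
        rw [tw_rpow, tw_rpow]
        have : tw ((j+2)*(1/4)) * tw ((j+2) * (1/2)) = tw (3/2) * tw (j * (3/4)) := by
          rw [← tw_add, ← tw_add]; congr 1; ring
        calc _ = C * D * (tw ((j+2)*(1/4)) * tw ((j+2) * (1/2))) * mN 2 r F * mN 2 2 G := by ring
          _ = _ := by rw [this]; ring
end band
end Strz


open MeasureTheory Real Complex
open scoped FourierTransform ENNReal SchwartzMap RealInnerProductSpace
set_option linter.all false
set_option linter.unusedVariables false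
set_option linter.unusedSimpArgs false
set_option linter.deprecated false
namespace Strz
section endp2
variable {d : ℕ}

lemma sum3 {ε c : ℝ} (hε : 0 < ε) (hc : 0 < c) : ∃ C : ℝ≥0∞, C ≠ ∞ ∧ ∀ a b : ℤ → ℝ≥0∞,
    ∑' j : ℤ, ∑' k : ℤ, ∑' l : ℤ, tw (-ε * (|(k:ℝ) - c * j| + |(l:ℝ) - c * j|)) * a k * b l ≤
      C * (∑' k, a k ^ (2:ℝ)) ^ (1/2:ℝ) * (∑' k, b k ^ (2:ℝ)) ^ (1/2:ℝ) := by
  obtain ⟨C1, hC1, h1⟩ := tw_geom (ε/2 * c) (by positivity)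
  obtain ⟨C2, hC2, h2⟩ := tw_geom (ε/2) (by positivity)
  refine ⟨C1 * C2, by finiteness, fun a b => ?_⟩
  have key : ∀ k l : ℤ, ∑' j : ℤ, tw (-ε * (|(k:ℝ) - c * j| + |(l:ℝ) - c * j|)) ≤ C1 * tw (-(ε/2) * |(k:ℝ) - l|) := by
    intro k l
    calc _ ≤ ∑' j : ℤ, tw (-(ε/2) * |(k:ℝ) - l|) * tw (-(ε/2 * c) * |(j:ℝ) - k / c|) := by
          refine ENNReal.tsum_le_tsum fun j => ?_
          rw [← tw_add]
          apply tw_mono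
          have e1 : c * |(j:ℝ) - k / c| = |(k:ℝ) - c * j| := by
            rw [← abs_of_pos hc, ← abs_mul, abs_of_pos hc, mul_sub, mul_div_cancel₀ _ hc.ne', abs_sub_comm]
          have e2 : |(k:ℝ) - l| ≤ |(k:ℝ) - c * j| + |(l:ℝ) - c * j| := by
            have := abs_sub_le (k:ℝ) (c * j) l
            rwa [abs_sub_comm (c * (j:ℝ)) l] at this
          have e3 := abs_nonneg ((l:ℝ) - c * j)
          rw [show -(ε/2 * c) * |(j:ℝ) - k / c| = -(ε/2) * (c * |(j:ℝ) - k / c|) by ring, e1]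
          nlinarith
      _ = tw (-(ε/2) * |(k:ℝ) - l|) * ∑' j : ℤ, tw (-(ε/2 * c) * |(j:ℝ) - k / c|) := ENNReal.tsum_mul_left
      _ ≤ tw (-(ε/2) * |(k:ℝ) - l|) * C1 := by gcongr; exact h1 _
      _ = _ := mul_comm _ _
  calc _ = ∑' k : ℤ, ∑' l : ℤ, (∑' j : ℤ, tw (-ε * (|(k:ℝ) - c * j| + |(l:ℝ) - c * j|))) * a k * b l := by
        rw [ENNReal.tsum_comm]; congr 1; funext k
        rw [ENNReal.tsum_comm]; congr 1; funext l
        rw [ENNReal.tsum_mul_right, ENNReal.tsum_mul_right]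
    _ ≤ ∑' k : ℤ, ∑' l : ℤ, (C1 * tw (-(ε/2) * |(k:ℝ) - l|)) * a k * b l := by
        refine ENNReal.tsum_le_tsum fun k => ENNReal.tsum_le_tsum fun l => ?_
        gcongr; exact key k l
    _ ≤ _ := by
        refine schur_tsum (fun k l : ℤ => C1 * tw (-(ε/2) * |(k:ℝ) - l|)) _ _ (C1 * C2) ?_ ?_
        · intro k
          rw [ENNReal.tsum_mul_left]
          gcongr
          refine le_trans (le_of_eq ?_) (h2 k)
          congr 1; funext l; rw [abs_sub_comm]
        · intro l
          rw [ENNReal.tsum_mul_left]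
          gcongr
          exact h2 l

lemma min_arith {D K L : ℝ} (hD : 1 ≤ D) :
    D * (K + L) ≤ -(1/8) * (|K| + |L|) ∨ -(K + 2 * L) ≤ -(1/8) * (|K| + |L|) ∨ -(2 * K + L) ≤ -(1/8) * (|K| + |L|) := by
  by_contra hc
  push Not at hc
  obtain ⟨h1, h2, h3⟩ := hc
  rcases le_total 0 (K + L) with h | h
  · rcases abs_cases K with ⟨e, _⟩ | ⟨e, _⟩ <;> rcases abs_cases L with ⟨e', _⟩ | ⟨e', _⟩ <;> rw [e, e'] at h2 h3 <;> linarith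
  · have : D * (K + L) ≤ K + L := by nlinarith
    rcases abs_cases K with ⟨e, _⟩ | ⟨e, _⟩ <;> rcases abs_cases L with ⟨e', _⟩ | ⟨e', _⟩ <;> rw [e, e'] at h1 h2 h3 <;> linarith

def sset (β : ℝ) (F : ℝ × Eu d → ℂ) (k : ℤ) : Set (ℝ × Eu d) := {z | z.2 ∈ gset β (fun y => F (z.1, y)) k}

lemma measurable_gfun2 (β : ℝ) {F : ℝ × Eu d → ℂ} (hF : Measurable F) : Measurable fun z : ℝ × Eu d => gfun β (fun y => F (z.1, y)) z.2 := by
  unfold gfun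
  have := measurable_nrm β hF
  have h2 : Measurable fun z : ℝ × Eu d => nrm β (fun y => F (z.1, y)) := this.comp measurable_fst
  fun_prop

lemma measurableSet_sset (β : ℝ) {F : ℝ × Eu d → ℂ} (hF : Measurable F) (k : ℤ) : MeasurableSet (sset β F k) := by
  have h := measurable_gfun2 β hF
  exact (measurableSet_lt (f := fun _ => tw (-((k:ℝ) + 1))) measurable_const h).inter (measurableSet_le (g := fun _ => tw (-(k:ℝ))) h measurable_const)

lemma sset_slice (β : ℝ) (F : ℝ × Eu d → ℂ) (k : ℤ) (s : ℝ) : (fun y => (sset β F k).indicator F (s, y)) = atom β (fun y => F (s, y)) k := by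
  funext y
  unfold atom
  by_cases h : y ∈ gset β (fun y => F (s, y)) k
  · rw [Set.indicator_of_mem h, Set.indicator_of_mem (show (s, y) ∈ sset β F k from h)]
  · rw [Set.indicator_of_notMem h, Set.indicator_of_notMem (show (s, y) ∉ sset β F k from h)]

noncomputable def ck (β : ℝ) (F : ℝ × Eu d → ℂ) (k : ℤ) : ℝ≥0∞ := (∫⁻ s, cof β (fun y => F (s, y)) k ^ (2:ℝ)) ^ (1/2:ℝ)

lemma mN_sset {β r : ℝ} (hβ : 1 ≤ β) (hr : 1 ≤ r) (hr2 : r ≤ 2) {F : ℝ × Eu d → ℂ} (hF : Nice F) (k : ℤ) :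
    mN 2 r ((sset β F k).indicator F) ≤ 2 * tw (k * (1 / r - 1 / β)) * ck β F k := by
  unfold mN ck
  have hc : (2 * tw (k * (1 / r - 1 / β))) ^ (2:ℝ) ≠ ∞ := by have := tw_ne_top (k * (1 / r - 1 / β)); finiteness
  calc _ ≤ (∫⁻ s, (2 * tw (k * (1 / r - 1 / β))) ^ (2:ℝ) * cof β (fun y => F (s, y)) k ^ (2:ℝ)) ^ (1/2:ℝ) := by
        refine ENNReal.rpow_le_rpow (lintegral_mono fun s => ?_) (by norm_num)
        dsimp only
        rw [sset_slice, ← ENNReal.mul_rpow_of_nonneg _ _ (by norm_num)]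
        exact ENNReal.rpow_le_rpow (atom_nrm hβ hr hr2 (hF.slice s).meas k) (by norm_num)
    _ = _ := by
        rw [lintegral_const_mul' _ _ hc, ENNReal.mul_rpow_of_nonneg _ _ (by norm_num), ← ENNReal.rpow_mul]
        norm_num

lemma measurable_cof2 (β : ℝ) {F : ℝ × Eu d → ℂ} (hF : Measurable F) (k : ℤ) : Measurable fun s => cof β (fun y => F (s, y)) k := by
  unfold cof
  have h1 := measurable_nrm β hF
  have h2 : Measurable fun s => ∫⁻ y, (sset β F k).indicator (fun z => gfun β (fun y => F (z.1, y)) z.2) (s, y) :=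
    Measurable.lintegral_prod_right' ((measurable_gfun2 β hF).indicator (measurableSet_sset β hF k))
  have e : (fun s => ∫⁻ y in gset β (fun y => F (s, y)) k, gfun β (fun y => F (s, y)) y) = fun s => ∫⁻ y, (sset β F k).indicator (fun z => gfun β (fun y => F (z.1, y)) z.2) (s, y) := by
    funext s
    rw [← lintegral_indicator (measurableSet_gset (f := fun y => F (s, y)) (hF.comp (by fun_prop)) k)]
    rfl
  rw [← e] at h2
  exact h1.mul (h2.pow_const _)

lemma ck_sum {β : ℝ} (hβ : 0 < β) {F : ℝ × Eu d → ℂ} (hF : Nice F) :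
    (∑' k, ck β F k ^ (2:ℝ)) ^ (1/2:ℝ) ≤ mN 2 β F := by
  unfold ck mN
  refine ENNReal.rpow_le_rpow ?_ (by norm_num)
  have e : ∀ x : ℝ≥0∞, (x ^ (1/2:ℝ)) ^ (2:ℝ) = x := fun x => by rw [← ENNReal.rpow_mul]; norm_num
  simp_rw [e]
  rw [← lintegral_tsum fun k => ((measurable_cof2 β hF.meas k).pow_const _).aemeasurable]
  exact lintegral_mono fun s => cof_sum hβ (hF.slice s).meas

/-- remove slices that vanish -/
noncomputable def nz (β : ℝ) (F : ℝ × Eu d → ℂ) : ℝ × Eu d → ℂ := {z : ℝ × Eu d | nrm β (fun y => F (z.1, y)) ≠ 0}.indicator F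

lemma nz_meas (β : ℝ) {F : ℝ × Eu d → ℂ} (hF : Measurable F) : MeasurableSet {z : ℝ × Eu d | nrm β (fun y => F (z.1, y)) ≠ 0} := by
  have h2 : Measurable fun z : ℝ × Eu d => nrm β (fun y => F (z.1, y)) := (measurable_nrm β hF).comp measurable_fst
  exact (measurableSet_eq_fun h2 measurable_const).compl

lemma nz_slice (β : ℝ) (F : ℝ × Eu d → ℂ) (s : ℝ) (h : nrm β (fun y => F (s, y)) ≠ 0) : (fun y => nz β F (s, y)) = fun y => F (s, y) := by
  funext y; exact Set.indicator_of_mem (show (s, y) ∈ {z : ℝ × Eu d | nrm β (fun y => F (z.1, y)) ≠ 0} from h) _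

lemma nz_slice0 (β : ℝ) (F : ℝ × Eu d → ℂ) (s : ℝ) (h : nrm β (fun y => F (s, y)) = 0) : (fun y => nz β F (s, y)) = fun y => 0 := by
  funext y; exact Set.indicator_of_notMem (show (s, y) ∉ {z : ℝ × Eu d | nrm β (fun y => F (z.1, y)) ≠ 0} from fun h' => h' h) _

lemma nz_ne {β : ℝ} {F : ℝ × Eu d → ℂ} {z : ℝ × Eu d} (hz : nz β F z ≠ 0) : nrm β (fun y => nz β F (z.1, y)) ≠ 0 := by
  by_cases h : nrm β (fun y => F (z.1, y)) = 0
  · exact absurd (congrFun (nz_slice0 β F z.1 h) z.2) hz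
  · rwa [nz_slice β F z.1 h]

lemma Bf_nz {β : ℝ} (hβ : 0 < β) (a : Eu d → ℝ) (S : Set (ℝ × ℝ)) {F G : ℝ × Eu d → ℂ} (hF : Nice F) (hG : Nice G) : Bf a S (nz β F) (nz β G) = Bf a S F G := by
  unfold Bf
  congr 1; funext z
  by_cases h : nrm β (fun y => F (z.1, y)) = 0
  · rw [nz_slice0 _ _ _ h, fm_zero_left (by rfl), fm_zero_left (nrm_zero_ae hβ (hF.slice _).meas h)]
  rw [nz_slice _ _ _ h]
  by_cases h' : nrm β (fun y => G (z.2, y)) = 0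
  · rw [nz_slice0 _ _ _ h', fm_zero_right (by rfl), fm_zero_right (nrm_zero_ae hβ (hG.slice _).meas h')]
  rw [nz_slice _ _ _ h']

lemma endpoint {a : Eu d → ℝ} (ha : Amp a) (hpos : ∀ ξ, 0 ≤ a ξ) (hd : 3 ≤ d) {β : ℝ} (hβ0 : 0 < β) (hβ : 1/β = 1/2 + 1/(d:ℝ)) :
    LocB a 2 β 2 β := by
  have hd' : (3:ℝ) ≤ d := by exact_mod_cast hd
  have hd0 : (0:ℝ) < d := by linarith
  have hinv : 1/(d:ℝ) ≤ 1/3 := one_div_le_one_div_of_le (by norm_num) hd'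
  have hβ1 : 1 ≤ β := by
    have : 1/β ≤ 1 := by rw [hβ]; linarith
    rwa [div_le_one hβ0] at this
  set r : ℝ := 1 / (1/2 + 1/(2*(d:ℝ))) with hr
  have hi2 : (0:ℝ) < 1/(2*(d:ℝ)) := by positivity
  have hi2' : 1/(2*(d:ℝ)) = (1/2) * (1/(d:ℝ)) := by field_simp
  have hrinv : 1/r = 1/2 + 1/(2*(d:ℝ)) := by rw [hr, one_div_one_div]
  have hr1 : 1 < r := by rw [hr, lt_div_iff₀ (by positivity)]; linarith
  have hr2 : r ≤ 2 := by rw [hr, div_le_iff₀ (by positivity)]; linarith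
  have hL : LocB a (4/3) r (4/3) r := diag_nonend ha hpos (by omega) (by norm_num) (by norm_num) hr1 (by rw [hrinv]; field_simp; ring)
  obtain ⟨C1, hC1, b1⟩ := bound_i ha
  obtain ⟨C3, hC3, b3⟩ := bound_iii ha hpos (by linarith) hL
  obtain ⟨C4, hC4, hsum⟩ := sum3 (ε := 1/(16 * (d:ℝ))) (c := (d:ℝ)/2) (by positivity) (by positivity)
  refine ⟨4 * (C1 + C3) * C4, by finiteness, fun S hS F0 G0 hF0 hG0 => ?_⟩
  rw [← Bf_nz hβ0 a S hF0 hG0]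
  have hF : Nice (nz β F0) := hF0.indicator (nz_meas β hF0.meas)
  have hG : Nice (nz β G0) := hG0.indicator (nz_meas β hG0.meas)
  have hnF : ∀ z, nz β F0 z ≠ 0 → ∃ k, z ∈ sset β (nz β F0) k := by
    intro z hz
    exact exists_gset hβ0 (nz_ne hz) ((hF.slice z.1).nrm_ne_top hβ1) hz
  have hnG : ∀ z, nz β G0 z ≠ 0 → ∃ k, z ∈ sset β (nz β G0) k := by
    intro z hz
    exact exists_gset hβ0 (nz_ne hz) ((hG.slice z.1).nrm_ne_top hβ1) hz
  have lF : mN 2 β (nz β F0) ≤ mN 2 β F0 := mN_mono (by norm_num) hβ0 fun z => enorm_indicator_le_enorm_self _ _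
  have lG : mN 2 β (nz β G0) ≤ mN 2 β G0 := mN_mono (by norm_num) hβ0 fun z => enorm_indicator_le_enorm_self _ _
  generalize nz β F0 = F at *
  generalize nz β G0 = G at *
  have dA : ∀ F : ℝ × Eu d → ℂ, Pairwise (Function.onFun Disjoint (sset β F)) := by
    intro F i j hij
    show Disjoint _ _
    rw [Set.disjoint_left]
    intro z h1 h2
    exact Set.disjoint_left.1 (gset_disj β (fun y => F (z.1, y)) hij) h1 h2
  have hdec := Bf_decomp ha hS hF hG measurableSet_Tj (measurableSet_sset β hF.meas) (measurableSet_sset β hG.meas) Tj_disj (dA F) (dA G)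
    Tj_cover hnF hnG
  refine hdec.trans ?_
  have key : ∀ j k l : ℤ, ‖Bf a (S ∩ Tj j) ((sset β F k).indicator F) ((sset β G l).indicator G)‖ₑ ≤
      4 * (C1 + C3) * (tw (-(1/(16 * (d:ℝ))) * (|(k:ℝ) - (d:ℝ)/2 * j| + |(l:ℝ) - (d:ℝ)/2 * j|)) * ck β F k * ck β G l) := by
    intro j k l
    have nF := hF.indicator (measurableSet_sset β hF.meas k)
    have nG := hG.indicator (measurableSet_sset β hG.meas l)
    set K := (k:ℝ) - (d:ℝ)/2 * j with hK
    set L := (l:ℝ) - (d:ℝ)/2 * j with hL'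
    have fin : ∀ (C : ℝ≥0∞) (x r1 r2 : ℝ), C ≤ C1 + C3 → 1 ≤ r1 → r1 ≤ 2 → 1 ≤ r2 → r2 ≤ 2 →
        x + k * (1/r1 - 1/β) + l * (1/r2 - 1/β) ≤ -(1/(16 * (d:ℝ))) * (|K| + |L|) →
        C * tw x * mN 2 r1 ((sset β F k).indicator F) * mN 2 r2 ((sset β G l).indicator G) ≤
        4 * (C1 + C3) * (tw (-(1/(16 * (d:ℝ))) * (|K| + |L|)) * ck β F k * ck β G l) := by
      intro C x r1 r2 hC h1 h2 h3 h4 hx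
      calc _ ≤ (C1 + C3) * tw x * (2 * tw (k * (1 / r1 - 1 / β)) * ck β F k) * (2 * tw (l * (1 / r2 - 1 / β)) * ck β G l) := by
            gcongr
            · exact mN_sset hβ1 h1 h2 hF k
            · exact mN_sset hβ1 h3 h4 hG l
        _ = 4 * (C1 + C3) * (tw (x + k * (1/r1 - 1/β) + l * (1/r2 - 1/β)) * ck β F k * ck β G l) := by
            rw [tw_add, tw_add]; ring
        _ ≤ _ := by gcongr; exact tw_mono hx
    have e16 : -(1/(16 * (d:ℝ))) * (|K| + |L|) = (1/(2*(d:ℝ))) * (-(1/8) * (|K| + |L|)) := by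
      generalize |K| + |L| = x; field_simp; ring
    have hkK : (k:ℝ) = K + (d:ℝ)/2 * j := by rw [hK]; ring
    have hlL : (l:ℝ) = L + (d:ℝ)/2 * j := by rw [hL']; ring
    rcases min_arith (D := (d:ℝ) - 2) (K := K) (L := L) (by linarith) with h | h | h
    · refine (b1 j S _ _ hS nF nG).trans (fin C1 _ 1 1 le_self_add le_rfl (by norm_num) le_rfl (by norm_num) ?_)
      rw [e16]
      refine le_trans (le_of_eq ?_) (mul_le_mul_of_nonneg_left h hi2.le)
      rw [hβ, hkK, hlL]; field_simp; ring
    · refine (b3 j S _ _ hS nF nG).trans (fin C3 _ r 2 le_add_self hr1.le hr2 (by norm_num) le_rfl ?_)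
      rw [e16]
      refine le_trans (le_of_eq ?_) (mul_le_mul_of_nonneg_left h hi2.le)
      rw [hβ, hrinv, hkK, hlL]; field_simp; ring
    · rw [Bf_swap a (hS.inter (measurableSet_Tj j)), enorm_conj', Set.preimage_inter, Tj_swap]
      refine (b3 j _ _ _ (measurable_swap hS) nG nF).trans ?_
      rw [mul_right_comm]
      refine fin C3 _ 2 r le_add_self (by norm_num) le_rfl hr1.le hr2 ?_
      rw [e16]
      refine le_trans (le_of_eq ?_) (mul_le_mul_of_nonneg_left h hi2.le)
      rw [hβ, hrinv, hkK, hlL]; field_simp; ring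
  calc _ ≤ ∑' j : ℤ, ∑' k : ℤ, ∑' l : ℤ, 4 * (C1 + C3) * (tw (-(1/(16 * (d:ℝ))) * (|(k:ℝ) - (d:ℝ)/2 * j| + |(l:ℝ) - (d:ℝ)/2 * j|)) * ck β F k * ck β G l) :=
        ENNReal.tsum_le_tsum fun j => ENNReal.tsum_le_tsum fun k => ENNReal.tsum_le_tsum fun l => key j k l
    _ = 4 * (C1 + C3) * ∑' j : ℤ, ∑' k : ℤ, ∑' l : ℤ, (tw (-(1/(16 * (d:ℝ))) * (|(k:ℝ) - (d:ℝ)/2 * j| + |(l:ℝ) - (d:ℝ)/2 * j|)) * ck β F k * ck β G l) := by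
        simp_rw [ENNReal.tsum_mul_left]
    _ ≤ 4 * (C1 + C3) * (C4 * mN 2 β F0 * mN 2 β G0) := by
        gcongr
        refine (hsum _ _).trans ?_
        gcongr
        · exact (ck_sum hβ0 hF).trans lF
        · exact (ck_sum hβ0 hG).trans lG
    _ = _ := by ring
end endp2
end Strz


open MeasureTheory Real Complex
open scoped FourierTransform ENNReal SchwartzMap RealInnerProductSpace
set_option linter.all false
set_option linter.unusedVariables false
set_option linter.unusedSimpArgs false
set_option linter.deprecated false
namespace Strz
section duality
variable {d : ℕ}

lemma nice_of_supp {G : ℝ × Eu d → ℂ} (hG : Measurable G) {M R : ℝ} (hM : ∀ z, ‖G z‖ ≤ M)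
    (h1 : ∀ z : ℝ × Eu d, R < |z.1| → G z = 0) (h2 : ∀ z : ℝ × Eu d, R < ‖z.2‖ → G z = 0) : Nice G := by
  set V := volume (Metric.closedBall (0 : Eu d) R) with hV
  have hVt : V ≠ ∞ := (measure_closedBall_lt_top).ne
  have hM0 : 0 ≤ M := (norm_nonneg _).trans (hM 0)
  refine ⟨hG, max M (M * V.toReal), R, fun s => ⟨fun y => (hM _).trans (le_max_left _ _), ?_, fun hs y => h1 _ hs⟩⟩
  calc _ ≤ ∫⁻ y, (Metric.closedBall (0 : Eu d) R).indicator (fun _ => ENNReal.ofReal M) y := by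
        refine lintegral_mono fun y => ?_
        by_cases hy : y ∈ Metric.closedBall (0 : Eu d) R
        · rw [Set.indicator_of_mem hy, ← ofReal_norm]; exact ENNReal.ofReal_le_ofReal (hM _)
        · have : R < ‖y‖ := by simpa using hy
          rw [Set.indicator_of_notMem hy, h2 (s, y) this]; simp
    _ = ENNReal.ofReal (M * V.toReal) := by
        rw [lintegral_indicator measurableSet_closedBall, lintegral_const, Measure.restrict_apply_univ, ENNReal.ofReal_mul hM0, ENNReal.ofReal_toReal hVt]
    _ ≤ _ := ENNReal.ofReal_le_ofReal (le_max_right _ _)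

lemma Nice.integrable {F : ℝ × Eu d → ℂ} (hF : Nice F) : Integrable F (volume.prod volume) := by
  refine ⟨hF.meas.aestronglyMeasurable, ?_⟩
  obtain ⟨M, R, h⟩ := hF.bd
  unfold HasFiniteIntegral
  rw [lintegral_prod _ (hF.meas.enorm).aemeasurable]
  calc _ ≤ ∫⁻ s, (Set.Icc (-R) R).indicator (fun _ => ENNReal.ofReal M) s := by
        refine lintegral_mono fun s => ?_
        by_cases hs : s ∈ Set.Icc (-R) R
        · rw [Set.indicator_of_mem hs]; exact (h s).2.1
        · rw [Set.indicator_of_notMem hs]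
          have : R < |s| := by by_contra hc; push Not at hc; exact hs (abs_le.1 hc)
          simp [(h s).2.2 this]
    _ < ∞ := by
        rw [lintegral_indicator measurableSet_Icc]
        simp; finiteness

def UR (u : ℝ × Eu d → ℂ) (R : ℝ) : Set (ℝ × Eu d) := {z | |z.1| ≤ R ∧ ‖z.2‖ ≤ R ∧ ‖u z‖ ≤ R}

lemma measurableSet_UR {u : ℝ × Eu d → ℂ} (hu : Measurable u) (R : ℝ) : MeasurableSet (UR u R) :=
  (measurableSet_le (f := fun z : ℝ × Eu d => |z.1|) (g := fun _ => R) (by fun_prop) (by fun_prop)).inter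
   ((measurableSet_le (f := fun z : ℝ × Eu d => ‖z.2‖) (g := fun _ => R) (by fun_prop) (by fun_prop)).inter
    (measurableSet_le (f := fun z : ℝ × Eu d => ‖u z‖) (g := fun _ => R) (by fun_prop) (by fun_prop)))

/-- `u` is in the dual of `L^α L^β` with norm `≤ C`, tested on nice functions where `u` is bounded. -/
def DualB (α β : ℝ) (C : ℝ≥0∞) (u : ℝ × Eu d → ℂ) : Prop :=
  ∀ G : ℝ × Eu d → ℂ, Nice G → (∃ R : ℝ, ∀ z, G z ≠ 0 → z ∈ UR u R) → ‖∫ z, u z * (starRingEnd ℂ) (G z) ∂(volume.prod volume)‖ₑ ≤ C * mN α β G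

lemma dual_trunc {α β q : ℝ} {C : ℝ≥0∞} (hα : 1 ≤ α) (hβ : 1 < β) (hq : 2 ≤ q) (hβq : 1/β + 1/q = 1) {u : ℝ × Eu d → ℂ} (hu : Measurable u) (H : DualB α β C u)
    {h : ℝ → ℝ≥0∞} (hh : Measurable h) {B : ℝ≥0∞} (hB : B ≠ ∞) (hhB : ∀ t, h t ≤ B) (R : ℝ) (hR : 1 ≤ R) :
    ∫⁻ t, {t | ENNReal.ofReal (1/R) ≤ nrm q (fun y => (UR u R).indicator u (t, y))}.indicator (fun t => nrm q (fun y => (UR u R).indicator u (t, y)) * h t) t ≤ C * (∫⁻ t, h t ^ α) ^ (1/α) := by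
  have hR0 : 0 < R := by linarith
  have hq0 : 0 < q := by linarith
  have hβ0 : 0 < β := by linarith
  set w := (UR u R).indicator u with hw
  have mw : Measurable w := hu.indicator (measurableSet_UR hu R)
  have wR : ∀ z, ‖w z‖ ≤ R := by
    intro z
    by_cases hz : z ∈ UR u R
    · rw [hw, Set.indicator_of_mem hz]; exact hz.2.2
    · rw [hw, Set.indicator_of_notMem hz]; simp; linarith
  have w0 : ∀ z, z ∉ UR u R → w z = 0 := fun z hz => Set.indicator_of_notMem hz _
  have w1 : ∀ z : ℝ × Eu d, R < |z.1| → w z = 0 := fun z hz => w0 z (fun h => absurd h.1 (not_le.2 hz))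
  have w2 : ∀ z : ℝ × Eu d, R < ‖z.2‖ → w z = 0 := fun z hz => w0 z (fun h => absurd h.2.1 (not_le.2 hz))
  have nw : Nice w := nice_of_supp mw wR w1 w2
  set n : ℝ → ℝ≥0∞ := fun t => nrm q (fun y => w (t, y)) with hn
  have mn : Measurable n := measurable_nrm q mw
  have nt : ∀ t, n t ≠ ∞ := fun t => (nw.slice t).nrm_ne_top (by linarith)
  set T : Set ℝ := {t | ENNReal.ofReal (1/R) ≤ n t} with hT
  have mT : MeasurableSet T := measurableSet_le measurable_const mn
  have nT : ∀ t ∈ T, n t ≠ 0 := by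
    intro t ht h0
    have : ENNReal.ofReal (1/R) ≤ n t := ht
    rw [h0] at this
    simp at this; linarith
  set κ : ℝ → ℝ≥0∞ := T.indicator fun t => h t * n t ^ (1 - q) with hκ
  have mκ : Measurable κ := (hh.mul (mn.pow_const _)).indicator mT
  set K : ℝ≥0∞ := B * ENNReal.ofReal (1/R) ^ (1 - q) with hK
  have hKt : K ≠ ∞ := by
    refine ENNReal.mul_ne_top hB (ENNReal.rpow_ne_top_of_ne_zero ?_ (by simp))
    simp; linarith
  have κK : ∀ t, κ t ≤ K := by
    intro t
    by_cases ht : t ∈ T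
    · rw [hκ, Set.indicator_of_mem ht, hK]
      refine mul_le_mul' (hhB t) ?_
      rw [show 1 - q = -(q-1) by ring, ENNReal.rpow_neg, ENNReal.rpow_neg, ENNReal.inv_le_inv]
      exact ENNReal.rpow_le_rpow ht (by linarith)
    · rw [hκ, Set.indicator_of_notMem ht]; exact zero_le
  have κt : ∀ t, κ t ≠ ∞ := fun t => ((κK t).trans_lt hKt.lt_top).ne
  set G : ℝ × Eu d → ℂ := fun z => (((κ z.1).toReal * ‖w z‖ ^ (q - 2) : ℝ) : ℂ) * w z with hGdef
  have mG : Measurable G := by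
    have : Measurable fun z : ℝ × Eu d => (κ z.1).toReal * ‖w z‖ ^ (q - 2) := by fun_prop
    exact (Complex.measurable_ofReal.comp this).mul mw
  have Gw : ∀ z, w z = 0 → G z = 0 := fun z hz => by rw [hGdef]; simp [hz]
  have GM : ∀ z, ‖G z‖ ≤ K.toReal * R ^ (q - 2) * R := by
    intro z
    rw [hGdef]; simp only
    rw [norm_mul, Complex.norm_real, Real.norm_of_nonneg (by positivity)]
    gcongr
    · exact κK _
    · exact wR z
    · exact wR z
  have nG : Nice G := nice_of_supp mG GM (fun z hz => Gw z (w1 z hz)) (fun z hz => Gw z (w2 z hz))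
  have key := H G nG ⟨R, fun z hz => by by_contra hc; exact hz (Gw z (w0 z hc))⟩
  -- left side
  have eL : ∀ z, u z * (starRingEnd ℂ) (G z) = (((κ z.1).toReal * ‖w z‖ ^ q : ℝ) : ℂ) := by
    intro z
    by_cases hz : z ∈ UR u R
    · have : w z = u z := Set.indicator_of_mem hz _
      rw [hGdef]; simp only
      rw [map_mul, Complex.conj_ofReal, mul_left_comm, ← this, Complex.mul_conj, Complex.normSq_eq_norm_sq, ← Complex.ofReal_mul]
      congr 1
      rw [mul_assoc, ← Real.rpow_natCast, ← Real.rpow_add_of_nonneg (norm_nonneg _) (by linarith) (by norm_num)]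
      norm_num
    · rw [Gw z (w0 z hz), w0 z hz]; simp [Real.zero_rpow hq0.ne']
  have iL : Integrable (fun z : ℝ × Eu d => (κ z.1).toReal * ‖w z‖ ^ q) (volume.prod volume) := by
    have hm : Measurable fun z : ℝ × Eu d => (κ z.1).toReal * ‖w z‖ ^ q := by fun_prop
    have : Nice (fun z : ℝ × Eu d => (((κ z.1).toReal * ‖w z‖ ^ q : ℝ) : ℂ)) := by
      refine nice_of_supp (M := K.toReal * R ^ q) (R := R) (Complex.measurable_ofReal.comp hm) (fun z => ?_) (fun z hz => ?_) (fun z hz => ?_)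
      · rw [Complex.norm_real, Real.norm_of_nonneg (by positivity)]
        gcongr
        · exact κK _
        · exact wR z
      · rw [w1 z hz]; simp [Real.zero_rpow hq0.ne']
      · rw [w2 z hz]; simp [Real.zero_rpow hq0.ne']
    have := this.integrable.re
    simpa using this
  have L : ‖∫ z, u z * (starRingEnd ℂ) (G z) ∂(volume.prod volume)‖ₑ = ∫⁻ t, T.indicator (fun t => n t * h t) t := by
    simp_rw [eL]
    rw [integral_complex_ofReal, ← ofReal_norm, Complex.norm_real, Real.norm_of_nonneg (integral_nonneg fun z => by positivity), ofReal_integral_eq_lintegral_ofReal iL (by filter_upwards with z; positivity)]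
    have e1 : ∀ z : ℝ × Eu d, ENNReal.ofReal ((κ z.1).toReal * ‖w z‖ ^ q) = κ z.1 * ‖w z‖ₑ ^ q := by
      intro z
      rw [ENNReal.ofReal_mul (by positivity), ENNReal.ofReal_toReal (κt _), ← ENNReal.ofReal_rpow_of_nonneg (norm_nonneg _) hq0.le, ofReal_norm]
    simp_rw [e1]
    rw [lintegral_prod _ (by fun_prop)]
    congr 1; funext t
    simp only
    rw [lintegral_const_mul' _ _ (κt t), ← nrm_rpow hq0]
    change κ t * n t ^ q = _
    by_cases ht : t ∈ T
    · rw [hκ, Set.indicator_of_mem ht, Set.indicator_of_mem ht, mul_assoc, ← ENNReal.rpow_add _ _ (nT t ht) (nt t), mul_comm]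
      simp
    · rw [hκ, Set.indicator_of_notMem ht, Set.indicator_of_notMem ht, zero_mul]
  have Rr : mN α β G ≤ (∫⁻ t, h t ^ α) ^ (1/α) := by
    unfold mN
    refine ENNReal.rpow_le_rpow (lintegral_mono fun t => ENNReal.rpow_le_rpow ?_ (by linarith)) (by positivity)
    have e : nrm β (fun y => G (t, y)) = κ t * n t ^ (q - 1) := by
      unfold nrm
      have e1 : ∀ y, ‖G (t, y)‖ₑ ^ β = κ t ^ β * ‖w (t, y)‖ₑ ^ q := by
        intro y
        rw [hGdef]; simp only
        rw [enorm_mul]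
        have : ‖(((κ t).toReal * ‖w (t, y)‖ ^ (q - 2) : ℝ) : ℂ)‖ₑ = κ t * ‖w (t, y)‖ₑ ^ (q - 2) := by
          rw [← ofReal_norm, Complex.norm_real, Real.norm_of_nonneg (by positivity), ENNReal.ofReal_mul (by positivity), ENNReal.ofReal_toReal (κt _), ← ENNReal.ofReal_rpow_of_nonneg (norm_nonneg _) (by linarith), ofReal_norm]
        rw [this, mul_assoc, ENNReal.mul_rpow_of_nonneg _ _ hβ0.le]
        congr 1
        have e2 : ‖w (t, y)‖ₑ ^ (q - 2) * ‖w (t, y)‖ₑ = ‖w (t, y)‖ₑ ^ (q - 1) := by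
          conv_lhs => rw [← ENNReal.rpow_one (‖w (t, y)‖ₑ), ← ENNReal.rpow_mul, ← ENNReal.rpow_add_of_nonneg _ _ (by linarith) (by norm_num)]
          congr 1; ring
        rw [e2, ← ENNReal.rpow_mul]
        congr 1
        field_simp at hβq; linarith
      simp_rw [e1]
      rw [lintegral_const_mul' _ _ (by have := κt t; finiteness), ENNReal.mul_rpow_of_nonneg _ _ (by positivity), ← ENNReal.rpow_mul, mul_one_div_cancel hβ0.ne', ENNReal.rpow_one, ← nrm_rpow hq0, ← ENNReal.rpow_mul]
      congr 2
      field_simp at hβq ⊢; linarith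
    rw [e]
    by_cases ht : t ∈ T
    · rw [hκ, Set.indicator_of_mem ht, mul_assoc, ← ENNReal.rpow_add _ _ (nT t ht) (nt t)]
      simp
    · rw [hκ, Set.indicator_of_notMem ht, zero_mul]; exact zero_le
  rw [← L]
  exact key.trans (by gcongr)

lemma dual_full {α β q : ℝ} {C : ℝ≥0∞} (hα : 1 ≤ α) (hβ : 1 < β) (hq : 2 ≤ q) (hβq : 1/β + 1/q = 1) {u : ℝ × Eu d → ℂ} (hu : Measurable u) (H : DualB α β C u)
    {h : ℝ → ℝ≥0∞} (hh : Measurable h) {B : ℝ≥0∞} (hB : B ≠ ∞) (hhB : ∀ t, h t ≤ B) :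
    ∫⁻ t, nrm q (fun y => u (t, y)) * h t ≤ C * (∫⁻ t, h t ^ α) ^ (1/α) := by
  have hq0 : 0 < q := by linarith
  set n : ℕ → ℝ → ℝ≥0∞ := fun R t => nrm q (fun y => (UR u ((R:ℝ)+1)).indicator u (t, y)) with hn
  have mn : ∀ R, Measurable (n R) := fun R => measurable_nrm q (hu.indicator (measurableSet_UR hu _))
  have nmono : ∀ t, Monotone fun R => n R t := by
    intro t R R' hRR
    refine nrm_mono hq0 fun y => ?_
    have hle : ((R:ℝ)+1) ≤ (R':ℝ)+1 := by
      have : (R:ℝ) ≤ R' := by exact_mod_cast hRR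
      linarith
    by_cases hz : (t, y) ∈ UR u ((R:ℝ)+1)
    · have hz' : (t, y) ∈ UR u ((R':ℝ)+1) := ⟨hz.1.trans hle, hz.2.1.trans hle, hz.2.2.trans hle⟩
      rw [Set.indicator_of_mem hz, Set.indicator_of_mem hz']
    · rw [Set.indicator_of_notMem hz]; simp
  have nsup : ∀ t, ⨆ R, n R t = nrm q (fun y => u (t, y)) := by
    intro t
    have hl : ∀ y, ⨆ R : ℕ, ‖(UR u ((R:ℝ)+1)).indicator u (t, y)‖ₑ ^ q = ‖u (t, y)‖ₑ ^ q := by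
      intro y
      apply le_antisymm
      · exact iSup_le fun R => ENNReal.rpow_le_rpow (enorm_indicator_le_enorm_self _ _) hq0.le
      · obtain ⟨R, hR⟩ := exists_nat_ge (max |t| (max ‖y‖ ‖u (t, y)‖))
        refine le_iSup_of_le R ?_
        have : (t, y) ∈ UR u ((R:ℝ)+1) := by
          refine ⟨?_, ?_, ?_⟩
          · linarith [le_max_left |t| (max ‖y‖ ‖u (t, y)‖)]
          · linarith [le_max_right |t| (max ‖y‖ ‖u (t, y)‖), le_max_left ‖y‖ ‖u (t, y)‖]
          · linarith [le_max_right |t| (max ‖y‖ ‖u (t, y)‖), le_max_right ‖y‖ ‖u (t, y)‖]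
        rw [Set.indicator_of_mem this]
    have hmc : ∫⁻ y, ‖u (t, y)‖ₑ ^ q = ⨆ R : ℕ, ∫⁻ y, ‖(UR u ((R:ℝ)+1)).indicator u (t, y)‖ₑ ^ q := by
      rw [← lintegral_iSup]
      · congr 1; funext y; rw [hl y]
      · intro R
        have : Measurable fun y => (UR u ((R:ℝ)+1)).indicator u (t, y) := (hu.indicator (measurableSet_UR hu _)).comp (by fun_prop)
        fun_prop
      · intro R R' hRR y
        have hle : ((R:ℝ)+1) ≤ (R':ℝ)+1 := by
          have : (R:ℝ) ≤ R' := by exact_mod_cast hRR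
          linarith
        refine ENNReal.rpow_le_rpow ?_ hq0.le
        by_cases hz : (t, y) ∈ UR u ((R:ℝ)+1)
        · have hz' : (t, y) ∈ UR u ((R':ℝ)+1) := ⟨hz.1.trans hle, hz.2.1.trans hle, hz.2.2.trans hle⟩
          rw [Set.indicator_of_mem hz, Set.indicator_of_mem hz']
        · rw [Set.indicator_of_notMem hz]; simp
    unfold nrm at hn ⊢
    rw [hmc, hn]
    exact ((ENNReal.orderIsoRpow (1/q) (by positivity)).map_iSup _).symm
  have mono2 : ∀ t, Monotone fun R : ℕ => {t | ENNReal.ofReal (1/((R:ℝ)+1)) ≤ n R t}.indicator (fun t => n R t * h t) t := by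
    intro t R R' hRR
    dsimp only
    by_cases hz : ENNReal.ofReal (1/((R:ℝ)+1)) ≤ n R t
    · have hz' : ENNReal.ofReal (1/((R':ℝ)+1)) ≤ n R' t := by
        refine le_trans (ENNReal.ofReal_le_ofReal ?_) (hz.trans (nmono t hRR))
        have : (R:ℝ) ≤ R' := by exact_mod_cast hRR
        apply one_div_le_one_div_of_le (by positivity); linarith
      rw [Set.indicator_of_mem (show t ∈ {t | ENNReal.ofReal (1/((R:ℝ)+1)) ≤ n R t} from hz), Set.indicator_of_mem (show t ∈ {t | ENNReal.ofReal (1/((R':ℝ)+1)) ≤ n R' t} from hz')]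
      gcongr; exact nmono t hRR
    · rw [Set.indicator_of_notMem (show t ∉ {t | ENNReal.ofReal (1/((R:ℝ)+1)) ≤ n R t} from hz)]; exact zero_le
  have sup2 : ∀ t, nrm q (fun y => u (t, y)) * h t = ⨆ R : ℕ, {t | ENNReal.ofReal (1/((R:ℝ)+1)) ≤ n R t}.indicator (fun t => n R t * h t) t := by
    intro t
    rw [← nsup t, ENNReal.iSup_mul]
    apply le_antisymm
    · refine iSup_le fun R => ?_
      by_cases h0 : n R t = 0
      · rw [h0]; simp
      · obtain ⟨k, hk⟩ := ENNReal.exists_inv_nat_lt h0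
        refine le_iSup_of_le (max R k) ?_
        have hz : ENNReal.ofReal (1/(((max R k : ℕ):ℝ)+1)) ≤ n (max R k) t := by
          refine le_trans ?_ (hk.le.trans (nmono t (le_max_left R k)))
          rw [one_div, ENNReal.ofReal_inv_of_pos (by positivity), ENNReal.inv_le_inv, ← ENNReal.ofReal_natCast]
          apply ENNReal.ofReal_le_ofReal
          have : (k:ℝ) ≤ ((max R k : ℕ):ℝ) := by exact_mod_cast le_max_right R k
          linarith
        rw [Set.indicator_of_mem (show t ∈ {t | ENNReal.ofReal (1/(((max R k : ℕ):ℝ)+1)) ≤ n (max R k) t} from hz)]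
        gcongr; exact nmono t (le_max_left R k)
    · refine iSup_mono fun R => ?_
      by_cases hz : ENNReal.ofReal (1/((R:ℝ)+1)) ≤ n R t
      · rw [Set.indicator_of_mem (show t ∈ {t | ENNReal.ofReal (1/((R:ℝ)+1)) ≤ n R t} from hz)]
      · rw [Set.indicator_of_notMem (show t ∉ {t | ENNReal.ofReal (1/((R:ℝ)+1)) ≤ n R t} from hz)]; exact zero_le
  calc _ = ∫⁻ t, ⨆ R : ℕ, {t | ENNReal.ofReal (1/((R:ℝ)+1)) ≤ n R t}.indicator (fun t => n R t * h t) t := by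
        congr 1; funext t; exact sup2 t
    _ = ⨆ R : ℕ, ∫⁻ t, {t | ENNReal.ofReal (1/((R:ℝ)+1)) ≤ n R t}.indicator (fun t => n R t * h t) t := by
        refine lintegral_iSup (fun R => ?_) (fun R R' hRR t => mono2 t hRR)
        exact ((mn R).mul hh).indicator (measurableSet_le measurable_const (mn R))
    _ ≤ _ := iSup_le fun R => dual_trunc hα hβ hq hβq hu H hh hB hhB ((R:ℝ)+1) (by have : (0:ℝ) ≤ R := Nat.cast_nonneg R; linarith)

lemma dual_1d {α p : ℝ} (hα : 1 < α) (hp : 1 < p) (hαp : 1/α + 1/p = 1) {C : ℝ≥0∞} {n : ℝ → ℝ≥0∞} (hn : Measurable n)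
    (H : ∀ h : ℝ → ℝ≥0∞, Measurable h → (∃ B : ℝ≥0∞, B ≠ ∞ ∧ ∀ t, h t ≤ B) → ∫⁻ t, n t * h t ≤ C * (∫⁻ t, h t ^ α) ^ (1/α)) :
    (∫⁻ t, n t ^ p) ^ (1/p) ≤ C := by
  have hp0 : 0 < p := by linarith
  have hα0 : 0 < α := by linarith
  set k : ℕ → ℝ → ℝ≥0∞ := fun R t => (Set.Icc (-(R:ℝ)) R).indicator (fun t => min (n t) R) t with hk
  have mk : ∀ R, Measurable (k R) := fun R => (hn.min measurable_const).indicator measurableSet_Icc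
  have kR : ∀ R t, k R t ≤ R := by
    intro R t
    rw [hk]; dsimp only
    refine (Set.indicator_le_self' (by intros; exact zero_le) t).trans (min_le_right _ _)
  have kn : ∀ R t, k R t ≤ n t := by
    intro R t
    rw [hk]; dsimp only
    refine (Set.indicator_le_self' (by intros; exact zero_le) t).trans (min_le_left _ _)
  have kfin : ∀ R, ∫⁻ t, k R t ^ p ≠ ∞ := by
    intro R
    have : ∫⁻ t, k R t ^ p ≤ ∫⁻ t, (Set.Icc (-(R:ℝ)) R).indicator (fun _ => (R:ℝ≥0∞) ^ p) t := by
      refine lintegral_mono fun t => ?_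
      by_cases ht : t ∈ Set.Icc (-(R:ℝ)) R
      · rw [Set.indicator_of_mem ht]; exact ENNReal.rpow_le_rpow (kR R t) hp0.le
      · rw [Set.indicator_of_notMem ht, hk]; dsimp only; rw [Set.indicator_of_notMem ht, ENNReal.zero_rpow_of_pos hp0]
    refine (this.trans_lt ?_).ne
    rw [lintegral_indicator measurableSet_Icc]; simp; finiteness
  have kb : ∀ R, (∫⁻ t, k R t ^ p) ^ (1/p) ≤ C := by
    intro R
    have h1 := H (fun t => k R t ^ (p - 1)) ((mk R).pow_const _) ⟨(R:ℝ≥0∞) ^ (p-1), by finiteness, fun t => ENNReal.rpow_le_rpow (kR R t) (by linarith)⟩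
    have e : ∀ t, (k R t ^ (p - 1)) ^ α = k R t ^ p := by
      intro t; rw [← ENNReal.rpow_mul]; congr 1; field_simp at hαp; linarith
    simp_rw [e] at h1
    have h2 : ∫⁻ t, k R t ^ p ≤ C * (∫⁻ t, k R t ^ p) ^ (1/α) := by
      refine le_trans (lintegral_mono fun t => ?_) h1
      calc k R t ^ p = k R t * k R t ^ (p - 1) := by
            conv_rhs => rw [← ENNReal.rpow_one (k R t), ← ENNReal.rpow_mul, ← ENNReal.rpow_add_of_nonneg _ _ (by norm_num) (by linarith)]
            congr 1; ring
        _ ≤ _ := by gcongr; exact kn R t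
    by_cases h0 : ∫⁻ t, k R t ^ p = 0
    · rw [h0, ENNReal.zero_rpow_of_pos (by positivity)]; exact zero_le
    · have h3 : (∫⁻ t, k R t ^ p) = (∫⁻ t, k R t ^ p) ^ (1/p) * (∫⁻ t, k R t ^ p) ^ (1/α) := by
        rw [← ENNReal.rpow_add _ _ h0 (kfin R), add_comm, hαp, ENNReal.rpow_one]
      rw [h3] at h2
      have h5 := kfin R
      rw [← h3] at h2
      nth_rewrite 1 [h3] at h2
      refine (ENNReal.mul_le_mul_iff_left ?_ ?_).1 h2
      · exact (ENNReal.rpow_pos (pos_iff_ne_zero.2 h0) h5).ne'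
      · finiteness
  have ksup : ∀ t, n t ^ p = ⨆ R, k R t ^ p := by
    intro t
    apply le_antisymm
    · have hlim : ⨆ R : ℕ, min (n t) R = n t := by
        apply le_antisymm (iSup_le fun R => min_le_left _ _)
        rw [← inf_iSup_eq, ENNReal.iSup_natCast]; simp
      have e : (⨆ R : ℕ, min (n t) (R:ℝ≥0∞)) ^ p = ⨆ R : ℕ, (min (n t) (R:ℝ≥0∞)) ^ p := (ENNReal.orderIsoRpow p hp0).map_iSup _
      rw [hlim] at e
      rw [e]
      refine iSup_le fun R => ?_
      obtain ⟨R', hR'⟩ := exists_nat_ge (max (R:ℝ) |t|)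
      refine le_iSup_of_le R' ?_
      have : t ∈ Set.Icc (-(R':ℝ)) R' := abs_le.1 ((le_max_right _ _).trans hR')
      rw [hk]; dsimp only; rw [Set.indicator_of_mem this]
      refine ENNReal.rpow_le_rpow (min_le_min_left _ ?_) hp0.le
      exact_mod_cast (le_max_left (R:ℝ) |t|).trans hR'
    · exact iSup_le fun R => ENNReal.rpow_le_rpow (kn R t) hp0.le
  have kmono : ∀ t, Monotone fun R => k R t := by
    intro t R R' hRR
    have hle : (R:ℝ) ≤ R' := by exact_mod_cast hRR
    dsimp only [k]
    by_cases ht : t ∈ Set.Icc (-(R:ℝ)) R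
    · have ht' : t ∈ Set.Icc (-(R':ℝ)) R' := ⟨by linarith [ht.1], by linarith [ht.2]⟩
      rw [Set.indicator_of_mem ht, Set.indicator_of_mem ht']
      exact min_le_min_left _ (by exact_mod_cast hRR)
    · rw [Set.indicator_of_notMem ht]; exact zero_le
  have : ∫⁻ t, n t ^ p = ⨆ R, ∫⁻ t, k R t ^ p := by
    rw [← lintegral_iSup (fun R => (mk R).pow_const _) (fun R R' hRR t => ENNReal.rpow_le_rpow (kmono t hRR) hp0.le)]
    congr 1; funext t; exact ksup t
  rw [this]
  have e : (⨆ R, ∫⁻ t, k R t ^ p) ^ (1/p) = ⨆ R, (∫⁻ t, k R t ^ p) ^ (1/p) := (ENNReal.orderIsoRpow (1/p) (by positivity)).map_iSup _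
  rw [e]
  exact iSup_le kb

lemma dual_1d_top {C : ℝ≥0∞} {n : ℝ → ℝ≥0∞} (hn : Measurable n)
    (H : ∀ h : ℝ → ℝ≥0∞, Measurable h → (∃ B : ℝ≥0∞, B ≠ ∞ ∧ ∀ t, h t ≤ B) → ∫⁻ t, n t * h t ≤ C * (∫⁻ t, h t)) :
    ∀ᵐ t, n t ≤ C := by
  refine ae_le_of_forall_setLIntegral_le_of_sigmaFinite hn fun s hs hsf => ?_
  have := H (s.indicator 1) (measurable_one.indicator hs) ⟨1, by simp, fun t => Set.indicator_le_self' (by intros; exact zero_le) t⟩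
  rw [lintegral_indicator hs] at this
  simp at this
  rw [← lintegral_indicator hs]
  calc _ = ∫⁻ t, n t * s.indicator 1 t := by
        congr 1; funext t
        by_cases h : t ∈ s <;> simp [h]
    _ ≤ _ := by simpa using this
end duality
end Strz


open MeasureTheory Real Complex
open scoped FourierTransform ENNReal SchwartzMap RealInnerProductSpace
set_option linter.all false
set_option linter.unusedVariables false
set_option linter.unusedSimpArgs false
set_option linter.deprecated false
namespace Strz
section offd
variable {d : ℕ}

lemma mp4 {A B : Type*} [MeasureSpace A] [MeasureSpace B] [SFinite (volume : Measure A)] [SFinite (volume : Measure B)] :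
    MeasurePreserving (fun w : (A × A) × (B × B) => ((w.1.1, w.2.1), (w.1.2, w.2.2)))
      ((volume.prod volume).prod (volume.prod volume)) ((volume.prod volume).prod (volume.prod volume)) := by
  have h1 := measurePreserving_prodAssoc (volume : Measure A) (volume : Measure A) ((volume : Measure B).prod (volume : Measure B))
  have h2 := (MeasurePreserving.id (volume : Measure A)).prod ((measurePreserving_prodAssoc (volume : Measure A) (volume : Measure B) (volume : Measure B)).symm)
  have h3 := (MeasurePreserving.id (volume : Measure A)).prod ((Measure.measurePreserving_swap (μ := (volume : Measure A)) (ν := (volume : Measure B))).prod (MeasurePreserving.id (volume : Measure B)))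
  have h4 := (MeasurePreserving.id (volume : Measure A)).prod (measurePreserving_prodAssoc (volume : Measure B) (volume : Measure A) (volume : Measure B))
  have h5 := (measurePreserving_prodAssoc (volume : Measure A) (volume : Measure B) ((volume : Measure A).prod (volume : Measure B))).symm
  exact h5.comp (h4.comp (h3.comp (h2.comp h1)))

lemma me4 {A B : Type*} [MeasurableSpace A] [MeasurableSpace B] :
    MeasurableEmbedding (fun w : (A × A) × (B × B) => ((w.1.1, w.2.1), (w.1.2, w.2.2))) := by
  let e : (A × A) × (B × B) ≃ᵐ (A × B) × (A × B) :=
    { toFun := fun w => ((w.1.1, w.2.1), (w.1.2, w.2.2))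
      invFun := fun w => ((w.1.1, w.2.1), (w.1.2, w.2.2))
      left_inv := fun _ => rfl
      right_inv := fun _ => rfl
      measurable_toFun := by dsimp; fun_prop
      measurable_invFun := by dsimp; fun_prop }
  exact e.measurableEmbedding

/-- integrand on X × X, first variable the source -/
noncomputable def hX (a : Eu d → ℝ) (S : Set (ℝ × ℝ)) (F : ℝ × Eu d → ℂ) (w z : ℝ × Eu d) : ℂ :=
  {v : (ℝ × Eu d) × (ℝ × Eu d) | (v.1.1, v.2.1) ∈ S}.indicator (fun v => ker a (v.2.1 - v.1.1) (v.2.2 - v.1.2) * F v.1) (w, z)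

lemma measurable_hX {a : Eu d → ℝ} (ha : Amp a) {S : Set (ℝ × ℝ)} (hS : MeasurableSet S) {F : ℝ × Eu d → ℂ} (hF : Measurable F) :
    Measurable (fun v : (ℝ × Eu d) × (ℝ × Eu d) => hX a S F v.1 v.2) := by
  unfold hX
  have m1 : Measurable (fun w : (ℝ × Eu d) × (ℝ × Eu d) => ker a (w.2.1 - w.1.1) (w.2.2 - w.1.2)) :=
    ((ker_cont ha).comp (by fun_prop : Continuous fun w : (ℝ × Eu d) × (ℝ × Eu d) => (w.2.1 - w.1.1, w.2.2 - w.1.2))).measurable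
  refine Measurable.indicator (m1.mul (hF.comp measurable_fst)) ?_
  exact (by fun_prop : Measurable fun v : (ℝ × Eu d) × (ℝ × Eu d) => (v.1.1, v.2.1)) hS

noncomputable def uop (a : Eu d → ℝ) (S : Set (ℝ × ℝ)) (F : ℝ × Eu d → ℂ) (z : ℝ × Eu d) : ℂ :=
  ∫ w, hX a S F w z ∂(volume.prod volume)

lemma measurable_uop {a : Eu d → ℝ} (ha : Amp a) {S : Set (ℝ × ℝ)} (hS : MeasurableSet S) {F : ℝ × Eu d → ℂ} (hF : Measurable F) :
    Measurable (uop a S F) := by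
  unfold uop
  have := (measurable_hX ha hS hF).stronglyMeasurable
  exact (StronglyMeasurable.integral_prod_left (f := fun w z => hX a S F w z) this).measurable

lemma uop_pair {a : Eu d → ℝ} (ha : Amp a) {S : Set (ℝ × ℝ)} (hS : MeasurableSet S) {F G : ℝ × Eu d → ℂ} (hF : Nice F) (hG : Nice G) :
    ∫ z, uop a S F z * (starRingEnd ℂ) (G z) ∂(volume.prod volume) = Bf a S F G := by
  have hI : Integrable (fun v : (ℝ × Eu d) × (ℝ × Eu d) => hX a S F v.1 v.2 * (starRingEnd ℂ) (G v.2)) ((volume.prod volume).prod (volume.prod volume)) := by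
    rw [← mp4.integrable_comp_emb me4]
    refine ((h4_int ha hF hG).indicator (hS.prod MeasurableSet.univ)).congr ?_
    filter_upwards with w
    by_cases h : w.1 ∈ S
    · rw [Set.indicator_of_mem (show w ∈ S ×ˢ Set.univ from ⟨h, trivial⟩)]
      simp only [Function.comp, hX]
      rw [Set.indicator_of_mem (by exact h)]
      rfl
    · rw [Set.indicator_of_notMem (show w ∉ S ×ˢ Set.univ from fun h' => h h'.1)]
      simp only [Function.comp, hX]
      rw [Set.indicator_of_notMem (by exact h)]
      simp
  rw [Bf_eq4 ha hS hF hG]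
  have e1 : ∫ w, (S ×ˢ Set.univ).indicator (h4 a F G) w ∂((volume.prod volume).prod (volume.prod volume)) = ∫ v, hX a S F v.1 v.2 * (starRingEnd ℂ) (G v.2) ∂((volume.prod volume).prod (volume.prod volume)) := by
    rw [← mp4.integral_comp me4]
    congr 1; funext w
    by_cases h : w.1 ∈ S
    · rw [Set.indicator_of_mem (show w ∈ S ×ˢ Set.univ from ⟨h, trivial⟩)]
      simp only [hX]
      rw [Set.indicator_of_mem (by exact h)]
      rfl
    · rw [Set.indicator_of_notMem (show w ∉ S ×ˢ Set.univ from fun h' => h h'.1)]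
      simp only [hX]
      rw [Set.indicator_of_notMem (by exact h)]
      simp
  refine Eq.trans ?_ e1.symm
  rw [integral_prod_symm _ hI]
  congr 1; funext z
  simp only [uop]
  rw [← integral_mul_const]

lemma uop_dual {a : Eu d → ℝ} (ha : Amp a) {S : Set (ℝ × ℝ)} (hS : MeasurableSet S) {F : ℝ × Eu d → ℂ} (hF : Nice F) {α β : ℝ} {C : ℝ≥0∞}
    (h : ∀ G, Nice G → ‖Bf a S F G‖ₑ ≤ C * mN α β G) : DualB α β C (uop a S F) := by
  intro G hG _
  rw [uop_pair ha hS hF hG]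
  exact h G hG

lemma offdiag_hol {n b : ℝ → ℝ≥0∞} {P α' : ℝ} (h : P.HolderConjugate α') (hn : Measurable n) (hb : Measurable b) :
    ∫⁻ t, n t * b t ≤ (∫⁻ t, n t ^ P) ^ (1/P) * (∫⁻ t, b t ^ α') ^ (1/α') :=
  ENNReal.lintegral_mul_le_Lp_mul_Lq _ h (by fun_prop) (by fun_prop)

lemma offdiag {a : Eu d → ℝ} (ha : Amp a) (hpos : ∀ ξ, 0 ≤ a ξ) {α β α' β' θ : ℝ} (hα : 1 < α) (hβ : 1 < β) (hβ2 : β ≤ 2) (hα' : 1 < α') (hβ' : 1 < β')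
    (h0 : 0 < θ) (h1 : θ < 1) (e1 : 1 - 1/α' = θ * (1 - 1/α)) (e2 : 1/β' - 1/2 = θ * (1/β - 1/2)) (h : LocB a α β α β) : LocB a α β α' β' := by
  obtain ⟨C1, hC1, H1⟩ := h
  obtain ⟨C2, hC2, H2⟩ := LocB_L1L2_right ha hpos (by linarith) (by linarith) ⟨C1, hC1, H1⟩
  refine ⟨C1 ^ θ * C2 ^ (1 - θ), by have : 0 ≤ 1 - θ := by linarith
                                    finiteness, fun S hS F G hF hG => ?_⟩
  set N := mN α β F with hN
  set u := uop a S F with hu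
  have mu : Measurable u := measurable_uop ha hS hF.meas
  have hα0 : 0 < α := by linarith
  have hβ0 : 0 < β := by linarith
  have hα0' : 0 < α' := by linarith
  have hβ0' : 0 < β' := by linarith
  have ia : 1/α < 1 := by rw [div_lt_one hα0]; exact hα
  have ib : 1/β < 1 := by rw [div_lt_one hβ0]; exact hβ
  have ib2 : 1/2 ≤ 1/β := one_div_le_one_div_of_le hβ0 hβ2
  have ia' : 1/α' < 1 := by rw [div_lt_one hα0']; exact hα'
  have ib' : 1/β' < 1 := by rw [div_lt_one hβ0']; exact hβ'
  have ib2' : 1/2 ≤ 1/β' := by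
    have : 0 ≤ θ * (1/β - 1/2) := mul_nonneg h0.le (by linarith)
    linarith
  obtain ⟨b, hb⟩ : ∃ b : ℝ, b = 1/(1-1/β) := ⟨_, rfl⟩
  obtain ⟨A, hA⟩ : ∃ b : ℝ, b = 1/(1-1/α) := ⟨_, rfl⟩
  obtain ⟨q, hq⟩ : ∃ b : ℝ, b = 1/(1-1/β') := ⟨_, rfl⟩
  obtain ⟨P, hP⟩ : ∃ b : ℝ, b = 1/(1-1/α') := ⟨_, rfl⟩
  have ipos : 0 < 1/α := by positivity
  have ipos' : 0 < 1/α' := by positivity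
  have eb : 1/b = 1 - 1/β := by rw [hb, one_div_one_div]
  have eA : 1/A = 1 - 1/α := by rw [hA, one_div_one_div]
  have eq : 1/q = 1 - 1/β' := by rw [hq, one_div_one_div]
  have eP : 1/P = 1 - 1/α' := by rw [hP, one_div_one_div]
  have b2 : 2 ≤ b := by rw [hb, le_div_iff₀ (by linarith)]; linarith
  have q2 : 2 ≤ q := by rw [hq, le_div_iff₀ (by linarith)]; linarith
  have A1 : 1 < A := by rw [hA, lt_div_iff₀ (by linarith)]; linarith
  have P1 : 1 < P := by rw [hP, lt_div_iff₀ (by linarith)]; linarith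
  have AP : θ * P = A := by
    have hA0 : A ≠ 0 := by linarith
    have hP0 : P ≠ 0 := by linarith
    have : 1/P = θ * (1/A) := by rw [eP, eA, e1]
    field_simp at this
    linarith
  have D1 : DualB α β (C1 * N) u := uop_dual ha hS hF fun G hG => H1 S hS F G hF hG
  have D2 : DualB 1 2 (C2 * N) u := uop_dual ha hS hF fun G hG => H2 S hS F G hF hG
  have B1 : (∫⁻ t, nrm b (fun y => u (t, y)) ^ A) ^ (1/A) ≤ C1 * N :=
    dual_1d hα A1 (by rw [eA]; ring) (measurable_nrm b mu) fun h hh ⟨B, hB, hhB⟩ =>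
      dual_full hα.le hβ b2 (by rw [eb]; ring) mu D1 hh hB hhB
  have B2 : ∀ᵐ t, nrm 2 (fun y => u (t, y)) ≤ C2 * N :=
    dual_1d_top (measurable_nrm 2 mu) fun h hh ⟨B, hB, hhB⟩ => by
      simpa using dual_full le_rfl (by norm_num) le_rfl (by norm_num) mu D2 hh hB hhB
  have m1 := measurable_nrm b mu
  have m3 := measurable_nrm β' hG.meas
  obtain ⟨n, hn⟩ : ∃ n : ℝ → ℝ≥0∞, n = fun t => nrm b (fun y => u (t, y)) := ⟨_, rfl⟩
  obtain ⟨g, hg⟩ : ∃ n : ℝ → ℝ≥0∞, n = fun t => nrm β' (fun y => G (t, y)) := ⟨_, rfl⟩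
  rw [← hn] at m1; rw [← hg] at m3
  have hqc : q.HolderConjugate β' := (Real.holderConjugate_iff).2 ⟨by linarith, by rw [← one_div, ← one_div, eq]; ring⟩
  have hPc : P.HolderConjugate α' := (Real.holderConjugate_iff).2 ⟨by linarith, by rw [← one_div, ← one_div, eP]; ring⟩
  have mul : Measurable fun z : ℝ × Eu d => ‖u z‖ₑ * ‖G z‖ₑ := mu.enorm.mul hG.meas.enorm
  rw [← uop_pair ha hS hF hG]
  calc _ ≤ ∫⁻ z, ‖u z‖ₑ * ‖G z‖ₑ ∂(volume.prod volume) := by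
        refine (enorm_integral_le_lintegral_enorm _).trans (le_of_eq ?_)
        congr 1; funext z
        rw [enorm_mul, enorm_conj']
    _ = ∫⁻ t, ∫⁻ x, ‖u (t, x)‖ₑ * ‖G (t, x)‖ₑ := lintegral_prod _ mul.aemeasurable
    _ ≤ ∫⁻ t, (C2 * N) ^ (1 - θ) * (n t ^ θ * g t) := by
        refine lintegral_mono_ae ?_
        filter_upwards [B2] with t ht
        refine (nrm_holder hqc (f := fun x => u (t, x)) (g := fun x => G (t, x)) (by fun_prop) (hG.meas.comp (by fun_prop))).trans ?_
        have := nrm_interp (p := b) (q := 2) (r := q) (by linarith) (by norm_num) (by linarith) h0 h1 (by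
          rw [eq]
          rw [show θ / b = θ * (1/b) by ring, eb]; linarith) (f := fun x => u (t, x)) (by fun_prop)
        rw [hn, hg]
        calc _ ≤ _ := mul_le_mul_left this _
          _ ≤ (nrm b (fun x => u (t, x)) ^ θ * (C2 * N) ^ (1 - θ)) * nrm β' (fun x => G (t, x)) := by
              refine mul_le_mul_left (mul_le_mul_right (ENNReal.rpow_le_rpow ht (by linarith)) _) _
          _ = _ := by ring
    _ = (C2 * N) ^ (1 - θ) * ∫⁻ t, (n t ^ θ * g t) := lintegral_const_mul _ ((m1.pow_const _).mul m3)
    _ ≤ (C2 * N) ^ (1 - θ) * ((C1 * N) ^ θ * mN α' β' G) := by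
        refine mul_le_mul_right ((offdiag_hol hPc (m1.pow_const _) m3).trans ?_) _
        refine mul_le_mul' ?_ (le_of_eq (by rw [hg]; rfl))
        simp_rw [← ENNReal.rpow_mul, AP]
        rw [show 1/P = (1/A) * θ by rw [eP, e1, eA]; ring, ENNReal.rpow_mul, hn]
        exact ENNReal.rpow_le_rpow B1 h0.le
    _ = _ := by
        rw [ENNReal.mul_rpow_of_nonneg _ _ (by linarith), ENNReal.mul_rpow_of_nonneg _ _ h0.le]
        rw [show C1 ^ θ * C2 ^ (1 - θ) * N = C1 ^ θ * C2 ^ (1 - θ) * (N ^ θ * N ^ (1 - θ)) by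
          rw [← ENNReal.rpow_add_of_nonneg _ _ h0.le (by linarith)]; simp]
        ring
end offd
end Strz


open MeasureTheory Real Complex
open scoped FourierTransform ENNReal SchwartzMap RealInnerProductSpace
set_option linter.all false
set_option linter.unusedVariables false
set_option linter.unusedSimpArgs false
set_option linter.deprecated false
namespace Strz
section sharp
variable {d : ℕ}

structure Sharp (d : ℕ) (α β : ℝ) : Prop where
  a1 : 1 ≤ α
  a2 : α ≤ 2
  b1 : 1 < β
  eq : 1 / β = 1/2 + 2 / d * (1 - 1/α)

lemma Sharp.b2 {α β : ℝ} (h : Sharp d α β) : β ≤ 2 := by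
  have h1 : 1/α ≤ 1 := by rw [div_le_one (by linarith [h.a1])]; exact h.a1
  have h2 : 0 ≤ 2 / (d:ℝ) * (1 - 1/α) := mul_nonneg (by positivity) (by linarith)
  have h3 := h.eq
  have hb := h.b1
  by_contra hc; push Not at hc
  have : 1/β < 1/2 := one_div_lt_one_div_of_lt (by norm_num) hc
  linarith

lemma sharp_diag {a : Eu d → ℝ} (ha : Amp a) (hpos : ∀ ξ, 0 ≤ a ξ) (hd : 1 ≤ d) {α β : ℝ} (h : Sharp d α β) (h1 : 1 < α) : LocB a α β α β := by
  rcases h.a2.lt_or_eq with h2 | h2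
  · exact diag_nonend ha hpos hd h1 h2 h.b1 h.eq
  · subst h2
    have e := h.eq
    have hd' : (0:ℝ) < d := by exact_mod_cast hd
    have : 1/β < 1 := by rw [div_lt_one (by linarith [h.b1])]; exact h.b1
    have e' : 1/β = 1/2 + 1/d := by rw [e]; ring
    refine endpoint ha hpos ?_ (by linarith [h.b1]) e'
    by_contra hc
    have : (d:ℝ) ≤ 2 := by exact_mod_cast (by omega : d ≤ 2)
    have : 1/2 ≤ 1/(d:ℝ) := one_div_le_one_div_of_le hd' this
    linarith

lemma sharp_le {a : Eu d → ℝ} (ha : Amp a) (hpos : ∀ ξ, 0 ≤ a ξ) (hd : 1 ≤ d) {α β α' β' : ℝ} (h : Sharp d α β) (h' : Sharp d α' β') (hle : α' ≤ α) : LocB a α β α' β' := by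
  have inj : ∀ {x y : ℝ}, 1/x = 1/y → x = y := fun h => by simpa using h
  rcases h.a1.lt_or_eq with h1 | h1
  · have D := sharp_diag ha hpos hd h h1
    rcases h'.a1.lt_or_eq with h1' | h1'
    · rcases hle.lt_or_eq with hlt | he
      · have i1 : 1/α < 1 := by rw [div_lt_one (by linarith)]; exact h1
        have i2 : 1/α' < 1 := by rw [div_lt_one (by linarith)]; exact h1'
        have i3 : 1/α < 1/α' := one_div_lt_one_div_of_lt (by linarith) hlt
        have e : 1 - 1/α' = (1 - 1/α')/(1 - 1/α) * (1 - 1/α) := by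
          rw [div_mul_cancel₀]; linarith
        refine offdiag ha hpos (θ := (1 - 1/α')/(1 - 1/α)) h1 h.b1 h.b2 h1' h'.b1 (div_pos (by linarith) (by linarith)) ?_ e ?_ D
        · rw [div_lt_one (by linarith)]; linarith
        · rw [h.eq, h'.eq]
          rw [show 1/2 + 2/(d:ℝ)*(1-1/α') - 1/2 = 2/(d:ℝ)*(1-1/α') by ring]
          generalize (1 - 1/α')/(1 - 1/α) = θ at e
          rw [e]; ring
      · subst he
        have : β = β' := inj (by rw [h.eq, h'.eq])
        subst this; exact D
    · subst h1'
      have : β' = 2 := inj (by rw [h'.eq]; norm_num)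
      subst this
      exact LocB_L1L2_right ha hpos (by linarith) (by linarith [h.b1]) D
  · have : α' = 1 := le_antisymm (by linarith) h'.a1
    subst this; subst h1
    have : β' = 2 := inj (by rw [h'.eq]; norm_num)
    subst this
    have : β = 2 := inj (by rw [h.eq]; norm_num)
    subst this
    exact diag_L1L2 ha hpos

lemma sharp_loc {a : Eu d → ℝ} (ha : Amp a) (hpos : ∀ ξ, 0 ≤ a ξ) (hd : 1 ≤ d) {α β α' β' : ℝ} (h : Sharp d α β) (h' : Sharp d α' β') : LocB a α β α' β' := by
  rcases le_total α' α with hle | hle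
  · exact sharp_le ha hpos hd h h' hle
  · exact (sharp_le ha hpos hd h' h hle).symm
end sharp
end Strz


open MeasureTheory Real Complex
open scoped FourierTransform ENNReal SchwartzMap RealInnerProductSpace
set_option linter.all false
set_option linter.unusedVariables false
set_option linter.unusedSimpArgs false
set_option linter.deprecated false
namespace Strz
section conv
variable {d : ℕ}

lemma wgt_holder {Ω : Type*} [MeasurableSpace Ω] {μ : Measure Ω} {w u : Ω → ℝ≥0∞} (hw : Measurable w)
    (hu : Measurable u) {β : ℝ} (hβ : 1 ≤ β) :
    (∫⁻ y, w y * u y ∂μ) ^ β ≤ (∫⁻ y, w y ∂μ) ^ (β - 1) * ∫⁻ y, w y * u y ^ β ∂μ := by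
  have hβ0 : 0 < β := by linarith
  have hi : 1/β ≤ 1 := by rw [div_le_one hβ0]; exact hβ
  have key := ENNReal.lintegral_prod_norm_pow_le (μ := μ) (Finset.univ : Finset (Fin 2)) (f := ![w, fun y => w y * u y ^ β]) (p := ![1 - 1/β, 1/β])
    (by intro i _; fin_cases i
        · exact hw.aemeasurable
        · exact (hw.mul (hu.pow_const _)).aemeasurable) (by simp) (by
        intro i _; fin_cases i
        · simp; simpa using hi
        · simp; linarith)
  simp only [Fin.prod_univ_two, Matrix.cons_val_zero, Matrix.cons_val_one] at key
  have e : ∀ y, w y ^ (1 - 1/β) * (w y * u y ^ β) ^ (1/β) = w y * u y := by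
    intro y
    rw [ENNReal.mul_rpow_of_nonneg _ _ (by positivity), ← ENNReal.rpow_mul, mul_one_div_cancel hβ0.ne', ENNReal.rpow_one, ← mul_assoc,
      ← ENNReal.rpow_add_of_nonneg _ _ (by linarith) (by positivity)]
    simp
  simp_rw [e] at key
  refine (ENNReal.rpow_le_rpow key hβ0.le).trans (le_of_eq ?_)
  rw [ENNReal.mul_rpow_of_nonneg _ _ hβ0.le, ← ENNReal.rpow_mul, ← ENNReal.rpow_mul]
  congr 1
  · congr 1; field_simp
  · rw [one_div_mul_cancel hβ0.ne', ENNReal.rpow_one]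

lemma young_l {w h : Eu d → ℝ≥0∞} (hw : Measurable w) (hh : Measurable h) {β : ℝ} (hβ : 1 ≤ β) :
    ∫⁻ x, (∫⁻ y, w y * h (x - y)) ^ β ≤ (∫⁻ y, w y) ^ β * ∫⁻ x, h x ^ β := by
  have hm : Measurable fun z : Eu d × Eu d => w z.2 * h (z.1 - z.2) ^ β := by fun_prop
  calc _ ≤ ∫⁻ x, (∫⁻ y, w y) ^ (β - 1) * ∫⁻ y, w y * h (x - y) ^ β := by
        refine lintegral_mono fun x => wgt_holder hw (by fun_prop) hβ
    _ = (∫⁻ y, w y) ^ (β - 1) * ∫⁻ x, ∫⁻ y, w y * h (x - y) ^ β := by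
        exact lintegral_const_mul _ (Measurable.lintegral_prod_right' (f := fun z : Eu d × Eu d => w z.2 * h (z.1 - z.2) ^ β) hm)
    _ = (∫⁻ y, w y) ^ (β - 1) * ∫⁻ y, w y * ∫⁻ x, h x ^ β := by
        congr 1
        rw [lintegral_lintegral_swap (f := fun x y => w y * h (x - y) ^ β) hm.aemeasurable]
        congr 1; funext y
        rw [lintegral_const_mul _ (by fun_prop), lintegral_sub_right_eq_self (fun x => h x ^ β) y]
    _ = _ := by
        rw [lintegral_mul_const _ hw, ← mul_assoc]
        congr 1
        nth_rw 2 [← ENNReal.rpow_one (∫⁻ y, w y)]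
        rw [← ENNReal.rpow_add_of_nonneg _ _ (by linarith) (by norm_num)]
        simp

noncomputable def cv (κ f : Eu d → ℂ) (x : Eu d) : ℂ := ∫ y, κ y * f (x - y)

lemma enorm_cv_le (κ f : Eu d → ℂ) (x : Eu d) : ‖cv κ f x‖ₑ ≤ ∫⁻ y, ‖κ y‖ₑ * ‖f (x - y)‖ₑ := by
  refine (enorm_integral_le_lintegral_enorm _).trans (le_of_eq ?_)
  simp_rw [enorm_mul]

lemma nrm_cv_le {κ f : Eu d → ℂ} (hκ : Measurable κ) (hf : Measurable f) {β : ℝ} (hβ : 1 ≤ β) :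
    nrm β (cv κ f) ≤ (∫⁻ y, ‖κ y‖ₑ) * nrm β f := by
  have hβ0 : 0 < β := by linarith
  have : ∫⁻ x, ‖cv κ f x‖ₑ ^ β ≤ (∫⁻ y, ‖κ y‖ₑ) ^ β * ∫⁻ x, ‖f x‖ₑ ^ β :=
    (lintegral_mono fun x => ENNReal.rpow_le_rpow (enorm_cv_le κ f x) hβ0.le).trans (young_l hκ.enorm hf.enorm hβ)
  unfold nrm
  refine (ENNReal.rpow_le_rpow this (by positivity)).trans (le_of_eq ?_)
  rw [ENNReal.mul_rpow_of_nonneg _ _ (by positivity), ← ENNReal.rpow_mul, mul_one_div_cancel hβ0.ne', ENNReal.rpow_one]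

lemma cv_sup {κ f : Eu d → ℂ} {M : ℝ≥0∞} (hM : ∀ y, ‖f y‖ₑ ≤ M) (hMt : M ≠ ∞) (x : Eu d) : ‖cv κ f x‖ₑ ≤ (∫⁻ y, ‖κ y‖ₑ) * M := by
  refine (enorm_cv_le κ f x).trans ?_
  rw [← lintegral_mul_const' _ _ hMt]
  exact lintegral_mono fun y => mul_le_mul_right (hM _) _

lemma cv_sup_holder {κ f : Eu d → ℂ} (hκ : Measurable κ) (hf : Measurable f) {β β' : ℝ} (h : β'.HolderConjugate β) (x : Eu d) :
    ‖cv κ f x‖ₑ ≤ nrm β' κ * nrm β f := by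
  refine (enorm_cv_le κ f x).trans ((nrm_holder h hκ (g := fun y => f (x - y)) (by fun_prop)).trans (le_of_eq ?_))
  congr 1
  unfold nrm
  rw [lintegral_sub_left_eq_self (fun y => ‖f y‖ₑ ^ β) x]

lemma measurable_cv {κ f : Eu d → ℂ} (hκ : Measurable κ) (hf : Measurable f) : Measurable (cv κ f) := by
  unfold cv
  have : Measurable fun z : Eu d × Eu d => κ z.2 * f (z.1 - z.2) := by fun_prop
  exact (StronglyMeasurable.integral_prod_right (f := fun x y => κ y * f (x - y)) this.stronglyMeasurable).measurable

lemma NiceS.lint_ne_top {f : Eu d → ℂ} (hf : NiceS f) : ∫⁻ y, ‖f y‖ₑ ≠ ∞ := hf.int.2.ne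

lemma NiceS.esup {f : Eu d → ℂ} (hf : NiceS f) : ∃ M : ℝ≥0∞, M ≠ ∞ ∧ ∀ y, ‖f y‖ₑ ≤ M := by
  obtain ⟨M, hM⟩ := hf.bdd
  refine ⟨ENNReal.ofReal M, by simp, fun y => ?_⟩
  rw [← ofReal_norm]; exact ENNReal.ofReal_le_ofReal (hM y)

lemma NiceS.mk' {f : Eu d → ℂ} (hf : Measurable f) (h1 : ∃ M : ℝ≥0∞, M ≠ ∞ ∧ ∀ y, ‖f y‖ₑ ≤ M) (h2 : ∫⁻ y, ‖f y‖ₑ ≠ ∞) : NiceS f := by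
  obtain ⟨M, hM, h⟩ := h1
  refine ⟨hf, ⟨M.toReal, fun y => ?_⟩, hf.aestronglyMeasurable, lt_top_iff_ne_top.2 h2⟩
  have := ENNReal.toReal_mono hM (h y)
  simpa using this

lemma NiceS.cv {κ f : Eu d → ℂ} (hκ : NiceS κ) (hf : NiceS f) : NiceS (cv κ f) := by
  obtain ⟨M, hM, h⟩ := hf.esup
  refine NiceS.mk' (measurable_cv hκ.meas hf.meas) ⟨_, ENNReal.mul_ne_top hκ.lint_ne_top hM, fun y => cv_sup h hM y⟩ ?_
  have := nrm_cv_le hκ.meas hf.meas (β := 1) le_rfl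
  rw [nrm_one, nrm_one] at this
  exact (this.trans_lt (ENNReal.mul_lt_top hκ.lint_ne_top.lt_top hf.lint_ne_top.lt_top)).ne

lemma fourier_cv {κ f : Eu d → ℂ} (hκ : Integrable κ) (hf : Integrable f) (ξ : Eu d) : 𝓕 (cv κ f) ξ = 𝓕 κ ξ * 𝓕 f ξ :=
  Real.fourier_mul_convolution_eq hκ hf ξ

/-- slicewise convolution -/
noncomputable def cvF (κ : Eu d → ℂ) (F : ℝ × Eu d → ℂ) (z : ℝ × Eu d) : ℂ := cv κ (fun y => F (z.1, y)) z.2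

lemma Nice.cvF {κ : Eu d → ℂ} (hκ : NiceS κ) {F : ℝ × Eu d → ℂ} (hF : Nice F) : Nice (cvF κ F) := by
  obtain ⟨M, R, h⟩ := hF.bd
  set K := ∫⁻ y, ‖κ y‖ₑ with hK
  have hKt : K ≠ ∞ := hκ.lint_ne_top
  have hm : Measurable (Strz.cvF κ F) := by
    unfold Strz.cvF Strz.cv
    have mm : Measurable fun z : (ℝ × Eu d) × Eu d => κ z.2 * F (z.1.1, z.1.2 - z.2) := (hκ.meas.comp measurable_snd).mul (hF.meas.comp (by fun_prop))
    exact (StronglyMeasurable.integral_prod_right (f := fun (x : ℝ × Eu d) (y : Eu d) => κ y * F (x.1, x.2 - y)) mm.stronglyMeasurable).measurable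
  have hM0 : 0 ≤ M := (norm_nonneg _).trans ((h 0).1 0)
  have eKM : K * ENNReal.ofReal M = ENNReal.ofReal (K.toReal * M) := by
    rw [ENNReal.ofReal_mul (by positivity), ENNReal.ofReal_toReal hKt]
  refine ⟨hm, K.toReal * M, R, fun s => ⟨fun y => ?_, ?_, fun hs y => ?_⟩⟩
  · have := cv_sup (κ := κ) (f := fun y => F (s, y)) (M := ENNReal.ofReal M) (fun y => by
      rw [← ofReal_norm]; exact ENNReal.ofReal_le_ofReal ((h s).1 y)) (by simp) y
    rw [← hK, eKM, ← ofReal_norm, ENNReal.ofReal_le_ofReal_iff (by positivity)] at this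
    exact this
  · have := nrm_cv_le hκ.meas (hF.slice s).meas (β := 1) le_rfl
    rw [nrm_one, nrm_one] at this
    rw [← eKM]
    exact this.trans (mul_le_mul_right (h s).2.1 _)
  · unfold Strz.cvF Strz.cv
    simp [(h s).2.2 hs]

lemma mN_le_of_slice {α β β' : ℝ} (hα : 0 < α) {F G : ℝ × Eu d → ℂ} {C : ℝ≥0∞} (hC : C ≠ ∞) (h : ∀ s, nrm β (fun y => F (s, y)) ≤ C * nrm β' (fun y => G (s, y))) :
    mN α β F ≤ C * mN α β' G := by
  unfold mN
  calc _ ≤ (∫⁻ s, C ^ α * nrm β' (fun y => G (s, y)) ^ α) ^ (1/α) := by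
        refine ENNReal.rpow_le_rpow (lintegral_mono fun s => ?_) (by positivity)
        rw [← ENNReal.mul_rpow_of_nonneg _ _ hα.le]
        exact ENNReal.rpow_le_rpow (h s) hα.le
    _ = _ := by
        rw [lintegral_const_mul' _ _ (by finiteness), ENNReal.mul_rpow_of_nonneg _ _ (by positivity), ← ENNReal.rpow_mul, mul_one_div_cancel hα.ne', ENNReal.rpow_one]

lemma nrm_up {g : Eu d → ℂ} {A : ℝ≥0∞} (hA : ∀ x, ‖g x‖ₑ ≤ A) (hAt : A ≠ ∞) {β β0 : ℝ} (hβ : 0 < β) (h : β ≤ β0) :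
    nrm β0 g ≤ A ^ (1 - β/β0) * nrm β g ^ (β/β0) := by
  have h0 : 0 < β0 := by linarith
  have : ∫⁻ x, ‖g x‖ₑ ^ β0 ≤ A ^ (β0 - β) * ∫⁻ x, ‖g x‖ₑ ^ β := by
    have : A ^ (β0 - β) ≠ ∞ := ENNReal.rpow_ne_top_of_nonneg (by linarith) hAt
    rw [← lintegral_const_mul' _ _ this]
    refine lintegral_mono fun x => ?_
    calc ‖g x‖ₑ ^ β0 = ‖g x‖ₑ ^ (β0 - β) * ‖g x‖ₑ ^ β := by
          rw [← ENNReal.rpow_add_of_nonneg _ _ (by linarith) hβ.le]; simp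
      _ ≤ _ := mul_le_mul_left (ENNReal.rpow_le_rpow (hA x) (by linarith)) _
  unfold nrm
  refine (ENNReal.rpow_le_rpow this (by positivity)).trans (le_of_eq ?_)
  rw [ENNReal.mul_rpow_of_nonneg _ _ (by positivity), ← ENNReal.rpow_mul, ← ENNReal.rpow_mul]
  congr 2 <;> field_simp

lemma bernstein {κ : Eu d → ℂ} (hκ : NiceS κ) {β β0 : ℝ} (hβ : 1 < β) (h : β ≤ β0) : ∃ C : ℝ≥0∞, C ≠ ∞ ∧ ∀ f : Eu d → ℂ, NiceS f →
    nrm β0 (cv κ f) ≤ C * nrm β f := by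
  have hβ0 : 0 < β := by linarith
  have hb0 : 0 < β0 := by linarith
  have hc := (Real.HolderConjugate.conjExponent hβ).symm
  set β' := β.conjExponent
  set A := nrm β' κ with hA
  have hAt : A ≠ ∞ := hκ.nrm_ne_top hc.lt.le
  set K := ∫⁻ y, ‖κ y‖ₑ with hK
  have hKt : K ≠ ∞ := hκ.lint_ne_top
  have r1 : β/β0 ≤ 1 := by rw [div_le_one hb0]; exact h
  have r0 : 0 < β/β0 := by positivity
  refine ⟨A ^ (1 - β/β0) * K ^ (β/β0), by have : 0 ≤ 1 - β/β0 := by linarith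
                                          finiteness, fun f hf => ?_⟩
  have hn : nrm β f ≠ ∞ := hf.nrm_ne_top hβ.le
  refine (nrm_up (A := A * nrm β f) (fun x => cv_sup_holder hκ.meas hf.meas hc x) (by finiteness) hβ0 h).trans ?_
  calc _ ≤ (A * nrm β f) ^ (1 - β/β0) * (K * nrm β f) ^ (β/β0) := by
        refine mul_le_mul_right (ENNReal.rpow_le_rpow (nrm_cv_le hκ.meas hf.meas hβ.le) r0.le) _
    _ = A ^ (1 - β/β0) * K ^ (β/β0) * (nrm β f ^ (1 - β/β0) * nrm β f ^ (β/β0)) := by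
        rw [ENNReal.mul_rpow_of_nonneg _ _ (by linarith), ENNReal.mul_rpow_of_nonneg _ _ r0.le]; ring
    _ = _ := by
        rw [← ENNReal.rpow_add_of_nonneg _ _ (by linarith) r0.le]; simp

lemma bernsteinF {κ : Eu d → ℂ} (hκ : NiceS κ) {α β β0 : ℝ} (hα : 0 < α) (hβ : 1 < β) (h : β ≤ β0) : ∃ C : ℝ≥0∞, C ≠ ∞ ∧ ∀ F : ℝ × Eu d → ℂ, Nice F →
    mN α β0 (cvF κ F) ≤ C * mN α β F := by
  obtain ⟨C, hC, H⟩ := bernstein hκ hβ h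
  exact ⟨C, hC, fun F hF => mN_le_of_slice hα hC fun s => H _ (hF.slice s)⟩

lemma fm_cv {a : Eu d → ℝ} {κ : Eu d → ℂ} (hκ : Integrable κ) (h1 : ∀ ξ, a ξ ≠ 0 → 𝓕 κ ξ = 1) (τ : ℝ) {f g : Eu d → ℂ} (hf : Integrable f) (hg : Integrable g) :
    fm a τ (cv κ f) (cv κ g) = fm a τ f g := by
  unfold fm
  congr 1; funext ξ
  by_cases h : a ξ = 0
  · simp [h]
  · rw [fourier_cv hκ hf, fourier_cv hκ hg, h1 ξ h]; simp

lemma Bf_cvF {a : Eu d → ℝ} {κ : Eu d → ℂ} (hκ : Integrable κ) (h1 : ∀ ξ, a ξ ≠ 0 → 𝓕 κ ξ = 1) (S : Set (ℝ × ℝ)) {F G : ℝ × Eu d → ℂ} (hF : Nice F) (hG : Nice G) :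
    Bf a S (cvF κ F) (cvF κ G) = Bf a S F G := by
  unfold Bf
  congr 1; funext z
  exact fm_cv hκ h1 (z.2 - z.1) (f := fun y => F (z.1, y)) (g := fun y => G (z.2, y)) (hF.slice z.1).int (hG.slice z.2).int

structure Adm (d : ℕ) (α β : ℝ) : Prop where
  a1 : 1 ≤ α
  a2 : α ≤ 2
  b1 : 1 < β
  b2 : β ≤ 2
  le : 1/2 + 2 / d * (1 - 1/α) ≤ 1 / β

lemma Adm.sharp {α β : ℝ} (h : Adm d α β) : ∃ β0, β ≤ β0 ∧ Sharp d α β0 := by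
  have h1 : 1/α ≤ 1 := by rw [div_le_one (by linarith [h.a1])]; exact h.a1
  have h2 : 0 ≤ 2 / (d:ℝ) * (1 - 1/α) := mul_nonneg (by positivity) (by linarith)
  have hb : 0 < β := by linarith [h.b1]
  have h3 : 1/β < 1 := by rw [div_lt_one hb]; exact h.b1
  have h4 := h.le
  refine ⟨1/(1/2 + 2 / d * (1 - 1/α)), ?_, h.a1, h.a2, ?_, by rw [one_div_one_div]⟩
  · rw [le_div_iff₀ (by linarith)]
    calc _ ≤ β * (1/β) := by gcongr
      _ = 1 := by field_simp
  · rw [lt_div_iff₀ (by linarith)]; linarith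

lemma adm_loc {a : Eu d → ℝ} (ha : Amp a) (hpos : ∀ ξ, 0 ≤ a ξ) (hd : 1 ≤ d) {κ : Eu d → ℂ} (hκ : NiceS κ) (h1 : ∀ ξ, a ξ ≠ 0 → 𝓕 κ ξ = 1)
    {α β α' β' : ℝ} (h : Adm d α β) (h' : Adm d α' β') : LocB a α β α' β' := by
  obtain ⟨b, hb, hs⟩ := h.sharp
  obtain ⟨b', hb', hs'⟩ := h'.sharp
  obtain ⟨C0, hC0, H0⟩ := sharp_loc ha hpos hd hs hs'
  obtain ⟨C1, hC1, H1⟩ := bernsteinF hκ (α := α) (by linarith [h.a1]) h.b1 hb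
  obtain ⟨C2, hC2, H2⟩ := bernsteinF hκ (α := α') (by linarith [h'.a1]) h'.b1 hb'
  refine ⟨C0 * C1 * C2, by finiteness, fun S hS F G hF hG => ?_⟩
  rw [← Bf_cvF hκ.int h1 S hF hG]
  refine (H0 S hS _ _ (hF.cvF hκ) (hG.cvF hκ)).trans ?_
  calc _ ≤ C0 * (C1 * mN α β F) * (C2 * mN α' β' G) := by
        exact mul_le_mul' (mul_le_mul_right (H1 F hF) _) (H2 G hG)
    _ = _ := by ring
end conv
end Strz


open MeasureTheory Real Complex
open scoped FourierTransform ENNReal SchwartzMap RealInnerProductSpace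
set_option linter.all false
set_option linter.unusedVariables false
set_option linter.unusedSimpArgs false
set_option linter.deprecated false
namespace Strz
section besov
variable {d : ℕ}

structure KernL (K : ℝ≥0∞) (l : ℝ) (κ : Eu d → ℂ) : Prop where
  nice : NiceS κ
  l1 : ∫⁻ y, ‖κ y‖ₑ ≤ K
  mean : ∫ y, κ y = 0
  mom : ∫⁻ y, ‖κ y‖ₑ * ‖y‖ₑ ≤ K * ENNReal.ofReal l⁻¹
  lip : ∀ y, ∫⁻ x, ‖κ (x + y) - κ x‖ₑ ≤ K * ENNReal.ofReal l * ‖y‖ₑ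

lemma tangent {p a b : ℝ} (hp : 1 ≤ p) (ha : 0 ≤ a) (hb : 0 ≤ b) : a ^ p - b ^ p ≤ p * a ^ (p - 1) * (a - b) := by
  have hp0 : 0 < p := by linarith
  have hi : 1/p ≤ 1 := by rw [div_le_one hp0]; exact hp
  have := Real.geom_mean_le_arith_mean2_weighted (w₁ := 1 - 1/p) (w₂ := 1/p) (p₁ := a ^ p) (p₂ := b ^ p) (by linarith) (by positivity) (by positivity) (by positivity) (by ring)
  rw [← Real.rpow_mul ha, ← Real.rpow_mul hb, mul_one_div_cancel hp0.ne', Real.rpow_one, show p * (1 - 1/p) = p - 1 by field_simp] at this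
  have e : a ^ p = a ^ (p-1) * a := by
    nth_rw 3 [← Real.rpow_one a]
    rw [← Real.rpow_add_of_nonneg ha (by linarith) (by norm_num)]; simp
  have h2 := mul_le_mul_of_nonneg_left this hp0.le
  have h3 : p * ((1 - 1/p) * a^p + 1/p * b^p) = p * a^p - a^p + b^p := by field_simp
  rw [h3] at h2
  nlinarith

noncomputable def mp (p : ℝ) (z : ℂ) : ℂ := ((‖z‖ ^ (p - 2) : ℝ) : ℂ) * (starRingEnd ℂ) z

lemma measurable_mp (p : ℝ) : Measurable (mp p) := by
  unfold mp
  have : Measurable fun z : ℂ => ‖z‖ ^ (p-2) := by fun_prop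
  exact (Complex.measurable_ofReal.comp this).mul Complex.continuous_conj.measurable

lemma rpow_split {p x : ℝ} (hp : 2 ≤ p) (hx : 0 ≤ x) : x ^ (p - 2) * x = x ^ (p - 1) := by
  nth_rw 2 [← Real.rpow_one x]
  rw [← Real.rpow_add_of_nonneg hx (by linarith) (by norm_num)]; congr 1; ring

lemma norm_mp {p : ℝ} (hp : 2 ≤ p) (z : ℂ) : ‖mp p z‖ = ‖z‖ ^ (p - 1) := by
  unfold mp
  rw [norm_mul, Complex.norm_real, RCLike.norm_conj, Real.norm_of_nonneg (by positivity), rpow_split hp (norm_nonneg _)]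

lemma mp_conv {p : ℝ} (hp : 2 ≤ p) (u z : ℂ) : ‖u‖ ^ p ≤ ‖z‖ ^ p + p * (mp p u * (u - z)).re := by
  have hp0 : 0 < p := by linarith
  have e1 : mp p u * u = ((‖u‖ ^ p : ℝ) : ℂ) := by
    unfold mp
    rw [mul_assoc, mul_comm ((starRingEnd ℂ) u), Complex.mul_conj, Complex.normSq_eq_norm_sq, ← Complex.ofReal_mul]
    congr 1
    rw [← Real.rpow_natCast, ← Real.rpow_add_of_nonneg (norm_nonneg _) (by linarith) (by norm_num)]
    norm_num
  have e2 : (mp p u * z).re ≤ ‖u‖ ^ (p-1) * ‖z‖ := by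
    refine (Complex.re_le_norm _).trans (le_of_eq ?_)
    rw [norm_mul, norm_mp hp]
  have t := tangent (p := p) (by linarith) (norm_nonneg u) (norm_nonneg z)
  have e3 : ‖u‖ ^ p = ‖u‖ ^ (p-1) * ‖u‖ := by
    nth_rw 3 [← Real.rpow_one ‖u‖]
    rw [← Real.rpow_add_of_nonneg (norm_nonneg _) (by linarith) (by norm_num)]; simp
  rw [mul_sub, e1, Complex.sub_re, Complex.ofReal_re]
  nlinarith

lemma mp_lip_aux {s a b : ℝ} (hs : 0 ≤ s) (ha : 0 ≤ a) (hb : 0 ≤ b) : |a ^ s - b ^ s| * b ≤ (s + 1) * (a ^ s + b ^ s) * |a - b| := by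
  have p : ∀ x : ℝ, 0 ≤ x → x ^ (s+1) = x ^ s * x := fun x hx => by
    rw [Real.rpow_add_of_nonneg hx hs (by norm_num), Real.rpow_one]
  rcases le_total b a with h | h
  · have h1 : b ^ s ≤ a ^ s := Real.rpow_le_rpow hb h hs
    have t := tangent (p := s + 1) (by linarith) ha hb
    rw [p a ha, p b hb, add_sub_cancel_right] at t
    rw [abs_of_nonneg (by linarith), abs_of_nonneg (by linarith)]
    have : 0 ≤ b ^ s := by positivity
    have : 0 ≤ a ^ s := by positivity
    have k1 : a ^ s * b ≤ a ^ s * a := by gcongr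
    have k2 : 0 ≤ (s+1) * b ^ s * (a - b) := mul_nonneg (by positivity) (by linarith)
    linarith
  · have h1 : a ^ s ≤ b ^ s := Real.rpow_le_rpow ha h hs
    have t := tangent (p := s + 1) (by linarith) hb ha
    rw [p a ha, p b hb, add_sub_cancel_right] at t
    rw [abs_sub_comm, abs_sub_comm a b, abs_of_nonneg (by linarith), abs_of_nonneg (by linarith)]
    have : 0 ≤ b ^ s := by positivity
    have : 0 ≤ a ^ s := by positivity
    have k1 : a ^ s * a ≤ a ^ s * b := by gcongr
    have k2 : 0 ≤ (s+1) * a ^ s * (b - a) := mul_nonneg (by positivity) (by linarith)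
    linarith

lemma mp_lip {p : ℝ} (hp : 2 ≤ p) (z w : ℂ) : ‖mp p z - mp p w‖ ≤ p * (‖z‖ ^ (p-2) + ‖w‖ ^ (p-2)) * ‖z - w‖ := by
  have e : mp p z - mp p w = ((‖z‖ ^ (p - 2) : ℝ) : ℂ) * (starRingEnd ℂ) (z - w) + ((‖z‖ ^ (p - 2) - ‖w‖ ^ (p-2) : ℝ) : ℂ) * (starRingEnd ℂ) w := by
    unfold mp; rw [map_sub]; push_cast; ring
  rw [e]
  refine (norm_add_le _ _).trans ?_
  rw [norm_mul, norm_mul, RCLike.norm_conj, RCLike.norm_conj, Complex.norm_real, Complex.norm_real, Real.norm_of_nonneg (by positivity), Real.norm_eq_abs]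
  have h1 := mp_lip_aux (s := p - 2) (by linarith) (norm_nonneg z) (norm_nonneg w)
  have h2 := abs_norm_sub_norm_le z w
  have h3 : (p - 2 + 1) * (‖z‖ ^ (p-2) + ‖w‖ ^ (p-2)) * |‖z‖ - ‖w‖| ≤ (p - 2 + 1) * (‖z‖ ^ (p-2) + ‖w‖ ^ (p-2)) * ‖z - w‖ :=
    mul_le_mul_of_nonneg_left h2 (mul_nonneg (by linarith) (by positivity))
  have h4 : 0 ≤ ‖w‖ ^ (p-2) * ‖z - w‖ := by positivity
  linarith

lemma NiceS.add {f g : Eu d → ℂ} (hf : NiceS f) (hg : NiceS g) : NiceS (fun x => f x + g x) := by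
  obtain ⟨M, hM⟩ := hf.bdd
  obtain ⟨M', hM'⟩ := hg.bdd
  exact ⟨hf.meas.add hg.meas, ⟨M + M', fun y => (norm_add_le _ _).trans (add_le_add (hM y) (hM' y))⟩, hf.int.add hg.int⟩

lemma NiceS.zero : NiceS (fun _ : Eu d => (0:ℂ)) := ⟨measurable_const, ⟨0, by simp⟩, integrable_zero _ _ _⟩

lemma NiceS.rpow_int {f : Eu d → ℂ} (hf : NiceS f) {p : ℝ} (hp : 1 ≤ p) : Integrable (fun x => ‖f x‖ ^ p) := by
  refine ⟨(by have := hf.meas; fun_prop : Measurable fun x => ‖f x‖ ^ p).aestronglyMeasurable, ?_⟩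
  have := hf.nrm_ne_top hp
  have h2 : ∫⁻ x, ‖f x‖ₑ ^ p ≠ ∞ := by rw [← nrm_rpow (by linarith)]; exact ENNReal.rpow_ne_top_of_nonneg (by linarith) this
  unfold HasFiniteIntegral
  refine lt_of_eq_of_lt ?_ h2.lt_top
  congr 1; funext x
  rw [← ofReal_norm, Real.norm_of_nonneg (by positivity), ← ENNReal.ofReal_rpow_of_nonneg (norm_nonneg _) (by linarith), ofReal_norm]

lemma nrm_rpow_ofReal {f : Eu d → ℂ} (hf : NiceS f) {p : ℝ} (hp : 1 ≤ p) : nrm p f ^ p = ENNReal.ofReal (∫ x, ‖f x‖ ^ p) := by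
  rw [nrm_rpow (by linarith), ofReal_integral_eq_lintegral_ofReal (hf.rpow_int hp) (by filter_upwards with x; positivity)]
  congr 1; funext x
  rw [← ENNReal.ofReal_rpow_of_nonneg (norm_nonneg _) (by linarith), ofReal_norm]

lemma mp_bdd {p : ℝ} (hp : 2 ≤ p) {f : Eu d → ℂ} (hf : NiceS f) : ∃ M : ℝ, ∀ x, ‖mp p (f x)‖ ≤ M := by
  obtain ⟨M, hM⟩ := hf.bdd
  exact ⟨M ^ (p-1), fun x => by rw [norm_mp hp]; exact Real.rpow_le_rpow (norm_nonneg _) (hM x) (by linarith)⟩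

lemma mp_int {p : ℝ} (hp : 2 ≤ p) {f g : Eu d → ℂ} (hf : NiceS f) (hg : Integrable g) : Integrable (fun x => mp p (f x) * g x) := by
  obtain ⟨M, hM⟩ := mp_bdd hp hf
  exact Integrable.bdd_mul hg ((measurable_mp p).comp hf.meas).aestronglyMeasurable (by filter_upwards with x; exact hM x)

lemma step {p : ℝ} (hp : 2 ≤ p) {z w : Eu d → ℂ} (hz : NiceS z) (hw : NiceS w) :
    nrm p (fun x => z x + w x) ^ p ≤ nrm p z ^ p + ENNReal.ofReal p * ‖∫ x, mp p (z x + w x) * w x‖ₑ := by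
  have hu := hz.add hw
  rw [nrm_rpow_ofReal hu (by linarith), nrm_rpow_ofReal hz (by linarith), ← ofReal_norm, ← ENNReal.ofReal_mul (by linarith), ← ENNReal.ofReal_add (integral_nonneg fun x => by positivity) (by positivity)]
  refine ENNReal.ofReal_le_ofReal ?_
  have hi := mp_int hp hu hw.int
  have hr : Integrable (fun x => (mp p (z x + w x) * w x).re) := hi.re
  calc _ ≤ ∫ x, (‖z x‖ ^ p + p * (mp p (z x + w x) * w x).re) := by
        refine integral_mono (hu.rpow_int (by linarith)) ((hz.rpow_int (by linarith)).add (hr.const_mul p)) fun x => ?_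
        have := mp_conv hp (z x + w x) (z x)
        rwa [add_sub_cancel_left] at this
    _ = (∫ x, ‖z x‖ ^ p) + p * (∫ x, mp p (z x + w x) * w x).re := by
        rw [integral_add (hz.rpow_int (by linarith)) (hr.const_mul p), integral_const_mul]
        congr 2
        exact integral_re hi
    _ ≤ _ := by
        have := Complex.re_le_norm (∫ x, mp p (z x + w x) * w x)
        gcongr
end besov
end Strz


open MeasureTheory Real Complex
open scoped FourierTransform ENNReal SchwartzMap RealInnerProductSpace
set_option linter.all false
set_option linter.unusedVariables false
set_option linter.unusedSimpArgs false
set_option linter.deprecated false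
namespace Strz
section besov2
variable {d : ℕ}

lemma nrm_add_le {β : ℝ} (hβ : 1 ≤ β) {f g : Eu d → ℂ} (hf : Measurable f) (hg : Measurable g) : nrm β (fun x => f x + g x) ≤ nrm β f + nrm β g :=
  eLpNorm'_add_le hf.aestronglyMeasurable hg.aestronglyMeasurable hβ

lemma nrm_sum_le {β : ℝ} (hβ : 1 ≤ β) {ι : Type*} (s : Finset ι) {f : ι → Eu d → ℂ} (hf : ∀ i, Measurable (f i)) : nrm β (fun x => ∑ i ∈ s, f i x) ≤ ∑ i ∈ s, nrm β (f i) := by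
  have := eLpNorm'_sum_le (μ := volume) (f := f) (s := s) (fun i _ => (hf i).aestronglyMeasurable) hβ
  have e : (∑ i ∈ s, f i) = fun x => ∑ i ∈ s, f i x := by funext x; simp
  rw [e] at this
  exact this

lemma nrm_shift {β : ℝ} (f : Eu d → ℂ) (y : Eu d) : nrm β (fun x => f (x + y)) = nrm β f := by
  unfold nrm
  rw [lintegral_add_right_eq_self (fun x => ‖f x‖ₑ ^ β) y]

lemma tri_holder {p : ℝ} (hp : 2 ≤ p) {A B G : Eu d → ℂ} (hA : Measurable A) (hB : Measurable B) (hG : Measurable G) :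
    ∫⁻ x, ‖A x‖ₑ ^ (p-2) * ‖B x‖ₑ * ‖G x‖ₑ ≤ nrm p A ^ (p-2) * nrm p B * nrm p G := by
  have hp0 : 0 < p := by linarith
  have key := ENNReal.lintegral_prod_norm_pow_le (μ := (volume : Measure (Eu d))) (Finset.univ : Finset (Fin 3))
    (f := ![fun x => ‖A x‖ₑ ^ p, fun x => ‖B x‖ₑ ^ p, fun x => ‖G x‖ₑ ^ p]) (p := ![(p-2)/p, 1/p, 1/p])
    (by intro i _; fin_cases i
        · exact (hA.enorm.pow_const _).aemeasurable
        · exact (hB.enorm.pow_const _).aemeasurable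
        · exact (hG.enorm.pow_const _).aemeasurable) (by simp [Fin.sum_univ_three]; field_simp; ring) (by
        intro i _; fin_cases i
        · simp; exact div_nonneg (by linarith) hp0.le
        · simp; linarith
        · simp; linarith)
  simp only [Fin.prod_univ_three, Matrix.cons_val_zero, Matrix.cons_val_one, Matrix.cons_val_two, Matrix.head_cons, Matrix.tail_cons, Matrix.cons_val] at key
  simp only [← ENNReal.rpow_mul, mul_one_div_cancel hp0.ne', ENNReal.rpow_one, mul_div_cancel₀ (p-2) hp0.ne'] at key
  refine key.trans (le_of_eq ?_)
  unfold nrm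
  rw [← ENNReal.rpow_mul]
  congr 4
  field_simp

lemma enorm_mp_lip {p : ℝ} (hp : 2 ≤ p) (z w : ℂ) : ‖mp p z - mp p w‖ₑ ≤ ENNReal.ofReal p * (‖z‖ₑ ^ (p-2) + ‖w‖ₑ ^ (p-2)) * ‖z - w‖ₑ := by
  have := ENNReal.ofReal_le_ofReal (mp_lip hp z w)
  rw [ofReal_norm, ENNReal.ofReal_mul (by positivity), ENNReal.ofReal_mul (by linarith), ENNReal.ofReal_add (by positivity) (by positivity),
    ← ENNReal.ofReal_rpow_of_nonneg (norm_nonneg _) (by linarith), ← ENNReal.ofReal_rpow_of_nonneg (norm_nonneg _) (by linarith), ofReal_norm, ofReal_norm, ofReal_norm] at this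
  exact this

lemma diff_pair {p : ℝ} (hp : 2 ≤ p) {S g : Eu d → ℂ} (hS : Measurable S) (hg : Measurable g) (y : Eu d) :
    ∫⁻ x, ‖mp p (S (x + y)) - mp p (S x)‖ₑ * ‖g x‖ₑ ≤ ENNReal.ofReal p * 2 * nrm p S ^ (p-2) * nrm p (fun x => S (x + y) - S x) * nrm p g := by
  have hSy : Measurable fun x => S (x + y) := by fun_prop
  have hD : Measurable fun x => S (x + y) - S x := by fun_prop
  calc _ ≤ ∫⁻ x, ENNReal.ofReal p * ((‖S (x+y)‖ₑ ^ (p-2) * ‖S (x + y) - S x‖ₑ * ‖g x‖ₑ) + (‖S x‖ₑ ^ (p-2) * ‖S (x + y) - S x‖ₑ * ‖g x‖ₑ)) := by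
        refine lintegral_mono fun x => ?_
        refine (mul_le_mul_left (enorm_mp_lip hp (S (x+y)) (S x)) _).trans (le_of_eq ?_)
        ring
    _ = ENNReal.ofReal p * ((∫⁻ x, ‖S (x+y)‖ₑ ^ (p-2) * ‖S (x + y) - S x‖ₑ * ‖g x‖ₑ) + ∫⁻ x, ‖S x‖ₑ ^ (p-2) * ‖S (x + y) - S x‖ₑ * ‖g x‖ₑ) := by
        rw [lintegral_const_mul' _ _ (by simp), lintegral_add_left (by fun_prop)]
    _ ≤ ENNReal.ofReal p * (nrm p S ^ (p-2) * nrm p (fun x => S (x + y) - S x) * nrm p g + nrm p S ^ (p-2) * nrm p (fun x => S (x + y) - S x) * nrm p g) := by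
        refine mul_le_mul_right (add_le_add ?_ (tri_holder hp hS hD hg)) _
        have := tri_holder hp hSy hD hg
        rwa [nrm_shift S y] at this
    _ = _ := by ring

lemma pair_cv {p : ℝ} (hp : 2 ≤ p) {S g κ : Eu d → ℂ} (hS : NiceS S) (hg : NiceS g) (hκ : NiceS κ) (h0 : ∫ y, κ y = 0) :
    ‖∫ x, mp p (S x) * cv κ g x‖ₑ ≤ ∫⁻ y, ‖κ y‖ₑ * ∫⁻ x, ‖mp p (S (x + y)) - mp p (S x)‖ₑ * ‖g x‖ₑ := by
  obtain ⟨M, hM⟩ := mp_bdd hp hS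
  have hmS : Measurable fun x => mp p (S x) := (measurable_mp p).comp hS.meas
  have hI : Integrable (fun z : Eu d × Eu d => mp p (S z.1) * (κ z.2 * g (z.1 - z.2))) (volume.prod volume) := by
    refine Integrable.bdd_mul (c := M) (hκ.int.convolution_integrand (ContinuousLinearMap.mul ℂ ℂ) hg.int) (hmS.comp measurable_fst).aestronglyMeasurable ?_
    filter_upwards with z; exact hM _
  set c := ∫ x, mp p (S x) * g x with hc
  have hSg : Integrable fun x => mp p (S x) * g x := mp_int hp hS hg.int
  have e1 : ∫ x, mp p (S x) * cv κ g x = ∫ y, κ y * ∫ x, mp p (S (x + y)) * g x := by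
    calc _ = ∫ x, ∫ y, mp p (S x) * (κ y * g (x - y)) := by
          congr 1; funext x; unfold cv; rw [integral_const_mul]
      _ = ∫ y, ∫ x, mp p (S x) * (κ y * g (x - y)) := integral_integral_swap (f := fun x y => mp p (S x) * (κ y * g (x - y))) hI
      _ = _ := by
          congr 1; funext y
          rw [← integral_const_mul]
          rw [← integral_add_right_eq_self (fun x => mp p (S x) * (κ y * g (x - y))) y]
          congr 1; funext x
          rw [add_sub_cancel_right]; ring
  have hSy : ∀ y, NiceS fun x => S (x + y) := fun y => by
    obtain ⟨M, hM⟩ := hS.bdd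
    exact ⟨by have := hS.meas; fun_prop, ⟨M, fun x => hM _⟩, hS.int.comp_add_right y⟩
  have hSyg : ∀ y, Integrable fun x => mp p (S (x + y)) * g x := fun y => mp_int hp (hSy y) hg.int
  have hi1 : Integrable fun y => κ y * ∫ x, mp p (S (x + y)) * g x := by
    have mm : Measurable fun z : Eu d × Eu d => mp p (S (z.1 + z.2)) * g z.2 := by
      have := hS.meas; have := hg.meas; have := measurable_mp p; fun_prop
    have m2 : Measurable fun y => ∫ x, mp p (S (y + x)) * g x := (StronglyMeasurable.integral_prod_right (f := fun y x => mp p (S (y + x)) * g x) mm.stronglyMeasurable).measurable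
    simp_rw [fun x y : Eu d => add_comm x y]
    refine hκ.int.mul_bdd (c := M * ∫ x, ‖g x‖) m2.aestronglyMeasurable ?_
    filter_upwards with y
    rw [← integral_const_mul]
    refine norm_integral_le_of_norm_le (hg.int.norm.const_mul M) ?_
    filter_upwards with x
    rw [norm_mul]; gcongr; exact hM _
  have e2 : ∫ x, mp p (S x) * cv κ g x = ∫ y, κ y * ∫ x, (mp p (S (x + y)) - mp p (S x)) * g x := by
    have : ∫ y, κ y * c = 0 := by rw [integral_mul_const, h0, zero_mul]
    rw [e1, ← sub_zero (∫ y, κ y * ∫ x, mp p (S (x + y)) * g x), ← this, ← integral_sub hi1 (hκ.int.mul_const c)]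
    congr 1; funext y
    rw [← mul_sub, hc, ← integral_sub (hSyg y) hSg]
    simp_rw [sub_mul]
  rw [e2]
  refine (enorm_integral_le_lintegral_enorm _).trans (lintegral_mono fun y => ?_)
  rw [enorm_mul]
  refine mul_le_mul_right ((enorm_integral_le_lintegral_enorm _).trans (le_of_eq ?_)) _
  simp_rw [enorm_mul]

lemma key_pair {p l : ℝ} {K D : ℝ≥0∞} (hp : 2 ≤ p) {S g κ : Eu d → ℂ} (hS : NiceS S) (hg : NiceS g) (hκ : KernL K l κ)
    (hD : ∀ y, nrm p (fun x => S (x + y) - S x) ≤ D * ‖y‖ₑ) :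
    ‖∫ x, mp p (S x) * cv κ g x‖ₑ ≤ ENNReal.ofReal p * 2 * nrm p S ^ (p-2) * nrm p g * D * (K * ENNReal.ofReal l⁻¹) := by
  refine (pair_cv hp hS hg hκ.nice hκ.mean).trans ?_
  have hm : Measurable fun y : Eu d => ‖κ y‖ₑ * ‖y‖ₑ := by have := hκ.nice.meas; fun_prop
  calc _ ≤ ∫⁻ y, (ENNReal.ofReal p * 2 * nrm p S ^ (p-2) * nrm p g * D) * (‖κ y‖ₑ * ‖y‖ₑ) := by
        refine lintegral_mono fun y => ?_
        refine (mul_le_mul_right (diff_pair hp hS.meas hg.meas y) _).trans ?_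
        refine (mul_le_mul_right (mul_le_mul_left (mul_le_mul_right (hD y) _) _) _).trans (le_of_eq ?_)
        ring
    _ = _ := lintegral_const_mul _ hm
    _ ≤ _ := mul_le_mul_right hκ.mom _

lemma cv_shift {κ g : Eu d → ℂ} (hκ : NiceS κ) (hg : NiceS g) (x y : Eu d) : cv κ g (x + y) - cv κ g x = cv (fun z => κ (z + y) - κ z) g x := by
  obtain ⟨M, hM⟩ := hg.bdd
  have i1 : ∀ x, Integrable fun z => κ z * g (x - z) := fun x =>
    hκ.int.mul_bdd (c := M) (by have := hg.meas; exact (by fun_prop : Measurable fun z => g (x - z)).aestronglyMeasurable) (by filter_upwards with z; exact hM _)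
  have i2 : Integrable fun z => κ (z + y) * g (x - z) := by
    have := (i1 (x + y)).comp_add_right y
    refine this.congr ?_
    filter_upwards with z
    congr 2; abel
  unfold cv
  simp_rw [sub_mul]
  rw [integral_sub i2 (i1 x)]
  congr 1
  rw [← integral_add_right_eq_self _ y]
  congr 1; funext z
  congr 2; abel

lemma nrm_cv_shift {p l : ℝ} {K : ℝ≥0∞} (hp : 1 ≤ p) {κ g : Eu d → ℂ} (hκ : KernL K l κ) (hg : NiceS g) (y : Eu d) :
    nrm p (fun x => cv κ g (x + y) - cv κ g x) ≤ K * ENNReal.ofReal l * ‖y‖ₑ * nrm p g := by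
  simp_rw [cv_shift hκ.nice hg]
  refine (nrm_cv_le (by have := hκ.nice.meas; fun_prop) hg.meas hp).trans ?_
  exact mul_le_mul_left (hκ.lip y) _
end besov2
end Strz


open MeasureTheory Real Complex
open scoped FourierTransform ENNReal SchwartzMap RealInnerProductSpace
set_option linter.all false
set_option linter.unusedVariables false
set_option linter.unusedSimpArgs false
set_option linter.deprecated false
namespace Strz
section besov3
variable {d : ℕ}

lemma NiceS.sum {ι : Type*} (s : Finset ι) {f : ι → Eu d → ℂ} (hf : ∀ i, NiceS (f i)) : NiceS (fun x => ∑ i ∈ s, f i x) := by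
  classical
  induction s using Finset.induction_on with
  | empty => simpa using NiceS.zero
  | insert i s hi ih =>
    simp_rw [Finset.sum_insert hi]
    exact (hf i).add ih

lemma disc_schur : ∃ C : ℝ≥0∞, C ≠ ∞ ∧ ∀ (b : ℕ → ℝ≥0∞) (N : ℕ),
    ∑ n ∈ Finset.range N, ∑ k ∈ Finset.range N, tw (-|(n:ℝ) - k|) * b n * b k ≤ C * ∑ n ∈ Finset.range N, b n ^ (2:ℝ) := by
  obtain ⟨C, hC, h⟩ := tw_geom (ε := 1) one_pos
  refine ⟨C, hC, fun b N => ?_⟩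
  have hN : ∀ c : ℝ, ∑' n : ℕ, tw (-|(n:ℝ) - c|) ≤ C := by
    intro c
    have := ENNReal.tsum_comp_le_tsum_of_injective (Nat.cast_injective (R := ℤ)) (fun n : ℤ => tw (-1 * |(n:ℝ) - c|))
    refine le_trans (le_of_eq ?_) (this.trans (h c))
    simp
  set b' : ℕ → ℝ≥0∞ := fun n => if n < N then b n else 0 with hb'
  have key := schur_tsum (fun n k : ℕ => tw (-|(n:ℝ) - k|)) b' b' C (fun n => by
    refine le_trans (le_of_eq ?_) (hN n)
    congr 1; funext k; rw [abs_sub_comm]) (fun k => hN k)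
  have e1 : ∑' n, b' n ^ (2:ℝ) = ∑ n ∈ Finset.range N, b n ^ (2:ℝ) := by
    rw [tsum_eq_sum (s := Finset.range N)]
    · refine Finset.sum_congr rfl fun n hn => ?_
      simp [hb', Finset.mem_range.1 hn]
    · intro n hn
      have : ¬ n < N := by simpa using hn
      simp [hb', this]
  rw [e1, mul_assoc, ← ENNReal.rpow_add_of_nonneg _ _ (by norm_num) (by norm_num)] at key
  norm_num at key
  refine le_trans ?_ (key.trans (le_of_eq (by simp)))
  calc _ = ∑ n ∈ Finset.range N, ∑ k ∈ Finset.range N, tw (-|(n:ℝ) - k|) * b' n * b' k := by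
        refine Finset.sum_congr rfl fun n hn => Finset.sum_congr rfl fun k hk => ?_
        simp [hb', Finset.mem_range.1 hn, Finset.mem_range.1 hk]
    _ ≤ ∑ n ∈ Finset.range N, ∑' k : ℕ, tw (-|(n:ℝ) - k|) * b' n * b' k := Finset.sum_le_sum fun n _ => ENNReal.sum_le_tsum _
    _ ≤ _ := ENNReal.sum_le_tsum _

lemma besov {p : ℝ} (hp : 2 ≤ p) {K : ℝ≥0∞} (hK : K ≠ ∞) : ∃ C : ℝ≥0∞, C ≠ ∞ ∧ ∀ (M : ℝ) (κ g : ℕ → Eu d → ℂ),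
    (∀ n : ℕ, KernL K ((2:ℝ) ^ (n - M)) (κ n)) → (∀ n, NiceS (g n)) → ∀ N : ℕ,
    nrm p (fun x => ∑ n ∈ Finset.range N, cv (κ n) (g n) x) ^ (2:ℝ) ≤ C * ∑ n ∈ Finset.range N, nrm p (g n) ^ (2:ℝ) := by
  obtain ⟨C, hC, hs⟩ := disc_schur
  refine ⟨ENNReal.ofReal p * (ENNReal.ofReal p * 2 * K * K) * C, by finiteness, fun M κ g hκ hg N => ?_⟩
  have hp0 : 0 < p := by linarith
  set b : ℕ → ℝ≥0∞ := fun n => nrm p (g n) with hb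
  set S : ℕ → Eu d → ℂ := fun n x => ∑ k ∈ Finset.range n, cv (κ k) (g k) x with hS
  have hf : ∀ k, NiceS (cv (κ k) (g k)) := fun k => NiceS.cv (hκ k).nice (hg k)
  have hSn : ∀ n, NiceS (S n) := fun n => NiceS.sum _ hf
  obtain ⟨m, hm, hmax⟩ := Finset.exists_max_image (Finset.range (N+1)) (fun n => nrm p (S n)) ⟨0, by simp⟩
  set A := nrm p (S m) with hA
  have hAt : A ≠ ∞ := (hSn m).nrm_ne_top (by linarith)
  have hmN : m ≤ N := by have := Finset.mem_range.1 hm; omega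
  have hD : ∀ n y, nrm p (fun x => S n (x + y) - S n x) ≤ (∑ k ∈ Finset.range n, K * ENNReal.ofReal ((2:ℝ)^((k:ℝ)-M)) * b k) * ‖y‖ₑ := by
    intro n y
    have e : (fun x => S n (x + y) - S n x) = fun x => ∑ k ∈ Finset.range n, (cv (κ k) (g k) (x + y) - cv (κ k) (g k) x) := by
      funext x; simp [hS]
    rw [e]
    refine (nrm_sum_le (by linarith) _ fun k => ?_).trans ?_
    · have := (hf k).meas; fun_prop
    · rw [Finset.sum_mul]
      refine Finset.sum_le_sum fun k _ => ?_
      refine (nrm_cv_shift (by linarith) (hκ k) (hg k) y).trans (le_of_eq ?_)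
      ring
  have hE : ∀ n < N, nrm p (S (n+1)) ^ p ≤ nrm p (S n) ^ p + ENNReal.ofReal p * (ENNReal.ofReal p * 2 * K * K) * A ^ (p-2) * ∑ k ∈ Finset.range N, tw (-|(n:ℝ) - k|) * b n * b k := by
    intro n hn
    have h1 := step hp (hSn n) (hf n)
    have e : S (n+1) = fun x => S n x + cv (κ n) (g n) x := by
      funext x; simp [hS, Finset.sum_range_succ]
    have h2 := key_pair hp (hSn (n+1)) (hg n) (hκ n) (hD (n+1))
    rw [e] at h2 ⊢
    refine h1.trans (add_le_add le_rfl ?_)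
    rw [mul_assoc, mul_assoc]
    refine mul_le_mul_right (h2.trans ?_) _
    rw [← e]
    have h3 : nrm p (S (n+1)) ^ (p-2) ≤ A ^ (p-2) := ENNReal.rpow_le_rpow (hmax _ (by simp; omega)) (by linarith)
    have h4 : (∑ k ∈ Finset.range (n+1), K * ENNReal.ofReal ((2:ℝ)^((k:ℝ)-M)) * b k) * (K * ENNReal.ofReal ((2:ℝ)^((n:ℝ)-M))⁻¹) * b n ≤ K * K * ∑ k ∈ Finset.range N, tw (-|(n:ℝ) - k|) * b n * b k := by
      rw [Finset.sum_mul, Finset.sum_mul, Finset.mul_sum]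
      refine le_trans (Finset.sum_le_sum (g := fun k : ℕ => K * K * (tw (-|(n:ℝ) - k|) * b n * b k)) fun k hk => le_of_eq ?_) (Finset.sum_le_sum_of_subset (fun k hk => by simp at hk ⊢; omega))
      have hk' : (k:ℝ) ≤ n := by exact_mod_cast (by simpa [Nat.lt_succ_iff] using hk)
      have e2 : ENNReal.ofReal ((2:ℝ)^((k:ℝ)-M)) * ENNReal.ofReal ((2:ℝ)^((n:ℝ)-M))⁻¹ = tw (-|(n:ℝ) - k|) := by
        rw [abs_of_nonneg (by linarith), ← Real.rpow_neg (by norm_num), ← tw_ofReal, ← tw_ofReal, ← tw_add]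
        congr 1; ring
      rw [← e2]; ring
    calc _ = ENNReal.ofReal p * 2 * nrm p (S (n+1)) ^ (p-2) * ((∑ k ∈ Finset.range (n+1), K * ENNReal.ofReal ((2:ℝ)^((k:ℝ)-M)) * b k) * (K * ENNReal.ofReal ((2:ℝ)^((n:ℝ)-M))⁻¹) * b n) := by
          simp only [hb]; ring
      _ ≤ ENNReal.ofReal p * 2 * A ^ (p-2) * (K * K * ∑ k ∈ Finset.range N, tw (-|(n:ℝ) - k|) * b n * b k) := mul_le_mul' (mul_le_mul_right h3 _) h4
      _ = _ := by ring
  have hsum : ∀ j ≤ N, nrm p (S j) ^ p ≤ ∑ n ∈ Finset.range j, ENNReal.ofReal p * (ENNReal.ofReal p * 2 * K * K) * A ^ (p-2) * ∑ k ∈ Finset.range N, tw (-|(n:ℝ) - k|) * b n * b k := by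
    intro j
    induction j with
    | zero =>
      intro _
      have : nrm p (S 0) = 0 := by
        simp [hS, nrm, ENNReal.zero_rpow_of_pos hp0, hp0]
      rw [this, ENNReal.zero_rpow_of_pos hp0]; simp
    | succ j ih =>
      intro hj
      rw [Finset.sum_range_succ]
      exact (hE j (by omega)).trans (add_le_add (ih (by omega)) le_rfl)
  have h5 := hsum m hmN
  have h6 : A ^ p ≤ A ^ (p-2) * (ENNReal.ofReal p * (ENNReal.ofReal p * 2 * K * K) * C * ∑ n ∈ Finset.range N, b n ^ (2:ℝ)) := by
    refine h5.trans ?_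
    refine (Finset.sum_le_sum_of_subset (Finset.range_subset_range.2 hmN)).trans ?_
    rw [← Finset.mul_sum]
    refine (mul_le_mul_right (hs b N) _).trans (le_of_eq ?_)
    ring
  have h7 : A ^ (2:ℝ) ≤ ENNReal.ofReal p * (ENNReal.ofReal p * 2 * K * K) * C * ∑ n ∈ Finset.range N, b n ^ (2:ℝ) := by
    rcases eq_or_ne A 0 with h0 | h0
    · rw [h0, ENNReal.zero_rpow_of_pos (by norm_num)]; exact zero_le
    · rw [show p = (p-2) + 2 by ring, ENNReal.rpow_add _ _ h0 hAt] at h6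
      rw [show p - 2 + 2 - 2 = p - 2 by ring, show p - 2 + 2 = p by ring] at h6
      exact (ENNReal.mul_le_mul_iff_right (ENNReal.rpow_pos (pos_iff_ne_zero.2 h0) hAt).ne' (ENNReal.rpow_ne_top_of_nonneg (by linarith) hAt)).1 h6
  refine le_trans (ENNReal.rpow_le_rpow (hmax N (by simp)) (by norm_num)) h7
end besov3
end Strz


open MeasureTheory Real Complex
open scoped FourierTransform ENNReal SchwartzMap RealInnerProductSpace
set_option linter.all false
set_option linter.unusedVariables false
set_option linter.unusedSimpArgs false
set_option linter.deprecated false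
namespace Strz
section besovdual
variable {d : ℕ}

lemma KernL.refl' {K : ℝ≥0∞} {l : ℝ} {κ : Eu d → ℂ} (h : KernL K l κ) : KernL K l (fun y => κ (-y)) := by
  have hm := h.nice.meas
  refine ⟨⟨by fun_prop, ?_, h.nice.int.comp_neg⟩, ?_, ?_, ?_, ?_⟩
  · obtain ⟨M, hM⟩ := h.nice.bdd; exact ⟨M, fun y => hM _⟩
  · rw [lintegral_neg_eq_self (fun y => ‖κ y‖ₑ)]; exact h.l1
  · rw [integral_neg_eq_self (fun y => κ y)]; exact h.mean
  · have := lintegral_neg_eq_self (μ := volume) (fun y => ‖κ y‖ₑ * ‖y‖ₑ)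
    simp only [enorm_neg] at this
    rw [this]; exact h.mom
  · intro y
    have := lintegral_neg_eq_self (μ := volume) (fun x => ‖κ (x - y) - κ x‖ₑ)
    calc _ = ∫⁻ x, ‖κ (-x - y) - κ (-x)‖ₑ := by congr 1; funext x; rw [neg_add']
      _ = _ := this
      _ ≤ _ := by simpa [sub_eq_add_neg] using h.lip (-y)

lemma cv_adj {κ f g : Eu d → ℂ} (hκ : NiceS κ) (hf : NiceS f) (hg : NiceS g) :
    ∫ x, cv κ f x * g x = ∫ x, f x * cv (fun y => κ (-y)) g x := by
  obtain ⟨M, hM⟩ := hg.bdd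
  have hI : Integrable (fun z : Eu d × Eu d => g z.1 * (κ z.2 * f (z.1 - z.2))) (volume.prod volume) := by
    refine Integrable.bdd_mul (c := M) (hκ.int.convolution_integrand (ContinuousLinearMap.mul ℂ ℂ) hf.int) (hg.meas.comp measurable_fst).aestronglyMeasurable ?_
    filter_upwards with z; exact hM _
  obtain ⟨M', hM'⟩ := hf.bdd
  have hκ' : NiceS (fun y => κ (-y)) := ⟨by have := hκ.meas; fun_prop, by obtain ⟨M, hM⟩ := hκ.bdd; exact ⟨M, fun y => hM _⟩, hκ.int.comp_neg⟩
  have hI2 : Integrable (fun z : Eu d × Eu d => f z.1 * (κ (- z.2) * g (z.1 - z.2))) (volume.prod volume) := by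
    refine Integrable.bdd_mul (c := M') (hκ'.int.convolution_integrand (ContinuousLinearMap.mul ℂ ℂ) hg.int) (hf.meas.comp measurable_fst).aestronglyMeasurable ?_
    filter_upwards with z; exact hM' _
  calc _ = ∫ x, ∫ y, g x * (κ y * f (x - y)) := by
        congr 1; funext x; unfold cv; rw [integral_const_mul, mul_comm]
    _ = ∫ y, ∫ x, g x * (κ y * f (x - y)) := integral_integral_swap (f := fun x y => g x * (κ y * f (x - y))) hI
    _ = ∫ y, ∫ x, g (x + y) * (κ y * f x) := by
        congr 1; funext y
        rw [← integral_add_right_eq_self (fun x => g x * (κ y * f (x - y))) y]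
        simp
    _ = ∫ y, ∫ x, g (x - y) * (κ (-y) * f x) := by
        rw [← integral_neg_eq_self (fun y => ∫ x, g (x + y) * (κ y * f x))]
        simp [sub_eq_add_neg]
    _ = ∫ y, ∫ x, f x * (κ (-y) * g (x - y)) := by
        congr 1; funext y; congr 1; funext x; ring
    _ = ∫ x, ∫ y, f x * (κ (-y) * g (x - y)) := (integral_integral_swap (f := fun x y => f x * (κ (-y) * g (x - y))) hI2).symm
    _ = _ := by
        congr 1; funext x; unfold cv; rw [integral_const_mul]

lemma dualfun {r p : ℝ} (hr : 1 < r) (hr2 : r ≤ 2) (hrp : r.HolderConjugate p) {h : Eu d → ℂ} (hh : NiceS h) {ε : ℝ} (hε : 0 < ε) :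
    ∃ g : Eu d → ℂ, NiceS g ∧ ‖∫ x, h x * g x‖ₑ = nrm r ({x | ε < ‖h x‖}.indicator h) ^ (2:ℝ) ∧ (∃ c : ℝ, 0 ≤ c ∧ ∫ x, h x * g x = c) ∧ 
      nrm p g ≤ nrm r ({x | ε < ‖h x‖}.indicator h) := by
  have hr0 : 0 < r := by linarith
  have hp0 : 0 < p := hrp.symm.pos
  have hms : MeasurableSet {x | ε < ‖h x‖} := measurableSet_lt measurable_const hh.meas.norm
  set k := {x | ε < ‖h x‖}.indicator h with hk
  have hkn : NiceS k := hh.indicator hms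
  have hkm := hkn.meas
  set J := ∫ x, ‖k x‖ ^ r with hJ
  have hJ0 : 0 ≤ J := integral_nonneg fun x => by positivity
  have hb : nrm r k = ENNReal.ofReal (J ^ (1/r)) := by
    rw [← ENNReal.ofReal_rpow_of_nonneg hJ0 (by positivity), ← nrm_rpow_ofReal hkn hr.le, ← ENNReal.rpow_mul, mul_one_div_cancel hr0.ne', ENNReal.rpow_one]
  set c := J ^ ((2-r)/r) with hc
  have hc0 : 0 ≤ c := by positivity
  set g : Eu d → ℂ := fun x => ((c * ‖k x‖ ^ (r-2) : ℝ) : ℂ) * (starRingEnd ℂ) (k x) with hg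
  have hcase : ∀ x, k x = 0 ∨ (ε < ‖k x‖ ∧ k x = h x) := by
    intro x
    by_cases hx : ε < ‖h x‖
    · right
      have : k x = h x := Set.indicator_of_mem (show x ∈ {x | ε < ‖h x‖} from hx) _
      rw [this]; exact ⟨hx, rfl⟩
    · left; exact Set.indicator_of_notMem (show x ∉ {x | ε < ‖h x‖} from hx) _
  have hgn : ∀ x, ‖g x‖ = c * ‖k x‖ ^ (r-1) := by
    intro x
    simp only [hg]
    rw [norm_mul, RCLike.norm_conj, Complex.norm_real, Real.norm_of_nonneg (by positivity), mul_assoc]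
    rcases hcase x with h0 | h1
    · rw [h0]; simp [Real.zero_rpow (by linarith : r - 1 ≠ 0)]
    · have : 0 < ‖k x‖ := hε.trans h1.1
      rw [← Real.rpow_add_one this.ne']; congr 2; ring
  have hgm : Measurable g := by
    simp only [hg]
    exact (Complex.measurable_ofReal.comp ((hkm.norm.pow_const _).const_mul c)).mul (Complex.continuous_conj.measurable.comp hkm)
  have hgN : NiceS g := by
    refine ⟨hgm, ?_, ?_⟩
    · obtain ⟨M, hM⟩ := hkn.bdd
      refine ⟨c * M ^ (r-1), fun x => ?_⟩
      rw [hgn x]; gcongr; 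
      exact hM x
    · refine Integrable.mono' (hkn.int.norm.const_mul (c * ε ^ (r-2))) hgm.aestronglyMeasurable ?_
      filter_upwards with x
      rw [hgn x, mul_assoc]
      refine mul_le_mul_of_nonneg_left ?_ hc0
      rcases hcase x with h0 | h1
      · rw [h0]; simp [Real.zero_rpow (by linarith : r - 1 ≠ 0)]
      · have hk0 : 0 < ‖k x‖ := hε.trans h1.1
        rw [show r - 1 = (r-2) + 1 by ring, Real.rpow_add_one hk0.ne']
        refine mul_le_mul_of_nonneg_right (Real.rpow_le_rpow_of_nonpos hε h1.1.le (by linarith)) hk0.le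
  have hpt : ∀ x, h x * g x = ((c * ‖k x‖ ^ r : ℝ) : ℂ) := by
    intro x
    rcases hcase x with h0 | h1
    · simp only [hg]; rw [h0]; simp [Real.zero_rpow hr0.ne']
    · have hk0 : 0 < ‖k x‖ := hε.trans h1.1
      simp only [hg]; rw [← h1.2]
      have : k x * (starRingEnd ℂ) (k x) = ((‖k x‖ ^ 2 : ℝ) : ℂ) := by rw [Complex.mul_conj, Complex.normSq_eq_norm_sq]
      rw [mul_left_comm, this, ← Complex.ofReal_mul]
      congr 1
      rw [mul_assoc, ← Real.rpow_two, ← Real.rpow_add hk0]; congr 2; ring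
  have hIntg : ∫ x, h x * g x = ((c * J : ℝ) : ℂ) := by
    simp_rw [hpt]
    rw [integral_complex_ofReal, integral_const_mul]
  have hcJ : c * J = (J ^ (1/r)) ^ (2:ℝ) := by
    rw [← Real.rpow_mul hJ0]
    rcases eq_or_lt_of_le hJ0 with h0 | h0
    · rw [← h0, mul_zero, Real.zero_rpow (by positivity)]
    · rw [hc, ← Real.rpow_add_one h0.ne']; congr 1; field_simp; ring
  refine ⟨g, hgN, ?_, ⟨c * J, by positivity, hIntg⟩, ?_⟩
  · rw [hIntg, hb, hcJ, ENNReal.ofReal_rpow_of_nonneg (by positivity) (by norm_num), ← ofReal_norm, Complex.norm_real, Real.norm_of_nonneg (by positivity)]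
  · have hp1 : 1 ≤ p := hrp.symm.lt.le
    have : nrm p g ^ p = ENNReal.ofReal (c ^ p * J) := by
      rw [nrm_rpow_ofReal hgN hp1]
      congr 1
      rw [hJ, ← integral_const_mul]
      congr 1; funext x
      rw [hgn x, Real.mul_rpow hc0 (by positivity), ← Real.rpow_mul (norm_nonneg _)]
      congr 2
      have := hrp.sub_one_mul_conj; exact this
    rw [hb]
    have h2 : nrm p g = (nrm p g ^ p) ^ (1/p) := by rw [← ENNReal.rpow_mul, mul_one_div_cancel hp0.ne', ENNReal.rpow_one]
    rw [h2, this, ENNReal.ofReal_rpow_of_nonneg (by positivity) (by positivity)]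
    refine ENNReal.ofReal_le_ofReal (le_of_eq ?_)
    rw [Real.mul_rpow (by positivity) hJ0, ← Real.rpow_mul hc0, mul_one_div_cancel hp0.ne', Real.rpow_one]
    have hpi : 1/p = 1 - 1/r := by have := hrp.inv_add_inv_eq_one; rw [one_div, one_div]; linarith
    rcases eq_or_lt_of_le hJ0 with h0 | h0
    · rw [← h0, Real.zero_rpow (by positivity : (1/p) ≠ 0), mul_zero, Real.zero_rpow (by positivity)]
    · rw [hc, ← Real.rpow_add h0, hpi]; congr 1; field_simp; ring

lemma NiceS.mul {f g : Eu d → ℂ} (hf : NiceS f) (hg : NiceS g) : Integrable (fun x => f x * g x) := by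
  obtain ⟨M, hM⟩ := hf.bdd
  exact Integrable.bdd_mul (c := M) hg.int hf.meas.aestronglyMeasurable (by filter_upwards with x; exact hM x)

lemma besov_dual {r : ℝ} (hr : 1 < r) (hr2 : r ≤ 2) {K : ℝ≥0∞} (hK : K ≠ ∞) : ∃ C : ℝ≥0∞, C ≠ ∞ ∧ ∀ (M : ℝ) (κ : ℕ → Eu d → ℂ) (f : Eu d → ℂ),
    (∀ n : ℕ, KernL K ((2:ℝ) ^ (n - M)) (κ n)) → NiceS f → ∀ N : ℕ,
    ∑ n ∈ Finset.range N, nrm r (cv (κ n) f) ^ (2:ℝ) ≤ C * nrm r f ^ (2:ℝ) := by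
  set p := r.conjExponent with hp
  have hrp : r.HolderConjugate p := Real.HolderConjugate.conjExponent hr
  have hp2 : 2 ≤ p := by
    rw [hp, Real.conjExponent, le_div_iff₀ (by linarith)]; linarith
  obtain ⟨C, hC, hbes⟩ := besov (d := d) hp2 hK
  refine ⟨C, hC, fun M κ f hκ hf N => ?_⟩
  have hh : ∀ n, NiceS (cv (κ n) f) := fun n => NiceS.cv (hκ n).nice hf
  have main : ∀ ε : ℝ, 0 < ε → ∑ n ∈ Finset.range N, nrm r ({x | ε < ‖cv (κ n) f x‖}.indicator (cv (κ n) f)) ^ (2:ℝ) ≤ C * nrm r f ^ (2:ℝ) := by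
    intro ε hε
    choose g hg h1 h2 h3 using fun n => dualfun hr hr2 hrp (hh n) hε
    set b : ℕ → ℝ≥0∞ := fun n => nrm r ({x | ε < ‖cv (κ n) f x‖}.indicator (cv (κ n) f)) with hb
    choose c hc0 hc using h2
    set X := ∑ n ∈ Finset.range N, b n ^ (2:ℝ) with hX
    have hXt : X ≠ ∞ := by
      refine ENNReal.sum_ne_top.2 fun n _ => ENNReal.rpow_ne_top_of_nonneg (by norm_num) (NiceS.nrm_ne_top (NiceS.indicator (hh n) ?_) hr.le)
      exact measurableSet_lt measurable_const (hh n).meas.norm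
    have e1 : X = ‖∑ n ∈ Finset.range N, ∫ x, cv (κ n) f x * g n x‖ₑ := by
      simp_rw [hc]
      rw [← Complex.ofReal_sum, ← ofReal_norm, Complex.norm_real, Real.norm_of_nonneg (Finset.sum_nonneg fun n _ => hc0 n), ENNReal.ofReal_sum_of_nonneg fun n _ => hc0 n]
      refine Finset.sum_congr rfl fun n _ => ?_
      rw [hb]; simp only []
      rw [← h1 n, hc, ← ofReal_norm, Complex.norm_real, Real.norm_of_nonneg (hc0 n)]
    have e2 : ∑ n ∈ Finset.range N, ∫ x, cv (κ n) f x * g n x = ∫ x, f x * ∑ n ∈ Finset.range N, cv (fun y => κ n (-y)) (g n) x := by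
      simp_rw [Finset.mul_sum]
      rw [integral_finset_sum _ fun n _ => hf.mul (NiceS.cv (hκ n).refl'.nice (hg n))]
      exact Finset.sum_congr rfl fun n _ => cv_adj (hκ n).nice hf (hg n)
    have hb2 := hbes M (fun n y => κ n (-y)) g (fun n => (hκ n).refl') hg N
    set Y := nrm p (fun x => ∑ n ∈ Finset.range N, cv (fun y => κ n (-y)) (g n) x) with hY
    have h4 : X ≤ nrm r f * Y := by
      rw [e1, e2]
      refine (enorm_integral_le_lintegral_enorm _).trans ?_
      simp_rw [enorm_mul]
      exact nrm_holder hrp hf.meas (NiceS.sum _ fun n => NiceS.cv (hκ n).refl'.nice (hg n)).meas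
    have h5 : Y ^ (2:ℝ) ≤ C * X := by
      refine hb2.trans (mul_le_mul_right (Finset.sum_le_sum fun n _ => ENNReal.rpow_le_rpow (h3 n) (by norm_num)) _)
    have h6 : X ^ (2:ℝ) ≤ (C * nrm r f ^ (2:ℝ)) * X := by
      refine (ENNReal.rpow_le_rpow h4 (by norm_num : (0:ℝ) ≤ 2)).trans ?_
      rw [ENNReal.mul_rpow_of_nonneg _ _ (by norm_num)]
      refine (mul_le_mul_right h5 _).trans (le_of_eq ?_)
      ring
    rcases eq_or_ne X 0 with h0 | h0
    · rw [h0]; exact zero_le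
    · have e : X ^ (2:ℝ) = X * X := by rw [ENNReal.rpow_two, sq]
      rw [e] at h6
      exact (ENNReal.mul_le_mul_iff_left h0 hXt).1 h6
  have lim : ∀ n, Filter.Tendsto (fun k : ℕ => nrm r ({x | 1/((k:ℝ)+1) < ‖cv (κ n) f x‖}.indicator (cv (κ n) f)) ^ (2:ℝ)) Filter.atTop (nhds (nrm r (cv (κ n) f) ^ (2:ℝ))) := by
    intro n
    refine (ENNReal.continuous_rpow_const.tendsto _).comp ?_
    unfold nrm
    refine (ENNReal.continuous_rpow_const.tendsto _).comp ?_
    have hm := (hh n).meas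
    have hms : ∀ k : ℕ, MeasurableSet {x | 1/((k:ℝ)+1) < ‖cv (κ n) f x‖} := fun k => measurableSet_lt measurable_const hm.norm
    refine lintegral_tendsto_of_tendsto_of_monotone (fun k => ((hm.indicator (hms k)).enorm.pow_const _).aemeasurable) ?_ ?_
    · filter_upwards with x
      intro i j hij
      simp only []
      refine ENNReal.rpow_le_rpow ?_ (by linarith)
      by_cases hx : 1/((i:ℝ)+1) < ‖cv (κ n) f x‖
      · have hx2 : 1/((j:ℝ)+1) < ‖cv (κ n) f x‖ := by
          refine lt_of_le_of_lt ?_ hx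
          have : (i:ℝ) ≤ j := by exact_mod_cast hij
          gcongr
        rw [Set.indicator_of_mem (show x ∈ {x | 1/((i:ℝ)+1) < ‖cv (κ n) f x‖} from hx), Set.indicator_of_mem (show x ∈ {x | 1/((j:ℝ)+1) < ‖cv (κ n) f x‖} from hx2)]
      · rw [Set.indicator_of_notMem (show x ∉ {x | 1/((i:ℝ)+1) < ‖cv (κ n) f x‖} from hx)]; simp
    · filter_upwards with x
      rcases eq_or_ne (cv (κ n) f x) 0 with h0 | h0
      · have : ∀ k : ℕ, {x | 1/((k:ℝ)+1) < ‖cv (κ n) f x‖}.indicator (cv (κ n) f) x = 0 := fun k => Set.indicator_apply_eq_zero.2 fun _ => h0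
        simp_rw [this, h0]; exact tendsto_const_nhds
      · have hp : 0 < ‖cv (κ n) f x‖ := norm_pos_iff.2 h0
        refine tendsto_const_nhds.congr' ?_
        filter_upwards [(tendsto_one_div_add_atTop_nhds_zero_nat (𝕜 := ℝ)).eventually (gt_mem_nhds hp)] with k hk
        rw [Set.indicator_of_mem (show x ∈ {x | 1/((k:ℝ)+1) < ‖cv (κ n) f x‖} from hk)]
  exact le_of_tendsto' (tendsto_finset_sum _ fun n _ => lim n) fun k => main _ (by positivity)
end besovdual
end Strz


open MeasureTheory Real Complex
open scoped FourierTransform ENNReal SchwartzMap RealInnerProductSpace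
set_option linter.all false
set_option linter.unusedVariables false
set_option linter.unusedSimpArgs false
set_option linter.deprecated false
namespace Strz
section mink
variable {d : ℕ}

lemma rpow_pred' (x : ℝ≥0∞) {P : ℝ} (hP : 1 ≤ P) : x ^ P = x ^ (P-1) * x := by
  have := ENNReal.rpow_add_of_nonneg (x := x) (P-1) 1 (by linarith) zero_le_one
  rwa [ENNReal.rpow_one, sub_add_cancel] at this

lemma mink_fin {Ω : Type*} [MeasurableSpace Ω] {μ : Measure Ω} {P : ℝ} (hP : 1 ≤ P) (s : Finset ℕ) (ψ : ℕ → Ω → ℝ≥0∞) (hm : ∀ n, Measurable (ψ n)) (hf : ∀ n, ∫⁻ x, ψ n x ∂μ ≠ ∞) :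
    ∑ n ∈ s, (∫⁻ x, ψ n x ∂μ) ^ P ≤ (∫⁻ x, (∑ n ∈ s, ψ n x ^ P) ^ (1/P) ∂μ) ^ P := by
  have hP0 : 0 < P := by linarith
  rcases eq_or_lt_of_le hP with h1 | h1
  · rw [← h1]; simp only [ENNReal.rpow_one, div_one]
    rw [lintegral_finset_sum _ fun n _ => hm n]
  have hpq : P.HolderConjugate P.conjExponent := Real.HolderConjugate.conjExponent h1
  set Q := P.conjExponent
  set x : ℕ → ℝ≥0∞ := fun n => ∫⁻ x, ψ n x ∂μ with hx
  set X := ∑ n ∈ s, x n ^ P with hX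
  set I := ∫⁻ x, (∑ n ∈ s, ψ n x ^ P) ^ (1/P) ∂μ with hI
  have hXt : X ≠ ∞ := ENNReal.sum_ne_top.2 fun n _ => ENNReal.rpow_ne_top_of_nonneg hP0.le (hf n)
  have e1 : ∀ n, x n ^ P = ∫⁻ y, x n ^ (P-1) * ψ n y ∂μ := by
    intro n
    rw [lintegral_const_mul' _ _ (ENNReal.rpow_ne_top_of_nonneg (by linarith) (hf n))]
    exact rpow_pred' _ hP
  have h2 : X ≤ X ^ (1/Q) * I := by
    calc X = ∫⁻ y, ∑ n ∈ s, x n ^ (P-1) * ψ n y ∂μ := by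
          rw [lintegral_finset_sum _ fun n _ => (hm n).const_mul _]
          exact Finset.sum_congr rfl fun n _ => e1 n
      _ ≤ ∫⁻ y, X ^ (1/Q) * (∑ n ∈ s, ψ n y ^ P) ^ (1/P) ∂μ := by
          refine lintegral_mono fun y => ?_
          refine (ENNReal.inner_le_Lp_mul_Lq s (fun n => x n ^ (P-1)) (fun n => ψ n y) hpq.symm).trans (le_of_eq ?_)
          congr 2
          refine Finset.sum_congr rfl fun n _ => ?_
          rw [← ENNReal.rpow_mul, hpq.sub_one_mul_conj]
      _ = _ := by rw [lintegral_const_mul' _ _ (ENNReal.rpow_ne_top_of_nonneg (by have := hpq.symm.pos; positivity) hXt)]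
  rcases eq_or_ne X 0 with h0 | h0
  · rw [h0]; exact zero_le
  · have h3 : X = X ^ (1/Q) * X ^ (1/P) := by
      rw [← ENNReal.rpow_add _ _ h0 hXt]
      have := hpq.inv_add_inv_eq_one
      rw [one_div, one_div, add_comm, this, ENNReal.rpow_one]
    have h4 : X ^ (1/P) ≤ I := by
      have h5 : X ^ (1/Q) * X ^ (1/P) ≤ X ^ (1/Q) * I := h3 ▸ h2
      exact (ENNReal.mul_le_mul_iff_right (ENNReal.rpow_pos (pos_iff_ne_zero.2 h0) hXt).ne' (ENNReal.rpow_ne_top_of_nonneg (by have := hpq.symm.pos; positivity) hXt)).1 h5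
    calc X = (X ^ (1/P)) ^ P := by rw [← ENNReal.rpow_mul, one_div_mul_cancel hP0.ne', ENNReal.rpow_one]
      _ ≤ _ := ENNReal.rpow_le_rpow h4 hP0.le

lemma Nice.mN_int_ne_top {F : ℝ × Eu d → ℂ} (hF : Nice F) {α β : ℝ} (hα : 0 < α) (hβ : 1 ≤ β) : ∫⁻ s, nrm β (fun y => F (s, y)) ^ α ≠ ∞ := by
  obtain ⟨M, R, h⟩ := hF.bd
  have hβ0 : 0 < β := by linarith
  set c : ℝ≥0∞ := (ENNReal.ofReal M ^ (β-1) * ENNReal.ofReal M) ^ (1/β)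
  have hn : ∀ s, nrm β (fun y => F (s, y)) ≤ (Set.Icc (-|R|) |R|).indicator (fun _ => c) s := by
    intro s
    by_cases hs : s ∈ Set.Icc (-|R|) |R|
    · rw [Set.indicator_of_mem hs]
      unfold nrm
      refine ENNReal.rpow_le_rpow ?_ (by positivity)
      calc _ ≤ ∫⁻ y, ENNReal.ofReal M ^ (β-1) * ‖F (s, y)‖ₑ := by
            refine lintegral_mono fun y => ?_
            have e : ‖F (s, y)‖ₑ ^ β = ‖F (s, y)‖ₑ ^ (β-1) * ‖F (s, y)‖ₑ := rpow_pred' _ hβ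
            rw [e]
            refine mul_le_mul_left (ENNReal.rpow_le_rpow ?_ (by linarith)) _
            rw [← ofReal_norm]; exact ENNReal.ofReal_le_ofReal ((h s).1 y)
        _ = _ := lintegral_const_mul' _ _ (ENNReal.rpow_ne_top_of_nonneg (by linarith) (by simp))
        _ ≤ _ := mul_le_mul_right (h s).2.1 _
    · have : ∀ y, F (s, y) = 0 := (h s).2.2 (by
        by_contra h'
        push Not at h'
        exact hs (abs_le.1 (h'.trans (le_abs_self R))))
      simp [nrm, this, hβ0]
  refine ne_top_of_le_ne_top ?_ (lintegral_mono fun s => ENNReal.rpow_le_rpow (hn s) hα.le)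
  have e : ∀ s, (Set.Icc (-|R|) |R|).indicator (fun _ => c) s ^ α = (Set.Icc (-|R|) |R|).indicator (fun _ => c ^ α) s := by
    intro s
    by_cases hs : s ∈ Set.Icc (-|R|) |R| <;> simp [hs, ENNReal.zero_rpow_of_pos hα]
  simp_rw [e]
  rw [lintegral_indicator_const measurableSet_Icc, Real.volume_Icc]
  have : (0:ℝ) ≤ 1/β := by positivity
  have : 0 ≤ β - 1 := by linarith
  simp only [c]
  finiteness

lemma besov_mixed {α β : ℝ} (hα : 1 ≤ α) (hα2 : α ≤ 2) (hβ : 1 < β) (hβ2 : β ≤ 2) {K : ℝ≥0∞} (hK : K ≠ ∞) : ∃ C : ℝ≥0∞, C ≠ ∞ ∧ ∀ (M : ℝ) (κ : ℕ → Eu d → ℂ) (F : ℝ × Eu d → ℂ),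
    (∀ n : ℕ, KernL K ((2:ℝ) ^ (n - M)) (κ n)) → Nice F → ∀ N : ℕ,
    ∑ n ∈ Finset.range N, mN α β (cvF (κ n) F) ^ (2:ℝ) ≤ C * mN α β F ^ (2:ℝ) := by
  obtain ⟨C, hC, h⟩ := besov_dual (d := d) hβ hβ2 hK
  have hα0 : 0 < α := by linarith
  refine ⟨C, hC, fun M κ F hκ hF N => ?_⟩
  have hcF : ∀ n, Nice (cvF (κ n) F) := fun n => hF.cvF (hκ n).nice
  have h2α : 1 ≤ 2/α := by rw [le_div_iff₀ hα0]; linarith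
  have e : ∀ G : ℝ × Eu d → ℂ, mN α β G ^ (2:ℝ) = (∫⁻ s, nrm β (fun y => G (s, y)) ^ α) ^ (2/α) := by
    intro G; unfold mN; rw [← ENNReal.rpow_mul]; congr 1; field_simp
  simp_rw [e]
  refine (mink_fin h2α _ (fun n s => nrm β (fun y => cvF (κ n) F (s, y)) ^ α) (fun n => (measurable_nrm β (hcF n).meas).pow_const _) (fun n => (hcF n).mN_int_ne_top hα0 hβ.le)).trans ?_
  have h3 : ∫⁻ s, (∑ n ∈ Finset.range N, (nrm β (fun y => cvF (κ n) F (s, y)) ^ α) ^ (2/α)) ^ (1/(2/α)) ≤ C ^ (α/2) * ∫⁻ s, nrm β (fun y => F (s, y)) ^ α := by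
    rw [← lintegral_const_mul' _ _ (ENNReal.rpow_ne_top_of_nonneg (by positivity) hC)]
    refine lintegral_mono fun s => ?_
    have h4 := h M κ (fun y => F (s, y)) hκ (hF.slice s) N
    have h5 := ENNReal.rpow_le_rpow h4 (show (0:ℝ) ≤ α/2 by positivity)
    rw [ENNReal.mul_rpow_of_nonneg _ _ (by positivity), ← ENNReal.rpow_mul, show (2:ℝ) * (α/2) = α by ring] at h5
    refine le_trans (le_of_eq ?_) h5
    rw [one_div_div]
    congr 1
    refine Finset.sum_congr rfl fun n _ => ?_
    rw [← ENNReal.rpow_mul, mul_div_cancel₀ _ hα0.ne']; rfl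
  refine (ENNReal.rpow_le_rpow h3 (by positivity)).trans (le_of_eq ?_)
  rw [ENNReal.mul_rpow_of_nonneg _ _ (by positivity), ← ENNReal.rpow_mul, show α/2 * (2/α) = 1 by field_simp, ENNReal.rpow_one]
end mink
end Strz


open MeasureTheory Real Complex
open scoped FourierTransform ENNReal SchwartzMap RealInnerProductSpace
set_option linter.all false
set_option linter.unusedVariables false
set_option linter.unusedSimpArgs false
set_option linter.deprecated false
namespace Strz
section dil
variable {d : ℕ}

lemma lint_smul {l : ℝ} (hl : 0 < l) (f : Eu d → ℝ≥0∞) : ∫⁻ y, f (l • y) = ENNReal.ofReal (l ^ d)⁻¹ * ∫⁻ y, f y := by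
  have h := Measure.map_addHaar_smul (volume : Measure (Eu d)) hl.ne'
  have h2 : ∫⁻ y, f y ∂(Measure.map (fun y : Eu d => l • y) volume) = ∫⁻ y, f (l • y) :=
    (Homeomorph.smulOfNeZero l hl.ne').measurableEmbedding.lintegral_map f
  rw [← h2]
  have h3 : (fun y : Eu d => l • y) = (l • ·) := rfl
  rw [h3, h, lintegral_smul_measure]
  simp [abs_of_pos (inv_pos.2 (pow_pos hl d)), abs_of_pos hl]

noncomputable def dil (l : ℝ) (κ : Eu d → ℂ) (y : Eu d) : ℂ := ((l ^ d : ℝ) : ℂ) * κ (l • y)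

lemma enorm_lpow {l : ℝ} (hl : 0 < l) : ‖((l ^ d : ℝ) : ℂ)‖ₑ = ENNReal.ofReal (l ^ d) := by
  rw [← ofReal_norm, Complex.norm_real, Real.norm_of_nonneg (by positivity)]

lemma ofReal_mul_inv {x : ℝ} (hx : 0 < x) : ENNReal.ofReal x * ENNReal.ofReal x⁻¹ = 1 := by
  rw [← ENNReal.ofReal_mul hx.le, mul_inv_cancel₀ hx.ne', ENNReal.ofReal_one]

lemma KernL.dil {K : ℝ≥0∞} {κ : Eu d → ℂ} (h : KernL K 1 κ) {l : ℝ} (hl : 0 < l) : KernL K l (dil l κ) := by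
  have hm := h.nice.meas
  have hld : 0 < l ^ d := pow_pos hl d
  have key : ∀ f : Eu d → ℝ≥0∞, ∫⁻ y, ENNReal.ofReal (l ^ d) * f (l • y) = ∫⁻ y, f y := by
    intro f
    rw [lintegral_const_mul' _ _ (by simp), lint_smul hl, ← mul_assoc, ofReal_mul_inv hld, one_mul]
  refine ⟨⟨?_, ?_, ?_⟩, ?_, ?_, ?_, ?_⟩
  · unfold Strz.dil; fun_prop
  · obtain ⟨M, hM⟩ := h.nice.bdd
    refine ⟨l ^ d * M, fun y => ?_⟩
    unfold Strz.dil
    rw [norm_mul, Complex.norm_real, Real.norm_of_nonneg hld.le]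
    gcongr; exact hM _
  · exact (h.nice.int.comp_smul hl.ne').const_mul _
  · refine le_trans (le_of_eq ?_) h.l1
    rw [← key (fun y => ‖κ y‖ₑ)]; unfold Strz.dil; simp_rw [enorm_mul, enorm_lpow hl]
  · unfold Strz.dil
    rw [integral_const_mul, Measure.integral_comp_smul]
    rw [h.mean]; simp
  · refine le_trans (le_of_eq ?_) (mul_le_mul_left h.mom (ENNReal.ofReal l⁻¹) |>.trans (le_of_eq ?_))
    · rw [← key (fun y => ‖κ y‖ₑ * ‖y‖ₑ), ← lintegral_mul_const' _ _ (by simp)]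
      congr 1; funext y; unfold Strz.dil; rw [enorm_mul, enorm_lpow hl, enorm_smul]
      have : ‖l‖ₑ * ENNReal.ofReal l⁻¹ = 1 := by
        rw [← ofReal_norm, Real.norm_of_nonneg hl.le, ofReal_mul_inv hl]
      calc _ = ENNReal.ofReal (l^d) * ‖κ (l • y)‖ₑ * ‖y‖ₑ * 1 := by ring
        _ = _ := by rw [← this]; ring
    · simp
  · intro y
    refine le_trans (le_of_eq ?_) ((h.lip (l • y)).trans (le_of_eq ?_))
    · rw [← key (fun x => ‖κ (x + l • y) - κ x‖ₑ)]; congr 1; funext x; unfold Strz.dil; rw [← mul_sub, enorm_mul, enorm_lpow hl, smul_add]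
    · rw [enorm_smul, ← ofReal_norm l, Real.norm_of_nonneg hl.le]; simp; ring

lemma fourier_dil {κ : Eu d → ℂ} {l : ℝ} (hl : 0 < l) (ξ : Eu d) : 𝓕 (dil l κ) ξ = 𝓕 κ (l⁻¹ • ξ) := by
  have hld : 0 < l ^ d := pow_pos hl d
  rw [fourier_uexp, fourier_uexp]
  unfold dil
  have := Measure.integral_comp_smul (volume : Measure (Eu d)) (fun y => uexp (-(2 * π * ⟪y, l⁻¹ • ξ⟫)) * κ y) l
  calc _ = ∫ y, ((l ^ d : ℝ) : ℂ) * (uexp (-(2 * π * ⟪l • y, l⁻¹ • ξ⟫)) * κ (l • y)) := by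
        congr 1; funext y
        rw [inner_smul_left, inner_smul_right]
        simp [hl.ne']; ring
    _ = _ := by
        rw [integral_const_mul, this]
        simp [abs_of_pos hl]
        rw [← mul_assoc, mul_inv_cancel₀ (by exact_mod_cast hld.ne'), one_mul]

lemma SW.nice (κ : 𝓢(Eu d, ℂ)) : NiceS κ := by
  refine ⟨κ.continuous.measurable, ?_, κ.integrable⟩
  obtain ⟨C, hC⟩ := κ.decay 0 0
  exact ⟨C, fun y => by simpa using hC.2 y⟩

lemma SW.kern (κ : 𝓢(Eu d, ℂ)) (h0 : ∫ y, κ y = 0) : ∃ K : ℝ≥0∞, K ≠ ∞ ∧ KernL K 1 κ := by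
  set D := SchwartzMap.fderivCLM ℝ (Eu d) ℂ κ with hD
  have hDi : Integrable D := D.integrable
  have hmo : Integrable fun x => ‖x‖ ^ 1 * ‖κ x‖ := κ.integrable_pow_mul volume 1
  set A := ∫⁻ y, ‖κ y‖ₑ
  set B := ∫⁻ y, ‖κ y‖ₑ * ‖y‖ₑ with hB
  set E := ∫⁻ y, ‖D y‖ₑ with hE
  have hA : A ≠ ∞ := κ.integrable.2.ne
  have hBt : B ≠ ∞ := by
    have := hmo.2.ne
    refine ne_of_eq_of_ne ?_ this
    rw [hB]; congr 1; funext y; rw [enorm_mul]; simp; ring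
  have hEt : E ≠ ∞ := hDi.2.ne
  have hDe : ∀ x, D x = fderiv ℝ κ x := fun x => rfl
  refine ⟨A + B + E, by finiteness, SW.nice κ, ?_, h0, ?_, ?_⟩
  · rw [add_assoc]; exact le_self_add
  · simp; rw [add_right_comm]; exact le_add_self
  · intro y
    have h1 : ∀ x, ‖κ (x + y) - κ x‖ₑ ≤ ∫⁻ t in Set.Ioc (0:ℝ) 1, ‖D (x + t • y)‖ₑ * ‖y‖ₑ := by
      intro x
      have hder : ∀ t : ℝ, HasDerivAt (fun t : ℝ => κ (x + t • y)) (D (x + t • y) y) t := by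
        intro t
        have h2 : HasFDerivAt κ (D (x + t • y)) (x + t • y) := by
          rw [hDe]; exact κ.differentiableAt.hasFDerivAt
        have h3 : HasDerivAt (fun t : ℝ => x + t • y) y t := by
          simpa using ((hasDerivAt_id t).smul_const y).const_add x
        exact h2.comp_hasDerivAt t h3
      have hc : Continuous fun t : ℝ => D (x + t • y) y := by
        have := D.continuous
        fun_prop
      have := intervalIntegral.integral_eq_sub_of_hasDerivAt (a := 0) (b := 1) (fun t _ => hder t) (hc.intervalIntegrable _ _)
      simp only [one_smul, zero_smul, add_zero] at this
      rw [← this, intervalIntegral.integral_of_le zero_le_one]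
      refine (enorm_integral_le_lintegral_enorm _).trans (lintegral_mono fun t => ?_)
      exact ContinuousLinearMap.le_opENorm _ _
    refine (lintegral_mono h1).trans ?_
    have hDm : Measurable fun z : Eu d × ℝ => ‖D (z.1 + z.2 • y)‖ₑ * ‖y‖ₑ := by
      have := D.continuous
      have h : Continuous fun z : Eu d × ℝ => D (z.1 + z.2 • y) := by fun_prop
      exact (h.enorm.measurable).mul_const _
    rw [lintegral_lintegral_swap (f := fun x t => ‖D (x + t • y)‖ₑ * ‖y‖ₑ) hDm.aemeasurable]
    have h2 : ∀ t : ℝ, ∫⁻ x, ‖D (x + t • y)‖ₑ * ‖y‖ₑ = E * ‖y‖ₑ := by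
      intro t
      rw [lintegral_mul_const' _ _ (by simp), lintegral_add_right_eq_self (fun x => ‖D x‖ₑ)]
    simp_rw [h2]
    simp
    exact mul_le_mul_left le_add_self _
end dil
end Strz


open MeasureTheory Real Complex
open scoped FourierTransform ENNReal SchwartzMap RealInnerProductSpace
set_option linter.all false
set_option linter.unusedVariables false
set_option linter.unusedSimpArgs false
set_option linter.deprecated false
namespace Strz
section cutoff
variable {d : ℕ}

noncomputable def eta (ξ : Eu d) : ℝ := Real.smoothTransition (2 - ‖ξ‖^2)
noncomputable def phi (ξ : Eu d) : ℝ := eta ξ - eta ((2:ℝ) • ξ)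
noncomputable def psi (ξ : Eu d) : ℝ := eta ((1/2:ℝ) • ξ) - eta ((4:ℝ) • ξ)

open scoped ContDiff in
lemma eta_smooth : ContDiff ℝ ∞ (eta (d := d)) := by
  unfold eta
  exact Real.smoothTransition.contDiff.comp (contDiff_const.sub (contDiff_norm_sq ℝ))

lemma eta_one {ξ : Eu d} (h : ‖ξ‖^2 ≤ 1) : eta ξ = 1 := Real.smoothTransition.one_of_one_le (by linarith)
lemma eta_zero {ξ : Eu d} (h : 2 ≤ ‖ξ‖^2) : eta ξ = 0 := Real.smoothTransition.zero_of_nonpos (by linarith)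
lemma eta_nonneg (ξ : Eu d) : 0 ≤ eta ξ := Real.smoothTransition.nonneg _
lemma eta_le_one (ξ : Eu d) : eta ξ ≤ 1 := Real.smoothTransition.le_one _

lemma nsq_smul (c : ℝ) (ξ : Eu d) : ‖c • ξ‖^2 = c^2 * ‖ξ‖^2 := by
  rw [norm_smul, mul_pow, Real.norm_eq_abs, sq_abs]

lemma phi_nonneg (ξ : Eu d) : 0 ≤ phi ξ := by
  unfold phi eta
  rw [nsq_smul, sub_nonneg]
  exact Real.smoothTransition.monotone (by nlinarith [sq_nonneg ‖ξ‖])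

lemma phi_le_one (ξ : Eu d) : phi ξ ≤ 1 := by
  unfold phi; linarith [eta_le_one ξ, eta_nonneg ((2:ℝ) • ξ)]

lemma phi_amp : Amp (phi (d := d)) := by
  refine ⟨?_, ?_, ?_⟩
  · unfold phi
    exact eta_smooth.sub (eta_smooth.comp (contDiff_const_smul _))
  · intro ξ h
    unfold phi
    rw [eta_one (by linarith), eta_one (by rw [nsq_smul]; linarith), sub_self]
  · intro ξ h
    unfold phi
    rw [eta_zero h.le, eta_zero (by rw [nsq_smul]; linarith), sub_self]

lemma phi_supp {ξ : Eu d} (h : phi ξ ≠ 0) : 1/4 ≤ ‖ξ‖^2 ∧ ‖ξ‖^2 ≤ 2 :=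
  ⟨not_lt.1 fun h' => h (phi_amp.low ξ h'), not_lt.1 fun h' => h (phi_amp.high ξ h')⟩

lemma psi_one {ξ : Eu d} (h : phi ξ ≠ 0) : psi ξ = 1 := by
  obtain ⟨h1, h2⟩ := phi_supp h
  unfold psi
  rw [eta_one (by rw [nsq_smul]; linarith), eta_zero (by rw [nsq_smul]; linarith), sub_zero]

open scoped ContDiff in
lemma exists_kernel : ∃ (K : ℝ≥0∞) (κ : Eu d → ℂ), K ≠ ⊤ ∧ KernL K 1 κ ∧ ∀ ξ, phi ξ ≠ 0 → 𝓕 κ ξ = 1 := by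
  have hcs : HasCompactSupport (fun ξ : Eu d => ((psi ξ : ℝ) : ℂ)) := by
    refine HasCompactSupport.of_support_subset_isCompact (isCompact_closedBall (0 : Eu d) 3) fun ξ hξ => ?_
    by_contra hc
    have : 3 < ‖ξ‖ := by simpa using hc
    apply hξ
    simp only [psi]
    rw [eta_zero (by rw [nsq_smul]; nlinarith), eta_zero (by rw [nsq_smul]; nlinarith)]; simp
  have hsm : ContDiff ℝ ∞ (fun ξ : Eu d => ((psi ξ : ℝ) : ℂ)) := by
    have : ContDiff ℝ ∞ (psi (d := d)) := by
      unfold psi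
      exact (eta_smooth.comp (contDiff_const_smul _)).sub (eta_smooth.comp (contDiff_const_smul _))
    exact Complex.ofRealCLM.contDiff.comp this
  set Ψ : 𝓢(Eu d, ℂ) := hcs.toSchwartzMap hsm with hΨ
  have hΨe : ∀ ξ, Ψ ξ = psi ξ := fun ξ => rfl
  set κ : 𝓢(Eu d, ℂ) := 𝓕⁻ Ψ with hκ
  have hF : ∀ ξ, 𝓕 (κ : Eu d → ℂ) ξ = psi ξ := by
    intro ξ
    rw [← hΨe, ← SchwartzMap.fourier_coe, hκ, FourierTransform.fourier_fourierInv_eq]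
  have h0 : ∫ y, κ y = 0 := by
    have := hF 0
    rw [fourier_uexp] at this
    simp [uexp, psi, eta_one] at this
    exact this
  obtain ⟨K, hK, h⟩ := SW.kern κ h0
  exact ⟨K, κ, hK, h, fun ξ hξ => by rw [hF, psi_one hξ]; simp⟩

/-- dyadic piece -/
noncomputable def phin (m : ℝ) (ξ : Eu d) : ℝ := phi ((2:ℝ) ^ (-m) • ξ)
noncomputable def Phi (M : ℕ) (ξ : Eu d) : ℝ := ∑ n ∈ Finset.range (2*M), phin ((n:ℝ) - M) ξ

lemma Phi_eq (M : ℕ) (ξ : Eu d) : Phi M ξ = eta ((2:ℝ)^(1 - (M:ℝ)) • ξ) - eta ((2:ℝ) ^ (1 + (M:ℝ)) • ξ) := by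
  unfold Phi
  have := Finset.sum_range_sub (fun n : ℕ => eta ((2:ℝ) ^ (1 + (M:ℝ) - n) • ξ)) (2*M)
  calc _ = ∑ n ∈ Finset.range (2*M), (eta ((2:ℝ) ^ (1 + (M:ℝ) - ((n+1:ℕ):ℝ)) • ξ) - eta ((2:ℝ) ^ (1 + (M:ℝ) - n) • ξ)) := by
        refine Finset.sum_congr rfl fun n _ => ?_
        unfold phin phi
        have e : (2:ℝ) * (2:ℝ) ^ (-((n:ℝ) - M)) = (2:ℝ) ^ (1 + (M:ℝ) - n) := by
          rw [show 1 + (M:ℝ) - n = 1 + (-((n:ℝ) - M)) by ring, Real.rpow_add (by norm_num), Real.rpow_one]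
        rw [smul_smul, e]
        congr 4
        push_cast; ring
    _ = _ := by
        rw [this]; congr 2
        · congr 2; push_cast; ring
        · simp

lemma Phi_nonneg (M : ℕ) (ξ : Eu d) : 0 ≤ Phi M ξ := Finset.sum_nonneg fun n _ => phi_nonneg _
lemma Phi_le_one (M : ℕ) (ξ : Eu d) : Phi M ξ ≤ 1 := by
  rw [Phi_eq]; linarith [eta_le_one ((2:ℝ)^(1 - (M:ℝ)) • ξ), eta_nonneg ((2:ℝ) ^ (1 + (M:ℝ)) • ξ)]

lemma Phi_tendsto {ξ : Eu d} (h : ξ ≠ 0) : Filter.Tendsto (fun M => Phi M ξ) Filter.atTop (nhds 1) := by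
  have hp : 0 < ‖ξ‖ := norm_pos_iff.2 h
  have h1 : Filter.Tendsto (fun M : ℕ => ((1/2:ℝ)) ^ M) Filter.atTop (nhds 0) := tendsto_pow_atTop_nhds_zero_of_lt_one (by norm_num) (by norm_num)
  have e1 : Filter.Tendsto (fun M : ℕ => ‖(2:ℝ)^(1 - (M:ℝ)) • ξ‖^2) Filter.atTop (nhds 0) := by
    have : Filter.Tendsto (fun M : ℕ => (2 * (1/2:ℝ) ^ M)^2 * ‖ξ‖^2) Filter.atTop (nhds ((2*0)^2*‖ξ‖^2)) := ((h1.const_mul 2).pow 2).mul_const _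
    simp only [mul_zero, ne_eq, OfNat.ofNat_ne_zero, not_false_eq_true, zero_pow, zero_mul] at this
    refine this.congr fun M => ?_
    rw [nsq_smul, Real.rpow_sub (by norm_num), Real.rpow_one, Real.rpow_natCast]; congr 2; simp [div_eq_mul_inv]
  have e2 : Filter.Tendsto (fun M : ℕ => ((2:ℝ) ^ M)) Filter.atTop Filter.atTop := tendsto_pow_atTop_atTop_of_one_lt (by norm_num)
  refine tendsto_const_nhds.congr' ?_
  filter_upwards [e1.eventually (gt_mem_nhds one_pos), e2.eventually (Filter.eventually_ge_atTop (1/‖ξ‖))] with M h2 h3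
  rw [Phi_eq, eta_one h2.le, eta_zero, sub_zero]
  rw [nsq_smul, Real.rpow_add (by norm_num), Real.rpow_one, Real.rpow_natCast]
  rw [div_le_iff₀ hp] at h3
  nlinarith
end cutoff
end Strz


open MeasureTheory Real Complex
open scoped FourierTransform ENNReal SchwartzMap RealInnerProductSpace
set_option linter.all false
set_option linter.unusedVariables false
set_option linter.unusedSimpArgs false
set_option linter.deprecated false
namespace Strz
section scaling
variable {d : ℕ}

lemma lint_smul_gen {E : Type*} [NormedAddCommGroup E] [NormedSpace ℝ E] [MeasurableSpace E] [BorelSpace E] [FiniteDimensional ℝ E] (μ : Measure E) [μ.IsAddHaarMeasure]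
    {l : ℝ} (hl : 0 < l) (f : E → ℝ≥0∞) : ∫⁻ y, f (l • y) ∂μ = ENNReal.ofReal (l ^ Module.finrank ℝ E)⁻¹ * ∫⁻ y, f y ∂μ := by
  have h := Measure.map_addHaar_smul μ hl.ne'
  have h2 : ∫⁻ y, f y ∂(Measure.map (fun y : E => l • y) μ) = ∫⁻ y, f (l • y) ∂μ :=
    (Homeomorph.smulOfNeZero l hl.ne').measurableEmbedding.lintegral_map f
  rw [← h2]
  have h3 : (fun y : E => l • y) = (l • ·) := rfl
  rw [h3, h, lintegral_smul_measure]
  simp [abs_of_pos hl]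

/-- parabolic dilation -/
noncomputable def DF (l : ℝ) (F : ℝ × Eu d → ℂ) (z : ℝ × Eu d) : ℂ := F ((l^4)⁻¹ * z.1, l⁻¹ • z.2)

lemma Nice.DF {F : ℝ × Eu d → ℂ} (hF : Nice F) {l : ℝ} (hl : 0 < l) : Nice (DF l F) := by
  obtain ⟨M, R, h⟩ := hF.bd
  have hM : 0 ≤ M := (norm_nonneg _).trans ((h 0).1 0)
  refine ⟨?_, M + l^d * M, l^4 * R, fun s => ⟨fun y => ?_, ?_, fun hs y => ?_⟩⟩
  · have := hF.meas
    unfold Strz.DF; fun_prop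
  · exact ((h _).1 _).trans (by have : 0 ≤ l^d * M := by positivity
                                linarith)
  · unfold Strz.DF
    rw [lint_smul (inv_pos.2 hl) (fun y => ‖F ((l^4)⁻¹ * s, y)‖ₑ)]
    refine (mul_le_mul_right (h _).2.1 _).trans ?_
    rw [← ENNReal.ofReal_mul (by positivity)]
    refine ENNReal.ofReal_le_ofReal ?_
    rw [inv_pow, inv_inv]; linarith
  · refine (h _).2.2 ?_ _
    rw [abs_mul, abs_of_pos (by positivity), inv_mul_eq_div, lt_div_iff₀ (by positivity)]; linarith

lemma nrm_scale {β : ℝ} (hβ : 0 < β) {l : ℝ} (hl : 0 < l) (f : Eu d → ℂ) : nrm β (fun y => f (l⁻¹ • y)) = ENNReal.ofReal l ^ ((d:ℝ)/β) * nrm β f := by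
  unfold nrm
  rw [lint_smul (inv_pos.2 hl) (fun y => ‖f y‖ₑ ^ β), inv_pow, inv_inv, ENNReal.mul_rpow_of_nonneg _ _ (by positivity)]
  congr 1
  rw [ENNReal.ofReal_pow hl.le, ← ENNReal.rpow_natCast, ← ENNReal.rpow_mul]; congr 1; ring

lemma mN_scale {α β : ℝ} (hα : 0 < α) (hβ : 0 < β) {l : ℝ} (hl : 0 < l) (F : ℝ × Eu d → ℂ) :
    mN α β (DF l F) = ENNReal.ofReal l ^ ((d:ℝ)/β + 4/α) * mN α β F := by
  have hl0 : ENNReal.ofReal l ≠ 0 := by simpa using hl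
  unfold mN DF
  simp only []
  simp_rw [fun s => nrm_scale hβ hl (fun y => F ((l^4)⁻¹ * s, y))]
  simp_rw [ENNReal.mul_rpow_of_nonneg _ _ hα.le]
  rw [lintegral_const_mul' _ _ (ENNReal.rpow_ne_top_of_nonneg hα.le (ENNReal.rpow_ne_top_of_nonneg (by positivity) (by simp)))]
  have := lint_smul_gen (volume : Measure ℝ) (l := (l^4)⁻¹) (by positivity) (fun s => nrm β (fun y => F (s, y)) ^ α)
  simp only [smul_eq_mul] at this
  rw [this, ENNReal.mul_rpow_of_nonneg _ _ (by positivity), ENNReal.mul_rpow_of_nonneg _ _ (by positivity), ← ENNReal.rpow_mul, ← mul_assoc]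
  congr 1
  rw [mul_one_div_cancel hα.ne', ENNReal.rpow_one, ENNReal.rpow_add _ _ hl0 (by simp)]
  congr 1
  simp only [Module.finrank_self, pow_one, inv_inv]
  rw [ENNReal.ofReal_pow hl.le, ← ENNReal.rpow_natCast, ← ENNReal.rpow_mul]; congr 1; push_cast; ring

lemma fourier_scale {f : Eu d → ℂ} {l : ℝ} (hl : 0 < l) (η : Eu d) : 𝓕 (fun y => f (l⁻¹ • y)) η = ((l^d : ℝ) : ℂ) * 𝓕 f (l • η) := by
  have h := fourier_dil (κ := f) (inv_pos.2 hl) η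
  rw [inv_inv] at h
  rw [← h]
  have hld : ((l^d : ℝ) : ℂ) ≠ 0 := by exact_mod_cast (pow_pos hl d).ne'
  rw [fourier_uexp, fourier_uexp, ← integral_const_mul]
  congr 1; funext y
  unfold dil
  rw [inv_pow]; push_cast; push_cast at hld; field_simp

lemma om_smul {l : ℝ} (hl : 0 < l) (η : Eu d) : om (l • η) = l^4 * om η := by
  unfold om; rw [norm_smul, Real.norm_of_nonneg hl.le]; ring

lemma fm_scale {a : Eu d → ℝ} {l : ℝ} (hl : 0 < l) (τ : ℝ) (f g : Eu d → ℂ) :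
    fm (fun ξ => a (l⁻¹ • ξ)) τ f g = (((l^d)⁻¹ : ℝ) : ℂ) * fm a (l^4 * τ) (fun y => f (l⁻¹ • y)) (fun y => g (l⁻¹ • y)) := by
  have hld : ((l^d : ℝ) : ℂ) ≠ 0 := by exact_mod_cast (pow_pos hl d).ne'
  have := Measure.integral_comp_smul (volume : Measure (Eu d)) (fun ξ => (a (l⁻¹ • ξ) : ℂ) * uexp (τ * om ξ) * 𝓕 f ξ * (starRingEnd ℂ) (𝓕 g ξ)) l
  simp only [smul_smul, inv_mul_cancel₀ hl.ne', one_smul, om_smul hl, finrank_euclideanSpace, Fintype.card_fin, abs_of_pos (inv_pos.2 (pow_pos hl d))] at this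
  unfold fm
  simp_rw [fourier_scale hl, map_mul, Complex.conj_ofReal]
  have e : ∀ ξ, (a ξ : ℂ) * uexp (l^4 * τ * om ξ) * (((l^d:ℝ):ℂ) * 𝓕 f (l • ξ)) * (((l^d:ℝ):ℂ) * (starRingEnd ℂ) (𝓕 g (l • ξ))) = (((l^d:ℝ):ℂ) * ((l^d:ℝ):ℂ)) * ((a ξ : ℂ) * uexp (τ * (l^4 * om ξ)) * 𝓕 f (l • ξ) * (starRingEnd ℂ) (𝓕 g (l • ξ))) := by
    intro ξ; rw [show l^4 * τ * om ξ = τ * (l^4 * om ξ) by ring]; ring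
  simp_rw [e]
  rw [integral_const_mul, this, Complex.real_smul]
  push_cast; push_cast at hld; field_simp

lemma Bf_scale {a : Eu d → ℝ} {l : ℝ} (hl : 0 < l) {S : Set (ℝ × ℝ)} (hS : MeasurableSet S) (F G : ℝ × Eu d → ℂ) :
    Bf (fun ξ => a (l⁻¹ • ξ)) S F G = (((l^d)⁻¹ * (l^8)⁻¹ : ℝ) : ℂ) * Bf a {z | (l^4)⁻¹ • z ∈ S} (DF l F) (DF l G) := by
  have hl4 : 0 < l^4 := by positivity
  have hS' : MeasurableSet {z : ℝ × ℝ | (l^4)⁻¹ • z ∈ S} := by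
    exact (measurable_const_smul (l^4)⁻¹ : Measurable fun z : ℝ × ℝ => (l^4)⁻¹ • z) hS
  unfold Bf
  rw [← integral_indicator hS, ← integral_indicator hS']
  set h : ℝ × ℝ → ℂ := fun z => fm a (z.2 - z.1) (fun y => DF l F (z.1, y)) (fun y => DF l G (z.2, y)) with hh
  have e : ∀ z, S.indicator (fun z : ℝ × ℝ => fm (fun ξ => a (l⁻¹ • ξ)) (z.2 - z.1) (fun y => F (z.1, y)) (fun y => G (z.2, y))) z
      = (((l^d)⁻¹ : ℝ) : ℂ) * ({z : ℝ × ℝ | (l^4)⁻¹ • z ∈ S}.indicator h) (l^4 • z) := by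
    intro z
    by_cases hz : z ∈ S
    · rw [Set.indicator_of_mem hz, Set.indicator_of_mem (show l^4 • z ∈ {z : ℝ × ℝ | (l^4)⁻¹ • z ∈ S} by
        show (l^4)⁻¹ • l^4 • z ∈ S
        rwa [smul_smul, inv_mul_cancel₀ hl4.ne', one_smul]), fm_scale hl]
      simp only [hh, DF, Prod.smul_fst, Prod.smul_snd, smul_eq_mul, inv_mul_cancel_left₀ hl4.ne', mul_sub]
    · rw [Set.indicator_of_notMem hz, Set.indicator_of_notMem (show ¬ (l^4 • z ∈ {z : ℝ × ℝ | (l^4)⁻¹ • z ∈ S}) by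
        show ¬ ((l^4)⁻¹ • l^4 • z ∈ S)
        rwa [smul_smul, inv_mul_cancel₀ hl4.ne', one_smul]), mul_zero]
  simp_rw [e]
  have vp : (volume : Measure (ℝ × ℝ)).IsAddHaarMeasure := by
    change ((volume : Measure ℝ).prod (volume : Measure ℝ)).IsAddHaarMeasure; infer_instance
  rw [integral_const_mul, Measure.integral_comp_smul, Complex.real_smul]
  simp only [Module.finrank_prod, Module.finrank_self]
  rw [abs_of_pos (by positivity), ← mul_assoc]
  congr 1
  push_cast; ring

lemma Wf_scale {l : ℝ} (hl : 0 < l) (G : ℝ × Eu d → ℂ) (η : Eu d) :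
    Wf G (l • η) = (((l^4)⁻¹ * (l^d)⁻¹ : ℝ) : ℂ) * Wf (DF l G) η := by
  have hl4 : 0 < l^4 := by positivity
  have hld : ((l^d : ℝ) : ℂ) ≠ 0 := by exact_mod_cast (pow_pos hl d).ne'
  unfold Wf
  have h := Measure.integral_comp_smul (volume : Measure ℝ) (fun s => uexp (-(s * om η)) * FH (DF l G) s η) (l^4)
  have e : ∀ s : ℝ, uexp (-(s * om (l • η))) * FH G s (l • η) = (((l^d)⁻¹ : ℝ) : ℂ) * (uexp (-((l^4 • s) * om η)) * FH (DF l G) (l^4 • s) η) := by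
    intro s
    rw [om_smul hl]
    unfold FH DF
    simp only [smul_eq_mul, inv_mul_cancel_left₀ hl4.ne']
    rw [fourier_scale (f := fun y => G (s, y)) hl, show s * (l^4 * om η) = l^4 * s * om η by ring]
    push_cast; push_cast at hld; field_simp
  simp_rw [e]
  rw [integral_const_mul, h, Complex.real_smul]
  simp only [Module.finrank_self, pow_one, abs_of_pos (inv_pos.2 hl4)]
  rw [← mul_assoc]
  congr 1
  push_cast; ring

lemma QW_scale {a : Eu d → ℝ} {l : ℝ} (hl : 0 < l) (G : ℝ × Eu d → ℂ) :
    QW (fun ξ => a (l⁻¹ • ξ)) G = ENNReal.ofReal l ^ (-(d:ℝ) - 8) * QW a (DF l G) := by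
  have hl0 : ENNReal.ofReal l ≠ 0 := by simpa using hl
  unfold QW
  have h := lint_smul hl (fun ξ : Eu d => ‖a (l⁻¹ • ξ)‖ₑ * ‖Wf G ξ‖ₑ ^ (2:ℝ))
  have h2 : ∫⁻ ξ : Eu d, ‖a (l⁻¹ • ξ)‖ₑ * ‖Wf G ξ‖ₑ ^ (2:ℝ) = ENNReal.ofReal (l^d) * ∫⁻ ξ, ‖a (l⁻¹ • l • ξ)‖ₑ * ‖Wf G (l • ξ)‖ₑ ^ (2:ℝ) := by
    rw [h, ← mul_assoc, ofReal_mul_inv (by positivity), one_mul]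
  rw [h2]
  have e : ∀ ξ : Eu d, ‖a (l⁻¹ • l • ξ)‖ₑ * ‖Wf G (l • ξ)‖ₑ ^ (2:ℝ) = ENNReal.ofReal l ^ (-8 - 2*(d:ℝ)) * (‖a ξ‖ₑ * ‖Wf (DF l G) ξ‖ₑ ^ (2:ℝ)) := by
    intro ξ
    rw [Wf_scale hl, enorm_mul, smul_smul, inv_mul_cancel₀ hl.ne', one_smul, ENNReal.mul_rpow_of_nonneg _ _ (by norm_num)]
    have : ‖(((l^4)⁻¹ * (l^d)⁻¹ : ℝ) : ℂ)‖ₑ ^ (2:ℝ) = ENNReal.ofReal l ^ (-8 - 2*(d:ℝ)) := by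
      rw [← ofReal_norm, Complex.norm_real, Real.norm_of_nonneg (by positivity), ENNReal.ofReal_rpow_of_nonneg (by positivity) (by norm_num),
        ENNReal.ofReal_rpow_of_pos hl]
      congr 1
      rw [Real.rpow_sub hl, Real.rpow_neg hl.le, Real.rpow_two, mul_comm 2 (d:ℝ), Real.rpow_mul hl.le, Real.rpow_natCast]
      norm_num
      field_simp
    rw [this]; ring
  simp_rw [e]
  rw [lintegral_const_mul' _ _ (ENNReal.rpow_ne_top_of_ne_zero hl0 (by simp)), ← mul_assoc]
  congr 1
  rw [ENNReal.ofReal_pow hl.le, ← ENNReal.rpow_natCast, ← ENNReal.rpow_add _ _ hl0 (by simp)]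
  congr 1; ring
end scaling
end Strz


open MeasureTheory Real Complex
open scoped FourierTransform ENNReal SchwartzMap RealInnerProductSpace
set_option linter.all false
set_option linter.unusedVariables false
set_option linter.unusedSimpArgs false
set_option linter.deprecated false
namespace Strz
section dyad
variable {d : ℕ}

lemma phin_eq (m : ℝ) : (phin m : Eu d → ℝ) = fun ξ => phi (((2:ℝ)^m)⁻¹ • ξ) := by
  funext ξ; unfold phin; rw [Real.rpow_neg (by norm_num)]

lemma dyad_setup : ∃ (K : ℝ≥0∞) (κ : ℝ → Eu d → ℂ), K ≠ ⊤ ∧ (∀ m, KernL K ((2:ℝ)^m) (κ m)) ∧ ∀ m ξ, phin m ξ ≠ 0 → 𝓕 (κ m) ξ = 1 := by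
  obtain ⟨K, κ, hK, hκ, h1⟩ := exists_kernel (d := d)
  refine ⟨K, fun m => dil ((2:ℝ)^m) κ, hK, fun m => hκ.dil (by positivity), fun m ξ h => ?_⟩
  rw [fourier_dil (by positivity)]
  apply h1
  rw [phin_eq] at h; exact h

lemma phi_loc (hd : 1 ≤ d) {α β α' β' : ℝ} (h : Adm d α β) (h' : Adm d α' β') : LocB (phi : Eu d → ℝ) α β α' β' := by
  obtain ⟨K, κ, hK, hκ, h1⟩ := exists_kernel (d := d)
  exact adm_loc phi_amp phi_nonneg hd hκ.nice h1 h h'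

lemma Bf_phin (hd : 1 ≤ d) {α β α' β' : ℝ} (h : Adm d α β) (h' : Adm d α' β') (he : (d:ℝ)/β + 4/α + ((d:ℝ)/β' + 4/α') = d + 8) :
    ∃ C : ℝ≥0∞, C ≠ ∞ ∧ ∀ (m : ℝ) (S : Set (ℝ × ℝ)), MeasurableSet S → ∀ F G : ℝ × Eu d → ℂ, Nice F → Nice G →
      ‖Bf (phin m) S F G‖ₑ ≤ C * mN α β F * mN α' β' G := by
  obtain ⟨C, hC, H⟩ := phi_loc hd h h'
  refine ⟨C, hC, fun m S hS F G hF hG => ?_⟩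
  have hl : (0:ℝ) < 2^m := by positivity
  set l : ℝ := 2^m with hldef
  have hl0 : ENNReal.ofReal l ≠ 0 := by simpa using hl
  have a0 : 0 < α := by linarith [h.a1]
  have a0' : 0 < α' := by linarith [h'.a1]
  have b0 : 0 < β := by linarith [h.b1]
  have b0' : 0 < β' := by linarith [h'.b1]
  rw [phin_eq, Bf_scale hl hS, enorm_mul]
  have hS' : MeasurableSet {z : ℝ × ℝ | (l^4)⁻¹ • z ∈ S} := (measurable_const_smul ((l^4)⁻¹)) hS
  refine (mul_le_mul_right (H _ hS' _ _ (hF.DF hl) (hG.DF hl)) _).trans ?_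
  rw [mN_scale a0 b0 hl, mN_scale a0' b0' hl]
  have : ‖(((l^d)⁻¹ * (l^8)⁻¹ : ℝ) : ℂ)‖ₑ = ENNReal.ofReal l ^ (-(d:ℝ) - 8) := by
    rw [← ofReal_norm, Complex.norm_real, Real.norm_of_nonneg (by positivity), ENNReal.ofReal_rpow_of_pos hl, Real.rpow_sub hl, Real.rpow_neg hl.le, Real.rpow_natCast,
      show (8:ℝ) = ((8:ℕ):ℝ) by norm_num, Real.rpow_natCast, div_eq_mul_inv]
  rw [this]
  have e : ENNReal.ofReal l ^ (-(d:ℝ) - 8) * (ENNReal.ofReal l ^ ((d:ℝ)/β + 4/α) * ENNReal.ofReal l ^ ((d:ℝ)/β' + 4/α')) = 1 := by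
    rw [← ENNReal.rpow_add _ _ hl0 (by simp), ← ENNReal.rpow_add _ _ hl0 (by simp), he]
    rw [show -(d:ℝ) - 8 + (d + 8) = 0 by ring, ENNReal.rpow_zero]
  refine le_of_eq ?_
  calc _ = (ENNReal.ofReal l ^ (-(d:ℝ) - 8) * (ENNReal.ofReal l ^ ((d:ℝ)/β + 4/α) * ENNReal.ofReal l ^ ((d:ℝ)/β' + 4/α'))) * (C * mN α β F * mN α' β' G) := by ring
    _ = _ := by rw [e, one_mul]

lemma QW_phin (hd : 1 ≤ d) {α β : ℝ} (h : Adm d α β) :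
    ∃ C : ℝ≥0∞, C ≠ ∞ ∧ ∀ (m : ℝ) (G : ℝ × Eu d → ℂ), Nice G →
      QW (phin m) G ≤ C * tw (m * (2*((d:ℝ)/β + 4/α) - d - 8)) * mN α β G ^ (2:ℝ) := by
  obtain ⟨C, hC, H⟩ := QW_le (phi_amp (d := d)) phi_nonneg (phi_loc hd h h)
  refine ⟨C ^ (2:ℝ), by finiteness, fun m G hG => ?_⟩
  have hl : (0:ℝ) < 2^m := by positivity
  have a0 : 0 < α := by linarith [h.a1]
  have b0 : 0 < β := by linarith [h.b1]
  have hl1 : ENNReal.ofReal ((2:ℝ)^m) = tw m := (tw_ofReal m).symm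
  rw [phin_eq, QW_scale hl, hl1, tw_rpow]
  have := ENNReal.rpow_le_rpow (H _ (hG.DF hl)) (show (0:ℝ) ≤ 2 by norm_num)
  rw [← ENNReal.rpow_mul, show (1/2:ℝ)*2 = 1 by norm_num, ENNReal.rpow_one, mN_scale a0 b0 hl, hl1, tw_rpow] at this
  refine (mul_le_mul_right this _).trans (le_of_eq ?_)
  rw [ENNReal.mul_rpow_of_nonneg _ _ (by norm_num), ENNReal.mul_rpow_of_nonneg _ _ (by norm_num), tw_rpow]
  have e : tw (m * (2*((d:ℝ)/β + 4/α) - d - 8)) = tw (m * (-(d:ℝ) - 8)) * tw (m * ((d:ℝ)/β + 4/α) * 2) := by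
    rw [← tw_add]; congr 1; ring
  rw [e]; ring

lemma Wf_cvF {κ : Eu d → ℂ} (hκ : NiceS κ) {G : ℝ × Eu d → ℂ} (hG : Nice G) (ξ : Eu d) : Wf (cvF κ G) ξ = 𝓕 κ ξ * Wf G ξ := by
  unfold Wf
  rw [← integral_const_mul]
  congr 1; funext s
  have : FH (cvF κ G) s ξ = 𝓕 κ ξ * FH G s ξ := fourier_cv hκ.int (hG.slice s).int ξ
  rw [this]; ring

lemma QW_cvF {a : Eu d → ℝ} {κ : Eu d → ℂ} (hκ : NiceS κ) (h1 : ∀ ξ, a ξ ≠ 0 → 𝓕 κ ξ = 1) {G : ℝ × Eu d → ℂ} (hG : Nice G) : QW a (cvF κ G) = QW a G := by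
  unfold QW
  congr 1; funext ξ
  by_cases h : a ξ = 0
  · simp [h]
  · rw [Wf_cvF hκ hG, h1 ξ h, one_mul]
end dyad
end Strz


open MeasureTheory Real Complex
open scoped FourierTransform ENNReal SchwartzMap RealInnerProductSpace
set_option linter.all false
set_option linter.unusedVariables false
set_option linter.unusedSimpArgs false
set_option linter.deprecated false
namespace Strz
section assembly
variable {d : ℕ}

/-- frequency decay, uniformly in time -/
def FD (F : ℝ × Eu d → ℂ) : Prop := ∃ (g : Eu d → ℝ) (R : ℝ), Integrable g ∧ ∀ s ξ, ‖FH F s ξ‖ ≤ g ξ * (Set.Icc (-R) R).indicator (fun _ => 1) s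

noncomputable def HS (S : Set (ℝ × ℝ)) (F G : ℝ × Eu d → ℂ) (ξ : Eu d) : ℂ :=
  ∫ z in S, uexp ((z.2 - z.1) * om ξ) * FH F z.1 ξ * (starRingEnd ℂ) (FH G z.2 ξ)

lemma int_ftt' {F G : ℝ × Eu d → ℂ} (hF : Nice F) (hFD : FD F) (hG : Nice G) :
    Integrable (fun w : Eu d × (ℝ × ℝ) => uexp ((w.2.2 - w.2.1) * om w.1) * FH F w.2.1 w.1 *
      (starRingEnd ℂ) (FH G w.2.2 w.1)) (volume.prod (volume.prod volume)) := by
  obtain ⟨g, R, hg, h1⟩ := hFD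
  obtain ⟨M', R', hM', h2⟩ := hG.FH_bd
  have hi : ∀ M R : ℝ, Integrable ((Set.Icc (-R) R).indicator (fun _ : ℝ => M)) volume := fun M R =>
    (integrable_indicator_iff measurableSet_Icc).2 (integrableOn_const (by simp) (by simp))
  have hb := hg.mul_prod ((hi 1 R).mul_prod (hi M' R'))
  refine hb.mono' ?_ ?_
  · apply Measurable.aestronglyMeasurable
    have m1 : Measurable (fun w : Eu d × (ℝ × ℝ) => FH F w.2.1 w.1) := (measurable_FH hF.meas).comp (g := fun p : ℝ × Eu d => FH F p.1 p.2) (f := fun w : Eu d × (ℝ × ℝ) => (w.2.1, w.1)) (by fun_prop)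
    have m2 : Measurable (fun w : Eu d × (ℝ × ℝ) => FH G w.2.2 w.1) := (measurable_FH hG.meas).comp (g := fun p : ℝ × Eu d => FH G p.1 p.2) (f := fun w : Eu d × (ℝ × ℝ) => (w.2.2, w.1)) (by fun_prop)
    have m3 : Measurable (fun w : Eu d × (ℝ × ℝ) => uexp ((w.2.2 - w.2.1) * om w.1)) := Continuous.measurable (by fun_prop)
    have m4 : Measurable (fun w : Eu d × (ℝ × ℝ) => (starRingEnd ℂ) (FH G w.2.2 w.1)) := (Complex.continuous_conj.measurable).comp m2
    exact (m3.mul m1).mul m4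
  · filter_upwards with w
    rw [norm_mul, norm_mul, norm_uexp, one_mul, RCLike.norm_conj, ← mul_assoc]
    have := h1 w.2.1 w.1
    have := h2 w.2.2 w.1
    gcongr
    · exact (norm_nonneg _).trans (h1 w.2.1 w.1)

lemma int_fttS {F G : ℝ × Eu d → ℂ} (hF : Nice F) (hFD : FD F) (hG : Nice G) (S : Set (ℝ × ℝ)) :
    Integrable (fun w : Eu d × (ℝ × ℝ) => uexp ((w.2.2 - w.2.1) * om w.1) * FH F w.2.1 w.1 *
      (starRingEnd ℂ) (FH G w.2.2 w.1)) (volume.prod ((volume.prod volume).restrict S)) := by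
  have := (int_ftt' hF hFD hG).integrableOn (s := Set.univ ×ˢ S)
  rw [IntegrableOn, ← Measure.prod_restrict, Measure.restrict_univ] at this
  exact this

lemma HS_int {F G : ℝ × Eu d → ℂ} (hF : Nice F) (hFD : FD F) (hG : Nice G) (S : Set (ℝ × ℝ)) : Integrable (HS S F G) :=
  (int_fttS hF hFD hG S).integral_prod_left

lemma Bf_HS {F G : ℝ × Eu d → ℂ} (hF : Nice F) (hFD : FD F) (hG : Nice G) (S : Set (ℝ × ℝ)) {a : Eu d → ℝ} (ha : Measurable a) (h1 : ∀ ξ, |a ξ| ≤ 1) :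
    Bf a S F G = ∫ ξ, (a ξ : ℂ) * HS S F G ξ := by
  have hi : Integrable (fun w : Eu d × (ℝ × ℝ) => (a w.1 : ℂ) * (uexp ((w.2.2 - w.2.1) * om w.1) * FH F w.2.1 w.1 *
      (starRingEnd ℂ) (FH G w.2.2 w.1))) (volume.prod ((volume.prod volume).restrict S)) := by
    refine (int_fttS hF hFD hG S).bdd_mul (c := 1) ?_ ?_
    · exact (Measurable.aestronglyMeasurable (by fun_prop))
    · filter_upwards with w
      rw [Complex.norm_real]; exact h1 _
  have hs := integral_integral_swap (f := fun (ξ : Eu d) (z : ℝ × ℝ) => (a ξ : ℂ) * (uexp ((z.2 - z.1) * om ξ) * FH F z.1 ξ *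
      (starRingEnd ℂ) (FH G z.2 ξ))) hi
  unfold HS
  simp_rw [← integral_const_mul]
  refine Eq.trans ?_ hs.symm
  unfold Bf fm
  congr 1; funext z; congr 1; funext ξ
  unfold FH; ring

lemma phin_meas (m : ℝ) : Measurable (phin m : Eu d → ℝ) := by
  have := (phi_amp (d := d)).smooth.continuous
  rw [phin_eq]
  exact Continuous.measurable (by fun_prop)

lemma Phi_meas (M : ℕ) : Measurable (Phi M : Eu d → ℝ) := by
  unfold Phi
  exact Finset.measurable_sum _ fun n _ => phin_meas _

lemma phin_nonneg (m : ℝ) (ξ : Eu d) : 0 ≤ phin m ξ := phi_nonneg _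
lemma phin_abs (m : ℝ) (ξ : Eu d) : |phin m ξ| ≤ 1 := by
  rw [abs_of_nonneg (phin_nonneg m ξ)]; exact phi_le_one _
lemma Phi_abs (M : ℕ) (ξ : Eu d) : |Phi M ξ| ≤ 1 := by
  rw [abs_of_nonneg (Phi_nonneg _ _)]; exact Phi_le_one _ _

lemma mulH_int {H : Eu d → ℂ} (hH : Integrable H) {a : Eu d → ℝ} (ha : Measurable a) (h1 : ∀ ξ, |a ξ| ≤ 1) :
    Integrable (fun ξ => (a ξ : ℂ) * H ξ) := by
  refine hH.bdd_mul (c := 1) (Measurable.aestronglyMeasurable (by fun_prop)) ?_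
  filter_upwards with w
  rw [Complex.norm_real]; exact h1 _

lemma Phi_sum {H : Eu d → ℂ} (hH : Integrable H) (M : ℕ) : ∫ ξ, (Phi M ξ : ℂ) * H ξ = ∑ n ∈ Finset.range (2*M), ∫ ξ, (phin ((n:ℝ) - M) ξ : ℂ) * H ξ := by
  rw [← integral_finsetSum _ fun n _ => mulH_int hH (phin_meas _) (phin_abs _)]
  congr 1; funext ξ
  unfold Phi; push_cast; rw [Finset.sum_mul]

lemma Phi_lim (hd : 1 ≤ d) {H : Eu d → ℂ} (hH : Integrable H) : Filter.Tendsto (fun M : ℕ => ∫ ξ, (Phi M ξ : ℂ) * H ξ) Filter.atTop (nhds (∫ ξ, H ξ)) := by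
  haveI : Nonempty (Fin d) := ⟨⟨0, hd⟩⟩
  refine tendsto_integral_of_dominated_convergence (fun ξ => ‖H ξ‖) (fun M => (mulH_int hH (Phi_meas M) (Phi_abs M)).aestronglyMeasurable) hH.norm ?_ ?_
  · intro M
    filter_upwards with ξ
    rw [norm_mul, Complex.norm_real]
    exact mul_le_of_le_one_left (norm_nonneg _) (Phi_abs M ξ)
  · have : ∀ᵐ ξ : Eu d, ξ ≠ 0 := by
      rw [ae_iff]; simp
    filter_upwards [this] with ξ hξ
    have h := ((Complex.continuous_ofReal.tendsto 1).comp (Phi_tendsto hξ)).mul_const (H ξ)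
    simpa using h

lemma sum_cs {s : Finset ℕ} (x y : ℕ → ℝ≥0∞) : ∑ n ∈ s, x n * y n ≤ (∑ n ∈ s, x n ^ (2:ℝ)) ^ (1/2:ℝ) * (∑ n ∈ s, y n ^ (2:ℝ)) ^ (1/2:ℝ) :=
  ENNReal.inner_le_Lp_mul_Lq s x y ⟨by norm_num, by norm_num, by norm_num⟩

theorem retard (hd : 1 ≤ d) {α β α' β' : ℝ} (h : Adm d α β) (h' : Adm d α' β') (he : (d:ℝ)/β + 4/α + ((d:ℝ)/β' + 4/α') = d + 8) :
    ∃ C : ℝ≥0∞, C ≠ ∞ ∧ ∀ (S : Set (ℝ × ℝ)), MeasurableSet S → ∀ F G : ℝ × Eu d → ℂ, Nice F → FD F → Nice G →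
      ‖∫ ξ, HS S F G ξ‖ₑ ≤ C * mN α β F * mN α' β' G := by
  obtain ⟨C, hC, H⟩ := Bf_phin hd h h' he
  obtain ⟨K, κ, hK, hκ, h1⟩ := dyad_setup (d := d)
  obtain ⟨C1, hC1, H1⟩ := besov_mixed (d := d) h.a1 h.a2 h.b1 h.b2 hK
  obtain ⟨C2, hC2, H2⟩ := besov_mixed (d := d) h'.a1 h'.a2 h'.b1 h'.b2 hK
  refine ⟨C * C1 ^ (1/2:ℝ) * C2 ^ (1/2:ℝ), by finiteness, fun S hS F G hF hFD hG => ?_⟩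
  have hH := HS_int hF hFD hG S
  refine le_of_tendsto' ((continuous_enorm.tendsto _).comp (Phi_lim hd hH)) fun M => ?_
  simp only [Function.comp_apply]
  rw [Phi_sum hH]
  set k : ℕ → Eu d → ℂ := fun n => κ ((n:ℝ) - M)
  have h3 : ∀ n : ℕ, ‖∫ ξ, (phin ((n:ℝ) - M) ξ : ℂ) * HS S F G ξ‖ₑ ≤ C * (mN α β (cvF (k n) F) * mN α' β' (cvF (k n) G)) := by
    intro n
    rw [← Bf_HS hF hFD hG S (phin_meas _) (phin_abs _), ← Bf_cvF (hκ ((n:ℝ) - M)).nice.int (h1 ((n:ℝ) - M)) S hF hG, ← mul_assoc]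
    exact H _ S hS _ _ (hF.cvF (hκ _).nice) (hG.cvF (hκ _).nice)
  refine (enorm_sum_le _ _).trans ((Finset.sum_le_sum fun n _ => h3 n).trans ?_)
  rw [← Finset.mul_sum]
  have r : ∀ {C X : ℝ≥0∞}, (C * X ^ (2:ℝ)) ^ (1/2:ℝ) = C ^ (1/2:ℝ) * X := by
    intro C X
    rw [ENNReal.mul_rpow_of_nonneg _ _ (by norm_num), ← ENNReal.rpow_mul]; norm_num
  have e1 := ENNReal.rpow_le_rpow (H1 M k F (fun n => hκ _) hF (2*M)) (show (0:ℝ) ≤ 1/2 by norm_num)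
  have e2 := ENNReal.rpow_le_rpow (H2 M k G (fun n => hκ _) hG (2*M)) (show (0:ℝ) ≤ 1/2 by norm_num)
  rw [r] at e1 e2
  refine (mul_le_mul_right ((sum_cs _ _).trans (mul_le_mul' e1 e2)) _).trans (le_of_eq ?_)
  ring
end assembly
end Strz


open MeasureTheory Real Complex
open scoped FourierTransform ENNReal SchwartzMap RealInnerProductSpace
set_option linter.all false
set_option linter.unusedVariables false
set_option linter.unusedSimpArgs false
set_option linter.deprecated false
namespace Strz
section homog
variable {d : ℕ}

lemma phin_supp {m : ℝ} {ξ : Eu d} (h : phin m ξ ≠ 0) : tw (m-1) ≤ ‖ξ‖ₑ ∧ ‖ξ‖ₑ ≤ tw (m+1) := by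
  rw [phin_eq] at h
  obtain ⟨h1, h2⟩ := phi_supp h
  have hl : (0:ℝ) < 2^m := by positivity
  rw [norm_smul, norm_inv, Real.norm_of_nonneg hl.le] at h1 h2
  set x := ((2:ℝ)^m)⁻¹ * ‖ξ‖ with hx
  have hxn : 0 ≤ x := by positivity
  have e : ‖ξ‖ = 2^m * x := by rw [hx, ← mul_assoc, mul_inv_cancel₀ hl.ne', one_mul]
  have a1 : 1/2 ≤ x := by nlinarith
  have a2 : x ≤ 2 := by nlinarith
  rw [← ofReal_norm, tw_ofReal, tw_ofReal, Real.rpow_sub (by norm_num), Real.rpow_add (by norm_num), Real.rpow_one, e]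
  constructor <;> apply ENNReal.ofReal_le_ofReal <;> nlinarith

lemma phin_wt {m : ℝ} {ξ : Eu d} (h : phin m ξ ≠ 0) (e : ℝ) : ‖ξ‖ₑ ^ e ≤ tw |e| * tw (m * e) := by
  obtain ⟨h1, h2⟩ := phin_supp h
  rcases le_total 0 e with he | he
  · refine (ENNReal.rpow_le_rpow h2 he).trans (le_of_eq ?_)
    rw [tw_rpow, ← tw_add, abs_of_nonneg he]; congr 1; ring
  · have h3 : ‖ξ‖ₑ ^ e ≤ tw (m-1) ^ e := by
      have := ENNReal.inv_le_inv.2 (ENNReal.rpow_le_rpow h1 (neg_nonneg.2 he))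
      rwa [← ENNReal.rpow_neg, ← ENNReal.rpow_neg, neg_neg] at this
    refine h3.trans (le_of_eq ?_)
    rw [tw_rpow, ← tw_add, abs_of_nonpos he]; congr 1; ring

lemma QW_wt (m e : ℝ) (G : ℝ × Eu d → ℂ) : ∫⁻ ξ, ‖phin m ξ‖ₑ * (‖ξ‖ₑ ^ e * ‖Wf G ξ‖ₑ ^ (2:ℝ)) ≤ tw |e| * tw (m * e) * QW (phin m) G := by
  unfold QW
  rw [← lintegral_const_mul' _ _ (ENNReal.mul_ne_top (tw_ne_top _) (tw_ne_top _))]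
  refine lintegral_mono fun ξ => ?_
  by_cases h : phin m ξ = 0
  · simp [h]
  · calc _ = ‖ξ‖ₑ ^ e * (‖phin m ξ‖ₑ * ‖Wf G ξ‖ₑ ^ (2:ℝ)) := by ring
      _ ≤ _ := mul_le_mul_left (phin_wt h e) _

theorem homog (hd : 1 ≤ d) {α β γ : ℝ} (h : Adm d α β) (he : γ = (d:ℝ)/β + 4/α - d/2 - 4) :
    ∃ C : ℝ≥0∞, C ≠ ∞ ∧ ∀ (f : Eu d → ℂ) (G : ℝ × Eu d → ℂ), Integrable f → Measurable f → Nice G →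
      ‖∫ ξ, f ξ * (starRingEnd ℂ) (Wf G ξ)‖ₑ ≤ C * (∫⁻ ξ, ‖ξ‖ₑ ^ (2*γ) * ‖f ξ‖ₑ ^ (2:ℝ)) ^ (1/2:ℝ) * mN α β G := by
  obtain ⟨C, hC, H⟩ := QW_phin hd h
  obtain ⟨K, κ, hK, hκ, h1⟩ := dyad_setup (d := d)
  obtain ⟨C1, hC1, H1⟩ := besov_mixed (d := d) h.a1 h.a2 h.b1 h.b2 hK
  refine ⟨(tw |(-2*γ)| * C * C1) ^ (1/2:ℝ), ?_, fun f G hf hfm hG => ?_⟩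
  · exact ENNReal.rpow_ne_top_of_nonneg (by norm_num) (ENNReal.mul_ne_top (ENNReal.mul_ne_top (tw_ne_top _) hC) hC1)
  have hWm := measurable_Wf hG.meas
  obtain ⟨B, hB⟩ := Wf_bd hG
  have hH : Integrable (fun ξ => f ξ * (starRingEnd ℂ) (Wf G ξ)) := by
    refine hf.mul_bdd (c := B) ((Complex.continuous_conj.measurable.comp hWm).aestronglyMeasurable) ?_
    filter_upwards with ξ
    rw [RCLike.norm_conj]; exact hB ξ
  refine le_of_tendsto' ((continuous_enorm.tendsto _).comp (Phi_lim hd hH)) fun M => ?_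
  simp only [Function.comp_apply]
  set k : ℕ → Eu d → ℂ := fun n => κ ((n:ℝ) - M)
  have hP := Phi_meas (d := d) M
  -- weighted square sum
  have hsum : ∫⁻ ξ : Eu d, (‖Phi M ξ‖ₑ * (‖ξ‖ₑ ^ (-γ) * ‖Wf G ξ‖ₑ)) ^ (2:ℝ) ≤ tw |(-2*γ)| * C * C1 * mN α β G ^ (2:ℝ) := by
    calc _ ≤ ∫⁻ ξ : Eu d, ∑ n ∈ Finset.range (2*M), ‖phin ((n:ℝ) - M) ξ‖ₑ * (‖ξ‖ₑ ^ (-2*γ) * ‖Wf G ξ‖ₑ ^ (2:ℝ)) := by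
          refine lintegral_mono fun ξ => ?_
          rw [← Finset.sum_mul, ENNReal.mul_rpow_of_nonneg _ _ (by norm_num), ENNReal.mul_rpow_of_nonneg _ _ (by norm_num), ← ENNReal.rpow_mul,
            show -γ * 2 = -2*γ by ring]
          refine mul_le_mul_left ?_ _
          have : ‖Phi M ξ‖ₑ ≤ 1 := by
            rw [← ofReal_norm, ← ENNReal.ofReal_one]; exact ENNReal.ofReal_le_ofReal (Phi_abs M ξ)
          calc ‖Phi M ξ‖ₑ ^ (2:ℝ) ≤ ‖Phi M ξ‖ₑ := by
                have := ENNReal.rpow_le_rpow_of_exponent_ge this (show (1:ℝ) ≤ 2 by norm_num)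
                rwa [ENNReal.rpow_one] at this
            _ ≤ _ := enorm_sum_le _ _
      _ = ∑ n ∈ Finset.range (2*M), ∫⁻ ξ : Eu d, ‖phin ((n:ℝ) - M) ξ‖ₑ * (‖ξ‖ₑ ^ (-2*γ) * ‖Wf G ξ‖ₑ ^ (2:ℝ)) := by
          refine lintegral_finsetSum _ fun n _ => ?_
          have := phin_meas (d := d) ((n:ℝ) - M)
          fun_prop
      _ ≤ ∑ n ∈ Finset.range (2*M), tw |(-2*γ)| * C * mN α β (cvF (k n) G) ^ (2:ℝ) := by
          refine Finset.sum_le_sum fun n _ => (QW_wt _ _ _).trans ?_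
          rw [← QW_cvF (hκ ((n:ℝ) - M)).nice (h1 ((n:ℝ) - M)) hG]
          refine (mul_le_mul_right (H _ _ (hG.cvF (hκ _).nice)) _).trans (le_of_eq ?_)
          have : tw (((n:ℝ) - M) * (-2*γ)) * tw (((n:ℝ) - M) * (2*((d:ℝ)/β + 4/α) - d - 8)) = 1 := by
            rw [← tw_add, ← mul_add, he, ← tw_zero]; congr 1; ring
          calc _ = (tw (((n:ℝ) - M) * (-2*γ)) * tw (((n:ℝ) - M) * (2*((d:ℝ)/β + 4/α) - d - 8))) * (tw |(-2*γ)| * C * mN α β (cvF (k n) G) ^ (2:ℝ)) := by ring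
            _ = _ := by rw [this, one_mul]
      _ ≤ _ := by
          rw [← Finset.mul_sum, mul_assoc (tw |(-2*γ)| * C)]
          exact mul_le_mul_right (H1 M k G (fun n => hκ _) hG (2*M)) _
  refine (enorm_integral_le_lintegral_enorm _).trans ?_
  have hpt : ∀ ξ : Eu d, ‖(Phi M ξ : ℂ) * (f ξ * (starRingEnd ℂ) (Wf G ξ))‖ₑ ≤ (‖ξ‖ₑ ^ γ * ‖f ξ‖ₑ) * (‖Phi M ξ‖ₑ * (‖ξ‖ₑ ^ (-γ) * ‖Wf G ξ‖ₑ)) := by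
    intro ξ
    rw [enorm_mul, enorm_mul, enorm_conj', ← ofReal_norm (Phi M ξ : ℂ), Complex.norm_real, ofReal_norm]
    by_cases h0 : ξ = 0
    · have : Phi M ξ = 0 := by
        unfold Phi
        refine Finset.sum_eq_zero fun n _ => ?_
        by_contra hc
        have := (phin_supp hc).1
        rw [h0, enorm_zero, nonpos_iff_eq_zero] at this
        exact tw_ne_zero _ this
      simp [this]
    · have : ‖ξ‖ₑ ^ γ * ‖ξ‖ₑ ^ (-γ) = 1 := by
        rw [← ENNReal.rpow_add _ _ (by simpa using h0) (by simp), add_neg_cancel, ENNReal.rpow_zero]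
      refine le_of_eq ?_
      calc _ = (‖ξ‖ₑ ^ γ * ‖ξ‖ₑ ^ (-γ)) * (‖Phi M ξ‖ₑ * (‖f ξ‖ₑ * ‖Wf G ξ‖ₑ)) := by rw [this, one_mul]
        _ = _ := by ring
  refine (lintegral_mono hpt).trans ?_
  refine (ENNReal.lintegral_mul_le_Lp_mul_Lq volume (p := 2) (q := 2) ⟨by norm_num, by norm_num, by norm_num⟩ ?_ ?_).trans ?_
  · exact Measurable.aemeasurable (by fun_prop)
  · exact Measurable.aemeasurable (by fun_prop)
  have e1 := ENNReal.rpow_le_rpow hsum (show (0:ℝ) ≤ 1/2 by norm_num)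
  rw [ENNReal.mul_rpow_of_nonneg _ (mN α β G ^ (2:ℝ)) (by norm_num), ← ENNReal.rpow_mul _ 2 (1/2), show (2:ℝ)*(1/2) = 1 by norm_num, ENNReal.rpow_one] at e1
  refine (mul_le_mul_right e1 _).trans (le_of_eq ?_)
  have : ∀ ξ : Eu d, (‖ξ‖ₑ ^ γ * ‖f ξ‖ₑ) ^ (2:ℝ) = ‖ξ‖ₑ ^ (2*γ) * ‖f ξ‖ₑ ^ (2:ℝ) := by
    intro ξ
    rw [ENNReal.mul_rpow_of_nonneg _ _ (by norm_num), ← ENNReal.rpow_mul, mul_comm γ]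
  simp only [Pi.pow_apply, this]
  ring
end homog
end Strz


open MeasureTheory Real Complex
open scoped FourierTransform ENNReal SchwartzMap RealInnerProductSpace
set_option linter.all false
set_option linter.unusedVariables false
set_option linter.unusedSimpArgs false
set_option linter.deprecated false
namespace Strz
section pairing
variable {d : ℕ}

noncomputable def sp (f : Eu d → ℂ) (t : ℝ) (x : Eu d) : ℂ := ∫ ξ, uexp (2 * Real.pi * inner ℝ x ξ) * uexp (t * om ξ) * f ξ

lemma prop4_eq (t : ℝ) (u : Eu d → ℂ) (x : Eu d) : prop4 t u x = sp (𝓕 u) t x := by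
  unfold prop4 sp
  congr 1; funext ξ
  congr 2
  · unfold uexp; congr 1; push_cast; ring
  · unfold uexp om; congr 1; push_cast; ring

lemma conj_FH (G : ℝ × Eu d → ℂ) (t : ℝ) (ξ : Eu d) : ∫ x, uexp (2 * Real.pi * inner ℝ x ξ) * (starRingEnd ℂ) (G (t, x)) = (starRingEnd ℂ) (FH G t ξ) := by
  unfold FH
  rw [fourier_uexp, ← integral_conj]
  congr 1; funext x
  rw [map_mul, uexp_conj, neg_neg]

lemma pair_hom_int {f : Eu d → ℂ} (hf : Integrable f) (hfm : Measurable f) {G : ℝ × Eu d → ℂ} (hG : Nice G) :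
    Integrable (fun w : (ℝ × Eu d) × Eu d => uexp (2 * Real.pi * inner ℝ w.1.2 w.2) * uexp (w.1.1 * om w.2) * f w.2 * (starRingEnd ℂ) (G w.1))
      ((volume.prod volume).prod volume) := by
  have hGi := hG.integrable
  have hGm := hG.meas
  have hb := hGi.norm.mul_prod hf.norm
  refine hb.mono' ?_ ?_
  · apply Measurable.aestronglyMeasurable
    have m1 : Measurable (fun w : (ℝ × Eu d) × Eu d => uexp (2 * Real.pi * inner ℝ w.1.2 w.2) * uexp (w.1.1 * om w.2)) := Continuous.measurable (by fun_prop)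
    have m4 : Measurable (fun w : (ℝ × Eu d) × Eu d => (starRingEnd ℂ) (G w.1)) := (Complex.continuous_conj.measurable).comp (by fun_prop)
    exact (m1.mul (by fun_prop)).mul m4
  · filter_upwards with w
    rw [norm_mul, norm_mul, norm_mul, norm_uexp, norm_uexp, RCLike.norm_conj, one_mul, one_mul, mul_comm]

lemma pair_hom {f : Eu d → ℂ} (hf : Integrable f) (hfm : Measurable f) {G : ℝ × Eu d → ℂ} (hG : Nice G) :
    Integrable (fun z : ℝ × Eu d => sp f z.1 z.2 * (starRingEnd ℂ) (G z)) (volume.prod volume) ∧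
    ∫ z, sp f z.1 z.2 * (starRingEnd ℂ) (G z) ∂(volume.prod volume) = ∫ ξ, f ξ * (starRingEnd ℂ) (Wf G ξ) := by
  have hJ := pair_hom_int hf hfm hG
  have e1 : ∀ z : ℝ × Eu d, ∫ ξ, uexp (2 * Real.pi * inner ℝ z.2 ξ) * uexp (z.1 * om ξ) * f ξ * (starRingEnd ℂ) (G z) = sp f z.1 z.2 * (starRingEnd ℂ) (G z) := by
    intro z; unfold sp; rw [integral_mul_const]
  have hi := hJ.integral_prod_left
  simp only [e1] at hi
  refine ⟨hi, ?_⟩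
  have hs := integral_integral_swap (f := fun (z : ℝ × Eu d) (ξ : Eu d) => uexp (2 * Real.pi * inner ℝ z.2 ξ) * uexp (z.1 * om ξ) * f ξ * (starRingEnd ℂ) (G z)) hJ
  simp only [e1] at hs
  rw [hs]
  refine integral_congr_ae ?_
  filter_upwards [hJ.prod_left_ae] with ξ hξ
  rw [integral_prod _ hξ]
  unfold Wf
  rw [← integral_conj, ← integral_const_mul]
  congr 1; funext t
  rw [map_mul, uexp_conj, neg_neg, ← conj_FH, ← integral_const_mul, ← integral_const_mul]
  congr 1; funext x
  ring

/-- retarded term -/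
noncomputable def rt (S : Set (ℝ × ℝ)) (F : ℝ × Eu d → ℂ) (t : ℝ) (x : Eu d) : ℂ :=
  ∫ s, S.indicator (fun z => sp (FH F z.1) (z.2 - z.1) x) (s, t)

lemma pair_rt_int {S : Set (ℝ × ℝ)} (hS : MeasurableSet S) {F G : ℝ × Eu d → ℂ} (hF : Nice F) (hFD : FD F) (hG : Nice G) :
    Integrable (fun w : (ℝ × Eu d) × (ℝ × Eu d) => S.indicator (fun _ => (1:ℂ)) (w.2.1, w.1.1) * (uexp (2 * Real.pi * inner ℝ w.1.2 w.2.2) * uexp ((w.1.1 - w.2.1) * om w.2.2) * FH F w.2.1 w.2.2 * (starRingEnd ℂ) (G w.1)))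
      ((volume.prod volume).prod (volume.prod volume)) := by
  have hGi := hG.integrable
  have hGm := hG.meas
  obtain ⟨g, R, hg, h1⟩ := hFD
  have hi : ∀ M R : ℝ, Integrable ((Set.Icc (-R) R).indicator (fun _ : ℝ => M)) volume := fun M R =>
    (integrable_indicator_iff measurableSet_Icc).2 (integrableOn_const (by simp) (by simp))
  have hb := hGi.norm.mul_prod ((hi 1 R).mul_prod hg)
  refine hb.mono' ?_ ?_
  · apply Measurable.aestronglyMeasurable
    have m1 : Measurable (fun w : (ℝ × Eu d) × (ℝ × Eu d) => uexp (2 * Real.pi * inner ℝ w.1.2 w.2.2) * uexp ((w.1.1 - w.2.1) * om w.2.2)) := Continuous.measurable (by fun_prop)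
    have m2 : Measurable (fun w : (ℝ × Eu d) × (ℝ × Eu d) => FH F w.2.1 w.2.2) := (measurable_FH hF.meas).comp (g := fun p : ℝ × Eu d => FH F p.1 p.2) (f := fun w : (ℝ × Eu d) × (ℝ × Eu d) => w.2) (by fun_prop)
    have m4 : Measurable (fun w : (ℝ × Eu d) × (ℝ × Eu d) => (starRingEnd ℂ) (G w.1)) := (Complex.continuous_conj.measurable).comp (by fun_prop)
    have m5 : Measurable (fun w : (ℝ × Eu d) × (ℝ × Eu d) => S.indicator (fun _ => (1:ℂ)) (w.2.1, w.1.1)) :=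
      (measurable_const.indicator hS).comp (g := S.indicator (fun _ => (1:ℂ))) (f := fun w : (ℝ × Eu d) × (ℝ × Eu d) => (w.2.1, w.1.1)) (by fun_prop)
    exact m5.mul ((m1.mul m2).mul m4)
  · filter_upwards with w
    rw [norm_mul, norm_mul, norm_mul, norm_mul, norm_uexp, norm_uexp, RCLike.norm_conj, one_mul, one_mul]
    have h2 := h1 w.2.1 w.2.2
    have h3 : ‖S.indicator (fun _ => (1:ℂ)) (w.2.1, w.1.1)‖ ≤ 1 := (norm_indicator_le_norm_self _ _).trans (by simp)
    refine (mul_le_of_le_one_left (by positivity) h3).trans ?_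
    rw [mul_comm]
    refine mul_le_mul_of_nonneg_left (h2.trans (le_of_eq (mul_comm _ _))) (norm_nonneg _)

lemma pair_rt {S : Set (ℝ × ℝ)} (hS : MeasurableSet S) {F G : ℝ × Eu d → ℂ} (hF : Nice F) (hFD : FD F) (hG : Nice G) :
    Integrable (fun z : ℝ × Eu d => rt S F z.1 z.2 * (starRingEnd ℂ) (G z)) (volume.prod volume) ∧
    ∫ z, rt S F z.1 z.2 * (starRingEnd ℂ) (G z) ∂(volume.prod volume) = ∫ ξ, HS S F G ξ := by
  have hJ := pair_rt_int hS hF hFD hG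
  have e1 : ∀ᵐ z : ℝ × Eu d ∂(volume.prod volume), ∫ y : ℝ × Eu d, S.indicator (fun _ => (1:ℂ)) (y.1, z.1) * (uexp (2 * Real.pi * inner ℝ z.2 y.2) * uexp ((z.1 - y.1) * om y.2) * FH F y.1 y.2 * (starRingEnd ℂ) (G z)) ∂(volume.prod volume) = rt S F z.1 z.2 * (starRingEnd ℂ) (G z) := by
    filter_upwards [hJ.prod_right_ae] with z hz
    rw [integral_prod _ hz]
    unfold rt sp
    rw [← integral_mul_const]
    congr 1; funext s
    dsimp only
    rw [integral_const_mul, integral_mul_const]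
    by_cases h : (s, z.1) ∈ S
    · rw [Set.indicator_of_mem h, Set.indicator_of_mem h, one_mul]
    · rw [Set.indicator_of_notMem h, Set.indicator_of_notMem h, zero_mul, zero_mul]
  refine ⟨hJ.integral_prod_left.congr e1, ?_⟩
  rw [← integral_congr_ae e1]
  have hs := integral_integral_swap (f := fun (z y : ℝ × Eu d) => S.indicator (fun _ => (1:ℂ)) (y.1, z.1) * (uexp (2 * Real.pi * inner ℝ z.2 y.2) * uexp ((z.1 - y.1) * om y.2) * FH F y.1 y.2 * (starRingEnd ℂ) (G z))) hJ
  rw [hs]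
  have hI := hJ.swap.integral_prod_left
  simp only [Function.comp_apply, Prod.fst_swap, Prod.snd_swap] at hI
  have e2 : ∀ᵐ y : ℝ × Eu d ∂(volume.prod volume), ∫ z : ℝ × Eu d, S.indicator (fun _ => (1:ℂ)) (y.1, z.1) * (uexp (2 * Real.pi * inner ℝ z.2 y.2) * uexp ((z.1 - y.1) * om y.2) * FH F y.1 y.2 * (starRingEnd ℂ) (G z)) ∂(volume.prod volume) = ∫ t, S.indicator (fun z : ℝ × ℝ => uexp ((z.2 - z.1) * om y.2) * FH F z.1 y.2 * (starRingEnd ℂ) (FH G z.2 y.2)) (y.1, t) := by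
    filter_upwards [hJ.prod_left_ae] with y hy
    rw [integral_prod _ hy]
    congr 1; funext t
    dsimp only
    rw [integral_const_mul]
    by_cases h : (y.1, t) ∈ S
    · rw [Set.indicator_of_mem h, Set.indicator_of_mem h, one_mul, ← conj_FH, ← integral_const_mul]
      congr 1; funext x
      ring
    · rw [Set.indicator_of_notMem h, Set.indicator_of_notMem h, zero_mul]
  rw [integral_congr_ae e2, integral_prod_symm _ (hI.congr e2)]
  refine integral_congr_ae ?_
  filter_upwards [(int_ftt' hF hFD hG).prod_right_ae] with ξ hξ
  unfold HS
  rw [← integral_indicator hS]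
  change _ = ∫ z, _ ∂(volume.prod volume)
  rw [integral_prod _ (hξ.indicator hS)]
end pairing
end Strz


open MeasureTheory Real Complex
open scoped FourierTransform ENNReal SchwartzMap RealInnerProductSpace
set_option linter.all false
set_option linter.unusedVariables false
set_option linter.unusedSimpArgs false
set_option linter.deprecated false
namespace Strz
section schw
variable {d : ℕ}

noncomputable def wt (y : Eu d) : ℝ := (1 + ‖y‖) ^ (-((d:ℝ)+1))

lemma wt_int : Integrable (wt (d := d)) := by
  have := integrable_one_add_norm (E := Eu d) (μ := volume) (r := (d:ℝ)+1) (by simp)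
  exact this

lemma wt_pos (y : Eu d) : 0 < wt y := by unfold wt; positivity

lemma wt_le_one (y : Eu d) : wt y ≤ 1 := by
  unfold wt
  exact Real.rpow_le_one_of_one_le_of_nonpos (by linarith [norm_nonneg y]) (by linarith [(Nat.cast_nonneg d : (0:ℝ) ≤ d)])

lemma le_wt {y : Eu d} {A C : ℝ} (h : (1 + ‖y‖) ^ (d+1) * A ≤ C) : A ≤ C * wt y := by
  have hp : 0 < (1 + ‖y‖) ^ (d+1) := by positivity
  have : wt y = ((1 + ‖y‖) ^ (d+1))⁻¹ := by
    unfold wt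
    rw [Real.rpow_neg (by positivity)]
    congr 1
    exact_mod_cast Real.rpow_natCast (1 + ‖y‖) (d+1)
  rw [this, ← div_eq_mul_inv, le_div_iff₀ hp]; linarith

lemma slice_fderiv (F : 𝓢(ℝ × Eu d, ℂ)) (j : ℕ) (s : ℝ) (y : Eu d) :
    ‖iteratedFDeriv ℝ j (fun y => F (s, y)) y‖ ≤ ‖iteratedFDeriv ℝ j F (s, y)‖ := by
  have e : (fun y : Eu d => F (s, y)) = (fun z => F ((s, 0) + z)) ∘ (ContinuousLinearMap.inr ℝ ℝ (Eu d)) := by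
    funext y; simp
  have hc : ContDiff ℝ (j : ℕ) (fun z : ℝ × Eu d => F ((s, 0) + z)) := (F.smooth j).comp (contDiff_const.add contDiff_id)
  rw [e, ContinuousLinearMap.iteratedFDeriv_comp_right _ hc _ le_rfl, iteratedFDeriv_comp_add_left]
  refine (ContinuousMultilinearMap.norm_compContinuousLinearMap_le _ _).trans ?_
  have e2 : ((s, (0 : Eu d)) + (ContinuousLinearMap.inr ℝ ℝ (Eu d)) y) = (s, y) := by simp
  rw [e2]
  refine mul_le_of_le_one_right (norm_nonneg _) ?_
  refine Finset.prod_le_one (fun _ _ => norm_nonneg _) fun _ _ => ?_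
  refine ContinuousLinearMap.opNorm_le_bound _ zero_le_one fun y => ?_
  simp

lemma slice_bd (F : 𝓢(ℝ × Eu d, ℂ)) : ∃ C : ℝ, 0 ≤ C ∧ ∀ j ≤ d+1, ∀ s y, ‖iteratedFDeriv ℝ j (fun y => F (s, y)) y‖ ≤ C * wt y := by
  refine ⟨2 ^ (d+1) * ((Finset.Iic (d+1, d+1)).sup (fun m => SchwartzMap.seminorm ℝ m.1 m.2)) F, by positivity, fun j hj s y => ?_⟩
  refine le_wt ?_
  have h := SchwartzMap.one_add_le_sup_seminorm_apply (𝕜 := ℝ) (m := (d+1, d+1)) (k := d+1) (n := j) le_rfl hj F (s, y)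
  refine le_trans ?_ h
  have h2 : ‖y‖ ≤ ‖(s, y)‖ := norm_snd_le (s, y)
  have := slice_fderiv F j s y
  gcongr

lemma slice_cd (F : 𝓢(ℝ × Eu d, ℂ)) (n : ℕ) (s : ℝ) : ContDiff ℝ n (fun y => F (s, y)) :=
  (F.smooth n).comp (contDiff_const.prodMk contDiff_id)

lemma slice_FH (F : 𝓢(ℝ × Eu d, ℂ)) : ∃ C : ℝ, 0 ≤ C ∧ ∀ s ξ, ‖FH F s ξ‖ ≤ C * wt ξ := by
  obtain ⟨C, hC, h⟩ := slice_bd F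
  have hIntg : ∀ s, ∀ j ≤ d+1, Integrable (fun y => ‖iteratedFDeriv ℝ j (fun y => F (s, y)) y‖) := by
    intro s j hj
    refine (wt_int.const_mul C).mono' ?_ ?_
    · exact (((slice_cd F j s).continuous_iteratedFDeriv le_rfl).norm).aestronglyMeasurable
    · filter_upwards with y
      rw [norm_norm]; exact h j hj s y
  set A : ℝ := ∑ j ∈ Finset.range (d+2), C * ∫ y : Eu d, wt y with hA
  have hA0 : 0 ≤ A := Finset.sum_nonneg fun j _ => mul_nonneg hC (integral_nonneg fun y => (wt_pos y).le)
  have key : ∀ n ≤ d+1, ∀ s ξ, ‖ξ‖ ^ n * ‖FH F s ξ‖ ≤ 2 ^ n * A := by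
    intro n hn s ξ
    have := Real.pow_mul_norm_iteratedFDeriv_fourier_le (f := fun y => F (s, y)) (K := 0) (N := (n:ℕ)) (slice_cd F n s) (by
      intro k m hk hm
      have hk : k = 0 := by simpa using hk
      have hm : m ≤ n := by exact_mod_cast hm
      subst hk
      simpa using hIntg s m (hm.trans hn)) (k := 0) (n := n) le_rfl le_rfl ξ
    rw [norm_iteratedFDeriv_zero] at this
    refine this.trans ?_
    simp only [pow_zero, one_mul, Nat.cast_zero, mul_zero, zero_add, Finset.range_one]
    refine mul_le_mul_of_nonneg_left ?_ (by positivity)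
    rw [Finset.sum_product]
    simp only [Finset.sum_singleton, pow_zero, one_mul]
    calc _ ≤ ∑ j ∈ Finset.range (n+1), C * ∫ y : Eu d, wt y := by
          refine Finset.sum_le_sum fun j hj => ?_
          have hj : j ≤ d+1 := by have := Finset.mem_range.1 hj; omega
          rw [← integral_const_mul]
          exact integral_mono (hIntg s j hj) (wt_int.const_mul C) fun y => h j hj s y
      _ ≤ _ := by
          refine Finset.sum_le_sum_of_subset_of_nonneg (Finset.range_mono (by omega)) fun j _ _ => mul_nonneg hC (integral_nonneg fun y => (wt_pos y).le)
  refine ⟨2 ^ d * (A + 2 ^ (d+1) * A), by positivity, fun s ξ => le_wt ?_⟩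
  have h0 := key 0 (by omega) s ξ
  have h1 := key (d+1) le_rfl s ξ
  rw [pow_zero, pow_zero, one_mul, one_mul] at h0
  have h2 := add_pow_le (zero_le_one) (norm_nonneg ξ) (d+1)
  rw [one_pow, Nat.add_sub_cancel] at h2
  calc _ ≤ 2 ^ d * (1 + ‖ξ‖ ^ (d+1)) * ‖FH F s ξ‖ := by gcongr
    _ = 2 ^ d * (‖FH F s ξ‖ + ‖ξ‖ ^ (d+1) * ‖FH F s ξ‖) := by ring
    _ ≤ _ := by gcongr

noncomputable def tr (R : ℝ) (F : ℝ × Eu d → ℂ) : ℝ × Eu d → ℂ := {z : ℝ × Eu d | |z.1| ≤ R}.indicator F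

lemma tr_nice (F : 𝓢(ℝ × Eu d, ℂ)) (R : ℝ) : Nice (tr R F) := by
  obtain ⟨C, hC, h⟩ := slice_bd F
  have h0 : ∀ s y, ‖F (s, y)‖ ≤ C * wt y := fun s y => by
    have := h 0 (by omega) s y; rwa [norm_iteratedFDeriv_zero] at this
  have hI : 0 ≤ ∫ y : Eu d, wt y := integral_nonneg fun y => (wt_pos y).le
  have hm : MeasurableSet {z : ℝ × Eu d | |z.1| ≤ R} := measurableSet_le (by fun_prop) (by fun_prop)
  have hle : ∀ s y, ‖tr R F (s, y)‖ ≤ C * wt y := fun s y => (norm_indicator_le_norm_self _ _).trans (h0 s y)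
  refine ⟨F.continuous.measurable.indicator hm, C + C * ∫ y : Eu d, wt y, R, fun s => ⟨fun y => ?_, ?_, fun hs y => ?_⟩⟩
  · refine (hle s y).trans ?_
    have := mul_le_mul_of_nonneg_left (wt_le_one y) hC
    nlinarith
  · calc ∫⁻ y, ‖tr R F (s, y)‖ₑ ≤ ∫⁻ y : Eu d, ENNReal.ofReal (C * wt y) := by
          refine lintegral_mono fun y => ?_
          rw [← ofReal_norm]; exact ENNReal.ofReal_le_ofReal (hle s y)
      _ = ENNReal.ofReal (C * ∫ y : Eu d, wt y) := by
          rw [← integral_const_mul, ofReal_integral_eq_lintegral_ofReal (wt_int.const_mul C)]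
          filter_upwards with y
          exact mul_nonneg hC (wt_pos y).le
      _ ≤ _ := ENNReal.ofReal_le_ofReal (by linarith)
  · exact Set.indicator_of_notMem (by simpa using hs) _

lemma FH_tr (F : ℝ × Eu d → ℂ) (R s : ℝ) (ξ : Eu d) : FH (tr R F) s ξ = if |s| ≤ R then FH F s ξ else 0 := by
  unfold FH
  split_ifs with h
  · have : (fun y => tr R F (s, y)) = fun y => F (s, y) := by
      funext y; exact Set.indicator_of_mem (show (s, y) ∈ {z : ℝ × Eu d | |z.1| ≤ R} from h) _
    rw [this]
  · have : (fun y => tr R F (s, y)) = 0 := by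
      funext y; exact Set.indicator_of_notMem (show (s, y) ∉ {z : ℝ × Eu d | |z.1| ≤ R} from h) _
    rw [this, fourier_uexp]; simp

lemma tr_FD (F : 𝓢(ℝ × Eu d, ℂ)) (R : ℝ) : FD (tr R F) := by
  obtain ⟨C, hC, h⟩ := slice_FH F
  refine ⟨fun ξ => C * wt ξ, R, wt_int.const_mul C, fun s ξ => ?_⟩
  rw [FH_tr]
  split_ifs with hs
  · rw [Set.indicator_of_mem (show s ∈ Set.Icc (-R) R from abs_le.1 hs), mul_one]; exact h s ξ
  · rw [norm_zero]
    exact mul_nonneg (mul_nonneg hC (wt_pos ξ).le) (Set.indicator_nonneg (fun _ _ => zero_le_one) _)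
end schw
end Strz


open MeasureTheory Real Complex
open scoped FourierTransform ENNReal SchwartzMap RealInnerProductSpace
set_option linter.all false
set_option linter.unusedVariables false
set_option linter.unusedSimpArgs false
set_option linter.deprecated false
namespace Strz
section final
variable {d : ℕ}

lemma sp_meas {f : Eu d → ℂ} (hf : Measurable f) : Measurable (fun z : ℝ × Eu d => sp f z.1 z.2) := by
  unfold sp
  have : StronglyMeasurable (fun q : (ℝ × Eu d) × Eu d => uexp (2 * Real.pi * inner ℝ q.1.2 q.2) * uexp (q.1.1 * om q.2) * f q.2) := by
    apply Measurable.stronglyMeasurable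
    have m1 : Measurable (fun w : (ℝ × Eu d) × Eu d => uexp (2 * Real.pi * inner ℝ w.1.2 w.2) * uexp (w.1.1 * om w.2)) := Continuous.measurable (by fun_prop)
    exact m1.mul (by fun_prop)
  exact (this.integral_prod_right' (ν := volume)).measurable

lemma rt_meas {S : Set (ℝ × ℝ)} (hS : MeasurableSet S) {F : ℝ × Eu d → ℂ} (hF : Measurable F) : Measurable (fun z : ℝ × Eu d => rt S F z.1 z.2) := by
  have h1 : StronglyMeasurable (fun q : ((ℝ × Eu d) × ℝ) × Eu d => uexp (2 * Real.pi * inner ℝ q.1.1.2 q.2) * uexp ((q.1.1.1 - q.1.2) * om q.2) * FH F q.1.2 q.2) := by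
    apply Measurable.stronglyMeasurable
    have m1 : Measurable (fun q : ((ℝ × Eu d) × ℝ) × Eu d => uexp (2 * Real.pi * inner ℝ q.1.1.2 q.2) * uexp ((q.1.1.1 - q.1.2) * om q.2)) := Continuous.measurable (by fun_prop)
    have m2 : Measurable (fun q : ((ℝ × Eu d) × ℝ) × Eu d => FH F q.1.2 q.2) := (measurable_FH hF).comp (g := fun p : ℝ × Eu d => FH F p.1 p.2) (f := fun q : ((ℝ × Eu d) × ℝ) × Eu d => (q.1.2, q.2)) (by fun_prop)
    exact m1.mul m2
  have h2 : Measurable (fun q : (ℝ × Eu d) × ℝ => sp (FH F q.2) (q.1.1 - q.2) q.1.2) := (h1.integral_prod_right' (ν := volume)).measurable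
  have h3 : Measurable (fun q : (ℝ × Eu d) × ℝ => S.indicator (fun z => sp (FH F z.1) (z.2 - z.1) q.1.2) (q.2, q.1.1)) := by
    have hS' : MeasurableSet {q : (ℝ × Eu d) × ℝ | (q.2, q.1.1) ∈ S} := (show Measurable (fun q : (ℝ × Eu d) × ℝ => (q.2, q.1.1)) by fun_prop) hS
    have := h2.indicator hS'
    have e : (fun q : (ℝ × Eu d) × ℝ => S.indicator (fun z => sp (FH F z.1) (z.2 - z.1) q.1.2) (q.2, q.1.1)) = {q : (ℝ × Eu d) × ℝ | (q.2, q.1.1) ∈ S}.indicator (fun q => sp (FH F q.2) (q.1.1 - q.2) q.1.2) := by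
      funext q
      by_cases h : (q.2, q.1.1) ∈ S
      · rw [Set.indicator_of_mem h, Set.indicator_of_mem (show q ∈ {q : (ℝ × Eu d) × ℝ | (q.2, q.1.1) ∈ S} from h)]
      · rw [Set.indicator_of_notMem h, Set.indicator_of_notMem (show q ∉ {q : (ℝ × Eu d) × ℝ | (q.2, q.1.1) ∈ S} from h)]
    rw [e]; exact this
  unfold rt
  exact (h3.stronglyMeasurable.integral_prod_right' (ν := volume)).measurable

def S1 : Set (ℝ × ℝ) := {z | 0 < z.1 ∧ z.1 ≤ z.2}
def S2 : Set (ℝ × ℝ) := {z | z.2 < z.1 ∧ z.1 ≤ 0}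
lemma S1_meas : MeasurableSet S1 := by
  have h1 : MeasurableSet {z : ℝ × ℝ | 0 < z.1} := measurableSet_lt (by fun_prop) (by fun_prop)
  have h2 : MeasurableSet {z : ℝ × ℝ | z.1 ≤ z.2} := measurableSet_le (by fun_prop) (by fun_prop)
  exact h1.inter h2
lemma S2_meas : MeasurableSet S2 := by
  have h1 : MeasurableSet {z : ℝ × ℝ | z.2 < z.1} := measurableSet_lt (by fun_prop) (by fun_prop)
  have h2 : MeasurableSet {z : ℝ × ℝ | z.1 ≤ 0} := measurableSet_le (by fun_prop) (by fun_prop)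
  exact h1.inter h2

noncomputable def uu (f : Eu d → ℂ) (F : ℝ × Eu d → ℂ) (z : ℝ × Eu d) : ℂ := sp f z.1 z.2 + (rt S1 F z.1 z.2 - rt S2 F z.1 z.2)

lemma uu_eq (u₀ : Eu d → ℂ) (F : ℝ × Eu d → ℂ) (t : ℝ) (x : Eu d) :
    prop4 t u₀ x + ∫ s in (0 : ℝ)..t, prop4 (t - s) (fun y => F (s, y)) x = uu (𝓕 u₀) F (t, x) := by
  unfold uu rt intervalIntegral
  rw [prop4_eq]
  congr 2
  · rw [← integral_indicator measurableSet_Ioc]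
    congr 1; funext s
    by_cases h : s ∈ Set.Ioc 0 t
    · rw [Set.indicator_of_mem h, Set.indicator_of_mem (show (s, t) ∈ S1 from h), prop4_eq]; rfl
    · rw [Set.indicator_of_notMem h, Set.indicator_of_notMem (show (s, t) ∉ S1 from h)]
  · rw [← integral_indicator measurableSet_Ioc]
    congr 1; funext s
    by_cases h : s ∈ Set.Ioc t 0
    · rw [Set.indicator_of_mem h, Set.indicator_of_mem (show (s, t) ∈ S2 from h), prop4_eq]; rfl
    · rw [Set.indicator_of_notMem h, Set.indicator_of_notMem (show (s, t) ∉ S2 from h)]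

lemma rt_tr {S : Set (ℝ × ℝ)} (hS : ∀ z ∈ S, |z.1| ≤ |z.2|) (F : ℝ × Eu d → ℂ) {R t : ℝ} (ht : |t| ≤ R) (x : Eu d) : rt S (tr R F) t x = rt S F t x := by
  unfold rt
  congr 1; funext s
  by_cases h : (s, t) ∈ S
  · rw [Set.indicator_of_mem h, Set.indicator_of_mem h]
    have : FH (tr R F) s = FH F s := by
      funext ξ; rw [FH_tr, if_pos ((hS _ h).trans ht)]
    dsimp only
    rw [this]
  · rw [Set.indicator_of_notMem h, Set.indicator_of_notMem h]

lemma S1_abs : ∀ z ∈ S1, |z.1| ≤ |z.2| := by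
  rintro ⟨s, t⟩ ⟨h1, h2⟩
  dsimp only at *
  rw [abs_of_pos h1, abs_of_pos (by linarith)]; exact h2
lemma S2_abs : ∀ z ∈ S2, |z.1| ≤ |z.2| := by
  rintro ⟨s, t⟩ ⟨h1, h2⟩
  dsimp only at *
  rw [abs_of_nonpos h2, abs_of_neg (by linarith)]; linarith

theorem uu_dual (hd : 1 ≤ d) {α β α' β' γ : ℝ} (h : Adm d α β) (h' : Adm d α' β') (he : (d:ℝ)/β + 4/α + ((d:ℝ)/β' + 4/α') = d + 8) (hg : γ = (d:ℝ)/β' + 4/α' - d/2 - 4) :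
    ∃ C : ℝ≥0∞, C ≠ ∞ ∧ ∀ (f : Eu d → ℂ) (F : 𝓢(ℝ × Eu d, ℂ)), Integrable f → Measurable f →
      DualB α' β' (C * ((∫⁻ ξ, ‖ξ‖ₑ ^ (2*γ) * ‖f ξ‖ₑ ^ (2:ℝ)) ^ (1/2:ℝ) + mN α β F)) (uu f F) := by
  obtain ⟨C0, hC0, H0⟩ := homog hd h' hg
  obtain ⟨C1, hC1, H1⟩ := retard hd h h' he
  refine ⟨C0 + 2 * C1, by finiteness, fun f F hf hfm G hG hR => ?_⟩
  obtain ⟨R, hR⟩ := hR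
  have hN := tr_nice F R
  have hD := tr_FD F R
  obtain ⟨i0, e0⟩ := pair_hom hf hfm hG
  obtain ⟨i1, e1⟩ := pair_rt S1_meas hN hD hG
  obtain ⟨i2, e2⟩ := pair_rt S2_meas hN hD hG
  have hmN : mN α β (tr R F) ≤ mN α β F := mN_mono (by linarith [h.a1]) (by linarith [h.b1]) fun z => by
    rw [← ofReal_norm, ← ofReal_norm]; exact ENNReal.ofReal_le_ofReal (norm_indicator_le_norm_self _ _)
  have hpt : ∀ z, uu f F z * (starRingEnd ℂ) (G z) = sp f z.1 z.2 * (starRingEnd ℂ) (G z) + (rt S1 (tr R F) z.1 z.2 * (starRingEnd ℂ) (G z) - rt S2 (tr R F) z.1 z.2 * (starRingEnd ℂ) (G z)) := by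
    intro z
    by_cases hz : G z = 0
    · simp [hz]
    · have := (hR z hz).1
      rw [rt_tr S1_abs _ this, rt_tr S2_abs _ this]; unfold uu; ring
  simp_rw [hpt]
  have e3 := integral_add i0 (i1.sub i2)
  have e4 := integral_sub i1 i2
  simp only [Pi.sub_apply] at e3
  rw [e3, e4, e0, e1, e2]
  refine (enorm_add_le _ _).trans ((add_le_add (H0 f G hf hfm hG) ((enorm_sub_le).trans (add_le_add (H1 _ S1_meas _ G hN hD hG) (H1 _ S2_meas _ G hN hD hG)))).trans ?_)
  set X := (∫⁻ ξ, ‖ξ‖ₑ ^ (2*γ) * ‖f ξ‖ₑ ^ (2:ℝ)) ^ (1/2:ℝ)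
  calc _ = C0 * X * mN α' β' G + 2 * C1 * mN α β (tr R F) * mN α' β' G := by ring
    _ ≤ (C0 + 2 * C1) * X * mN α' β' G + (C0 + 2 * C1) * mN α β F * mN α' β' G := by
        gcongr
        · exact le_self_add
        · exact le_add_self
    _ = _ := by ring
end final
end Strz


open MeasureTheory Real Complex
open scoped FourierTransform ENNReal SchwartzMap RealInnerProductSpace
set_option linter.all false
set_option linter.unusedVariables false
set_option linter.unusedSimpArgs false
set_option linter.deprecated false
namespace Strz
lemma conj_real {a a' : ℝ≥0∞} (ha : 2 ≤ a) (h : 1 / a + 1 / a' = 1) :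
    a' ≠ ∞ ∧ a' ≠ 0 ∧ 1 / a'.toReal = 1 - 1 / a.toReal := by
  have ha0 : a ≠ 0 := by rintro rfl; simp at ha
  have h0 : a' ≠ 0 := by rintro rfl; simp at h
  have ht : a' ≠ ∞ := by
    rintro rfl
    simp only [one_div, ENNReal.inv_top, add_zero, ENNReal.inv_eq_one] at h
    rw [h] at ha; norm_num at ha
  refine ⟨ht, h0, ?_⟩
  have := congrArg ENNReal.toReal h
  simp only [one_div] at this ⊢
  rw [ENNReal.toReal_add (by simpa using ha0) (by simpa using h0), ENNReal.toReal_inv, ENNReal.toReal_inv, ENNReal.toReal_one] at this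
  linarith

lemma inv_real {a : ℝ≥0∞} (ha : 2 ≤ a) : 0 ≤ 1 / a.toReal ∧ 1 / a.toReal ≤ 1/2 := by
  refine ⟨by positivity, ?_⟩
  by_cases h : a = ∞
  · simp [h]
  · have : (2:ℝ) ≤ a.toReal := by
      have := ENNReal.toReal_mono h ha; simpa using this
    exact one_div_le_one_div_of_le (by norm_num) this

lemma adm_of {d : ℕ} {p q : ℝ≥0∞} (A : Admissible d p q) (hq : q ≠ ∞) (hd : 1 ≤ d) {α β : ℝ}
    (h1 : 1/α = 1 - 1/p.toReal) (h2 : 1/β = 1 - 1/q.toReal) : Adm d α β := by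
  obtain ⟨A1, A2, -, A3⟩ := A
  have p0 : p ≠ 0 := by rintro rfl; simp at A1
  have q0 : q ≠ 0 := by rintro rfl; simp at A2
  obtain ⟨i1, i2⟩ := inv_real A1
  obtain ⟨j1, j2⟩ := inv_real A2
  have Q2 : (2:ℝ) ≤ q.toReal := by
    have := ENNReal.toReal_mono hq A2; simpa using this
  have j3 : 0 < 1 / q.toReal := by positivity
  have hdp : (0:ℝ) < d := by exact_mod_cast hd
  have A4 : 2 / p.toReal + d / q.toReal ≤ d / 2 := by
    have e1 : 2 / p ≠ ∞ := ENNReal.div_ne_top (by simp) p0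
    have e2 : (d:ℝ≥0∞) / q ≠ ∞ := ENNReal.div_ne_top (by simp) q0
    have e3 : (d:ℝ≥0∞) / 2 ≠ ∞ := ENNReal.div_ne_top (by simp) (by simp)
    have := ENNReal.toReal_mono e3 A3
    rw [ENNReal.toReal_add e1 e2] at this
    simpa [ENNReal.toReal_div] using this
  have ea : α = 1 / (1 - 1/p.toReal) := by rw [← h1]; simp
  have eb : β = 1 / (1 - 1/q.toReal) := by rw [← h2]; simp
  refine ⟨?_, ?_, ?_, ?_, ?_⟩
  · rw [ea, le_div_iff₀ (by linarith)]; linarith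
  · rw [ea, div_le_iff₀ (by linarith)]; linarith
  · rw [eb, lt_div_iff₀ (by linarith)]; linarith
  · rw [eb, div_le_iff₀ (by linarith)]; linarith
  · rw [h1, h2]
    have : (2 / p.toReal + d / q.toReal) / d ≤ (d / 2) / d := div_le_div_of_nonneg_right A4 hdp.le
    have e1 : (2 / p.toReal + d / q.toReal) / d = 2 / d * (1 / p.toReal) + 1 / q.toReal := by
      field_simp
    have e2 : ((d:ℝ) / 2) / d = 1/2 := by field_simp
    rw [e1, e2] at this
    have e3 : 2 / (d:ℝ) * (1 - (1 - 1 / p.toReal)) = 2 / d * (1 / p.toReal) := by ring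
    rw [e3]; linarith

lemma eL_nrm {d : ℕ} {q : ℝ≥0∞} (q0 : q ≠ 0) (hq : q ≠ ∞) (f : Eu d → ℂ) : eLpNorm f q volume = nrm q.toReal f := by
  rw [eLpNorm_eq_eLpNorm' q0 hq]; rfl

lemma uu_meas {d : ℕ} {f : Eu d → ℂ} (hf : Measurable f) (F : 𝓢(ℝ × Eu d, ℂ)) : Measurable (uu f F) := by
  have h1 := sp_meas hf
  have h2 := rt_meas S1_meas F.continuous.measurable
  have h3 := rt_meas S2_meas F.continuous.measurable
  exact h1.add (h2.sub h3)

lemma mixed_le {d : ℕ} {p q : ℝ≥0∞} (hp : 2 ≤ p) (hq2 : 2 ≤ q) (hq : q ≠ ∞) {α β : ℝ}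
    (h1 : 1/α = 1 - 1/p.toReal) (h2 : 1/β = 1 - 1/q.toReal) (hA : Adm d α β) {u : ℝ × Eu d → ℂ} (hu : Measurable u)
    {C : ℝ≥0∞} (H : DualB α β C u) : mixedLp p q Set.univ (fun t x => u (t, x)) ≤ C := by
  have q0 : q ≠ 0 := by rintro rfl; simp at hq2
  have Q2 : (2:ℝ) ≤ q.toReal := by
    have := ENNReal.toReal_mono hq hq2; simpa using this
  have hn : Measurable (fun t => nrm q.toReal (fun y => u (t, y))) := measurable_nrm _ hu
  have K : ∀ h : ℝ → ℝ≥0∞, Measurable h → (∃ B, B ≠ ∞ ∧ ∀ t, h t ≤ B) → ∫⁻ t, nrm q.toReal (fun y => u (t, y)) * h t ≤ C * (∫⁻ t, h t ^ α) ^ (1/α) := by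
    rintro h hh ⟨B, hB, hhB⟩
    exact dual_full hA.a1 hA.b1 Q2 (by rw [h2]; ring) hu H hh hB hhB
  unfold mixedLp timeLp
  simp_rw [eL_nrm q0 hq]
  rw [Measure.restrict_univ]
  split_ifs with hpt
  · have ea : α = 1 := by
      rw [hpt] at h1; simp at h1; exact h1
    refine essSup_le_of_ae_le C (dual_1d_top hn fun h hh hB => ?_)
    have := K h hh hB
    simpa [ea] using this
  · have P2 : (2:ℝ) ≤ p.toReal := by
      have := ENNReal.toReal_mono hpt hp; simpa using this
    have hi : 0 < 1 / p.toReal := by positivity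
    have ha : 1 < α := by
      have : 1 / α < 1 := by rw [h1]; linarith
      have h0 : 0 < α := by linarith [hA.a1]
      rwa [div_lt_one h0] at this
    exact dual_1d ha (by linarith) (by rw [h1]; ring) hn K

theorem final (d : ℕ) (hd : 1 ≤ d) (p q a b a' b' : ℝ≥0∞)
    (hpq : Admissible d p q) (hab : Admissible d a b) (hq : q ≠ ∞) (hb : b ≠ ∞)
    (ha' : 1 / a + 1 / a' = 1) (hb' : 1 / b + 1 / b' = 1)
    (hγ : gammaExp d p q = gammaExp d a' b' + 4) :
    ∃ C > (0 : ℝ), ∀ (u₀ : 𝓢(EuclideanSpace ℝ (Fin d), ℂ))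
      (F : 𝓢(ℝ × EuclideanSpace ℝ (Fin d), ℂ)),
      mixedLp p q Set.univ
          (fun t x => prop4 t ⇑u₀ x + ∫ s in (0 : ℝ)..t, prop4 (t - s) (fun y => F (s, y)) x) ≤
        ENNReal.ofReal C *
          (homSobNorm (gammaExp d p q) ⇑u₀ +
            mixedLp a' b' Set.univ (fun s y => F (s, y))) := by
  obtain ⟨ta, za, ea⟩ := conj_real hab.1 ha'
  obtain ⟨tb, zb, eb⟩ := conj_real hab.2.1 hb'
  have hA : Adm d a'.toReal b'.toReal := adm_of hab hb hd ea eb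
  have e1 : 1 / (1 - 1/p.toReal)⁻¹ = 1 - 1/p.toReal := by simp
  have e2 : 1 / (1 - 1/q.toReal)⁻¹ = 1 - 1/q.toReal := by simp
  have hA' := adm_of hpq hq hd e1 e2
  set α' := (1 - 1/p.toReal)⁻¹
  set β' := (1 - 1/q.toReal)⁻¹
  have f1 : (d:ℝ)/β' = d * (1 - 1/q.toReal) := by rw [← e2]; ring
  have f2 : (4:ℝ)/α' = 4 * (1 - 1/p.toReal) := by rw [← e1]; ring
  have hγ' := hγ
  unfold gammaExp at hγ'
  have g1 : (d:ℝ) / q.toReal = d * (1 / q.toReal) := by ring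
  have g2 : (4:ℝ) / p.toReal = 4 * (1 / p.toReal) := by ring
  rw [g1, g2] at hγ'
  obtain ⟨C, hC, H⟩ := uu_dual (γ := gammaExp d p q) hd hA hA' (by rw [f1, f2]; linarith) (by unfold gammaExp; rw [f1, f2, g1, g2]; ring)
  refine ⟨C.toReal + 1, by positivity, fun u₀ F => ?_⟩
  have hfc : (𝓕 (⇑u₀ : Eu d → ℂ)) = ⇑(𝓕 u₀ : 𝓢(Eu d, ℂ)) := (SchwartzMap.fourier_coe u₀)
  have hi : Integrable (𝓕 (⇑u₀ : Eu d → ℂ)) := by rw [hfc]; exact SchwartzMap.integrable _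
  have hm : Measurable (𝓕 (⇑u₀ : Eu d → ℂ)) := by rw [hfc]; exact (SchwartzMap.continuous _).measurable
  have := mixed_le hpq.1 hpq.2.1 hq e1 e2 hA' (uu_meas hm F) (H _ F hi hm)
  simp_rw [uu_eq]
  refine this.trans ?_
  have hN : mixedLp a' b' Set.univ (fun s y => F (s, y)) = mN a'.toReal b'.toReal F := by
    unfold mixedLp timeLp
    rw [if_neg ta, Measure.restrict_univ]
    simp_rw [eL_nrm zb tb]
    rfl
  rw [hN]
  refine mul_le_mul' ?_ (le_of_eq rfl)
  rw [← ENNReal.ofReal_toReal hC]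
  exact ENNReal.ofReal_le_ofReal (by rw [ENNReal.ofReal_toReal hC]; linarith)
end Strz


/-- full (retarded) Strichartz estimate for the fourth-order Schrödinger
equation. -/
theorem stmt4 (d : ℕ) (hd : 1 ≤ d) (p q a b a' b' : ℝ≥0∞)
    (hpq : Admissible d p q) (hab : Admissible d a b) (hq : q ≠ ∞) (hb : b ≠ ∞)
    (ha' : 1 / a + 1 / a' = 1) (hb' : 1 / b + 1 / b' = 1)
    (hγ : gammaExp d p q = gammaExp d a' b' + 4) :
    ∃ C > (0 : ℝ), ∀ (u₀ : 𝓢(EuclideanSpace ℝ (Fin d), ℂ))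
      (F : 𝓢(ℝ × EuclideanSpace ℝ (Fin d), ℂ)),
      mixedLp p q Set.univ
          (fun t x => prop4 t ⇑u₀ x + ∫ s in (0 : ℝ)..t, prop4 (t - s) (fun y => F (s, y)) x) ≤
        ENNReal.ofReal C *
          (homSobNorm (gammaExp d p q) ⇑u₀ +
            mixedLp a' b' Set.univ (fun s y => F (s, y))) := by
  exact Strz.final d hd p q a b a' b' hpq hab hq hb ha' hb' hγ
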